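/- Suppose |1−χ| = O(ε), Re < Re₀ and ε ≤ ε₂. Then there exists a positive constant N₁ depending only on Re, Pr, μ′/μ and γ such that if N̂ ≤ N₁, then for all t ∈ [0,T]: ε²A₄(t) ≤ C(ε²A₃(0) + ε²A₄(0) + A₁(0) + A₂(0) + ε⁻²A₀(0)), where C depends only on Re, Pr, μ′/μ and γ. -/

import Mathlib

noncomputable section

open MeasureTheory Real Filter Topology

namespace Couette

/-- The periodic cell of the horizontally periodic layer `Ω = 𝕊¹ × (0,1)`. -/
def Ω : Set (ℝ × ℝ) := {x : ℝ × ℝ | x.1 ∈ Set.Ioo 0 (2 * π) ∧ x.2 ∈ Set.Ioo 0 1}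

variable {F : Type*} [NormedAddCommGroup F] [NormedSpace ℝ F]

/-- Partial derivative in the horizontal direction `x₁`. -/
def d1 (f : ℝ × ℝ → F) (x : ℝ × ℝ) : F := fderiv ℝ f x (1, 0)

/-- Partial derivative in the vertical direction `x₂`. -/
def d2 (f : ℝ × ℝ → F) (x : ℝ × ℝ) : F := fderiv ℝ f x (0, 1)

/-- Time derivative of a time-dependent field. -/
def dt (f : ℝ → ℝ × ℝ → F) (t : ℝ) (x : ℝ × ℝ) : F := deriv (fun s => f s x) t

/-- Divergence of a (two-dimensional) vector field. -/
def divv (v : ℝ × ℝ → ℝ × ℝ) (x : ℝ × ℝ) : ℝ :=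
  d1 (fun y => (v y).1) x + d2 (fun y => (v y).2) x

/-- Gradient of a scalar field. -/
def grad (f : ℝ × ℝ → ℝ) (x : ℝ × ℝ) : ℝ × ℝ := (d1 f x, d2 f x)

/-- Laplacian. -/
def lap (f : ℝ × ℝ → F) (x : ℝ × ℝ) : F := d1 (d1 f) x + d2 (d2 f) x

/-- Euclidean inner product on `ℝ²`. -/
def dot (a b : ℝ × ℝ) : ℝ := a.1 * b.1 + a.2 * b.2

/-- The contraction `𝔇(v) : 𝔇(w)` of deformation tensors, where
`𝔇(v) = (∇v + (∇v)ᵀ)/2`. -/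
def defContract (v w : ℝ × ℝ → ℝ × ℝ) (x : ℝ × ℝ) : ℝ :=
  d1 (fun y => (v y).1) x * d1 (fun y => (w y).1) x
    + d2 (fun y => (v y).2) x * d2 (fun y => (w y).2) x
    + 2 * ((d1 (fun y => (v y).2) x + d2 (fun y => (v y).1) x) / 2)
        * ((d1 (fun y => (w y).2) x + d2 (fun y => (w y).1) x) / 2)

/-- Squared `L²(Ω)` norm of the `j`-th spatial derivative. -/
def dSq (j : ℕ) (f : ℝ × ℝ → F) : ℝ := ∫ x in Ω, ‖iteratedFDeriv ℝ j f x‖ ^ 2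

/-- Squared `L²(Ω)` norm. -/
def L2Sq (f : ℝ × ℝ → F) : ℝ := dSq 0 f

/-- Squared `Hᵏ(Ω)` norm. -/
def HSq (k : ℕ) (f : ℝ × ℝ → F) : ℝ := ∑ j ∈ Finset.range (k + 1), dSq j f

/-- `L∞(Ω)` (sup) norm. -/
def LinfSup (f : ℝ × ℝ → F) : ℝ := ⨆ x ∈ Ω, ‖f x‖

/-- Membership in the Sobolev space `Hᵏ(Ω)`. -/
def MemH (k : ℕ) (f : ℝ × ℝ → F) : Prop :=
  ∀ j ≤ k, IntegrableOn (fun x => ‖iteratedFDeriv ℝ j f x‖ ^ 2) Ω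

/-- Continuity in time, with values in `Hᵏ(Ω)`, on the time set `s`. -/
def ContInH (k : ℕ) (f : ℝ → ℝ × ℝ → F) (s : Set ℝ) : Prop :=
  (∀ t ∈ s, MemH k (f t)) ∧
    ∀ t₀ ∈ s, Tendsto (fun t => HSq k (fun x => f t x - f t₀ x)) (nhdsWithin t₀ s) (nhds 0)

/-- Square integrability in time, with values in `Hᵏ(Ω)`, on the time set `s`. -/
def L2InH (k : ℕ) (f : ℝ → ℝ × ℝ → F) (s : Set ℝ) : Prop :=
  IntegrableOn (fun t => HSq k (f t)) s

/-- Temperature `𝒯̃` of the non-dimensional plane Couette flow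
(here `C_p = γ/(γ-1)`, the gas constant being normalized to `R = 1`). -/
def tT (γ Pr ε χ : ℝ) (x : ℝ × ℝ) : ℝ :=
  χ + (1 - χ) * x.2 - ε ^ 2 * Pr / (2 * (γ / (γ - 1))) * (x.2 ^ 2 - x.2)

/-- Density `ρ̃ = 𝒯̃⁻¹` of the plane Couette flow. -/
def tρ (γ Pr ε χ : ℝ) (x : ℝ × ℝ) : ℝ := (tT γ Pr ε χ x)⁻¹

/-- Velocity `ũ = (x₂, 0)` of the plane Couette flow. -/
def tu (x : ℝ × ℝ) : ℝ × ℝ := (x.2, 0)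

/-- Total density `ρ = ρ̃ + φ`. -/
def pρ (γ Pr ε χ : ℝ) (φ : ℝ → ℝ × ℝ → ℝ) (t : ℝ) (x : ℝ × ℝ) : ℝ := tρ γ Pr ε χ x + φ t x

/-- Total temperature `𝒯 = 𝒯̃ + θ`. -/
def pT (γ Pr ε χ : ℝ) (θ : ℝ → ℝ × ℝ → ℝ) (t : ℝ) (x : ℝ × ℝ) : ℝ := tT γ Pr ε χ x + θ t x

/-- Total velocity `u = ũ + ψ`. -/
def pu (ψ : ℝ → ℝ × ℝ → ℝ × ℝ) (t : ℝ) (x : ℝ × ℝ) : ℝ × ℝ := tu x + ψ t x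

/-- A classical solution `(φ, ψ, θ) = (ρ - ρ̃, u - ũ, 𝒯 - 𝒯̃)` of the perturbation
system around the plane Couette flow on `Ω × [0,T]`, with non-slip and isothermal
boundary conditions and periodicity in `x₁`.  Here `μ = 1/Re`, `μ' = r·μ`
(`r = μ'/μ = ν'/ν`), and `κ = C_p/(Re·Pr)` with `C_p = γ/(γ-1)`. -/
structure PerturbSol (γ Pr r Re ε χ T : ℝ) where
  φ : ℝ → ℝ × ℝ → ℝ
  ψ : ℝ → ℝ × ℝ → ℝ × ℝ
  θ : ℝ → ℝ × ℝ → ℝ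
  mass_eq : ∀ t ∈ Set.Icc (0 : ℝ) T, ∀ x ∈ Ω,
    dt φ t x + dot (pu ψ t x) (grad (φ t) x) + pρ γ Pr ε χ φ t x * divv (ψ t) x
      + dot (ψ t x) (grad (tρ γ Pr ε χ) x) = 0
  mom_eq1 : ∀ t ∈ Set.Icc (0 : ℝ) T, ∀ x ∈ Ω,
    pρ γ Pr ε χ φ t x * ((dt ψ t x).1 + dot (pu ψ t x) (grad (fun y => (ψ t y).1) x)
        + dot (ψ t x) (grad (fun y => (tu y).1) x))
      + (ε ^ 2)⁻¹ * d1 (fun y => pρ γ Pr ε χ φ t y * pT γ Pr ε χ θ t y) x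
      - Re⁻¹ * lap (fun y => (ψ t y).1) x
      - (Re⁻¹ + r * Re⁻¹) * d1 (divv (ψ t)) x = 0
  mom_eq2 : ∀ t ∈ Set.Icc (0 : ℝ) T, ∀ x ∈ Ω,
    pρ γ Pr ε χ φ t x * ((dt ψ t x).2 + dot (pu ψ t x) (grad (fun y => (ψ t y).2) x)
        + dot (ψ t x) (grad (fun y => (tu y).2) x))
      + (ε ^ 2)⁻¹ * d2 (fun y => pρ γ Pr ε χ φ t y * pT γ Pr ε χ θ t y) x
      - Re⁻¹ * lap (fun y => (ψ t y).2) x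
      - (Re⁻¹ + r * Re⁻¹) * d2 (divv (ψ t)) x = 0
  energy_eq : ∀ t ∈ Set.Icc (0 : ℝ) T, ∀ x ∈ Ω,
    pρ γ Pr ε χ φ t x / (γ - 1) * (dt θ t x + dot (pu ψ t x) (grad (θ t) x)
        + dot (ψ t x) (grad (tT γ Pr ε χ) x))
      + pρ γ Pr ε χ φ t x * pT γ Pr ε χ θ t x * divv (ψ t) x
      - γ / (γ - 1) / (Re * Pr) * lap (θ t) x
      = ε ^ 2 * (2 * Re⁻¹ * defContract (ψ t) (ψ t) x
          + 4 * Re⁻¹ * defContract tu (ψ t) x + r * Re⁻¹ * (divv (ψ t) x) ^ 2)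
  bc_ψ : ∀ t ∈ Set.Icc (0 : ℝ) T, ∀ x : ℝ × ℝ, (x.2 = 0 ∨ x.2 = 1) → ψ t x = 0
  bc_θ : ∀ t ∈ Set.Icc (0 : ℝ) T, ∀ x : ℝ × ℝ, (x.2 = 0 ∨ x.2 = 1) → θ t x = 0
  periodic_φ : ∀ t x, φ t (x.1 + 2 * π, x.2) = φ t x
  periodic_ψ : ∀ t x, ψ t (x.1 + 2 * π, x.2) = ψ t x
  periodic_θ : ∀ t x, θ t (x.1 + 2 * π, x.2) = θ t x

/-- Smoothness (in time and space) of a solution of the perturbation system. -/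
def SmoothSol {γ Pr r Re ε χ T : ℝ} (S : PerturbSol γ Pr r Re ε χ T) : Prop :=
  ContDiff ℝ (⊤ : ℕ∞) (Function.uncurry S.φ) ∧ ContDiff ℝ (⊤ : ℕ∞) (Function.uncurry S.ψ) ∧
    ContDiff ℝ (⊤ : ℕ∞) (Function.uncurry S.θ)

/-- Standing hypotheses on a solution of the perturbation system: initial regularity
`(φ₀, ψ₀, θ₀) ∈ H³`, zero average of the initial density perturbation, and the
compatibility conditions `∂tψ(0) = ∂tθ(0) = 0` on `∂Ω`. -/
def StdHyp {γ Pr r Re ε χ T : ℝ} (S : PerturbSol γ Pr r Re ε χ T) : Prop :=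
  MemH 3 (S.φ 0) ∧ MemH 3 (S.ψ 0) ∧ MemH 3 (S.θ 0) ∧
    (∫ x in Ω, S.φ 0 x) = 0 ∧
    ∀ x : ℝ × ℝ, (x.2 = 0 ∨ x.2 = 1) → dt S.ψ 0 x = 0 ∧ dt S.θ 0 x = 0

/-- The energy functional `A₀`. -/
def A0 (ε : ℝ) (φ : ℝ → ℝ × ℝ → ℝ) (ψ : ℝ → ℝ × ℝ → ℝ × ℝ) (θ : ℝ → ℝ × ℝ → ℝ)
    (t : ℝ) : ℝ :=
  (⨆ s ∈ Set.Icc (0 : ℝ) t,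
      (L2Sq (ψ s) + (ε ^ 2)⁻¹ * L2Sq (φ s) + (ε ^ 2)⁻¹ * L2Sq (θ s)))
    + ∫ s in (0 : ℝ)..t, (HSq 1 (ψ s) + (ε ^ 2)⁻¹ * HSq 1 (θ s))

/-- The energy functional `A₁`. -/
def A1 (ε : ℝ) (φ : ℝ → ℝ × ℝ → ℝ) (ψ : ℝ → ℝ × ℝ → ℝ × ℝ) (θ : ℝ → ℝ × ℝ → ℝ)
    (t : ℝ) : ℝ :=
  (⨆ s ∈ Set.Icc (0 : ℝ) t, (dSq 1 (ψ s) + (ε ^ 2)⁻¹ * dSq 1 (θ s)))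
    + ∫ s in (0 : ℝ)..t, (L2Sq (dt ψ s) + (ε ^ 2)⁻¹ * L2Sq (dt θ s))

/-- The energy functional `A₂`. -/
def A2 (ε : ℝ) (φ : ℝ → ℝ × ℝ → ℝ) (ψ : ℝ → ℝ × ℝ → ℝ × ℝ) (θ : ℝ → ℝ × ℝ → ℝ)
    (t : ℝ) : ℝ :=
  (ε ^ 2)⁻¹ * (⨆ s ∈ Set.Icc (0 : ℝ) t, dSq 1 (φ s))
    + (∫ s in (0 : ℝ)..t, ((ε ^ 4)⁻¹ * HSq 1 (φ s) + (ε ^ 2)⁻¹ * L2Sq (dt φ s)))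
    + ∫ s in (0 : ℝ)..t, (HSq 2 (ψ s) + (ε ^ 2)⁻¹ * HSq 2 (θ s))

/-- The energy functional `A₃`. -/
def A3 (ε : ℝ) (φ : ℝ → ℝ × ℝ → ℝ) (ψ : ℝ → ℝ × ℝ → ℝ × ℝ) (θ : ℝ → ℝ × ℝ → ℝ)
    (t : ℝ) : ℝ :=
  (⨆ s ∈ Set.Icc (0 : ℝ) t,
      ((ε ^ 2)⁻¹ * L2Sq (dt φ s) + L2Sq (dt ψ s) + (ε ^ 2)⁻¹ * L2Sq (dt θ s)))
    + ∫ s in (0 : ℝ)..t, (dSq 1 (dt ψ s) + (ε ^ 2)⁻¹ * dSq 1 (dt θ s))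

/-- The energy functional `A₄`. -/
def A4 (ε : ℝ) (φ : ℝ → ℝ × ℝ → ℝ) (ψ : ℝ → ℝ × ℝ → ℝ × ℝ) (θ : ℝ → ℝ × ℝ → ℝ)
    (t : ℝ) : ℝ :=
  (⨆ s ∈ Set.Icc (0 : ℝ) t,
      ((ε ^ 2)⁻¹ * dSq 2 (φ s) + dSq 2 (ψ s) + (ε ^ 2)⁻¹ * dSq 2 (θ s)))
    + ∫ s in (0 : ℝ)..t, ((ε ^ 4)⁻¹ * HSq 2 (φ s) + HSq 3 (ψ s) + (ε ^ 2)⁻¹ * HSq 3 (θ s))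

/-- The energy functional `A₅`. -/
def A5 (ε : ℝ) (φ : ℝ → ℝ × ℝ → ℝ) (ψ : ℝ → ℝ × ℝ → ℝ × ℝ) (θ : ℝ → ℝ × ℝ → ℝ)
    (t : ℝ) : ℝ :=
  (⨆ s ∈ Set.Icc (0 : ℝ) t,
      ((ε ^ 2)⁻¹ * dSq 3 (φ s) + (dSq 3 (ψ s) + dSq 1 (dt ψ s))
        + (ε ^ 2)⁻¹ * (dSq 3 (θ s) + dSq 1 (dt θ s))))
    + ∫ s in (0 : ℝ)..t, (L2Sq (dt (dt ψ) s) + (ε ^ 2)⁻¹ * L2Sq (dt (dt θ) s))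

/-- The total weighted energy functional `N(t)`. -/
def Nfun (ε : ℝ) (φ : ℝ → ℝ × ℝ → ℝ) (ψ : ℝ → ℝ × ℝ → ℝ × ℝ) (θ : ℝ → ℝ × ℝ → ℝ)
    (t : ℝ) : ℝ :=
  (ε ^ 2)⁻¹ * A0 ε φ ψ θ t + A1 ε φ ψ θ t + A2 ε φ ψ θ t
    + ε ^ 2 * A3 ε φ ψ θ t + ε ^ 2 * A4 ε φ ψ θ t + ε ^ 4 * A5 ε φ ψ θ t

/-- The relative entropy
`η = (ε²ρ/𝒯̃)|ψ|² + (ρ/(γ-1))(𝒯/𝒯̃ - ln(𝒯/𝒯̃) - 1) + ρ(τ/τ̃ - ln(τ/τ̃) - 1)`,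
where `τ = 1/ρ`, `τ̃ = 1/ρ̃`. -/
def relEnt (γ Pr ε χ : ℝ) (φ θ : ℝ → ℝ × ℝ → ℝ) (ψ : ℝ → ℝ × ℝ → ℝ × ℝ)
    (t : ℝ) (x : ℝ × ℝ) : ℝ :=
  ε ^ 2 * pρ γ Pr ε χ φ t x / tT γ Pr ε χ x * ‖ψ t x‖ ^ 2
    + pρ γ Pr ε χ φ t x / (γ - 1) *
        (pT γ Pr ε χ θ t x / tT γ Pr ε χ x
          - Real.log (pT γ Pr ε χ θ t x / tT γ Pr ε χ x) - 1)
    + pρ γ Pr ε χ φ t x *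
        ((pρ γ Pr ε χ φ t x)⁻¹ / (tρ γ Pr ε χ x)⁻¹
          - Real.log ((pρ γ Pr ε χ φ t x)⁻¹ / (tρ γ Pr ε χ x)⁻¹) - 1)

/-- A classical solution `(ρ, u, 𝒯)` of the non-dimensional full compressible
Navier–Stokes system on `Ω × (0,∞)`, with non-slip and isothermal boundary
conditions and periodicity in `x₁`. -/
structure FullSol (γ Pr r Re ε χ : ℝ) where
  rho : ℝ → ℝ × ℝ → ℝ
  vel : ℝ → ℝ × ℝ → ℝ × ℝ
  temp : ℝ → ℝ × ℝ → ℝ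
  mass_eq : ∀ t ∈ Set.Ioi (0 : ℝ), ∀ x ∈ Ω,
    dt rho t x + divv (fun y => rho t y • vel t y) x = 0
  mom_eq1 : ∀ t ∈ Set.Ioi (0 : ℝ), ∀ x ∈ Ω,
    rho t x * ((dt vel t x).1 + dot (vel t x) (grad (fun y => (vel t y).1) x))
      + (ε ^ 2)⁻¹ * d1 (fun y => rho t y * temp t y) x
      = Re⁻¹ * lap (fun y => (vel t y).1) x + (Re⁻¹ + r * Re⁻¹) * d1 (divv (vel t)) x
  mom_eq2 : ∀ t ∈ Set.Ioi (0 : ℝ), ∀ x ∈ Ω,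
    rho t x * ((dt vel t x).2 + dot (vel t x) (grad (fun y => (vel t y).2) x))
      + (ε ^ 2)⁻¹ * d2 (fun y => rho t y * temp t y) x
      = Re⁻¹ * lap (fun y => (vel t y).2) x + (Re⁻¹ + r * Re⁻¹) * d2 (divv (vel t)) x
  energy_eq : ∀ t ∈ Set.Ioi (0 : ℝ), ∀ x ∈ Ω,
    rho t x / (γ - 1) * (dt temp t x + dot (vel t x) (grad (temp t) x))
      + rho t x * temp t x * divv (vel t) x
      = γ / (γ - 1) / (Re * Pr) * lap (temp t) x
        + ε ^ 2 * (2 * Re⁻¹ * defContract (vel t) (vel t) x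
            + r * Re⁻¹ * (divv (vel t) x) ^ 2)
  bc_top : ∀ t ∈ Set.Ioi (0 : ℝ), ∀ x : ℝ × ℝ, x.2 = 1 →
    vel t x = (1, 0) ∧ temp t x = 1
  bc_bot : ∀ t ∈ Set.Ioi (0 : ℝ), ∀ x : ℝ × ℝ, x.2 = 0 →
    vel t x = 0 ∧ temp t x = χ
  periodic_rho : ∀ t x, rho t (x.1 + 2 * π, x.2) = rho t x
  periodic_vel : ∀ t x, vel t (x.1 + 2 * π, x.2) = vel t x
  periodic_temp : ∀ t x, temp t (x.1 + 2 * π, x.2) = temp t x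

/-- `∂tφ(0)`, defined from the initial data by taking `t = 0` in the mass equation
of the perturbation system. -/
def dtφ0 (γ Pr ε χ : ℝ) (φ₀ : ℝ × ℝ → ℝ) (ψ₀ : ℝ × ℝ → ℝ × ℝ) (x : ℝ × ℝ) : ℝ :=
  -(dot (tu x + ψ₀ x) (grad φ₀ x) + (tρ γ Pr ε χ x + φ₀ x) * divv ψ₀ x
      + dot (ψ₀ x) (grad (tρ γ Pr ε χ) x))

/-- `∂tψ(0)`, defined from the initial data by taking `t = 0` in the momentum
equation of the perturbation system. -/
def dtψ0 (γ Pr r Re ε χ : ℝ) (φ₀ θ₀ : ℝ × ℝ → ℝ) (ψ₀ : ℝ × ℝ → ℝ × ℝ)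
    (x : ℝ × ℝ) : ℝ × ℝ :=
  ((tρ γ Pr ε χ x + φ₀ x)⁻¹ *
      (Re⁻¹ * lap (fun y => (ψ₀ y).1) x + (Re⁻¹ + r * Re⁻¹) * d1 (divv ψ₀) x
        - (ε ^ 2)⁻¹ * d1 (fun y => (tρ γ Pr ε χ y + φ₀ y) * (tT γ Pr ε χ y + θ₀ y)) x)
      - dot (tu x + ψ₀ x) (grad (fun y => (ψ₀ y).1) x)
      - dot (ψ₀ x) (grad (fun y => (tu y).1) x),
   (tρ γ Pr ε χ x + φ₀ x)⁻¹ *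
      (Re⁻¹ * lap (fun y => (ψ₀ y).2) x + (Re⁻¹ + r * Re⁻¹) * d2 (divv ψ₀) x
        - (ε ^ 2)⁻¹ * d2 (fun y => (tρ γ Pr ε χ y + φ₀ y) * (tT γ Pr ε χ y + θ₀ y)) x)
      - dot (tu x + ψ₀ x) (grad (fun y => (ψ₀ y).2) x)
      - dot (ψ₀ x) (grad (fun y => (tu y).2) x))

/-- `∂tθ(0)`, defined from the initial data by taking `t = 0` in the temperature
equation of the perturbation system. -/
def dtθ0 (γ Pr r Re ε χ : ℝ) (φ₀ θ₀ : ℝ × ℝ → ℝ) (ψ₀ : ℝ × ℝ → ℝ × ℝ)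
    (x : ℝ × ℝ) : ℝ :=
  (γ - 1) * (tρ γ Pr ε χ x + φ₀ x)⁻¹ *
      (γ / (γ - 1) / (Re * Pr) * lap θ₀ x
        - (tρ γ Pr ε χ x + φ₀ x) * (tT γ Pr ε χ x + θ₀ x) * divv ψ₀ x
        + ε ^ 2 * (2 * Re⁻¹ * defContract ψ₀ ψ₀ x + 4 * Re⁻¹ * defContract tu ψ₀ x
            + r * Re⁻¹ * (divv ψ₀ x) ^ 2))
    - dot (tu x + ψ₀ x) (grad θ₀ x) - dot (ψ₀ x) (grad (tT γ Pr ε χ) x)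



section

/-- Space-time. -/
abbrev V := ℝ × (ℝ × ℝ)

/-- Families of smooth functions, periodic in `x₁`. -/
def smAlg (P : Type) : Subalgebra ℝ (P → V → ℝ) where
  carrier := {G | (∀ p, ContDiff ℝ (⊤ : ℕ∞) (G p)) ∧
    ∀ p t x1 x2, G p (t, (x1 + 2 * π, x2)) = G p (t, (x1, x2))}
  mul_mem' := by
    rintro G H ⟨h1, h2⟩ ⟨h3, h4⟩
    refine ⟨fun p => (h1 p).mul (h3 p), fun p t x1 x2 => ?_⟩
    simp only [Pi.mul_apply, h2, h4]
  add_mem' := by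
    rintro G H ⟨h1, h2⟩ ⟨h3, h4⟩
    refine ⟨fun p => (h1 p).add (h3 p), fun p t x1 x2 => ?_⟩
    simp only [Pi.add_apply, h2, h4]
  algebraMap_mem' := by
    intro r
    exact ⟨fun p => contDiff_const, fun p t x1 x2 => rfl⟩

/-- The algebra of families of smooth functions. -/
def Sm (P : Type) : Type := smAlg P

variable {P : Type}

instance : CommRing (Sm P) := inferInstanceAs (CommRing (smAlg P))
instance : Algebra ℝ (Sm P) := inferInstanceAs (Algebra ℝ (smAlg P))

/-- Evaluation. -/
def ev (p : P) (v : V) : Sm P →ₐ[ℝ] ℝ :=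
  ((Pi.evalAlgHom ℝ (fun _ : V => ℝ) v).comp (Pi.evalAlgHom ℝ (fun _ : P => V → ℝ) p)).comp
    (smAlg P).val

def mkSm (G : P → V → ℝ) (h : ∀ p, ContDiff ℝ (⊤ : ℕ∞) (G p))
    (h' : ∀ p t x1 x2, G p (t, (x1 + 2 * π, x2)) = G p (t, (x1, x2))) : Sm P := ⟨G, h, h'⟩

@[simp] lemma ev_mkSm (G : P → V → ℝ) (h h') (p : P) (v : V) :
    ev p v (mkSm G h h') = G p v := rfl

lemma Sm.ext' {G H : Sm P} (h : ∀ p v, ev p v G = ev p v H) : G = H :=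
  Subtype.ext (funext fun p => funext fun v => h p v)

lemma ev_smooth (G : Sm P) (p : P) : ContDiff ℝ (⊤ : ℕ∞) (fun v => ev p v G) := G.2.1 p

lemma ev_cont (G : Sm P) (p : P) : Continuous (fun v => ev p v G) := (ev_smooth G p).continuous

lemma ev_diff (G : Sm P) (p : P) : Differentiable ℝ (fun v => ev p v G) :=
  (ev_smooth G p).differentiable (by simp)

lemma ev_per (G : Sm P) (p : P) (t x1 x2 : ℝ) :
    ev p (t, (x1 + 2 * π, x2)) G = ev p (t, (x1, x2)) G := G.2.2 p t x1 x2

/-- Directional derivative. -/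
def DD (e : V) : Derivation ℝ (Sm P) (Sm P) := Derivation.mk'
  { toFun := fun G => mkSm (fun p v => fderiv ℝ (fun v => ev p v G) v e)
      (fun p => ((ev_smooth G p).fderiv_right (m := (⊤ : ℕ∞)) (by simp)).clm_apply contDiff_const)
      (fun p t x1 x2 => by
        have : (fun v => ev p v G) = (fun v : V => ev p (v + (0, (2 * π, 0))) G) := by
          funext v
          obtain ⟨t, x1, x2⟩ := v
          have := ev_per G p t x1 x2
          simpa using this.symm
        conv_rhs => rw [this]
        rw [fderiv_comp_add_right (f := fun v => ev p v G)]
        simp)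
    map_add' := fun G H => by
      apply Sm.ext'
      intro p v
      simp only [ev_mkSm, map_add]
      rw [fderiv_fun_add (ev_diff G p v) (ev_diff H p v)]; rfl
    map_smul' := fun r G => by
      apply Sm.ext'
      intro p v
      simp only [ev_mkSm, map_smul, RingHom.id_apply, smul_eq_mul]
      rw [fderiv_const_mul (ev_diff G p v)]; rfl }
  (fun G H => by
    apply Sm.ext'
    intro p v
    simp only [LinearMap.coe_mk, AddHom.coe_mk, ev_mkSm, map_mul, smul_eq_mul, map_add]
    rw [fderiv_fun_mul (ev_diff G p v) (ev_diff H p v)]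
    simp)

lemma ev_DD (e : V) (G : Sm P) (p : P) (v : V) :
    ev p v (DD e G) = fderiv ℝ (fun v => ev p v G) v e := rfl

lemma DD_comm (e e' : V) (G : Sm P) : DD e (DD e' G) = DD e' (DD e G) := by
  apply Sm.ext'
  intro p v
  rw [ev_DD, ev_DD]
  simp only [ev_DD]
  have h : ContDiffAt ℝ (⊤ : ℕ∞) (fun v => ev p v G) v := (ev_smooth G p).contDiffAt
  have hs := (h.isSymmSndFDerivAt (by simpa using (WithTop.coe_le_coe.2 le_top : ((2 : ℕ∞) : WithTop ℕ∞) ≤ ((⊤ : ℕ∞) : WithTop ℕ∞)))).eq e e'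
  have hd : DifferentiableAt ℝ (fderiv ℝ (fun v => ev p v G)) v :=
    ((ev_smooth G p).fderiv_right (m := (⊤ : ℕ∞)) (by simp)).differentiable (by simp) v
  rw [fderiv_clm_apply hd (by fun_prop), fderiv_clm_apply hd (by fun_prop)]
  simpa using hs

abbrev D0 : Derivation ℝ (Sm P) (Sm P) := DD (1, (0, 0))
abbrev D1 : Derivation ℝ (Sm P) (Sm P) := DD (0, (1, 0))
abbrev D2 : Derivation ℝ (Sm P) (Sm P) := DD (0, (0, 1))

lemma D10 (G : Sm P) : D1 (D0 G) = D0 (D1 G) := DD_comm _ _ _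
lemma D20 (G : Sm P) : D2 (D0 G) = D0 (D2 G) := DD_comm _ _ _
lemma D21 (G : Sm P) : D2 (D1 G) = D1 (D2 G) := DD_comm _ _ _

lemma hasDerivAt0 (G : Sm P) (p : P) (t x1 x2 : ℝ) :
    HasDerivAt (fun t => ev p (t, (x1, x2)) G) (ev p (t, (x1, x2)) (D0 G)) t := by
  have h := (ev_diff G p (t, (x1, x2))).hasFDerivAt
  have h2 : HasDerivAt (fun t : ℝ => ((t, (x1, x2)) : V)) (1, (0, 0)) t :=
    (hasDerivAt_id t).prodMk ((hasDerivAt_const t x1).prodMk (hasDerivAt_const t x2))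
  exact h.comp_hasDerivAt t h2

lemma hasDerivAt1 (G : Sm P) (p : P) (t x1 x2 : ℝ) :
    HasDerivAt (fun x1 => ev p (t, (x1, x2)) G) (ev p (t, (x1, x2)) (D1 G)) x1 := by
  have h := (ev_diff G p (t, (x1, x2))).hasFDerivAt
  have h2 : HasDerivAt (fun x1 : ℝ => ((t, (x1, x2)) : V)) (0, (1, 0)) x1 :=
    (hasDerivAt_const x1 t).prodMk ((hasDerivAt_id x1).prodMk (hasDerivAt_const x1 x2))
  exact h.comp_hasDerivAt x1 h2

lemma hasDerivAt2 (G : Sm P) (p : P) (t x1 x2 : ℝ) :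
    HasDerivAt (fun x2 => ev p (t, (x1, x2)) G) (ev p (t, (x1, x2)) (D2 G)) x2 := by
  have h := (ev_diff G p (t, (x1, x2))).hasFDerivAt
  have h2 : HasDerivAt (fun x2 : ℝ => ((t, (x1, x2)) : V)) (0, (0, 1)) x2 :=
    (hasDerivAt_const x2 t).prodMk ((hasDerivAt_const x2 x1).prodMk (hasDerivAt_id x2))
  exact h.comp_hasDerivAt x2 h2

/-! ### Integration -/

lemma Ω_eq : Ω = Set.Ioo 0 (2 * π) ×ˢ Set.Ioo (0 : ℝ) 1 := by
  ext x; simp [Ω]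

lemma Ω_meas : MeasurableSet Ω := by
  rw [Ω_eq]; exact measurableSet_Ioo.prod measurableSet_Ioo

/-- Closed cell. -/
def Ωc : Set (ℝ × ℝ) := Set.Icc 0 (2 * π) ×ˢ Set.Icc (0 : ℝ) 1

lemma Ωc_compact : IsCompact Ωc := isCompact_Icc.prod isCompact_Icc

lemma Ω_sub : Ω ⊆ Ωc := by
  rw [Ω_eq]; exact Set.prod_mono Set.Ioo_subset_Icc_self Set.Ioo_subset_Icc_self

lemma Ωc_eq : Ωc = closure Ω := by
  rw [Ω_eq, closure_prod_eq, closure_Ioo (by positivity), closure_Ioo (by norm_num)]; rfl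

lemma Ω_open : IsOpen Ω := by
  rw [Ω_eq]; exact isOpen_Ioo.prod isOpen_Ioo

lemma integrable_of_cont {g : ℝ × ℝ → ℝ} (hg : Continuous g) : IntegrableOn g Ω :=
  (hg.continuousOn.integrableOn_compact Ωc_compact).mono_set Ω_sub

lemma int_Ω_eq {g : ℝ × ℝ → ℝ} (hg : Continuous g) :
    ∫ x in Ω, g x = ∫ x1 in (0 : ℝ)..(2 * π), ∫ x2 in (0 : ℝ)..1, g (x1, x2) := by
  have h := integrable_of_cont hg
  rw [Ω_eq, Measure.volume_eq_prod] at h ⊢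
  rw [setIntegral_prod _ h, intervalIntegral.integral_of_le (by positivity),
    integral_Ioc_eq_integral_Ioo]
  refine setIntegral_congr_fun measurableSet_Ioo fun x1 _ => ?_
  rw [intervalIntegral.integral_of_le (by norm_num), integral_Ioc_eq_integral_Ioo]

lemma int_Ω_eq' {g : ℝ × ℝ → ℝ} (hg : Continuous g) :
    ∫ x in Ω, g x = ∫ x2 in (0 : ℝ)..1, ∫ x1 in (0 : ℝ)..(2 * π), g (x1, x2) := by
  have h := integrable_of_cont hg
  rw [Ω_eq, Measure.volume_eq_prod] at h ⊢
  rw [← setIntegral_prod_swap, setIntegral_prod (fun z : ℝ × ℝ => g z.swap) h.swap, intervalIntegral.integral_of_le (by norm_num),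
    integral_Ioc_eq_integral_Ioo]
  refine setIntegral_congr_fun measurableSet_Ioo fun x1 _ => ?_
  rw [intervalIntegral.integral_of_le (by positivity), integral_Ioc_eq_integral_Ioo]
  rfl

lemma sl_cont (G : Sm P) (p : P) (t : ℝ) : Continuous (fun x : ℝ × ℝ => ev p (t, x) G) :=
  (ev_cont G p).comp (by fun_prop)

/-- Integral over the cell. -/
def I (p : P) (t : ℝ) : Sm P →ₗ[ℝ] ℝ where
  toFun := fun G => ∫ x in Ω, ev p (t, x) G
  map_add' := fun G H => by
    simp only [map_add]
    exact integral_add (integrable_of_cont (sl_cont G p t)) (integrable_of_cont (sl_cont H p t))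
  map_smul' := fun r G => by
    simp only [map_smul, smul_eq_mul, RingHom.id_apply]
    exact integral_const_mul _ _

lemma I_def (p : P) (t : ℝ) (G : Sm P) : I p t G = ∫ x in Ω, ev p (t, x) G := rfl

/-- Boundary integral at height `c`. -/
def Bt (c : ℝ) (p : P) (t : ℝ) : Sm P →ₗ[ℝ] ℝ where
  toFun := fun G => ∫ x1 in (0 : ℝ)..(2 * π), ev p (t, (x1, c)) G
  map_add' := fun G H => by
    simp only [map_add]
    exact intervalIntegral.integral_add
      (((ev_cont G p).comp (by fun_prop : Continuous fun x1 : ℝ => ((t, (x1, c)) : V))).intervalIntegrable _ _)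
      (((ev_cont H p).comp (by fun_prop : Continuous fun x1 : ℝ => ((t, (x1, c)) : V))).intervalIntegrable _ _)
  map_smul' := fun r G => by
    simp only [map_smul, smul_eq_mul, RingHom.id_apply]
    exact intervalIntegral.integral_const_mul _ _

lemma I_congr {p : P} {t : ℝ} {G H : Sm P} (h : ∀ x ∈ Ω, ev p (t, x) G = ev p (t, x) H) :
    I p t G = I p t H := setIntegral_congr_fun Ω_meas h

lemma I_mono {p : P} {t : ℝ} {G H : Sm P} (h : ∀ x ∈ Ω, ev p (t, x) G ≤ ev p (t, x) H) :
    I p t G ≤ I p t H :=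
  setIntegral_mono_on (integrable_of_cont (sl_cont G p t)) (integrable_of_cont (sl_cont H p t))
    Ω_meas h

lemma I_nonneg {p : P} {t : ℝ} {G : Sm P} (h : ∀ x ∈ Ω, 0 ≤ ev p (t, x) G) : 0 ≤ I p t G :=
  setIntegral_nonneg Ω_meas h

lemma I_sq_nonneg (p : P) (t : ℝ) (G : Sm P) : 0 ≤ I p t (G * G) :=
  I_nonneg fun x _ => by rw [map_mul]; exact mul_self_nonneg _

lemma Bt_mono {c : ℝ} {p : P} {t : ℝ} {G H : Sm P}
    (h : ∀ x1, ev p (t, (x1, c)) G ≤ ev p (t, (x1, c)) H) : Bt c p t G ≤ Bt c p t H := by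
  apply intervalIntegral.integral_mono (by positivity)
  · exact ((ev_cont G p).comp (by fun_prop : Continuous fun x1 : ℝ => ((t, (x1, c)) : V))).intervalIntegrable _ _
  · exact ((ev_cont H p).comp (by fun_prop : Continuous fun x1 : ℝ => ((t, (x1, c)) : V))).intervalIntegrable _ _
  · exact h

lemma I_D1 (p : P) (t : ℝ) (G : Sm P) : I p t (D1 G) = 0 := by
  rw [I_def, int_Ω_eq' (sl_cont _ p t)]
  have : ∀ x2 : ℝ, ∫ x1 in (0 : ℝ)..(2 * π), ev p (t, (x1, x2)) (D1 G) = 0 := by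
    intro x2
    rw [intervalIntegral.integral_eq_sub_of_hasDerivAt (fun x1 _ => hasDerivAt1 G p t x1 x2)]
    · have := ev_per G p t 0 x2
      rw [zero_add] at this
      rw [this, sub_self]
    · exact ((ev_cont _ p).comp
        (by fun_prop : Continuous fun x1 : ℝ => ((t, (x1, x2)) : V))).intervalIntegrable _ _
  simp [this]

lemma I_D2 (p : P) (t : ℝ) (G : Sm P) : I p t (D2 G) = Bt 1 p t G - Bt 0 p t G := by
  rw [I_def, int_Ω_eq (sl_cont _ p t)]
  have : ∀ x1 : ℝ, ∫ x2 in (0 : ℝ)..1, ev p (t, (x1, x2)) (D2 G) =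
      ev p (t, (x1, 1)) G - ev p (t, (x1, 0)) G := by
    intro x1
    rw [intervalIntegral.integral_eq_sub_of_hasDerivAt (fun x2 _ => hasDerivAt2 G p t x1 x2)]
    exact ((ev_cont _ p).comp
        (by fun_prop : Continuous fun x2 : ℝ => ((t, (x1, x2)) : V))).intervalIntegrable _ _
  simp only [this]
  exact intervalIntegral.integral_sub
      (((ev_cont G p).comp (by fun_prop : Continuous fun x1 : ℝ => ((t, (x1, 1)) : V))).intervalIntegrable _ _)
      (((ev_cont G p).comp (by fun_prop : Continuous fun x1 : ℝ => ((t, (x1, 0)) : V))).intervalIntegrable _ _)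

lemma Bt_zero {c : ℝ} {p : P} {t : ℝ} {G : Sm P} (h : ∀ x1, ev p (t, (x1, c)) G = 0) :
    Bt c p t G = 0 := by
  change ∫ x1 in (0 : ℝ)..(2 * π), ev p (t, (x1, c)) G = 0
  simp [h]

lemma I_D2_zero {p : P} {t : ℝ} {G : Sm P} (h0 : ∀ x1, ev p (t, (x1, 0)) G = 0)
    (h1 : ∀ x1, ev p (t, (x1, 1)) G = 0) : I p t (D2 G) = 0 := by
  rw [I_D2, Bt_zero h0, Bt_zero h1, sub_self]

lemma I_hasDerivAt (p : P) (t : ℝ) (G : Sm P) :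
    HasDerivAt (fun s => I p s G) (I p t (D0 G)) t := by
  obtain ⟨M, hM⟩ := ((isCompact_Icc (a := t - 1) (b := t + 1)).prod Ωc_compact).exists_bound_of_continuousOn
    (ev_cont (D0 G) p).continuousOn
  refine (hasDerivAt_integral_of_dominated_loc_of_deriv_le (μ := volume.restrict Ω)
    (F := fun s x => ev p (s, x) G) (F' := fun s x => ev p (s, x) (D0 G)) (x₀ := t)
    (s := Set.Icc (t - 1) (t + 1)) (bound := fun _ => M)
    (Icc_mem_nhds (by linarith) (by linarith)) ?_ ?_ ?_ ?_ ?_ ?_).2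
  · exact Eventually.of_forall fun s => (sl_cont G p s).aestronglyMeasurable
  · exact integrable_of_cont (sl_cont G p t)
  · exact (sl_cont (D0 G) p t).aestronglyMeasurable
  · refine (ae_restrict_iff' Ω_meas).2 (Eventually.of_forall fun x hx s hs => ?_)
    exact hM (s, x) ⟨hs, Ω_sub hx⟩
  · exact integrable_of_cont continuous_const
  · exact Eventually.of_forall fun x s _ => hasDerivAt0 G p s x.1 x.2

lemma I_cont (p : P) (G : Sm P) : Continuous (fun t => I p t G) :=
  continuous_iff_continuousAt.2 fun t => (I_hasDerivAt p t G).continuousAt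

/-- The height coordinate. -/
def yy : Sm P := mkSm (fun _ v => v.2.2) (fun _ => by fun_prop) (fun _ _ _ _ => rfl)

@[simp] lemma ev_yy (p : P) (v : V) : ev p v yy = v.2.2 := rfl

/-- Constant families. -/
def cst (g : P → ℝ) : Sm P := mkSm (fun p _ => g p) (fun _ => by fun_prop) (fun _ _ _ _ => rfl)

@[simp] lemma ev_cst (g : P → ℝ) (p : P) (v : V) : ev p v (cst g) = g p := rfl

lemma DD_cst (e : V) (g : P → ℝ) : DD e (cst g) = 0 := by
  apply Sm.ext'; intro p v; rw [ev_DD]; simp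

lemma DD_yy (e : V) : DD e (yy : Sm P) = cst fun _ => e.2.2 := by
  apply Sm.ext'; intro p v
  rw [ev_DD]
  have : HasFDerivAt (fun v : V => v.2.2)
      ((ContinuousLinearMap.snd ℝ ℝ ℝ).comp (ContinuousLinearMap.snd ℝ ℝ (ℝ × ℝ))) v :=
    ((ContinuousLinearMap.snd ℝ ℝ ℝ).comp (ContinuousLinearMap.snd ℝ ℝ (ℝ × ℝ))).hasFDerivAt
  change fderiv ℝ (fun v : V => v.2.2) v e = _
  rw [this.fderiv]; simp

lemma D0_yy : D0 (yy : Sm P) = 0 := by rw [DD_yy]; exact Sm.ext' fun p v => by simp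
lemma D1_yy : D1 (yy : Sm P) = 0 := by rw [DD_yy]; exact Sm.ext' fun p v => by simp
lemma D2_yy : D2 (yy : Sm P) = 1 := by rw [DD_yy]; exact Sm.ext' fun p v => by simp

lemma I_cst_mul (p : P) (t : ℝ) (g : P → ℝ) (G : Sm P) : I p t (cst g * G) = g p * I p t G := by
  simp only [I_def, map_mul, ev_cst]
  exact integral_const_mul _ _

lemma Bt_def (c : ℝ) (p : P) (t : ℝ) (G : Sm P) :
    Bt c p t G = ∫ x1 in (0 : ℝ)..(2 * π), ev p (t, (x1, c)) G := rfl

attribute [irreducible] Sm mkSm ev DD I Bt cst yy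

end

section
variable {P : Type}

lemma I_two (p : P) (t : ℝ) (c1 c2 : ℝ) (G H : Sm P) :
    I p t (c1 • G + c2 • H) = c1 * I p t G + c2 * I p t H := by
  rw [map_add, map_smul, map_smul]; rfl

/-- Weighted Young inequality. -/
lemma I_young (p : P) (t : ℝ) {s : ℝ} (hs : 0 < s) (G H : Sm P) :
    |I p t (G * H)| ≤ s * I p t (G * G) + s⁻¹ * I p t (H * H) := by
  have key : ∀ a b : ℝ, |a * b| ≤ s * (a * a) + s⁻¹ * (b * b) := by
    intro a b
    have h1 : s * s⁻¹ = 1 := mul_inv_cancel₀ hs.ne'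
    have h2 : 0 < s⁻¹ := inv_pos.2 hs
    have h3 : s * (a * a) + s⁻¹ * (b * b) - 2 * (a * b) = s * (a - s⁻¹ * b) ^ 2 := by
      linear_combination (2 * a * b - s⁻¹ * b * b) * h1
    have h4 : s * (a * a) + s⁻¹ * (b * b) + 2 * (a * b) = s * (a + s⁻¹ * b) ^ 2 := by
      linear_combination (-2 * a * b - s⁻¹ * b * b) * h1
    have h5 : 0 ≤ s * (a - s⁻¹ * b) ^ 2 := by positivity
    have h6 : 0 ≤ s * (a + s⁻¹ * b) ^ 2 := by positivity
    have h7 : 0 ≤ s * (a * a) := mul_nonneg hs.le (mul_self_nonneg a)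
    have h8 : 0 ≤ s⁻¹ * (b * b) := mul_nonneg h2.le (mul_self_nonneg b)
    rw [abs_le]; constructor <;> linarith
  have e : I p t (s • (G * G) + s⁻¹ • (H * H)) = s * I p t (G * G) + s⁻¹ * I p t (H * H) :=
    I_two _ _ _ _ _ _
  rw [← e, abs_le]
  constructor
  · rw [← map_neg]
    apply I_mono; intro x _
    simp only [map_neg, map_add, map_smul, map_mul, smul_eq_mul]
    linarith [(abs_le.1 (key (ev p (t, x) G) (ev p (t, x) H))).1]
  · apply I_mono; intro x _
    simp only [map_add, map_smul, map_mul, smul_eq_mul]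
    linarith [(abs_le.1 (key (ev p (t, x) G) (ev p (t, x) H))).2]

lemma y_mem {x : ℝ × ℝ} (hx : x ∈ Ω) : 0 < x.2 ∧ x.2 < 1 := hx.2

/-- Integral of a product with a bounded weight. -/
lemma I_young3 (p : P) (t : ℝ) {s : ℝ} (hs : 0 < s) (K : Sm P)
    (hK : ∀ x ∈ Ω, |ev p (t, x) K| ≤ 1) (G H : Sm P) :
    |I p t (K * G * H)| ≤ s * I p t (G * G) + s⁻¹ * I p t (H * H) := by
  refine (I_young p t hs _ _).trans ?_
  gcongr
  apply I_mono; intro x hx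
  simp only [map_mul]
  have h := sq_le_one_iff_abs_le_one _ |>.2 (hK x hx)
  nlinarith [mul_self_nonneg (ev p (t, x) G)]

/-- Poincaré inequality in the vertical direction. -/
lemma poincare2 (p : P) (t : ℝ) (G : Sm P) (h0 : ∀ x1, ev p (t, (x1, 0)) G = 0) :
    I p t (G * G) ≤ 16 * I p t (D2 G * D2 G) := by
  have e : G * G = D2 ((yy - 1) * (G * G)) - (2 : ℝ) • ((yy - 1) * G * D2 G) := by
    simp only [Derivation.leibniz, map_sub, D2_yy, smul_eq_mul, Derivation.map_one_eq_zero,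
      Algebra.smul_def, map_ofNat]
    ring
  have h1 : I p t (D2 ((yy - 1) * (G * G))) = 0 := by
    apply I_D2_zero <;> intro x1 <;> simp [h0]
  have h2 := I_young3 p t (s := 1 / 4) (by norm_num) (yy - 1) (fun x hx => by
    have := y_mem hx
    simp only [map_sub, ev_yy, map_one]; rw [abs_le]; constructor <;> linarith) G (D2 G)
  have h3 : I p t (G * G) = - (2 * I p t ((yy - 1) * G * D2 G)) := by
    conv_lhs => rw [e]
    rw [map_sub, h1, map_smul, smul_eq_mul]; ring
  have h4 := (abs_le.1 h2).1
  norm_num at h4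
  nlinarith

lemma interp1 (p : P) (t : ℝ) {s : ℝ} (hs : 0 < s) (G : Sm P) :
    I p t (D1 G * D1 G) ≤ s * I p t (G * G) + s⁻¹ * I p t (D1 (D1 G) * D1 (D1 G)) := by
  have e : D1 G * D1 G = D1 (G * D1 G) - G * D1 (D1 G) := by
    simp only [Derivation.leibniz, smul_eq_mul]; ring
  have h := (abs_le.1 (I_young p t hs G (D1 (D1 G)))).1
  rw [e, map_sub, I_D1]
  linarith

/-- With Dirichlet conditions. -/
lemma interp2_bc (p : P) (t : ℝ) {s : ℝ} (hs : 0 < s) (G : Sm P)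
    (h0 : ∀ x1, ev p (t, (x1, 0)) G = 0) (h1 : ∀ x1, ev p (t, (x1, 1)) G = 0) :
    I p t (D2 G * D2 G) ≤ s * I p t (G * G) + s⁻¹ * I p t (D2 (D2 G) * D2 (D2 G)) := by
  have e : D2 G * D2 G = D2 (G * D2 G) - G * D2 (D2 G) := by
    simp only [Derivation.leibniz, smul_eq_mul]; ring
  have h := (abs_le.1 (I_young p t hs G (D2 (D2 G)))).1
  have hz : I p t (D2 (G * D2 G)) = 0 := by
    apply I_D2_zero <;> intro x1 <;> simp [h0, h1]
  rw [e, map_sub, hz]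
  linarith

lemma mixed_bc (p : P) (t : ℝ) {s : ℝ} (hs : 0 < s) (G : Sm P)
    (h0 : ∀ x1, ev p (t, (x1, 0)) (D1 G) = 0) (h1 : ∀ x1, ev p (t, (x1, 1)) (D1 G) = 0) :
    I p t (D1 (D2 G) * D1 (D2 G)) ≤
      s * I p t (D1 (D1 G) * D1 (D1 G)) + s⁻¹ * I p t (D2 (D2 G) * D2 (D2 G)) := by
  have e : D1 (D2 G) * D1 (D2 G) = D2 (D1 G * D1 (D2 G)) - D1 (D1 G * D2 (D2 G))
      + D1 (D1 G) * D2 (D2 G) := by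
    simp only [Derivation.leibniz, smul_eq_mul, D21]; ring
  have hz : I p t (D2 (D1 G * D1 (D2 G))) = 0 := by
    apply I_D2_zero <;> intro x1 <;> simp [h0, h1]
  have h := (abs_le.1 (I_young p t hs (D1 (D1 G)) (D2 (D2 G)))).2
  rw [e, map_add, map_sub, hz, I_D1]
  linarith

lemma trace1 (p : P) (t : ℝ) {s : ℝ} (hs : 0 < s) (G : Sm P) :
    Bt 1 p t (G * G) ≤ (1 + 2 * s⁻¹) * I p t (G * G) + 2 * s * I p t (D2 G * D2 G) := by
  have e : D2 (yy * (G * G)) = G * G + (2 : ℝ) • (yy * D2 G * G) := by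
    simp only [Derivation.leibniz, D2_yy, smul_eq_mul, Algebra.smul_def, map_ofNat]
    ring
  have h := I_D2 p t (yy * (G * G))
  have hz : Bt 0 p t (yy * (G * G)) = 0 := Bt_zero fun x1 => by simp
  have h1 : Bt 1 p t (G * G) ≤ Bt 1 p t (yy * (G * G)) := Bt_mono fun x1 => by simp
  have h2 := (abs_le.1 (I_young3 p t hs yy (fun x hx => by
    have := y_mem hx
    simp only [ev_yy]; rw [abs_le]; constructor <;> linarith) (D2 G) G)).2
  rw [e, map_add, map_smul, smul_eq_mul] at h
  linarith

lemma trace0 (p : P) (t : ℝ) {s : ℝ} (hs : 0 < s) (G : Sm P) :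
    Bt 0 p t (G * G) ≤ (1 + 2 * s⁻¹) * I p t (G * G) + 2 * s * I p t (D2 G * D2 G) := by
  have e : D2 ((yy - 1) * (G * G)) = G * G + (2 : ℝ) • ((yy - 1) * D2 G * G) := by
    simp only [Derivation.leibniz, map_sub, D2_yy, smul_eq_mul, Derivation.map_one_eq_zero,
      Algebra.smul_def, map_ofNat]
    ring
  have h := I_D2 p t ((yy - 1) * (G * G))
  have hz : Bt 1 p t ((yy - 1) * (G * G)) = 0 := Bt_zero fun x1 => by simp
  have h1 : Bt 0 p t (G * G) ≤ - Bt 0 p t ((yy - 1) * (G * G)) := by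
    rw [← map_neg]; exact Bt_mono fun x1 => by simp
  have h2 := (abs_le.1 (I_young3 p t hs (yy - 1) (fun x hx => by
    have := y_mem hx
    simp only [map_sub, ev_yy, map_one]; rw [abs_le]; constructor <;> linarith) (D2 G) G)).2
  rw [e, map_add, map_smul, smul_eq_mul] at h
  linarith

/-- Interpolation in the vertical direction without boundary conditions. -/
lemma interp2 (p : P) (t : ℝ) {s : ℝ} (hs : 0 < s) (hs1 : s ≤ 1) (G : Sm P) :
    I p t (D2 G * D2 G) ≤
      1000 * (s⁻¹ ^ 2 * I p t (G * G) + s ^ 2 * I p t (D2 (D2 G) * D2 (D2 G))) := by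
  have e : D2 G * D2 G = D2 (G * D2 G) - G * D2 (D2 G) := by
    simp only [Derivation.leibniz, smul_eq_mul]; ring
  have h := (abs_le.1 (I_young p t (s := s⁻¹ ^ 2) (by positivity) G (D2 (D2 G)))).1
  have hb : Bt 1 p t (G * D2 G) - Bt 0 p t (G * D2 G) ≤
      (2 * s⁻¹) * (Bt 1 p t (G * G) + Bt 0 p t (G * G)) +
      (s / 8) * (Bt 1 p t (D2 G * D2 G) + Bt 0 p t (D2 G * D2 G)) := by
    have k : ∀ a b : ℝ, |a * b| ≤ (2 * s⁻¹) * (a * a) + (s / 8) * (b * b) := by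
      intro a b
      have h1 : s * s⁻¹ = 1 := mul_inv_cancel₀ hs.ne'
      have h2 : 0 < s⁻¹ := inv_pos.2 hs
      have h3 : (2 * s⁻¹) * (a * a) + (s / 8) * (b * b) - a * b
          = (s / 8) * (b - 4 * s⁻¹ * a) ^ 2 := by
        linear_combination (a * b - 2 * s⁻¹ * a * a) * h1
      have h4 : (2 * s⁻¹) * (a * a) + (s / 8) * (b * b) + a * b
          = (s / 8) * (b + 4 * s⁻¹ * a) ^ 2 := by
        linear_combination (-a * b - 2 * s⁻¹ * a * a) * h1
      have h5 : 0 ≤ (s / 8) * (b - 4 * s⁻¹ * a) ^ 2 := by positivity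
      have h6 : 0 ≤ (s / 8) * (b + 4 * s⁻¹ * a) ^ 2 := by positivity
      rw [abs_le]; constructor <;> linarith
    have k1 : Bt 1 p t (G * D2 G) ≤ Bt 1 p t ((2 * s⁻¹) • (G * G) + (s / 8) • (D2 G * D2 G)) :=
      Bt_mono fun x1 => by
        simp only [map_add, map_smul, map_mul, smul_eq_mul]; exact (abs_le.1 (k _ _)).2
    have k2 : - Bt 0 p t (G * D2 G) ≤ Bt 0 p t ((2 * s⁻¹) • (G * G) + (s / 8) • (D2 G * D2 G)) := by
      rw [← map_neg]
      exact Bt_mono fun x1 => by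
        simp only [map_add, map_smul, map_mul, smul_eq_mul, map_neg]
        linarith [(abs_le.1 (k (ev p (t, (x1, 0)) G) (ev p (t, (x1, 0)) (D2 G)))).1]
    simp only [map_add, map_smul, smul_eq_mul] at k1 k2
    linarith
  have hq : 0 < s / 32 := by positivity
  have t1 := trace1 p t hq G
  have t0 := trace0 p t hq G
  have T1 := trace1 p t (s := 8 * s) (by positivity) (D2 G)
  have T0 := trace0 p t (s := 8 * s) (by positivity) (D2 G)
  have e2 := I_D2 p t (G * D2 G)
  have e3 : I p t (D2 G * D2 G) = I p t (D2 (G * D2 G)) - I p t (G * D2 (D2 G)) := by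
    conv_lhs => rw [e]
    rw [map_sub]
  set X := I p t (G * G)
  set Y := I p t (D2 G * D2 G) with hY
  set Z := I p t (D2 (D2 G) * D2 (D2 G))
  have hX : 0 ≤ X := I_sq_nonneg _ _ _
  have hYn : 0 ≤ Y := I_sq_nonneg _ _ _
  have hZ : 0 ≤ Z := I_sq_nonneg _ _ _
  have hsi : s * s⁻¹ = 1 := mul_inv_cancel₀ hs.ne'
  have hi : 0 < s⁻¹ := inv_pos.2 hs
  have hi1 : 1 ≤ s⁻¹ := (one_le_inv₀ hs).2 hs1
  have hr1 : (s / 32)⁻¹ = 32 * s⁻¹ := by rw [inv_div]; field_simp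
  have hr2 : (8 * s)⁻¹ = s⁻¹ / 8 := by rw [mul_inv]; ring
  have hr3 : (s⁻¹ ^ 2)⁻¹ = s ^ 2 := by rw [inv_pow, inv_inv]
  rw [hr1] at t1 t0
  rw [hr2] at T1 T0
  rw [hr3] at h
  have m1 : (2 * s⁻¹) * (Bt 1 p t (G * G) + Bt 0 p t (G * G)) ≤
      (2 * s⁻¹) * (2 * ((1 + 2 * (32 * s⁻¹)) * X + 2 * (s / 32) * Y)) := by
    gcongr; linarith
  have m2 : (s / 8) * (Bt 1 p t (D2 G * D2 G) + Bt 0 p t (D2 G * D2 G)) ≤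
      (s / 8) * (2 * ((1 + 2 * (s⁻¹ / 8)) * Y + 2 * (8 * s) * Z)) := by
    gcongr; linarith
  have m1' : (2 * s⁻¹) * (2 * ((1 + 2 * (32 * s⁻¹)) * X + 2 * (s / 32) * Y))
      = 4 * s⁻¹ * X + 256 * s⁻¹ ^ 2 * X + (1 / 4) * Y := by
    linear_combination ((1 / 4) * Y) * hsi
  have m2' : (s / 8) * (2 * ((1 + 2 * (s⁻¹ / 8)) * Y + 2 * (8 * s) * Z))
      = s / 4 * Y + (1 / 16) * Y + 4 * s ^ 2 * Z := by
    linear_combination ((1 / 16) * Y) * hsi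
  have m3 : s⁻¹ * X ≤ s⁻¹ ^ 2 * X := by
    apply mul_le_mul_of_nonneg_right _ hX
    nlinarith
  have m4 : s / 4 * Y ≤ 1 / 4 * Y := by gcongr
  have m5 : 0 ≤ s ^ 2 * Z := by positivity
  have m6 : 0 ≤ s⁻¹ ^ 2 * X := by positivity
  linarith
end

section
variable {P : Type}

/-! ### One-dimensional inequalities -/

lemma sub1D {g g' : ℝ → ℝ} (hg : ∀ x, HasDerivAt g (g' x) x) (hc : Continuous g') {L s : ℝ}
    (hs : 0 < s) {x z : ℝ} (hx : x ∈ Set.Icc 0 L) (hz : z ∈ Set.Icc 0 L) :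
    g x ^ 2 - g z ^ 2 ≤ s⁻¹ * (∫ r in (0 : ℝ)..L, g r ^ 2) + s * ∫ r in (0 : ℝ)..L, g' r ^ 2 := by
  have hgc : Continuous g := continuous_iff_continuousAt.2 fun x => (hg x).continuousAt
  have h1 : g x ^ 2 - g z ^ 2 = ∫ r in z..x, 2 * (g r * g' r) := by
    rw [intervalIntegral.integral_eq_sub_of_hasDerivAt (f := fun r => g r ^ 2)]
    · intro r _
      have := (hg r).fun_pow 2
      simpa [mul_assoc] using this
    · exact (by fun_prop : Continuous fun r => 2 * (g r * g' r)).intervalIntegrable _ _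
  have hL : 0 ≤ L := hx.1.trans hx.2
  have hi : 0 < s⁻¹ := inv_pos.2 hs
  have h2 : s⁻¹ * (∫ r in (0 : ℝ)..L, g r ^ 2) + s * ∫ r in (0 : ℝ)..L, g' r ^ 2
      = ∫ r in (0 : ℝ)..L, (s⁻¹ * g r ^ 2 + s * g' r ^ 2) := by
    rw [intervalIntegral.integral_add, intervalIntegral.integral_const_mul,
      intervalIntegral.integral_const_mul]
    · exact (by fun_prop : Continuous fun r => s⁻¹ * g r ^ 2).intervalIntegrable _ _
    · exact (by fun_prop : Continuous fun r => s * g' r ^ 2).intervalIntegrable _ _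
  rw [h1, h2]
  have hC : Continuous fun r => s⁻¹ * g r ^ 2 + s * g' r ^ 2 := by fun_prop
  have h3 : ∀ r, ‖2 * (g r * g' r)‖ ≤ s⁻¹ * g r ^ 2 + s * g' r ^ 2 := by
    intro r
    have hsi : s * s⁻¹ = 1 := mul_inv_cancel₀ hs.ne'
    have e1 : s⁻¹ * g r ^ 2 + s * g' r ^ 2 - 2 * (g r * g' r) = s * (g' r - s⁻¹ * g r) ^ 2 := by
      linear_combination (2 * g r * g' r - s⁻¹ * g r ^ 2) * hsi
    have e2 : s⁻¹ * g r ^ 2 + s * g' r ^ 2 + 2 * (g r * g' r) = s * (g' r + s⁻¹ * g r) ^ 2 := by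
      linear_combination (-2 * g r * g' r - s⁻¹ * g r ^ 2) * hsi
    have e3 : 0 ≤ s * (g' r - s⁻¹ * g r) ^ 2 := by positivity
    have e4 : 0 ≤ s * (g' r + s⁻¹ * g r) ^ 2 := by positivity
    rw [Real.norm_eq_abs, abs_le]; constructor <;> linarith
  have h4 : ‖∫ r in z..x, 2 * (g r * g' r)‖ ≤ |∫ r in z..x, (s⁻¹ * g r ^ 2 + s * g' r ^ 2)| :=
    intervalIntegral.norm_integral_le_abs_of_norm_le (Eventually.of_forall fun r => h3 r)
      (hC.intervalIntegrable _ _)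
  refine (le_abs_self _).trans (h4.trans ?_)
  have h5 : ∀ a b : ℝ, a ∈ Set.Icc 0 L → b ∈ Set.Icc 0 L → a ≤ b →
      |∫ r in a..b, (s⁻¹ * g r ^ 2 + s * g' r ^ 2)| ≤ ∫ r in (0 : ℝ)..L, (s⁻¹ * g r ^ 2 + s * g' r ^ 2) := by
    intro a b ha hb hab
    rw [abs_of_nonneg (intervalIntegral.integral_nonneg hab fun r _ => by positivity)]
    exact intervalIntegral.integral_mono_interval ha.1 hab hb.2
      (Eventually.of_forall fun r => by simp only [Pi.zero_apply]; positivity) (hC.intervalIntegrable _ _)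
  rcases le_total z x with h | h
  · exact h5 z x hz hx h
  · rw [intervalIntegral.integral_symm, abs_neg]; exact h5 x z hx hz h

lemma agmon1D {g g' : ℝ → ℝ} (hg : ∀ x, HasDerivAt g (g' x) x) (hc : Continuous g') {L s : ℝ}
    (hL : 1 ≤ L) (hs : 0 < s) (hs1 : s ≤ 1) {x : ℝ} (hx : x ∈ Set.Icc 0 L) :
    g x ^ 2 ≤ 2 * (s⁻¹ * (∫ r in (0 : ℝ)..L, g r ^ 2) + s * ∫ r in (0 : ℝ)..L, g' r ^ 2) := by
  have hgc : Continuous g := continuous_iff_continuousAt.2 fun x => (hg x).continuousAt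
  set X := ∫ r in (0 : ℝ)..L, g r ^ 2 with hX
  set Y := ∫ r in (0 : ℝ)..L, g' r ^ 2
  have hL0 : 0 < L := by linarith
  have hX0 : 0 ≤ X := intervalIntegral.integral_nonneg hL0.le fun r _ => by positivity
  have hY0 : 0 ≤ Y := intervalIntegral.integral_nonneg hL0.le fun r _ => by positivity
  have h1 : ∫ z in (0 : ℝ)..L, (g x ^ 2 - (s⁻¹ * X + s * Y)) ≤ X := by
    apply intervalIntegral.integral_mono_on hL0.le (continuous_const.intervalIntegrable _ _)
      ((by fun_prop : Continuous fun r => g r ^ 2).intervalIntegrable _ _)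
    intro z hz
    linarith [sub1D hg hc hs hx hz]
  rw [intervalIntegral.integral_const, smul_eq_mul, sub_zero] at h1
  have hi1 : 1 ≤ s⁻¹ := (one_le_inv₀ hs).2 hs1
  have h2 : X ≤ L * (s⁻¹ * X) := by
    have : 1 ≤ L * s⁻¹ := by nlinarith
    nlinarith
  have h3 : L * (g x ^ 2) ≤ L * (2 * (s⁻¹ * X + s * Y)) := by
    have : 0 ≤ L * (s * Y) := by positivity
    nlinarith
  exact le_of_mul_le_mul_left h3 hL0

lemma var1D {g : ℝ → ℝ} (hgc : Continuous g) {L : ℝ} (hL : 0 < L) :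
    ∫ r in (0 : ℝ)..L, (g r - (∫ r in (0 : ℝ)..L, g r) / L) ^ 2 =
      (∫ r in (0 : ℝ)..L, g r ^ 2) - (∫ r in (0 : ℝ)..L, g r) ^ 2 / L := by
  set m := ∫ r in (0 : ℝ)..L, g r with hm
  have : ∀ r, (g r - m / L) ^ 2 = g r ^ 2 - (2 * (m / L)) * g r + (m / L) ^ 2 := fun r => by ring
  simp only [this]
  rw [intervalIntegral.integral_add, intervalIntegral.integral_sub,
    intervalIntegral.integral_const_mul, intervalIntegral.integral_const, ← hm]
  · simp only [smul_eq_mul]; field_simp; ring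
  · exact (by fun_prop : Continuous fun r => g r ^ 2).intervalIntegrable _ _
  · exact (by fun_prop : Continuous fun r => (2 * (m / L)) * g r).intervalIntegrable _ _
  · exact (by fun_prop : Continuous fun r => g r ^ 2 - (2 * (m / L)) * g r).intervalIntegrable _ _
  · exact continuous_const.intervalIntegrable _ _

lemma cs1D {g : ℝ → ℝ} (hgc : Continuous g) {L : ℝ} (hL : 0 < L) :
    (∫ r in (0 : ℝ)..L, g r) ^ 2 ≤ L * ∫ r in (0 : ℝ)..L, g r ^ 2 := by
  have h := var1D hgc hL
  have h0 : 0 ≤ ∫ r in (0 : ℝ)..L, (g r - (∫ r in (0 : ℝ)..L, g r) / L) ^ 2 :=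
    intervalIntegral.integral_nonneg hL.le fun r _ => by positivity
  rw [h, sub_nonneg, div_le_iff₀ hL] at h0
  linarith

lemma wirt1D {g g' : ℝ → ℝ} (hg : ∀ x, HasDerivAt g (g' x) x) (hc : Continuous g') {L : ℝ}
    (hL : 0 < L) : (∫ r in (0 : ℝ)..L, g r ^ 2) ≤
      4 * L ^ 2 * (∫ r in (0 : ℝ)..L, g' r ^ 2) + (∫ r in (0 : ℝ)..L, g r) ^ 2 / L := by
  have hgc : Continuous g := continuous_iff_continuousAt.2 fun x => (hg x).continuousAt
  have hv := var1D hgc hL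
  set m := ∫ r in (0 : ℝ)..L, g r with hm
  have hk : ∀ x, HasDerivAt (fun r => g r - m / L) (g' x) x := fun x => (hg x).sub_const _
  have hkc : Continuous fun r => g r - m / L := by fun_prop
  have hz : ∃ z ∈ Set.Icc 0 L, g z - m / L = 0 := by
    by_contra hne
    push Not at hne
    have hIntg : ∫ r in (0 : ℝ)..L, (g r - m / L) = 0 := by
      rw [intervalIntegral.integral_sub (hgc.intervalIntegrable _ _)
        (continuous_const.intervalIntegrable _ _), intervalIntegral.integral_const, ← hm]
      simp only [smul_eq_mul]; field_simp; ring
    have hconn : IsPreconnected (Set.Icc 0 L) := isPreconnected_Icc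
    have h0m : (0 : ℝ) ∈ Set.Icc 0 L := ⟨le_rfl, hL.le⟩
    rcases lt_or_gt_of_ne (hne 0 h0m) with hlt | hgt
    · have hall : ∀ z ∈ Set.Icc 0 L, g z - m / L < 0 := by
        intro z hz'
        by_contra hc'
        push Not at hc'
        obtain ⟨w, hw, hw0⟩ := hconn.intermediate_value h0m hz' hkc.continuousOn ⟨hlt.le, hc'⟩
        exact hne w hw hw0
      have := intervalIntegral.intervalIntegral_pos_of_pos_on (f := fun r => -(g r - m / L))
        (hkc.neg.intervalIntegrable 0 L) (fun z hz' => by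
          have := hall z ⟨hz'.1.le, hz'.2.le⟩; linarith) hL
      rw [intervalIntegral.integral_neg, hIntg] at this
      linarith
    · have hall : ∀ z ∈ Set.Icc 0 L, 0 < g z - m / L := by
        intro z hz'
        by_contra hc'
        push Not at hc'
        obtain ⟨w, hw, hw0⟩ := hconn.intermediate_value hz' h0m hkc.continuousOn ⟨hc', hgt.le⟩
        exact hne w hw hw0
      have := intervalIntegral.intervalIntegral_pos_of_pos_on (f := fun r => (g r - m / L))
        (hkc.intervalIntegrable 0 L) (fun z hz' => hall z ⟨hz'.1.le, hz'.2.le⟩) hL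
      rw [hIntg] at this
      linarith
  obtain ⟨z, hz, hz0⟩ := hz
  set X := ∫ r in (0 : ℝ)..L, (g r - m / L) ^ 2 with hX
  set Y := ∫ r in (0 : ℝ)..L, g' r ^ 2
  have h1 : X ≤ ∫ _x in (0 : ℝ)..L, ((2 * L)⁻¹ * X + (2 * L) * Y) := by
    apply intervalIntegral.integral_mono_on hL.le
      ((by fun_prop : Continuous fun r => (g r - m / L) ^ 2).intervalIntegrable _ _)
      (continuous_const.intervalIntegrable _ _)
    intro x hx
    have := sub1D hk hc (show 0 < 2 * L by positivity) hx hz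
    rw [hz0] at this
    linarith
  rw [intervalIntegral.integral_const, smul_eq_mul, sub_zero] at h1
  have h2 : L * ((2 * L)⁻¹ * X + (2 * L) * Y) = X / 2 + 2 * L ^ 2 * Y := by field_simp
  rw [h2] at h1
  linarith

/-! ### Two-dimensional consequences -/

lemma cont_x1 (G : Sm P) (p : P) (t x2 : ℝ) : Continuous fun x1 : ℝ => ev p (t, (x1, x2)) G :=
  (ev_cont G p).comp (by fun_prop)

lemma cont_x2 (G : Sm P) (p : P) (t x1 : ℝ) : Continuous fun x2 : ℝ => ev p (t, (x1, x2)) G :=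
  (ev_cont G p).comp (by fun_prop)

lemma two_pi_ge : (1 : ℝ) ≤ 2 * π := by linarith [Real.pi_gt_three]

lemma I_sq (p : P) (t : ℝ) (G : Sm P) : I p t (G * G) =
    ∫ x1 in (0 : ℝ)..(2 * π), ∫ x2 in (0 : ℝ)..1, ev p (t, (x1, x2)) G ^ 2 := by
  rw [I_def, int_Ω_eq (sl_cont _ p t)]
  simp only [map_mul, pow_two]

lemma I_sq' (p : P) (t : ℝ) (G : Sm P) : I p t (G * G) =
    ∫ x2 in (0 : ℝ)..1, ∫ x1 in (0 : ℝ)..(2 * π), ev p (t, (x1, x2)) G ^ 2 := by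
  rw [I_def, int_Ω_eq' (sl_cont _ p t)]
  simp only [map_mul, pow_two]

lemma cont_int_x1 (G : Sm P) (p : P) (t : ℝ) :
    Continuous fun x2 : ℝ => ∫ x1 in (0 : ℝ)..(2 * π), ev p (t, (x1, x2)) G ^ 2 := by
  apply intervalIntegral.continuous_parametric_intervalIntegral_of_continuous'
  exact ((ev_cont G p).comp (by fun_prop : Continuous fun z : ℝ × ℝ => ((t, (z.2, z.1)) : V))).pow 2

lemma agmon (p : P) (t : ℝ) (G : Sm P) {s : ℝ} (hs : 0 < s) (hs1 : s ≤ 1) {x : ℝ × ℝ} (hx : x ∈ Ω) :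
    ev p (t, x) G ^ 2 ≤ 4 * (s⁻¹ ^ 2 * I p t (G * G) + I p t (D1 G * D1 G) + I p t (D2 G * D2 G)
      + s ^ 2 * I p t (D1 (D2 G) * D1 (D2 G))) := by
  obtain ⟨x1, x2⟩ := x
  have hx' := Ω_sub hx
  have h1 : x1 ∈ Set.Icc 0 (2 * π) := hx'.1
  have h2 : x2 ∈ Set.Icc (0 : ℝ) 1 := hx'.2
  have key : ∀ K : Sm P, (∫ z in (0 : ℝ)..1, ev p (t, (x1, z)) K ^ 2) ≤
      2 * (s⁻¹ * I p t (K * K) + s * I p t (D1 K * D1 K)) := by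
    intro K
    rw [I_sq', I_sq', ← intervalIntegral.integral_const_mul, ← intervalIntegral.integral_const_mul,
      ← intervalIntegral.integral_add, ← intervalIntegral.integral_const_mul]
    · apply intervalIntegral.integral_mono_on (by norm_num)
      · exact ((cont_x2 K p t x1).pow 2).intervalIntegrable _ _
      · exact (by
          have := cont_int_x1 K p t
          have := cont_int_x1 (D1 K) p t
          fun_prop : Continuous fun x2 : ℝ => 2 * (s⁻¹ * (∫ x1 in (0 : ℝ)..(2 * π), ev p (t, (x1, x2)) K ^ 2)
            + s * ∫ x1 in (0 : ℝ)..(2 * π), ev p (t, (x1, x2)) (D1 K) ^ 2)).intervalIntegrable _ _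
      · intro z _
        exact agmon1D (fun r => hasDerivAt1 K p t r z) (cont_x1 (D1 K) p t z) two_pi_ge hs hs1 h1
    · exact ((cont_int_x1 K p t).const_mul _).intervalIntegrable _ _
    · exact ((cont_int_x1 (D1 K) p t).const_mul _).intervalIntegrable _ _
  have h3 := agmon1D (fun r => hasDerivAt2 G p t x1 r) (cont_x2 (D2 G) p t x1) le_rfl hs hs1 h2
  have k1 := key G
  have k2 := key (D2 G)
  have hi : 0 < s⁻¹ := inv_pos.2 hs
  have hsi : s * s⁻¹ = 1 := mul_inv_cancel₀ hs.ne'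
  have k1' := mul_le_mul_of_nonneg_left k1 hi.le
  have k2' := mul_le_mul_of_nonneg_left k2 hs.le
  have e1 : s⁻¹ * (2 * (s⁻¹ * I p t (G * G) + s * I p t (D1 G * D1 G))) =
      2 * (s⁻¹ ^ 2 * I p t (G * G) + I p t (D1 G * D1 G)) := by
    linear_combination (2 * I p t (D1 G * D1 G)) * hsi
  have e2 : s * (2 * (s⁻¹ * I p t (D2 G * D2 G) + s * I p t (D1 (D2 G) * D1 (D2 G)))) =
      2 * (I p t (D2 G * D2 G) + s ^ 2 * I p t (D1 (D2 G) * D1 (D2 G))) := by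
    linear_combination (2 * I p t (D2 G * D2 G)) * hsi
  linarith

lemma Bt_hasDerivAt (p : P) (t c : ℝ) (G : Sm P) :
    HasDerivAt (fun c => Bt c p t G) (Bt c p t (D2 G)) c := by
  simp only [Bt_def]
  obtain ⟨M, hM⟩ := ((isCompact_Icc (a := 0) (b := 2 * π)).prod
    (isCompact_Icc (a := c - 1) (b := c + 1))).exists_bound_of_continuousOn
    (sl_cont (D2 G) p t).continuousOn
  refine (intervalIntegral.hasDerivAt_integral_of_dominated_loc_of_deriv_le (μ := volume)
    (F := fun c x1 => ev p (t, (x1, c)) G) (F' := fun c x1 => ev p (t, (x1, c)) (D2 G)) (x₀ := c)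
    (s := Set.Icc (c - 1) (c + 1)) (bound := fun _ => M)
    (Icc_mem_nhds (by linarith) (by linarith)) ?_ ?_ ?_ ?_ ?_ ?_).2
  · exact Eventually.of_forall fun s => (cont_x1 G p t s).aestronglyMeasurable
  · exact (cont_x1 G p t c).intervalIntegrable _ _
  · exact (cont_x1 (D2 G) p t c).aestronglyMeasurable
  · refine Eventually.of_forall fun x hx s hs => ?_
    rw [Set.uIoc_of_le (by positivity)] at hx
    exact hM (x, s) ⟨Set.Ioc_subset_Icc_self hx, hs⟩
  · exact continuous_const.intervalIntegrable _ _
  · exact Eventually.of_forall fun x _ s _ => hasDerivAt2 G p t x s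

/-- Poincaré inequality for mean-zero functions. -/
lemma poincare_mean (p : P) (t : ℝ) (G : Sm P) (h0 : I p t G = 0) :
    I p t (G * G) ≤ 200 * (I p t (D1 G * D1 G) + I p t (D2 G * D2 G)) := by
  have hpi : (0 : ℝ) < 2 * π := by positivity
  have c1 := fun K : Sm P => cont_int_x1 K p t
  have cB : ∀ K : Sm P, Continuous fun c => Bt c p t K := fun K =>
    continuous_iff_continuousAt.2 fun c => (Bt_hasDerivAt p t c K).continuousAt
  have h1 : I p t (G * G) ≤ 4 * (2 * π) ^ 2 * I p t (D1 G * D1 G)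
      + (2 * π)⁻¹ * ∫ c in (0 : ℝ)..1, Bt c p t G ^ 2 := by
    rw [I_sq', I_sq', ← intervalIntegral.integral_const_mul, ← intervalIntegral.integral_const_mul,
      ← intervalIntegral.integral_add]
    · apply intervalIntegral.integral_mono_on (by norm_num)
      · exact (c1 G).intervalIntegrable _ _
      · exact (((c1 (D1 G)).const_mul _).add (((cB G).pow 2).const_mul _)).intervalIntegrable _ _
      · intro z _
        have := wirt1D (fun r => hasDerivAt1 G p t r z) (cont_x1 (D1 G) p t z) hpi
        rw [div_eq_inv_mul] at this
        rw [Bt_def]; exact this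
    · exact ((c1 (D1 G)).const_mul _).intervalIntegrable _ _
    · exact (((cB G).pow 2).const_mul _).intervalIntegrable _ _
  have h2 : (∫ c in (0 : ℝ)..1, Bt c p t G ^ 2) ≤ 4 * ∫ c in (0 : ℝ)..1, Bt c p t (D2 G) ^ 2 := by
    have := wirt1D (fun r => Bt_hasDerivAt p t r G) (cB (D2 G)) one_pos
    have e : ∫ c in (0 : ℝ)..1, Bt c p t G = 0 := by
      rw [I_def, int_Ω_eq' (sl_cont _ p t)] at h0
      simp only [Bt_def]; exact h0
    rw [e] at this
    linarith
  have h3 : (∫ c in (0 : ℝ)..1, Bt c p t (D2 G) ^ 2) ≤ (2 * π) * I p t (D2 G * D2 G) := by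
    rw [I_sq', ← intervalIntegral.integral_const_mul]
    apply intervalIntegral.integral_mono_on (by norm_num)
    · exact ((cB (D2 G)).pow 2).intervalIntegrable _ _
    · exact ((c1 (D2 G)).const_mul _).intervalIntegrable _ _
    · intro z _
      rw [Bt_def]; exact cs1D (cont_x1 (D2 G) p t z) hpi
  have h4 : (2 * π)⁻¹ * ∫ c in (0 : ℝ)..1, Bt c p t G ^ 2 ≤ 4 * I p t (D2 G * D2 G) := by
    rw [inv_mul_le_iff₀ hpi]; linarith
  have h5 : 4 * (2 * π) ^ 2 ≤ 200 := by nlinarith [Real.pi_lt_d2, Real.pi_pos]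
  have h6 := mul_le_mul_of_nonneg_right h5 (I_sq_nonneg p t (D1 G))
  linarith [I_sq_nonneg p t (D2 G)]

/-! ### A Nečas-type inequality -/

/-- Vertical dilation. -/
def dil (α β : ℝ) (G : Sm P) : Sm P :=
  mkSm (fun p v => ev p (v.1, (v.2.1, α * v.2.2 + β)) G)
    (fun p => (ev_smooth G p).comp (by fun_prop)) (fun p t x1 x2 => ev_per G p t x1 _)

lemma ev_dil (α β : ℝ) (G : Sm P) (p : P) (t x1 x2 : ℝ) :
    ev p (t, (x1, x2)) (dil α β G) = ev p (t, (x1, α * x2 + β)) G := by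
  unfold dil; rw [ev_mkSm]

attribute [irreducible] dil

lemma D1_dil (α β : ℝ) (G : Sm P) : D1 (dil α β G) = dil α β (D1 G) := by
  apply Sm.ext'
  rintro p ⟨t, x1, x2⟩
  rw [ev_dil]
  refine (hasDerivAt1 (dil α β G) p t x1 x2).unique ?_
  simp only [ev_dil]
  exact hasDerivAt1 G p t x1 (α * x2 + β)

lemma D2_dil (α β : ℝ) (G : Sm P) : D2 (dil α β G) = α • dil α β (D2 G) := by
  apply Sm.ext'
  rintro p ⟨t, x1, x2⟩
  refine (hasDerivAt2 (dil α β G) p t x1 x2).unique ?_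
  rw [map_smul, ev_dil, smul_eq_mul, mul_comm]
  simp only [ev_dil]
  have h := hasDerivAt2 G p t x1 (α * x2 + β)
  have h2 : HasDerivAt (fun x2 : ℝ => α * x2 + β) α x2 := by
    simpa using ((hasDerivAt_id x2).const_mul α).add_const β
  exact h.comp x2 h2

lemma I_dil (p : P) (t : ℝ) {α β : ℝ} (hα : 0 < α) (hβ : 0 ≤ β) (hαβ : α + β ≤ 1) (G : Sm P) :
    I p t (dil α β G * dil α β G) ≤ α⁻¹ * I p t (G * G) := by
  rw [I_sq, I_sq, ← intervalIntegral.integral_const_mul]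
  have cc : ∀ K : Sm P, Continuous fun x1 : ℝ => ∫ x2 in (0 : ℝ)..1, ev p (t, (x1, x2)) K ^ 2 := by
    intro K
    apply intervalIntegral.continuous_parametric_intervalIntegral_of_continuous'
    exact ((ev_cont K p).comp (by fun_prop : Continuous fun z : ℝ × ℝ => ((t, (z.1, z.2)) : V))).pow 2
  apply intervalIntegral.integral_mono_on (by positivity) ((cc _).intervalIntegrable _ _)
    (((cc _).const_mul _).intervalIntegrable _ _)
  intro x1 _
  simp only [ev_dil]
  rw [intervalIntegral.integral_comp_mul_add (fun z => ev p (t, (x1, z)) G ^ 2) hα.ne' β, smul_eq_mul]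
  gcongr
  apply intervalIntegral.integral_mono_interval
  · simpa using hβ
  · linarith
  · linarith
  · exact Eventually.of_forall fun r => by simp only [Pi.zero_apply]; positivity
  · exact ((cont_x2 G p t x1).pow 2).intervalIntegrable _ _

set_option maxHeartbeats 1000000 in
lemma necas (p : P) (t : ℝ) (q G g : Sm P) {η : ℝ} (hη : 0 < η) (hη1 : η ≤ 1)
    (h : ∀ x ∈ Ω, ev p (t, x) (D1 q) = ev p (t, x) (D2 G + g)) :
    I p t (D1 q * D1 q) ≤ 2 * η * I p t (q * q) + 30000 * η⁻¹ * I p t (D1 G * D1 G)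
      + 2 * I p t (D2 q * D2 q) + 10 * I p t (g * g) := by
  obtain ⟨α, hα⟩ : ∃ α : ℝ, α = 1 / 1024 := ⟨_, rfl⟩
  set G0 := dil α 0 G with hG0
  set G1 := dil α (1 - α) G with hG1
  set W := G - yy * G1 - (1 - yy) * G0 with hW
  have b0 : ∀ K : Sm P, I p t (dil α 0 K * dil α 0 K) ≤ 1024 * I p t (K * K) := fun K => by
    have := I_dil p t (α := α) (β := 0) (by norm_num [hα]) le_rfl (by norm_num [hα]) K
    convert this using 2; norm_num [hα]
  have b1 : ∀ K : Sm P, I p t (dil α (1 - α) K * dil α (1 - α) K) ≤ 1024 * I p t (K * K) := fun K => by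
    have := I_dil p t (α := α) (β := 1 - α) (by norm_num [hα]) (by norm_num [hα]) (by norm_num [hα]) K
    convert this using 2; norm_num [hα]
  have w0 : ∀ x1, ev p (t, (x1, 0)) W = 0 := fun x1 => by
    simp [hW, hG0, hG1, ev_dil]
  have w1 : ∀ x1, ev p (t, (x1, 1)) W = 0 := fun x1 => by
    simp [hW, hG0, hG1, ev_dil]
  have hz : I p t (D2 (D1 q * W)) = 0 := by apply I_D2_zero <;> intro x1 <;> simp [w0, w1]
  have e : D1 q * D2 G = D2 (D1 q * W) - D1 (D2 q * W) + D2 q * D1 W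
      + (D1 (q * G1) - q * D1 G1) - (D1 (q * G0) - q * D1 G0)
      + α • (yy * D1 q * dil α (1 - α) (D2 G)) + α • ((1 - yy) * D1 q * dil α 0 (D2 G)) := by
    simp only [hW, hG1, hG0, Derivation.leibniz, map_sub, D2_yy, D1_yy, smul_eq_mul,
      Derivation.map_one_eq_zero, D21, D2_dil, D1_dil, Algebra.smul_def]
    ring
  have hyy : ∀ x ∈ Ω, |ev p (t, x) yy| ≤ 1 := fun x hx => by
    have := y_mem hx
    simp only [ev_yy]; rw [abs_le]; constructor <;> linarith
  have hyy' : ∀ x ∈ Ω, |ev p (t, x) (1 - yy)| ≤ 1 := fun x hx => by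
    have := y_mem hx
    simp only [map_sub, map_one, ev_yy]; rw [abs_le]; constructor <;> linarith
  have j1 := (abs_le.1 (I_young3 p t (s := 32) (by norm_num) yy hyy (D1 q) (dil α (1 - α) (D2 G)))).2
  have j2 := (abs_le.1 (I_young3 p t (s := 32) (by norm_num) (1 - yy) hyy' (D1 q) (dil α 0 (D2 G)))).2
  have j3 := (abs_le.1 (I_young p t (s := η / 2) (by positivity) q (D1 G1))).1
  have j4 := (abs_le.1 (I_young p t (s := η / 2) (by positivity) q (D1 G0))).2
  have j5 := (abs_le.1 (I_young p t (s := 1) (by norm_num) (D2 q) (D1 W))).2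
  have j6 := (abs_le.1 (I_young p t (s := 1 / 4) (by norm_num) (D1 q) g)).2
  have hmain : I p t (D1 q * D1 q) = I p t (D1 q * D2 G) + I p t (D1 q * g) := by
    rw [← map_add]; apply I_congr; intro x hx
    rw [map_mul, map_add, map_mul, map_mul, h x hx, map_add]; ring
  have hE : I p t (D1 q * D2 G) = I p t (D2 q * D1 W) - I p t (q * D1 G1) + I p t (q * D1 G0)
      + α * I p t (yy * D1 q * dil α (1 - α) (D2 G)) + α * I p t ((1 - yy) * D1 q * dil α 0 (D2 G)) := by
    rw [e]
    simp only [map_add, map_sub, map_smul, smul_eq_mul, hz, I_D1]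
    ring
  have hG2 : I p t (D2 G * D2 G) ≤ 2 * I p t (D1 q * D1 q) + 2 * I p t (g * g) := by
    have : I p t (D2 G * D2 G) ≤ I p t ((2 : ℝ) • (D1 q * D1 q) + (2 : ℝ) • (g * g)) := by
      apply I_mono; intro x hx
      have := h x hx
      rw [map_add] at this
      simp only [map_add, map_mul, map_smul, smul_eq_mul, this]
      nlinarith [sq_nonneg (ev p (t, x) (D2 G) + 2 * ev p (t, x) g)]
    rwa [I_two] at this
  have hW1 : I p t (D1 W * D1 W) ≤ 3 * (I p t (D1 G * D1 G) + I p t (D1 G1 * D1 G1) + I p t (D1 G0 * D1 G0)) := by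
    have : I p t (D1 W * D1 W) ≤
        I p t ((3 : ℝ) • (D1 G * D1 G + D1 G1 * D1 G1 + D1 G0 * D1 G0)) := by
      apply I_mono; intro x hx
      have hy := y_mem hx
      simp only [hW, Derivation.leibniz, map_add, map_sub, D1_yy, smul_eq_mul,
        Derivation.map_one_eq_zero, map_mul, map_smul, ev_yy, map_one, map_zero]
      have := sq_nonneg (ev p (t, x) (D1 G) + x.2 * ev p (t, x) (D1 G1))
      have := sq_nonneg (ev p (t, x) (D1 G) + (1 - x.2) * ev p (t, x) (D1 G0))
      have := sq_nonneg (x.2 * ev p (t, x) (D1 G1) - (1 - x.2) * ev p (t, x) (D1 G0))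
      have h1 : (x.2 * ev p (t, x) (D1 G1)) ^ 2 ≤ ev p (t, x) (D1 G1) ^ 2 := by
        rw [mul_pow]; exact mul_le_of_le_one_left (sq_nonneg _) (by nlinarith)
      have h2 : ((1 - x.2) * ev p (t, x) (D1 G0)) ^ 2 ≤ ev p (t, x) (D1 G0) ^ 2 := by
        rw [mul_pow]; exact mul_le_of_le_one_left (sq_nonneg _) (by nlinarith)
      nlinarith
    rwa [map_smul, map_add, map_add, smul_eq_mul] at this
  have c0 := b0 (D1 G)
  have c1 := b1 (D1 G)
  have c2 := b0 (D2 G)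
  have c3 := b1 (D2 G)
  rw [hG1, D1_dil] at j3
  rw [hG0, D1_dil] at j4
  rw [hG1, hG0, D1_dil, D1_dil] at hW1 hE
  have hη2 : 1 ≤ η⁻¹ := (one_le_inv₀ hη).2 hη1
  have hr : (η / 2)⁻¹ = 2 * η⁻¹ := by rw [inv_div]; rfl
  rw [hr] at j3 j4
  have hGn := I_sq_nonneg p t (D1 G)
  have i1 : 2 * η⁻¹ * I p t (dil α (1 - α) (D1 G) * dil α (1 - α) (D1 G)) ≤
    2 * η⁻¹ * (1024 * I p t (D1 G * D1 G)) := by gcongr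
  have i2 : 2 * η⁻¹ * I p t (dil α 0 (D1 G) * dil α 0 (D1 G)) ≤
    2 * η⁻¹ * (1024 * I p t (D1 G * D1 G)) := by gcongr
  have i3 : I p t (D1 G * D1 G) ≤ η⁻¹ * I p t (D1 G * D1 G) := le_mul_of_one_le_left hGn hη2
  have e1 : (32 : ℝ)⁻¹ = 1 / 32 := by norm_num
  have e2 : (1 : ℝ)⁻¹ = 1 := by norm_num
  have e3 : (1 / 4 : ℝ)⁻¹ = 4 := by norm_num
  rw [e1] at j1 j2
  rw [e2] at j5
  rw [e3] at j6
  have hαX : ∀ X : ℝ, α * X = X / 1024 := fun X => by rw [hα]; ring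
  rw [hαX, hαX] at hE
  linarith [I_sq_nonneg p t (D1 q), I_sq_nonneg p t g, I_sq_nonneg p t (D2 q)]

end

section

/-! ### Configurations -/

/-- The fixed physical parameters. -/
structure Par where
  γ : ℝ
  Pr : ℝ
  r : ℝ
  K : ℝ
  Re : ℝ
  hγ : 1 < γ
  hPr : 0 < Pr
  hr : 0 < 1 + r
  hK : 0 < K
  hRe : 0 < Re

/-- Solutions with all the standing hypotheses. -/
structure Cfg (q : Par) where
  ε : ℝ
  χ : ℝ
  T : ℝ
  S : PerturbSol q.γ q.Pr q.r q.Re ε χ T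
  hε : 0 < ε
  hε1 : ε ≤ 1
  hχ : |1 - χ| ≤ q.K * ε
  hχ2 : |1 - χ| ≤ 1 / 2
  hT : 0 < T
  sm : SmoothSol S
  std : StdHyp S
  hN : Nfun ε S.φ S.ψ S.θ T ≤ 1

variable {q : Par}

def ff : Sm (Cfg q) := mkSm (fun c v => c.S.φ v.1 v.2) (fun c => c.sm.1)
  (fun c t x1 x2 => c.S.periodic_φ t (x1, x2))
def uu : Sm (Cfg q) := mkSm (fun c v => (c.S.ψ v.1 v.2).1) (fun c => c.sm.2.1.fst)
  (fun c t x1 x2 => congrArg Prod.fst (c.S.periodic_ψ t (x1, x2)))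
def ww : Sm (Cfg q) := mkSm (fun c v => (c.S.ψ v.1 v.2).2) (fun c => c.sm.2.1.snd)
  (fun c t x1 x2 => congrArg Prod.snd (c.S.periodic_ψ t (x1, x2)))
def hh : Sm (Cfg q) := mkSm (fun c v => c.S.θ v.1 v.2) (fun c => c.sm.2.2)
  (fun c t x1 x2 => c.S.periodic_θ t (x1, x2))

/-- A smooth positive cutoff of the identity. -/
def cutp (s : ℝ) : ℝ := s * Real.smoothTransition (4 * s - 1) + (1 - Real.smoothTransition (4 * s - 1)) / 4

lemma cutp_smooth : ContDiff ℝ (⊤ : ℕ∞) cutp := by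
  unfold cutp
  have : ContDiff ℝ (⊤ : ℕ∞) fun s : ℝ => Real.smoothTransition (4 * s - 1) :=
    Real.smoothTransition.contDiff.comp (by fun_prop)
  fun_prop

lemma cutp_pos (s : ℝ) : 0 < cutp s := by
  unfold cutp
  rcases le_or_gt s (1 / 4) with h | h
  · rw [Real.smoothTransition.zero_of_nonpos (by linarith)]; norm_num
  · have h1 := Real.smoothTransition.nonneg (4 * s - 1)
    have h2 := Real.smoothTransition.le_one (4 * s - 1)
    nlinarith

lemma cutp_eq {s : ℝ} (h : 1 / 2 ≤ s) : cutp s = s := by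
  unfold cutp
  rw [Real.smoothTransition.one_of_one_le (by linarith)]; ring

lemma tT_smooth (c : Cfg q) : ContDiff ℝ (⊤ : ℕ∞) (fun v : V => tT q.γ q.Pr c.ε c.χ v.2) := by
  unfold tT; fun_prop

def aa : Sm (Cfg q) := mkSm (fun c v => cutp (tT q.γ q.Pr c.ε c.χ v.2))
  (fun c => cutp_smooth.comp (tT_smooth c)) (fun c t x1 x2 => by simp [tT])
def bb : Sm (Cfg q) := mkSm (fun c v => (cutp (tT q.γ q.Pr c.ε c.χ v.2))⁻¹)
  (fun c => (cutp_smooth.comp (tT_smooth c)).inv fun v => (cutp_pos _).ne') (fun c t x1 x2 => by simp [tT])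

/-- Real constants and powers of `ε`. -/
def kc (x : ℝ) : Sm (Cfg q) := cst fun _ => x
def Ep (n : ℤ) : Sm (Cfg q) := cst fun c => c.ε ^ n

@[simp] lemma ev_kc (x : ℝ) (c : Cfg q) (v : V) : ev c v (kc x) = x := by simp [kc]
@[simp] lemma ev_Ep (n : ℤ) (c : Cfg q) (v : V) : ev c v (Ep n) = c.ε ^ n := by simp [Ep]
@[simp] lemma DD_kc (e : V) (x : ℝ) : DD e (kc x : Sm (Cfg q)) = 0 := DD_cst _ _
@[simp] lemma DD_Ep (e : V) (n : ℤ) : DD e (Ep n : Sm (Cfg q)) = 0 := DD_cst _ _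
lemma Ep_mul (m n : ℤ) : (Ep m * Ep n : Sm (Cfg q)) = Ep (m + n) := by
  apply Sm.ext'; intro c v; simp [zpow_add₀ c.hε.ne']
lemma Ep_zero : (Ep 0 : Sm (Cfg q)) = 1 := by
  apply Sm.ext'; intro c v; simp

lemma ev_ff (c : Cfg q) (v : V) : ev c v ff = c.S.φ v.1 v.2 := by
  unfold ff; exact ev_mkSm _ _ _ _ _
lemma ev_uu (c : Cfg q) (v : V) : ev c v uu = (c.S.ψ v.1 v.2).1 := by
  unfold uu; exact ev_mkSm _ _ _ _ _
lemma ev_ww (c : Cfg q) (v : V) : ev c v ww = (c.S.ψ v.1 v.2).2 := by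
  unfold ww; exact ev_mkSm _ _ _ _ _
lemma ev_hh (c : Cfg q) (v : V) : ev c v hh = c.S.θ v.1 v.2 := by
  unfold hh; exact ev_mkSm _ _ _ _ _

lemma ev_aa0 (c : Cfg q) (v : V) : ev c v aa = cutp (tT q.γ q.Pr c.ε c.χ v.2) := by
  unfold aa; exact ev_mkSm _ _ _ _ _
lemma ev_bb0 (c : Cfg q) (v : V) : ev c v bb = (cutp (tT q.γ q.Pr c.ε c.χ v.2))⁻¹ := by
  unfold bb; exact ev_mkSm _ _ _ _ _

lemma tT_ge (c : Cfg q) {x : ℝ × ℝ} (h0 : 0 ≤ x.2) (h1 : x.2 ≤ 1) : 1 / 2 ≤ tT q.γ q.Pr c.ε c.χ x := by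
  unfold tT
  have h := abs_le.1 c.hχ2
  have hγ := q.hγ
  have hP := q.hPr
  have h2 : 0 ≤ c.ε ^ 2 * q.Pr / (2 * (q.γ / (q.γ - 1))) := by
    have : 0 < q.γ - 1 := by linarith
    have : 0 < q.γ := by linarith
    positivity
  nlinarith [mul_nonneg h2 (mul_nonneg h0 (sub_nonneg.2 h1))]

lemma ev_aa (c : Cfg q) (t : ℝ) {x : ℝ × ℝ} (hx : x ∈ Ω) : ev c (t, x) aa = tT q.γ q.Pr c.ε c.χ x := by
  rw [ev_aa0]
  exact cutp_eq (tT_ge c (y_mem hx).1.le (y_mem hx).2.le)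
lemma ev_bb (c : Cfg q) (t : ℝ) {x : ℝ × ℝ} (hx : x ∈ Ω) : ev c (t, x) bb = tρ q.γ q.Pr c.ε c.χ x := by
  rw [ev_bb0, tρ]
  rw [cutp_eq (tT_ge c (y_mem hx).1.le (y_mem hx).2.le)]

lemma ab1 : (aa * bb : Sm (Cfg q)) = 1 := by
  apply Sm.ext'; intro c v; simp [ev_aa0, ev_bb0, (cutp_pos _).ne']

lemma D0_aa : D0 (aa : Sm (Cfg q)) = 0 := by
  apply Sm.ext'; rintro c ⟨t, x1, x2⟩
  refine (hasDerivAt0 aa c t x1 x2).unique ?_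
  simp only [ev_aa0, map_zero]; exact hasDerivAt_const _ _
lemma D1_aa : D1 (aa : Sm (Cfg q)) = 0 := by
  apply Sm.ext'; rintro c ⟨t, x1, x2⟩
  refine (hasDerivAt1 aa c t x1 x2).unique ?_
  simp only [ev_aa0, map_zero, tT]; exact hasDerivAt_const _ _

lemma DD_bb (e : V) : DD e (bb : Sm (Cfg q)) = - DD e aa * bb * bb := by
  have h : DD e (aa * bb : Sm (Cfg q)) = 0 := by rw [ab1]; simp
  simp only [Derivation.leibniz, smul_eq_mul] at h
  linear_combination bb * h - DD e bb * ab1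
lemma D0_bb : D0 (bb : Sm (Cfg q)) = 0 := by rw [DD_bb, D0_aa]; ring
lemma D1_bb : D1 (bb : Sm (Cfg q)) = 0 := by rw [DD_bb, D1_aa]; ring
lemma D2_bb : D2 (bb : Sm (Cfg q)) = - D2 aa * bb * bb := DD_bb _

attribute [irreducible] ff uu ww hh aa bb kc Ep

/-! ### Vanishing on the space-time domain -/

/-- `G` vanishes on `[0,T] × Ω`. -/
def Zr (G : Sm (Cfg q)) : Prop := ∀ c : Cfg q, ∀ t ∈ Set.Icc 0 c.T, ∀ x ∈ Ω, ev c (t, x) G = 0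

/-- `G` vanishes on the boundary for `t ∈ [0,T]`. -/
def Zb (G : Sm (Cfg q)) : Prop :=
  ∀ c : Cfg q, ∀ t ∈ Set.Icc 0 c.T, ∀ x1 x2 : ℝ, (x2 = 0 ∨ x2 = 1) → ev c (t, (x1, x2)) G = 0

lemma Zr.add {G H : Sm (Cfg q)} (h : Zr G) (h' : Zr H) : Zr (G + H) := fun c t ht x hx => by
  rw [map_add, h c t ht x hx, h' c t ht x hx, add_zero]
lemma Zr.mul {G : Sm (Cfg q)} (H : Sm (Cfg q)) (h : Zr G) : Zr (H * G) := fun c t ht x hx => by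
  rw [map_mul, h c t ht x hx, mul_zero]
lemma Zb.add {G H : Sm (Cfg q)} (h : Zb G) (h' : Zb H) : Zb (G + H) := fun c t ht x y hx => by
  rw [map_add, h c t ht x y hx, h' c t ht x y hx, add_zero]
lemma Zb.sub {G H : Sm (Cfg q)} (h : Zb G) (h' : Zb H) : Zb (G - H) := fun c t ht x y hx => by
  rw [map_sub, h c t ht x y hx, h' c t ht x y hx, sub_zero]
lemma Zb.mul {G : Sm (Cfg q)} (H : Sm (Cfg q)) (h : Zb G) : Zb (H * G) := fun c t ht x y hx => by
  rw [map_mul, h c t ht x y hx, mul_zero]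
lemma Zb.mulr {G : Sm (Cfg q)} (H : Sm (Cfg q)) (h : Zb G) : Zb (G * H) := fun c t ht x y hx => by
  rw [map_mul, h c t ht x y hx, zero_mul]

lemma deriv_zero_of_Icc {g : ℝ → ℝ} {g' T t : ℝ} (hT : 0 < T) (ht : t ∈ Set.Icc 0 T)
    (h : HasDerivAt g g' t) (hz : ∀ s ∈ Set.Icc 0 T, g s = 0) : g' = 0 := by
  have h1 := h.hasDerivWithinAt (s := Set.Icc 0 T)
  have h2 : HasDerivWithinAt g 0 (Set.Icc 0 T) t :=
    (hasDerivWithinAt_const t _ (0 : ℝ)).congr (fun s hs => hz s hs) (hz t ht)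
  exact (uniqueDiffOn_Icc hT t ht).eq_deriv _ h1 h2

lemma Zr.D0 {G : Sm (Cfg q)} (h : Zr G) : Zr (D0 G) := fun c t ht x hx =>
  deriv_zero_of_Icc c.hT ht (hasDerivAt0 G c t x.1 x.2) fun s hs => h c s hs x hx
lemma Zb.D0 {G : Sm (Cfg q)} (h : Zb G) : Zb (D0 G) := fun c t ht x y hx =>
  deriv_zero_of_Icc c.hT ht (hasDerivAt0 G c t x y) fun s hs => h c s hs x y hx
lemma Zb.D1 {G : Sm (Cfg q)} (h : Zb G) : Zb (D1 G) := fun c t ht x y hx => by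
  refine (hasDerivAt1 G c t x y).unique ?_
  have : (fun x1 => ev c (t, (x1, y)) G) = fun _ => 0 := funext fun x1 => h c t ht x1 y hx
  rw [this]; exact hasDerivAt_const _ _
lemma Zr.D1 {G : Sm (Cfg q)} (h : Zr G) : Zr (D1 G) := fun c t ht x hx => by
  refine (hasDerivAt1 G c t x.1 x.2).unique ?_
  refine (hasDerivAt_const x.1 (0 : ℝ)).congr_of_eventuallyEq ?_
  filter_upwards [Ioo_mem_nhds hx.1.1 hx.1.2] with z hz
  exact h c t ht (z, x.2) ⟨hz, hx.2⟩
lemma Zr.D2 {G : Sm (Cfg q)} (h : Zr G) : Zr (D2 G) := fun c t ht x hx => by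
  refine (hasDerivAt2 G c t x.1 x.2).unique ?_
  refine (hasDerivAt_const x.2 (0 : ℝ)).congr_of_eventuallyEq ?_
  filter_upwards [Ioo_mem_nhds hx.2.1 hx.2.2] with z hz
  exact h c t ht (x.1, z) ⟨hx.1, hz⟩

/-! ### The equations -/

lemma d1_ev {P : Type} (G : Sm P) (c : P) (t : ℝ) (x : ℝ × ℝ) : d1 (fun x => ev c (t, x) G) x = ev c (t, x) (D1 G) := by
  unfold d1
  have h := (ev_diff G c (t, x)).hasFDerivAt
  have h2 : HasFDerivAt (fun x : ℝ × ℝ => ((t, x) : V)) (ContinuousLinearMap.inr ℝ ℝ (ℝ × ℝ)) x := hasFDerivAt_prodMk_right t x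
  have h3 := h.comp x h2
  have h4 := h3.fderiv
  simp only [Function.comp_def] at h4
  rw [h4, ev_DD]; simp
lemma d2_ev {P : Type} (G : Sm P) (c : P) (t : ℝ) (x : ℝ × ℝ) : d2 (fun x => ev c (t, x) G) x = ev c (t, x) (D2 G) := by
  unfold d2
  have h := (ev_diff G c (t, x)).hasFDerivAt
  have h2 : HasFDerivAt (fun x : ℝ × ℝ => ((t, x) : V)) (ContinuousLinearMap.inr ℝ ℝ (ℝ × ℝ)) x := hasFDerivAt_prodMk_right t x
  have h3 := h.comp x h2
  have h4 := h3.fderiv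
  simp only [Function.comp_def] at h4
  rw [h4, ev_DD]; simp

lemma φ_eq (c : Cfg q) (t : ℝ) : c.S.φ t = fun x => ev c (t, x) ff := by simp [ev_ff]
lemma θ_eq (c : Cfg q) (t : ℝ) : c.S.θ t = fun x => ev c (t, x) hh := by simp [ev_hh]
lemma ψ1_eq (c : Cfg q) (t : ℝ) : (fun y => (c.S.ψ t y).1) = fun x => ev c (t, x) uu := by simp [ev_uu]
lemma ψ2_eq (c : Cfg q) (t : ℝ) : (fun y => (c.S.ψ t y).2) = fun x => ev c (t, x) ww := by simp [ev_ww]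
lemma ψ_eq (c : Cfg q) (t : ℝ) : c.S.ψ t = fun x => (ev c (t, x) uu, ev c (t, x) ww) := by simp [ev_uu, ev_ww]

lemma d_congr {g g' : ℝ × ℝ → ℝ} (h : ∀ x ∈ Ω, g x = g' x) {x : ℝ × ℝ} (hx : x ∈ Ω) :
    d1 g x = d1 g' x ∧ d2 g x = d2 g' x := by
  have : g =ᶠ[𝓝 x] g' := by
    filter_upwards [Ω_open.mem_nhds hx] with z hz using h z hz
  simp only [d1, d2, this.fderiv_eq, and_self]

lemma dtφ_eq (c : Cfg q) (t : ℝ) : dt c.S.φ t = fun x => ev c (t, x) (D0 ff) := by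
  funext x
  have := (hasDerivAt0 ff c t x.1 x.2).deriv
  simpa only [dt, ev_ff] using this
lemma dtθ_eq (c : Cfg q) (t : ℝ) : dt c.S.θ t = fun x => ev c (t, x) (D0 hh) := by
  funext x
  have := (hasDerivAt0 hh c t x.1 x.2).deriv
  simpa only [dt, ev_hh] using this
lemma dtψ_eq (c : Cfg q) (t : ℝ) : dt c.S.ψ t = fun x => (ev c (t, x) (D0 uu), ev c (t, x) (D0 ww)) := by
  funext x
  have := ((hasDerivAt0 uu c t x.1 x.2).prodMk (hasDerivAt0 ww c t x.1 x.2)).deriv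
  simpa only [dt, ev_uu, ev_ww] using this

lemma tρ_grad (c : Cfg q) (t : ℝ) {x : ℝ × ℝ} (hx : x ∈ Ω) :
    grad (tρ q.γ q.Pr c.ε c.χ) x = (0, ev c (t, x) (D2 bb)) := by
  have := d_congr (g := tρ q.γ q.Pr c.ε c.χ) (g' := fun x => ev c (t, x) bb) (fun x hx => (ev_bb c t hx).symm) hx
  rw [grad, this.1, this.2, d1_ev, d2_ev, D1_bb, map_zero]
lemma tT_grad (c : Cfg q) (t : ℝ) {x : ℝ × ℝ} (hx : x ∈ Ω) :
    grad (tT q.γ q.Pr c.ε c.χ) x = (0, ev c (t, x) (D2 aa)) := by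
  have := d_congr (g := tT q.γ q.Pr c.ε c.χ) (g' := fun x => ev c (t, x) aa) (fun x hx => (ev_aa c t hx).symm) hx
  rw [grad, this.1, this.2, d1_ev, d2_ev, D1_aa, map_zero]

lemma divv_eq (c : Cfg q) (t : ℝ) : divv (c.S.ψ t) = fun x => ev c (t, x) (D1 uu + D2 ww) := by
  funext x
  rw [divv, ψ1_eq, ψ2_eq, d1_ev, d2_ev, map_add]

lemma lap_ev {P : Type} (G : Sm P) (c : P) (t : ℝ) (x : ℝ × ℝ) :
    lap (fun x => ev c (t, x) G) x = ev c (t, x) (D1 (D1 G) + D2 (D2 G)) := by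
  rw [lap, show d1 (fun x => ev c (t, x) G) = _ from funext (d1_ev G c t),
    show d2 (fun x => ev c (t, x) G) = _ from funext (d2_ev G c t), d1_ev, d2_ev, map_add]

lemma tu_grad1 (x : ℝ × ℝ) : grad (fun y => (tu y).1) x = (0, 1) := by
  have h : HasFDerivAt (fun y : ℝ × ℝ => (tu y).1) (ContinuousLinearMap.snd ℝ ℝ ℝ) x :=
    (ContinuousLinearMap.snd ℝ ℝ ℝ).hasFDerivAt
  simp [grad, d1, d2, h.fderiv]
lemma tu_grad2 (x : ℝ × ℝ) : grad (fun y => (tu y).2) x = (0, 0) := by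
  have h : HasFDerivAt (fun y : ℝ × ℝ => (tu y).2) (0 : ℝ × ℝ →L[ℝ] ℝ) x :=
    hasFDerivAt_const _ _
  simp [grad, d1, d2, h.fderiv]

abbrev RR : Sm (Cfg q) := bb + ff
abbrev dv : Sm (Cfg q) := D1 uu + D2 ww
/-- The pressure perturbation. -/
abbrev pp : Sm (Cfg q) := aa * ff + bb * hh + ff * hh
abbrev B1 : Sm (Cfg q) := D0 uu + (yy + uu) * D1 uu + ww * D2 uu + ww
abbrev B2 : Sm (Cfg q) := D0 ww + (yy + uu) * D1 ww + ww * D2 ww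
abbrev B3 : Sm (Cfg q) := D0 hh + (yy + uu) * D1 hh + ww * D2 hh + ww * D2 aa
/-- Constants. -/
def cμ (q : Par) : ℝ := q.Re⁻¹
def cl (q : Par) : ℝ := q.Re⁻¹ + q.r * q.Re⁻¹
def cκ (q : Par) : ℝ := q.γ / (q.γ - 1) / (q.Re * q.Pr)
def cg (q : Par) : ℝ := (q.γ - 1)⁻¹
abbrev Mu : Sm (Cfg q) := kc (cμ q)
abbrev La : Sm (Cfg q) := kc (cl q)
abbrev Ka : Sm (Cfg q) := kc (cκ q)
abbrev Cg : Sm (Cfg q) := kc (cg q)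
/-- Viscous heating. -/
abbrev HT : Sm (Cfg q) := kc (2 * cμ q) * (D1 uu * D1 uu + D2 ww * D2 ww)
  + Mu * (D1 ww + D2 uu) * (D1 ww + D2 uu) + kc (2 * cμ q) * (D1 ww + D2 uu)
  + kc (q.r * q.Re⁻¹) * dv * dv

def eqM : Sm (Cfg q) := D0 ff + (yy + uu) * D1 ff + ww * D2 ff + RR * dv + ww * D2 bb
def eq1 : Sm (Cfg q) := RR * B1 + Ep (-2) * D1 pp - Mu * (D1 (D1 uu) + D2 (D2 uu)) - La * D1 dv
def eq2 : Sm (Cfg q) := RR * B2 + Ep (-2) * D2 pp - Mu * (D1 (D1 ww) + D2 (D2 ww)) - La * D2 dv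
def eqE : Sm (Cfg q) := Cg * RR * B3 + (1 + pp) * dv - Ka * (D1 (D1 hh) + D2 (D2 hh)) - Ep 2 * HT

lemma zM : Zr (eqM : Sm (Cfg q)) := fun c t ht x hx => by
  have h := c.S.mass_eq t ht x hx
  rw [tρ_grad c t hx, divv_eq, φ_eq, dtφ_eq, ψ_eq] at h
  simp only [dot, pu, tu, grad, d1_ev, d2_ev, pρ, ← ev_bb c t hx, φ_eq, ψ_eq] at h
  simp only [eqM, map_add, map_mul, ev_yy]
  simp at h
  linarith

lemma pp_d (c : Cfg q) (t : ℝ) {x : ℝ × ℝ} (hx : x ∈ Ω) :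
    d1 (fun y => pρ q.γ q.Pr c.ε c.χ c.S.φ t y * pT q.γ q.Pr c.ε c.χ c.S.θ t y) x = ev c (t, x) (D1 pp) ∧
    d2 (fun y => pρ q.γ q.Pr c.ε c.χ c.S.φ t y * pT q.γ q.Pr c.ε c.χ c.S.θ t y) x = ev c (t, x) (D2 pp) := by
  have := d_congr (g := fun y => pρ q.γ q.Pr c.ε c.χ c.S.φ t y * pT q.γ q.Pr c.ε c.χ c.S.θ t y)
    (g' := fun x => ev c (t, x) (1 + pp)) (fun x hx => by
      have h1 : ev c (t, x) (aa * bb) = 1 := by rw [ab1, map_one]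
      simp only [map_mul] at h1
      simp only [pρ, pT, ← ev_aa c t hx, ← ev_bb c t hx, φ_eq, θ_eq, map_add, map_mul, map_one]
      linear_combination h1) hx
  rw [this.1, this.2, d1_ev, d2_ev]
  constructor <;> simp

lemma z1 : Zr (eq1 : Sm (Cfg q)) := fun c t ht x hx => by
  have h := c.S.mom_eq1 t ht x hx
  rw [(pp_d c t hx).1, ψ1_eq, dtψ_eq, tu_grad1, lap_ev, divv_eq, d1_ev, ψ_eq] at h
  simp only [dot, pu, tu, grad, d1_ev, d2_ev, pρ, ← ev_bb c t hx, φ_eq, ψ_eq] at h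
  simp only [eq1, map_add, map_sub, map_mul, ev_yy, ev_kc, ev_Ep, cμ, cl] at h ⊢
  simp at h ⊢
  linarith

lemma z2 : Zr (eq2 : Sm (Cfg q)) := fun c t ht x hx => by
  have h := c.S.mom_eq2 t ht x hx
  rw [(pp_d c t hx).2, ψ2_eq, dtψ_eq, tu_grad2, lap_ev, divv_eq, d2_ev, ψ_eq] at h
  simp only [dot, pu, tu, grad, d1_ev, d2_ev, pρ, ← ev_bb c t hx, φ_eq, ψ_eq] at h
  simp only [eq2, map_add, map_sub, map_mul, ev_yy, ev_kc, ev_Ep, cμ, cl] at h ⊢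
  simp at h ⊢
  linarith

lemma zE : Zr (eqE : Sm (Cfg q)) := fun c t ht x hx => by
  have h := c.S.energy_eq t ht x hx
  have g1 : d1 (fun y => (tu y).1) x = 0 ∧ d2 (fun y => (tu y).1) x = 1 := by
    have := tu_grad1 x; simpa [grad] using this
  have g2 : d1 (fun y => (tu y).2) x = 0 ∧ d2 (fun y => (tu y).2) x = 0 := by
    have := tu_grad2 x; simpa [grad] using this
  have hab : ev c (t, x) (aa * bb) = 1 := by rw [ab1, map_one]
  rw [tT_grad c t hx, θ_eq, dtθ_eq, lap_ev, divv_eq] at h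
  simp only [defContract, g1, g2] at h
  rw [ψ1_eq, ψ2_eq, ψ_eq] at h
  simp only [dot, pu, tu, grad, d1_ev, d2_ev, pρ, pT, ← ev_bb c t hx, ← ev_aa c t hx, φ_eq, θ_eq, ψ_eq] at h
  simp only [eqE, map_add, map_sub, map_mul, ev_yy, ev_kc, ev_Ep, cμ, cg, cκ, map_one] at h ⊢ hab
  simp only [Prod.fst_add, Prod.snd_add, zero_add, mul_zero, zero_mul] at h
  rw [show c.ε ^ (2 : ℤ) = c.ε ^ 2 by norm_cast]
  rw [div_eq_mul_inv] at h
  linear_combination h + (-(ev c (t, x) (D1 uu)) - ev c (t, x) (D2 ww)) * hab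

lemma bu : Zb (uu : Sm (Cfg q)) := fun c t ht x y hy => by rw [ev_uu, c.S.bc_ψ t ht _ hy]; rfl
lemma bw : Zb (ww : Sm (Cfg q)) := fun c t ht x y hy => by rw [ev_ww, c.S.bc_ψ t ht _ hy]; rfl
lemma bh : Zb (hh : Sm (Cfg q)) := fun c t ht x y hy => by rw [ev_hh, c.S.bc_θ t ht _ hy]

end

section

/-! ### Comparison of the Sobolev norms with the jets -/

section
variable {E' : Type*} [NormedAddCommGroup E'] [NormedSpace ℝ E']

lemma fderiv_split (f : ℝ × ℝ → E') (x : ℝ × ℝ) :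
    fderiv ℝ f x = (ContinuousLinearMap.smulRightL ℝ (ℝ × ℝ) E' (ContinuousLinearMap.fst ℝ ℝ ℝ)) (d1 f x)
      + (ContinuousLinearMap.smulRightL ℝ (ℝ × ℝ) E' (ContinuousLinearMap.snd ℝ ℝ ℝ)) (d2 f x) := by
  ext
  · simp [d1]
  · simp [d2]

lemma d1_smooth {f : ℝ × ℝ → E'} (hf : ContDiff ℝ (⊤ : ℕ∞) f) : ContDiff ℝ (⊤ : ℕ∞) (d1 f) :=
  (hf.fderiv_right (m := (⊤ : ℕ∞)) (by simp)).clm_apply contDiff_const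
lemma d2_smooth {f : ℝ × ℝ → E'} (hf : ContDiff ℝ (⊤ : ℕ∞) f) : ContDiff ℝ (⊤ : ℕ∞) (d2 f) :=
  (hf.fderiv_right (m := (⊤ : ℕ∞)) (by simp)).clm_apply contDiff_const

lemma nle (n : ℕ) : (n : WithTop ℕ∞) ≤ ((⊤ : ℕ∞) : WithTop ℕ∞) := by
  exact_mod_cast (le_top : (n : ℕ∞) ≤ ⊤)

lemma norm_smulRightL_le (L : ℝ × ℝ →L[ℝ] ℝ) (hL : ‖L‖ ≤ 1) :
    ‖ContinuousLinearMap.smulRightL ℝ (ℝ × ℝ) E' L‖ ≤ 1 := by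
  refine ContinuousLinearMap.opNorm_le_bound _ zero_le_one fun y => ?_
  have e : ‖ContinuousLinearMap.smulRightL ℝ (ℝ × ℝ) E' L y‖ = ‖L‖ * ‖y‖ :=
    ContinuousLinearMap.norm_smulRight_apply L y
  rw [e]
  gcongr

lemma norm_comp_le {F' : Type*} [NormedAddCommGroup F'] [NormedSpace ℝ F'] (L : E' →L[ℝ] F') (hL : ‖L‖ ≤ 1)
    {f : ℝ × ℝ → E'} (hf : ContDiff ℝ (⊤ : ℕ∞) f) (n : ℕ) (x : ℝ × ℝ) :
    ‖iteratedFDeriv ℝ n (fun x => L (f x)) x‖ ≤ ‖iteratedFDeriv ℝ n f x‖ := by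
  have := L.norm_iteratedFDeriv_comp_left (f := f) (x := x) (n := n) (hf.contDiffAt) (nle n)
  exact this.trans (mul_le_of_le_one_left (norm_nonneg _) hL)

lemma norm_add_le' {f g : ℝ × ℝ → E'} (hf : ContDiff ℝ (⊤ : ℕ∞) f) (hg : ContDiff ℝ (⊤ : ℕ∞) g) (n : ℕ) (x : ℝ × ℝ) :
    ‖iteratedFDeriv ℝ n (fun x => f x + g x) x‖ ≤ ‖iteratedFDeriv ℝ n f x‖ + ‖iteratedFDeriv ℝ n g x‖ := by
  have : iteratedFDeriv ℝ n (fun x => f x + g x) x = _ :=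
    iteratedFDeriv_add_apply ((hf.of_le (nle n)).contDiffAt) ((hg.of_le (nle n)).contDiffAt)
  rw [this]; exact norm_add_le _ _

lemma norm_succ_le {f : ℝ × ℝ → E'} (hf : ContDiff ℝ (⊤ : ℕ∞) f) (n : ℕ) (x : ℝ × ℝ) :
    ‖iteratedFDeriv ℝ (n + 1) f x‖ ≤ ‖iteratedFDeriv ℝ n (d1 f) x‖ + ‖iteratedFDeriv ℝ n (d2 f) x‖ := by
  rw [← norm_iteratedFDeriv_fderiv, show fderiv ℝ f = _ from funext (fderiv_split f)]
  refine (norm_add_le' ?_ ?_ n x).trans (add_le_add ?_ ?_)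
  · exact (ContinuousLinearMap.contDiff _).comp (d1_smooth hf)
  · exact (ContinuousLinearMap.contDiff _).comp (d2_smooth hf)
  · exact norm_comp_le _ (norm_smulRightL_le _ (ContinuousLinearMap.norm_fst_le ..)) (d1_smooth hf) n x
  · exact norm_comp_le _ (norm_smulRightL_le _ (ContinuousLinearMap.norm_snd_le ..)) (d2_smooth hf) n x

lemma norm_d_le {f : ℝ × ℝ → E'} (hf : ContDiff ℝ (⊤ : ℕ∞) f) (n : ℕ) (x : ℝ × ℝ) :
    ‖iteratedFDeriv ℝ n (d1 f) x‖ ≤ ‖iteratedFDeriv ℝ (n + 1) f x‖ ∧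
    ‖iteratedFDeriv ℝ n (d2 f) x‖ ≤ ‖iteratedFDeriv ℝ (n + 1) f x‖ := by
  rw [← norm_iteratedFDeriv_fderiv]
  have hs := hf.fderiv_right (m := (⊤ : ℕ∞)) (by simp)
  have h : ∀ e : ℝ × ℝ, ‖e‖ ≤ 1 → ‖ContinuousLinearMap.apply ℝ E' e‖ ≤ 1 := fun e he =>
    ContinuousLinearMap.opNorm_le_bound _ zero_le_one fun y => by
      simp only [ContinuousLinearMap.apply_apply, one_mul]
      exact (y.le_opNorm e).trans (mul_le_of_le_one_right (norm_nonneg _) he)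
  exact ⟨norm_comp_le (ContinuousLinearMap.apply ℝ E' ((1, 0) : ℝ × ℝ)) (h _ (by simp [Prod.norm_def])) hs n x,
    norm_comp_le (ContinuousLinearMap.apply ℝ E' ((0, 1) : ℝ × ℝ)) (h _ (by simp [Prod.norm_def])) hs n x⟩

lemma dSq_nonneg (j : ℕ) (f : ℝ × ℝ → E') : 0 ≤ dSq j f :=
  integral_nonneg fun _ => by positivity

lemma cont_norm_iter {f : ℝ × ℝ → E'} (hf : ContDiff ℝ (⊤ : ℕ∞) f) (n : ℕ) :
    Continuous fun x => ‖iteratedFDeriv ℝ n f x‖ ^ 2 :=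
  ((hf.continuous_iteratedFDeriv (nle n)).norm).pow 2

lemma dSq_mono {F' : Type*} [NormedAddCommGroup F'] [NormedSpace ℝ F'] {j k : ℕ} {f : ℝ × ℝ → E'} {g : ℝ × ℝ → F'}
    (hf : ContDiff ℝ (⊤ : ℕ∞) f) (hg : ContDiff ℝ (⊤ : ℕ∞) g)
    (h : ∀ x, ‖iteratedFDeriv ℝ j f x‖ ≤ ‖iteratedFDeriv ℝ k g x‖) : dSq j f ≤ dSq k g := by
  unfold dSq
  refine setIntegral_mono (integrable_of_cont (cont_norm_iter hf j)) (integrable_of_cont (cont_norm_iter hg k)) ?_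
  intro x; have := h x; dsimp only; gcongr

lemma dSq_le2 {F' F'' : Type*} [NormedAddCommGroup F'] [NormedSpace ℝ F'] [NormedAddCommGroup F''] [NormedSpace ℝ F'']
    {j k : ℕ} {f : ℝ × ℝ → E'} {g : ℝ × ℝ → F'} {g' : ℝ × ℝ → F''}
    (hf : ContDiff ℝ (⊤ : ℕ∞) f) (hg : ContDiff ℝ (⊤ : ℕ∞) g) (hg' : ContDiff ℝ (⊤ : ℕ∞) g')
    (h : ∀ x, ‖iteratedFDeriv ℝ j f x‖ ≤ ‖iteratedFDeriv ℝ k g x‖ + ‖iteratedFDeriv ℝ k g' x‖) :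
    dSq j f ≤ 2 * (dSq k g + dSq k g') := by
  unfold dSq
  rw [← integral_add (integrable_of_cont (cont_norm_iter hg k)) (integrable_of_cont (cont_norm_iter hg' k)),
    ← integral_const_mul]
  refine setIntegral_mono (integrable_of_cont (cont_norm_iter hf j)) ?_ ?_
  · exact integrable_of_cont (((cont_norm_iter hg k).add (cont_norm_iter hg' k)).const_mul 2)
  · intro x; have := h x; dsimp only
    nlinarith [norm_nonneg (iteratedFDeriv ℝ j f x), sq_nonneg (‖iteratedFDeriv ℝ k g x‖ - ‖iteratedFDeriv ℝ k g' x‖)]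
end

variable {P : Type}

/-- Slices and their Sobolev norms. -/
def sl (p : P) (t : ℝ) (G : Sm P) : ℝ × ℝ → ℝ := fun x => ev p (t, x) G

lemma sl_smooth (p : P) (t : ℝ) (G : Sm P) : ContDiff ℝ (⊤ : ℕ∞) (sl p t G) :=
  (ev_smooth G p).comp (by fun_prop : ContDiff ℝ (⊤ : ℕ∞) fun x : ℝ × ℝ => ((t, x) : V))

lemma d1_sl (p : P) (t : ℝ) (G : Sm P) : d1 (sl p t G) = sl p t (D1 G) := funext (d1_ev G p t)
lemma d2_sl (p : P) (t : ℝ) (G : Sm P) : d2 (sl p t G) = sl p t (D2 G) := funext (d2_ev G p t)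

lemma dSq_zero (p : P) (t : ℝ) (G : Sm P) : dSq 0 (sl p t G) = I p t (G * G) := by
  rw [I_def]; unfold dSq sl
  congr 1; ext x
  rw [norm_iteratedFDeriv_zero, Real.norm_eq_abs, sq_abs, map_mul]; ring
lemma dSq_D1 (p : P) (t : ℝ) (G : Sm P) (j : ℕ) : dSq j (sl p t (D1 G)) ≤ dSq (j + 1) (sl p t G) := by
  rw [← d1_sl]
  exact dSq_mono (d1_smooth (sl_smooth p t G)) (sl_smooth p t G) fun x => (norm_d_le (sl_smooth p t G) j x).1
lemma dSq_D2 (p : P) (t : ℝ) (G : Sm P) (j : ℕ) : dSq j (sl p t (D2 G)) ≤ dSq (j + 1) (sl p t G) := by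
  rw [← d2_sl]
  exact dSq_mono (d2_smooth (sl_smooth p t G)) (sl_smooth p t G) fun x => (norm_d_le (sl_smooth p t G) j x).2
lemma dSq_succ (p : P) (t : ℝ) (G : Sm P) (j : ℕ) :
    dSq (j + 1) (sl p t G) ≤ 2 * (dSq j (sl p t (D1 G)) + dSq j (sl p t (D2 G))) := by
  rw [← d1_sl, ← d2_sl]
  exact dSq_le2 (sl_smooth p t G) (d1_smooth (sl_smooth p t G)) (d2_smooth (sl_smooth p t G))
    fun x => norm_succ_le (sl_smooth p t G) j x

lemma pair_smooth (p : P) (t : ℝ) (G H : Sm P) : ContDiff ℝ (⊤ : ℕ∞) fun x => (sl p t G x, sl p t H x) :=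
  (sl_smooth p t G).prodMk (sl_smooth p t H)
lemma dSq_fst (p : P) (t : ℝ) (G H : Sm P) (j : ℕ) : dSq j (sl p t G) ≤ dSq j fun x => (sl p t G x, sl p t H x) :=
  dSq_mono (sl_smooth p t G) (pair_smooth p t G H) fun x =>
    norm_comp_le (ContinuousLinearMap.fst ℝ ℝ ℝ) (ContinuousLinearMap.norm_fst_le ..) (pair_smooth p t G H) j x
lemma dSq_snd (p : P) (t : ℝ) (G H : Sm P) (j : ℕ) : dSq j (sl p t H) ≤ dSq j fun x => (sl p t G x, sl p t H x) :=
  dSq_mono (sl_smooth p t H) (pair_smooth p t G H) fun x =>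
    norm_comp_le (ContinuousLinearMap.snd ℝ ℝ ℝ) (ContinuousLinearMap.norm_snd_le ..) (pair_smooth p t G H) j x
lemma dSq_pair (p : P) (t : ℝ) (G H : Sm P) (j : ℕ) :
    (dSq j fun x => (sl p t G x, sl p t H x)) ≤ 2 * (dSq j (sl p t G) + dSq j (sl p t H)) := by
  refine dSq_le2 (pair_smooth p t G H) (sl_smooth p t G) (sl_smooth p t H) fun x => ?_
  have e : (fun x => (sl p t G x, sl p t H x)) = fun x => ContinuousLinearMap.inl ℝ ℝ ℝ (sl p t G x)
      + ContinuousLinearMap.inr ℝ ℝ ℝ (sl p t H x) := by funext x; simp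
  have h1 : ContDiff ℝ (⊤ : ℕ∞) fun x => ContinuousLinearMap.inl ℝ ℝ ℝ (sl p t G x) :=
    (ContinuousLinearMap.inl ℝ ℝ ℝ).contDiff.comp (sl_smooth p t G)
  have h2 : ContDiff ℝ (⊤ : ℕ∞) fun x => ContinuousLinearMap.inr ℝ ℝ ℝ (sl p t H x) :=
    (ContinuousLinearMap.inr ℝ ℝ ℝ).contDiff.comp (sl_smooth p t H)
  have h3 := norm_add_le' h1 h2 j x
  have h4 := norm_comp_le (ContinuousLinearMap.inl ℝ ℝ ℝ) (ContinuousLinearMap.norm_inl_le_one ℝ ℝ ℝ) (sl_smooth p t G) j x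
  have h5 := norm_comp_le (ContinuousLinearMap.inr ℝ ℝ ℝ) (ContinuousLinearMap.norm_inr_le_one ℝ ℝ ℝ) (sl_smooth p t H) j x
  rw [e]
  exact h3.trans (add_le_add h4 h5)

/-- Every Sobolev norm is locally bounded in time. -/
lemma dSq_bdd (p : P) (j : ℕ) : ∀ G : Sm P, ∃ Y : ℝ → ℝ, Continuous Y ∧ ∀ t, dSq j (sl p t G) ≤ Y t := by
  induction j with
  | zero => intro G; exact ⟨fun t => I p t (G * G), I_cont p _, fun t => (dSq_zero p t G).le⟩
  | succ j ih =>
    intro G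
    obtain ⟨Y, hY, h1⟩ := ih (D1 G)
    obtain ⟨Z, hZ, h2⟩ := ih (D2 G)
    exact ⟨fun t => 2 * (Y t + Z t), by fun_prop, fun t => (dSq_succ p t G j).trans (by
      have := h1 t; have := h2 t; linarith)⟩

lemma dSq_bdd2 (p : P) (j : ℕ) (G H : Sm P) : ∃ Y : ℝ → ℝ, Continuous Y ∧
    ∀ t, (dSq j fun x => (sl p t G x, sl p t H x)) ≤ Y t := by
  obtain ⟨Y, hY, h1⟩ := dSq_bdd p j G
  obtain ⟨Z, hZ, h2⟩ := dSq_bdd p j H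
  exact ⟨fun t => 2 * (Y t + Z t), by fun_prop, fun t => (dSq_pair p t G H j).trans (by
    have := h1 t; have := h2 t; linarith)⟩

/-! ### Suprema in time -/

lemma isup_eq (X : ℝ → ℝ) (t s : ℝ) [Decidable (s ∈ Set.Icc 0 t)] : (⨆ (_ : s ∈ Set.Icc 0 t), X s) = if s ∈ Set.Icc 0 t then X s else 0 := by
  split_ifs with h
  · exact ciSup_pos h
  · have : IsEmpty (s ∈ Set.Icc 0 t) := ⟨h⟩
    exact Real.iSup_of_isEmpty _

lemma sup_nonneg {X : ℝ → ℝ} (h0 : ∀ s, 0 ≤ X s) (t : ℝ) : 0 ≤ ⨆ s ∈ Set.Icc 0 t, X s := by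
  classical
  refine Real.iSup_nonneg fun s => ?_
  rw [isup_eq]; split_ifs; exacts [h0 s, le_rfl]

lemma sup_le' {X : ℝ → ℝ} {t M : ℝ} (hM : 0 ≤ M) (h : ∀ s ∈ Set.Icc 0 t, X s ≤ M) :
    (⨆ s ∈ Set.Icc 0 t, X s) ≤ M := by
  classical
  refine Real.iSup_le (fun s => ?_) hM
  rw [isup_eq]; split_ifs with hs; exacts [h s hs, hM]

lemma le_sup' {X Y : ℝ → ℝ} (hY : Continuous Y) (hXY : ∀ s, X s ≤ Y s) {t s : ℝ}
    (hs : s ∈ Set.Icc 0 t) : X s ≤ ⨆ s ∈ Set.Icc 0 t, X s := by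
  classical
  obtain ⟨M, hM⟩ := (isCompact_Icc (a := (0 : ℝ)) (b := t)).exists_bound_of_continuousOn hY.continuousOn
  have hb : BddAbove (Set.range fun s => ⨆ (_ : s ∈ Set.Icc 0 t), X s) := by
    refine ⟨max M 0, ?_⟩
    rintro _ ⟨r, rfl⟩
    dsimp only
    rw [isup_eq]; split_ifs with hr
    · exact (hXY r).trans (((le_abs_self _).trans (hM r hr)).trans (le_max_left _ _))
    · exact le_max_right _ _
  have := le_ciSup hb s
  rwa [isup_eq, if_pos hs] at this

lemma HSq_nonneg {E' : Type*} [NormedAddCommGroup E'] [NormedSpace ℝ E'] (k : ℕ) (f : ℝ × ℝ → E') : 0 ≤ HSq k f :=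
  Finset.sum_nonneg fun j _ => dSq_nonneg j f

/-! ### What the smallness of `N` gives -/

variable {q : Par}

def NN (c : Cfg q) : ℝ := Nfun c.ε c.S.φ c.S.ψ c.S.θ c.T

lemma φsl (c : Cfg q) (t : ℝ) : c.S.φ t = sl c t ff := φ_eq c t
lemma θsl (c : Cfg q) (t : ℝ) : c.S.θ t = sl c t hh := θ_eq c t
lemma ψsl (c : Cfg q) (t : ℝ) : c.S.ψ t = fun x => (sl c t uu x, sl c t ww x) := ψ_eq c t
lemma dtφsl (c : Cfg q) (t : ℝ) : dt c.S.φ t = sl c t (D0 ff) := dtφ_eq c t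
lemma dtθsl (c : Cfg q) (t : ℝ) : dt c.S.θ t = sl c t (D0 hh) := dtθ_eq c t
lemma dtψsl (c : Cfg q) (t : ℝ) : dt c.S.ψ t = fun x => (sl c t (D0 uu) x, sl c t (D0 ww) x) := dtψ_eq c t

lemma bdd3 (c : Cfg q) (j : ℕ) (k1 k2 k3 : ℝ) (h1 : 0 ≤ k1) (h2 : 0 ≤ k2) (h3 : 0 ≤ k3) : ∃ Y : ℝ → ℝ, Continuous Y ∧
    ∀ t, k1 * dSq j (c.S.φ t) + k2 * dSq j (c.S.ψ t) + k3 * dSq j (c.S.θ t) ≤ Y t := by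
  obtain ⟨X, hX, a1⟩ := dSq_bdd c j (ff : Sm (Cfg q))
  obtain ⟨Y, hY, a2⟩ := dSq_bdd2 c j (uu : Sm (Cfg q)) ww
  obtain ⟨Z, hZ, a3⟩ := dSq_bdd c j (hh : Sm (Cfg q))
  refine ⟨fun t => k1 * X t + k2 * Y t + k3 * Z t, by fun_prop, fun t => ?_⟩
  rw [φsl, θsl, ψsl]
  have := a1 t; have := a2 t; have := a3 t
  dsimp only
  gcongr

section
variable (ε : ℝ) (φ : ℝ → ℝ × ℝ → ℝ) (ψ : ℝ → ℝ × ℝ → ℝ × ℝ) (θ : ℝ → ℝ × ℝ → ℝ) {t : ℝ}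
lemma p2n : 0 ≤ (ε ^ 2)⁻¹ := by positivity
lemma p4n : 0 ≤ (ε ^ 4)⁻¹ := by positivity
lemma A0_nonneg (ht : 0 ≤ t) : 0 ≤ A0 ε φ ψ θ t := add_nonneg
  (sup_nonneg (fun _ => add_nonneg (add_nonneg (dSq_nonneg _ _) (mul_nonneg (p2n ε) (dSq_nonneg _ _)))
    (mul_nonneg (p2n ε) (dSq_nonneg _ _))) t)
  (intervalIntegral.integral_nonneg ht fun _ _ => add_nonneg (HSq_nonneg _ _) (mul_nonneg (p2n ε) (HSq_nonneg _ _)))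
lemma A1_nonneg (ht : 0 ≤ t) : 0 ≤ A1 ε φ ψ θ t := add_nonneg
  (sup_nonneg (fun _ => add_nonneg (dSq_nonneg _ _) (mul_nonneg (p2n ε) (dSq_nonneg _ _))) t)
  (intervalIntegral.integral_nonneg ht fun _ _ => add_nonneg (dSq_nonneg _ _) (mul_nonneg (p2n ε) (dSq_nonneg _ _)))
lemma A2_nonneg (ht : 0 ≤ t) : 0 ≤ A2 ε φ ψ θ t := add_nonneg (add_nonneg
  (mul_nonneg (p2n ε) (sup_nonneg (fun _ => dSq_nonneg _ _) t))
  (intervalIntegral.integral_nonneg ht fun _ _ =>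
    add_nonneg (mul_nonneg (p4n ε) (HSq_nonneg _ _)) (mul_nonneg (p2n ε) (dSq_nonneg _ _))))
  (intervalIntegral.integral_nonneg ht fun _ _ => add_nonneg (HSq_nonneg _ _) (mul_nonneg (p2n ε) (HSq_nonneg _ _)))
lemma A3_nonneg (ht : 0 ≤ t) : 0 ≤ A3 ε φ ψ θ t := add_nonneg
  (sup_nonneg (fun _ => add_nonneg (add_nonneg (mul_nonneg (p2n ε) (dSq_nonneg _ _)) (dSq_nonneg _ _))
    (mul_nonneg (p2n ε) (dSq_nonneg _ _))) t)
  (intervalIntegral.integral_nonneg ht fun _ _ => add_nonneg (dSq_nonneg _ _) (mul_nonneg (p2n ε) (dSq_nonneg _ _)))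
lemma A4_nonneg (ht : 0 ≤ t) : 0 ≤ A4 ε φ ψ θ t := add_nonneg
  (sup_nonneg (fun _ => add_nonneg (add_nonneg (mul_nonneg (p2n ε) (dSq_nonneg _ _)) (dSq_nonneg _ _))
    (mul_nonneg (p2n ε) (dSq_nonneg _ _))) t)
  (intervalIntegral.integral_nonneg ht fun _ _ => add_nonneg (add_nonneg (mul_nonneg (p4n ε) (HSq_nonneg _ _))
    (HSq_nonneg _ _)) (mul_nonneg (p2n ε) (HSq_nonneg _ _)))
lemma A5_nonneg (ht : 0 ≤ t) : 0 ≤ A5 ε φ ψ θ t := add_nonneg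
  (sup_nonneg (fun _ => add_nonneg (add_nonneg (mul_nonneg (p2n ε) (dSq_nonneg _ _))
    (add_nonneg (dSq_nonneg _ _) (dSq_nonneg _ _)))
    (mul_nonneg (p2n ε) (add_nonneg (dSq_nonneg _ _) (dSq_nonneg _ _)))) t)
  (intervalIntegral.integral_nonneg ht fun _ _ => add_nonneg (dSq_nonneg _ _) (mul_nonneg (p2n ε) (dSq_nonneg _ _)))
lemma A_nonneg (ht : 0 ≤ t) :
    0 ≤ A0 ε φ ψ θ t ∧ 0 ≤ A1 ε φ ψ θ t ∧ 0 ≤ A2 ε φ ψ θ t ∧ 0 ≤ A3 ε φ ψ θ t ∧ 0 ≤ A4 ε φ ψ θ t ∧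
      0 ≤ A5 ε φ ψ θ t :=
  ⟨A0_nonneg ε φ ψ θ ht, A1_nonneg ε φ ψ θ ht, A2_nonneg ε φ ψ θ ht, A3_nonneg ε φ ψ θ ht, A4_nonneg ε φ ψ θ ht,
    A5_nonneg ε φ ψ θ ht⟩
end

lemma NN_nonneg (c : Cfg q) : 0 ≤ NN c := by
  obtain ⟨h0, h1, h2, h3, h4, h5⟩ := A_nonneg c.ε c.S.φ c.S.ψ c.S.θ c.hT.le
  unfold NN Nfun; positivity

lemma NN_ge (c : Cfg q) {t : ℝ} (ht : t ∈ Set.Icc 0 c.T) :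
    (c.ε ^ 2)⁻¹ * (L2Sq (c.S.ψ t) + (c.ε ^ 2)⁻¹ * L2Sq (c.S.φ t) + (c.ε ^ 2)⁻¹ * L2Sq (c.S.θ t)) ≤ NN c ∧
    dSq 1 (c.S.ψ t) + (c.ε ^ 2)⁻¹ * dSq 1 (c.S.θ t) ≤ NN c ∧
    (c.ε ^ 2)⁻¹ * dSq 1 (c.S.φ t) ≤ NN c ∧
    c.ε ^ 2 * ((c.ε ^ 2)⁻¹ * dSq 2 (c.S.φ t) + dSq 2 (c.S.ψ t) + (c.ε ^ 2)⁻¹ * dSq 2 (c.S.θ t)) ≤ NN c ∧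
    c.ε ^ 4 * ((c.ε ^ 2)⁻¹ * dSq 3 (c.S.φ t) + dSq 3 (c.S.ψ t) + (c.ε ^ 2)⁻¹ * dSq 3 (c.S.θ t)) ≤ NN c := by
  obtain ⟨h0, h1, h2, h3, h4, h5⟩ := A_nonneg c.ε c.S.φ c.S.ψ c.S.θ c.hT.le
  have hi : 0 ≤ (c.ε ^ 2)⁻¹ := by positivity
  have hi4 : 0 ≤ (c.ε ^ 4)⁻¹ := by positivity
  have g0 : L2Sq (c.S.ψ t) + (c.ε ^ 2)⁻¹ * L2Sq (c.S.φ t) + (c.ε ^ 2)⁻¹ * L2Sq (c.S.θ t) ≤ A0 c.ε c.S.φ c.S.ψ c.S.θ c.T := by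
    obtain ⟨Y, hY, hb⟩ := bdd3 c 0 (c.ε ^ 2)⁻¹ 1 (c.ε ^ 2)⁻¹ hi zero_le_one hi
    have := le_sup' (X := fun t => L2Sq (c.S.ψ t) + (c.ε ^ 2)⁻¹ * L2Sq (c.S.φ t) + (c.ε ^ 2)⁻¹ * L2Sq (c.S.θ t)) hY
      (fun s => by have := hb s; simp only [L2Sq]; linarith) ht
    refine this.trans (le_add_of_nonneg_right (intervalIntegral.integral_nonneg c.hT.le fun s _ => ?_))
    exact add_nonneg (HSq_nonneg _ _) (mul_nonneg hi (HSq_nonneg _ _))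
  have g1 : dSq 1 (c.S.ψ t) + (c.ε ^ 2)⁻¹ * dSq 1 (c.S.θ t) ≤ A1 c.ε c.S.φ c.S.ψ c.S.θ c.T := by
    obtain ⟨Y, hY, hb⟩ := bdd3 c 1 0 1 (c.ε ^ 2)⁻¹ le_rfl zero_le_one hi
    have := le_sup' (X := fun t => dSq 1 (c.S.ψ t) + (c.ε ^ 2)⁻¹ * dSq 1 (c.S.θ t)) hY
      (fun s => by have := hb s; linarith) ht
    refine this.trans (le_add_of_nonneg_right (intervalIntegral.integral_nonneg c.hT.le fun s _ => ?_))
    exact add_nonneg (dSq_nonneg _ _) (mul_nonneg hi (dSq_nonneg _ _))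
  have g2 : (c.ε ^ 2)⁻¹ * dSq 1 (c.S.φ t) ≤ A2 c.ε c.S.φ c.S.ψ c.S.θ c.T := by
    obtain ⟨Y, hY, hb⟩ := bdd3 c 1 1 0 0 zero_le_one le_rfl le_rfl
    have := le_sup' (X := fun t => dSq 1 (c.S.φ t)) hY (fun s => by have := hb s; linarith) ht
    have h' := mul_le_mul_of_nonneg_left this hi
    unfold A2
    have i1 : 0 ≤ ∫ s in (0 : ℝ)..c.T, ((c.ε ^ 4)⁻¹ * HSq 1 (c.S.φ s) + (c.ε ^ 2)⁻¹ * L2Sq (dt c.S.φ s)) :=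
      intervalIntegral.integral_nonneg c.hT.le fun s _ =>
        add_nonneg (mul_nonneg hi4 (HSq_nonneg _ _)) (mul_nonneg hi (dSq_nonneg _ _))
    have i2 : 0 ≤ ∫ s in (0 : ℝ)..c.T, (HSq 2 (c.S.ψ s) + (c.ε ^ 2)⁻¹ * HSq 2 (c.S.θ s)) :=
      intervalIntegral.integral_nonneg c.hT.le fun s _ =>
        add_nonneg (HSq_nonneg _ _) (mul_nonneg hi (HSq_nonneg _ _))
    linarith
  have g4 : (c.ε ^ 2)⁻¹ * dSq 2 (c.S.φ t) + dSq 2 (c.S.ψ t) + (c.ε ^ 2)⁻¹ * dSq 2 (c.S.θ t) ≤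
      A4 c.ε c.S.φ c.S.ψ c.S.θ c.T := by
    obtain ⟨Y, hY, hb⟩ := bdd3 c 2 (c.ε ^ 2)⁻¹ 1 (c.ε ^ 2)⁻¹ hi zero_le_one hi
    have := le_sup' (X := fun t => (c.ε ^ 2)⁻¹ * dSq 2 (c.S.φ t) + dSq 2 (c.S.ψ t) + (c.ε ^ 2)⁻¹ * dSq 2 (c.S.θ t)) hY
      (fun s => by have := hb s; linarith) ht
    refine this.trans (le_add_of_nonneg_right (intervalIntegral.integral_nonneg c.hT.le fun s _ => ?_))
    exact add_nonneg (add_nonneg (mul_nonneg hi4 (HSq_nonneg _ _)) (HSq_nonneg _ _)) (mul_nonneg hi (HSq_nonneg _ _))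
  have g5 : (c.ε ^ 2)⁻¹ * dSq 3 (c.S.φ t) + dSq 3 (c.S.ψ t) + (c.ε ^ 2)⁻¹ * dSq 3 (c.S.θ t) ≤
      A5 c.ε c.S.φ c.S.ψ c.S.θ c.T := by
    obtain ⟨Y, hY, hb⟩ := bdd3 c 3 (c.ε ^ 2)⁻¹ 1 (c.ε ^ 2)⁻¹ hi zero_le_one hi
    obtain ⟨Y', hY', hb'⟩ := dSq_bdd2 c 1 (D0 uu : Sm (Cfg q)) (D0 ww)
    obtain ⟨Z', hZ', hb''⟩ := dSq_bdd c 1 (D0 hh : Sm (Cfg q))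
    have := le_sup' (X := fun t => (c.ε ^ 2)⁻¹ * dSq 3 (c.S.φ t) + (dSq 3 (c.S.ψ t) + dSq 1 (dt c.S.ψ t))
        + (c.ε ^ 2)⁻¹ * (dSq 3 (c.S.θ t) + dSq 1 (dt c.S.θ t)))
      (Y := fun t => Y t + Y' t + (c.ε ^ 2)⁻¹ * Z' t) (by fun_prop)
      (fun s => by
        have a1 := hb s
        have a2 := hb' s
        have a3 := mul_le_mul_of_nonneg_left (hb'' s) hi
        rw [dtψsl, dtθsl]
        linarith) ht
    have i0 := dSq_nonneg 1 (dt c.S.ψ t)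
    have i1 := mul_nonneg hi (dSq_nonneg 1 (dt c.S.θ t))
    have i2 : 0 ≤ ∫ s in (0 : ℝ)..c.T, (L2Sq (dt (dt c.S.ψ) s) + (c.ε ^ 2)⁻¹ * L2Sq (dt (dt c.S.θ) s)) :=
      intervalIntegral.integral_nonneg c.hT.le fun s _ =>
        add_nonneg (dSq_nonneg _ _) (mul_nonneg hi (dSq_nonneg _ _))
    unfold A5
    linarith
  have k0 := mul_le_mul_of_nonneg_left g0 hi
  have k4 := mul_le_mul_of_nonneg_left g4 (by positivity : 0 ≤ c.ε ^ 2)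
  have k5 := mul_le_mul_of_nonneg_left g5 (by positivity : 0 ≤ c.ε ^ 4)
  have n0 := mul_nonneg hi h0
  have n3 := mul_nonneg (by positivity : 0 ≤ c.ε ^ 2) h3
  have n4 := mul_nonneg (by positivity : 0 ≤ c.ε ^ 2) h4
  have n5 := mul_nonneg (by positivity : 0 ≤ c.ε ^ 4) h5
  unfold NN Nfun
  refine ⟨?_, ?_, ?_, ?_, ?_⟩ <;> linarith

end

section
variable {q : Par}

/-! ### Calculus of pointwise bounds -/

/-- The jets controlled by the dissipation, with their weights. -/
def jl : List (ℤ × Sm (Cfg q)) := [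
  (1, uu), (1, ww), (1, D1 uu), (1, D2 uu), (1, D1 ww), (1, D2 ww),
  (0, D1 (D1 uu)), (0, D1 (D2 uu)), (0, D2 (D2 uu)), (0, D1 (D1 ww)), (0, D1 (D2 ww)), (0, D2 (D2 ww)),
  (-1, D1 (D1 (D1 uu))), (-1, D1 (D1 (D2 uu))), (-1, D1 (D2 (D2 uu))), (-1, D2 (D2 (D2 uu))),
  (-1, D1 (D1 (D1 ww))), (-1, D1 (D1 (D2 ww))), (-1, D1 (D2 (D2 ww))), (-1, D2 (D2 (D2 ww))),
  (-1, D0 uu), (-1, D0 (D1 uu)), (-1, D0 (D2 uu)), (-1, D0 ww), (-1, D0 (D1 ww)), (-1, D0 (D2 ww)),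
  (1, ff), (1, D1 ff), (1, D2 ff), (1, D1 (D1 ff)), (1, D1 (D2 ff)), (1, D2 (D2 ff)), (1, D0 ff),
  (2, hh), (2, D1 hh), (2, D2 hh), (1, D1 (D1 hh)), (1, D1 (D2 hh)), (1, D2 (D2 hh)),
  (0, D1 (D1 (D1 hh))), (0, D1 (D1 (D2 hh))), (0, D1 (D2 (D2 hh))), (0, D2 (D2 (D2 hh))),
  (0, D0 hh), (0, D0 (D1 hh)), (0, D0 (D2 hh))]

/-- The weighted square sum of the jets. -/
def QQ : Sm (Cfg q) := (jl.map fun p => Ep (-2 * p.1) * (p.2 * p.2)).sum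

/-- The total dissipation. -/
def DT (c : Cfg q) (t : ℝ) : ℝ := I c t QQ

lemma Ep_sq_nonneg (c : Cfg q) (v : V) (n : ℤ) (G : Sm (Cfg q)) : 0 ≤ ev c v (Ep n * (G * G)) := by
  have := c.hε
  rw [map_mul, ev_Ep, map_mul]
  exact mul_nonneg (by positivity) (mul_self_nonneg _)

lemma ev_QQ (c : Cfg q) (v : V) : ev c v QQ = (jl.map fun p => ev c v (Ep (-2 * p.1) * (p.2 * p.2))).sum := by
  unfold QQ; rw [map_list_sum, List.map_map]; rfl

lemma jet_sq_le (c : Cfg q) (v : V) {p : ℤ × Sm (Cfg q)} (hp : p ∈ jl) :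
    ev c v (Ep (-2 * p.1) * (p.2 * p.2)) ≤ ev c v QQ := by
  rw [ev_QQ]
  refine List.single_le_sum ?_ _ (List.mem_map_of_mem (f := fun p : ℤ × Sm (Cfg q) => ev c v (Ep (-2 * p.1) * (p.2 * p.2))) hp)
  intro x hx
  obtain ⟨r, -, rfl⟩ := List.mem_map.1 hx
  exact Ep_sq_nonneg c v _ _

lemma QQ_nonneg (c : Cfg q) (v : V) : 0 ≤ ev c v QQ :=
  (Ep_sq_nonneg c v _ uu).trans (jet_sq_le c v (p := (1, uu)) List.mem_cons_self)

lemma DT_nonneg (c : Cfg q) (t : ℝ) : 0 ≤ DT c t := I_nonneg fun _ _ => QQ_nonneg c _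

/-- The small parameter. -/
def dl (c : Cfg q) : ℝ := √(NN c) + c.ε

lemma dl_ge (c : Cfg q) : c.ε ≤ dl c := le_add_of_nonneg_left (Real.sqrt_nonneg _)
lemma dl_pos (c : Cfg q) : 0 < dl c := c.hε.trans_le (dl_ge c)
lemma sqN_le (c : Cfg q) : √(NN c) ≤ dl c := le_add_of_nonneg_right c.hε.le
lemma dl_le (c : Cfg q) : dl c ≤ 2 := by
  have h1 : √(NN c) ≤ 1 := Real.sqrt_le_one.2 c.hN
  have := c.hε1
  unfold dl; linarith

/-- Pointwise bound of order `ε ^ n δ ^ (m - n)` and homogeneity `j` in the jets. -/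
def Bd (n m : ℤ) (j : ℕ) (G : Sm (Cfg q)) : Prop := ∃ C : ℝ, 0 ≤ C ∧ ∀ c : Cfg q, ∀ t ∈ Set.Icc 0 c.T, ∀ x ∈ Ω,
  |ev c (t, x) G| ≤ C * (c.ε ^ n * dl c ^ (m - n) * √(ev c (t, x) QQ) ^ j)

lemma wt_nonneg (c : Cfg q) (n m : ℤ) (j : ℕ) (v : V) : 0 ≤ c.ε ^ n * dl c ^ (m - n) * √(ev c v QQ) ^ j := by
  have := c.hε; have := dl_pos c; positivity

lemma Bd.mul {n m n' m' : ℤ} {j j' : ℕ} {G H : Sm (Cfg q)} (h : Bd n m j G) (h' : Bd n' m' j' H) :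
    Bd (n + n') (m + m') (j + j') (G * H) := by
  obtain ⟨C, hC, h⟩ := h
  obtain ⟨C', hC', h'⟩ := h'
  refine ⟨C * C', by positivity, fun c t ht x hx => ?_⟩
  rw [map_mul, abs_mul]
  refine (mul_le_mul (h c t ht x hx) (h' c t ht x hx) (abs_nonneg _)
    (mul_nonneg hC (wt_nonneg c n m j _))).trans (le_of_eq ?_)
  rw [show m + m' - (n + n') = (m - n) + (m' - n') by ring, zpow_add₀ c.hε.ne', zpow_add₀ (dl_pos c).ne', pow_add]
  ring

lemma Bd.mono {n m : ℤ} {j : ℕ} {G : Sm (Cfg q)} (h : Bd n m j G) {n' m' : ℤ}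
    (hn : n' ≤ n := by decide) (hm : m' ≤ m := by decide) : Bd n' m' j G := by
  obtain ⟨C, hC, h⟩ := h
  refine ⟨C * 2 ^ (m - m'), by positivity, fun c t ht x hx => (h c t ht x hx).trans ?_⟩
  have hε := c.hε
  have hd := dl_pos c
  have key : c.ε ^ n * dl c ^ (m - n) ≤ 2 ^ (m - m') * (c.ε ^ n' * dl c ^ (m' - n')) := by
    have e : c.ε ^ n * dl c ^ (m - n) = (c.ε ^ (n - n') * dl c ^ (n' - n)) * dl c ^ (m - m') * (c.ε ^ n' * dl c ^ (m' - n')) := by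
      rw [show m - n = (n' - n) + (m - m') + (m' - n') by ring, zpow_add₀ hd.ne', zpow_add₀ hd.ne']
      nth_rewrite 1 [show n = (n - n') + n' by ring]
      rw [zpow_add₀ hε.ne']
      ring
    rw [e]
    have h1 : c.ε ^ (n - n') * dl c ^ (n' - n) ≤ 1 := by
      rw [show n' - n = -(n - n') by ring, zpow_neg, ← div_eq_mul_inv, div_le_one (by positivity)]
      exact zpow_le_zpow_left₀ (by linarith) hε.le (dl_ge c)
    have h2 : dl c ^ (m - m') ≤ 2 ^ (m - m') := zpow_le_zpow_left₀ (by linarith) hd.le (dl_le c)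
    have h3 : 0 ≤ c.ε ^ n' * dl c ^ (m' - n') := by positivity
    refine mul_le_mul_of_nonneg_right ?_ h3
    have h4 : 0 ≤ dl c ^ (m - m') := by positivity
    nlinarith
  calc _ ≤ C * ((2 ^ (m - m') * (c.ε ^ n' * dl c ^ (m' - n'))) * √(ev c (t, x) QQ) ^ j) := by gcongr
    _ = _ := by ring

lemma Bd.add {n m : ℤ} {j : ℕ} {G H : Sm (Cfg q)} (h : Bd n m j G) (h' : Bd n m j H) : Bd n m j (G + H) := by
  obtain ⟨C, hC, h⟩ := h
  obtain ⟨C', hC', h'⟩ := h'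
  refine ⟨C + C', by positivity, fun c t ht x hx => ?_⟩
  rw [map_add, add_mul]
  exact (abs_add_le _ _).trans (add_le_add (h c t ht x hx) (h' c t ht x hx))

lemma Bd.neg {n m : ℤ} {j : ℕ} {G : Sm (Cfg q)} (h : Bd n m j G) : Bd n m j (-G) := by
  obtain ⟨C, hC, h⟩ := h
  exact ⟨C, hC, fun c t ht x hx => by rw [map_neg, abs_neg]; exact h c t ht x hx⟩

lemma Bd.sub {n m : ℤ} {j : ℕ} {G H : Sm (Cfg q)} (h : Bd n m j G) (h' : Bd n m j H) : Bd n m j (G - H) := by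
  rw [sub_eq_add_neg]; exact h.add h'.neg

/-- Congruence modulo the equations. -/
lemma Bd.congr {n m : ℤ} {j : ℕ} {G H : Sm (Cfg q)} (h : Bd n m j G) (hz : Zr (G - H)) : Bd n m j H := by
  obtain ⟨C, hC, h⟩ := h
  refine ⟨C, hC, fun c t ht x hx => ?_⟩
  have := hz c t ht x hx
  rw [map_sub, sub_eq_zero] at this
  rw [← this]; exact h c t ht x hx

lemma Bd.cst0 {G : Sm (Cfg q)} (C : ℝ) (h : ∀ c : Cfg q, ∀ t ∈ Set.Icc 0 c.T, ∀ x ∈ Ω, |ev c (t, x) G| ≤ C) : Bd 0 0 0 G := by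
  refine ⟨|C|, abs_nonneg _, fun c t ht x hx => ?_⟩
  simpa using (h c t ht x hx).trans (le_abs_self C)

lemma bd_k (x : ℝ) : Bd 0 0 0 (kc x : Sm (Cfg q)) := Bd.cst0 |x| fun c t ht x hx => by simp
lemma bd_1 : Bd 0 0 0 (1 : Sm (Cfg q)) := Bd.cst0 1 fun c t ht x hx => by simp
lemma bd_n (n : ℕ) [n.AtLeastTwo] : Bd 0 0 0 (OfNat.ofNat n : Sm (Cfg q)) := Bd.cst0 (OfNat.ofNat n) fun c t ht x hx => by
  rw [map_ofNat]; exact (abs_of_nonneg (by rw [← Nat.cast_ofNat]; exact Nat.cast_nonneg _)).le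
lemma bd_E (n : ℤ) : Bd n n 0 (Ep n : Sm (Cfg q)) := ⟨1, zero_le_one, fun c t ht x hx => by
  have := c.hε; rw [ev_Ep, abs_of_nonneg (by positivity)]; simp⟩
lemma bd_y : Bd 0 0 0 (yy : Sm (Cfg q)) := Bd.cst0 1 fun c t ht x hx => by
  rw [ev_yy]; have := y_mem hx; rw [abs_le]; constructor <;> linarith

lemma bd_jet {n : ℤ} {G : Sm (Cfg q)} (h : (n, G) ∈ jl) : Bd n n 1 G := by
  refine ⟨1, zero_le_one, fun c t ht x hx => ?_⟩
  have h1 := jet_sq_le c (t, x) h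
  have hε := c.hε
  rw [map_mul, ev_Ep, map_mul] at h1
  have h2 : (c.ε ^ (-n) * |ev c (t, x) G|) ^ 2 ≤ ev c (t, x) QQ := by
    refine le_trans (le_of_eq ?_) h1
    rw [mul_pow, sq_abs, ← zpow_natCast, ← zpow_mul]
    rw [show -n * ((2 : ℕ) : ℤ) = -2 * n by push_cast; ring]; ring
  have h3 := Real.le_sqrt_of_sq_le h2
  have : |ev c (t, x) G| = c.ε ^ n * (c.ε ^ (-n) * |ev c (t, x) G|) := by
    rw [← mul_assoc, ← zpow_add₀ hε.ne']; simp
  rw [this]; simp only [sub_self, zpow_zero, mul_one, pow_one, one_mul]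
  gcongr

/-- Integrated consequences. -/
lemma Bd.int {G : Sm (Cfg q)} (h : Bd 0 1 2 G) : ∃ C : ℝ, 0 ≤ C ∧ ∀ c : Cfg q, ∀ t ∈ Set.Icc 0 c.T,
    |I c t G| ≤ C * dl c * DT c t := by
  obtain ⟨C, hC, h⟩ := h
  refine ⟨C, hC, fun c t ht => ?_⟩
  have hb : ∀ x ∈ Ω, |ev c (t, x) G| ≤ (C * dl c) * ev c (t, x) QQ := fun x hx => by
    have := h c t ht x hx
    rw [Real.sq_sqrt (QQ_nonneg c _)] at this
    simpa [mul_assoc] using this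
  have e : (C * dl c) * DT c t = I c t ((C * dl c) • QQ) := by rw [map_smul]; rfl
  rw [e, abs_le, ← map_neg]
  constructor
  · refine I_mono fun x hx => ?_
    have := (abs_le.1 (hb x hx)).1
    simpa using this
  · refine I_mono fun x hx => ?_
    have := (abs_le.1 (hb x hx)).2
    simpa using this

lemma Bd.int1 {n m : ℤ} {G : Sm (Cfg q)} (h : Bd n m 1 G) : ∃ C : ℝ, 0 ≤ C ∧ ∀ c : Cfg q, ∀ t ∈ Set.Icc 0 c.T,
    I c t (G * G) ≤ C * (c.ε ^ n * dl c ^ (m - n)) ^ 2 * DT c t := by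
  obtain ⟨C, hC, h⟩ := h
  refine ⟨C ^ 2, by positivity, fun c t ht => ?_⟩
  have e : C ^ 2 * (c.ε ^ n * dl c ^ (m - n)) ^ 2 * DT c t = I c t ((C ^ 2 * (c.ε ^ n * dl c ^ (m - n)) ^ 2) • QQ) := by
    rw [map_smul]; rfl
  rw [e]
  refine I_mono fun x hx => ?_
  have h1 := h c t ht x hx
  rw [map_mul, map_smul, smul_eq_mul, ← abs_mul_abs_self]
  calc _ ≤ (C * (c.ε ^ n * dl c ^ (m - n) * √(ev c (t, x) QQ) ^ 1)) * (C * (c.ε ^ n * dl c ^ (m - n) * √(ev c (t, x) QQ) ^ 1)) :=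
        mul_le_mul h1 h1 (abs_nonneg _) ((abs_nonneg _).trans h1)
    _ = C ^ 2 * (c.ε ^ n * dl c ^ (m - n)) ^ 2 * (√(ev c (t, x) QQ)) ^ 2 := by ring
    _ = _ := by rw [Real.sq_sqrt (QQ_nonneg c _)]

/-! ### Uniform bounds -/

lemma bd_of_agmon {G : Sm (Cfg q)} (n : ℤ)
    (h0 : ∀ c : Cfg q, ∀ t ∈ Set.Icc 0 c.T, I c t (G * G) ≤ c.ε ^ 2 * (c.ε ^ n) ^ 2 * NN c)
    (h1 : ∀ c : Cfg q, ∀ t ∈ Set.Icc 0 c.T, I c t (D1 G * D1 G) ≤ (c.ε ^ n) ^ 2 * NN c)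
    (h2 : ∀ c : Cfg q, ∀ t ∈ Set.Icc 0 c.T, I c t (D2 G * D2 G) ≤ (c.ε ^ n) ^ 2 * NN c)
    (h12 : ∀ c : Cfg q, ∀ t ∈ Set.Icc 0 c.T, c.ε ^ 2 * I c t (D1 (D2 G) * D1 (D2 G)) ≤ (c.ε ^ n) ^ 2 * NN c) :
    Bd n (n + 1) 0 G := by
  refine ⟨4, by norm_num, fun c t ht x hx => ?_⟩
  have hε := c.hε
  have ha := agmon c t G c.hε c.hε1 hx
  have e0 : c.ε⁻¹ ^ 2 * I c t (G * G) ≤ (c.ε ^ n) ^ 2 * NN c := by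
    rw [inv_pow, inv_mul_le_iff₀ (by positivity)]
    exact (h0 c t ht).trans (le_of_eq (by ring))
  have hb : ev c (t, x) G ^ 2 ≤ (4 * (c.ε ^ n * √(NN c))) ^ 2 := by
    rw [mul_pow, mul_pow, Real.sq_sqrt (NN_nonneg c)]
    have := h1 c t ht; have := h2 c t ht; have := h12 c t ht
    linarith
  have h3 := abs_le_of_sq_le_sq hb (by positivity)
  rw [show n + 1 - n = 1 by ring, zpow_one, pow_zero, mul_one]
  refine h3.trans ?_
  have := sqN_le c
  gcongr

lemma N_bounds (c : Cfg q) {t : ℝ} (ht : t ∈ Set.Icc 0 c.T) :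
    (dSq 0 (sl c t uu) ≤ c.ε ^ 2 * NN c ∧ dSq 0 (sl c t ww) ≤ c.ε ^ 2 * NN c ∧ dSq 0 (sl c t ff) ≤ c.ε ^ 4 * NN c ∧
      dSq 0 (sl c t hh) ≤ c.ε ^ 4 * NN c) ∧
    (dSq 1 (sl c t uu) ≤ NN c ∧ dSq 1 (sl c t ww) ≤ NN c ∧ dSq 1 (sl c t ff) ≤ c.ε ^ 2 * NN c ∧
      dSq 1 (sl c t hh) ≤ c.ε ^ 2 * NN c) ∧
    (c.ε ^ 2 * dSq 2 (sl c t uu) ≤ NN c ∧ c.ε ^ 2 * dSq 2 (sl c t ww) ≤ NN c ∧ dSq 2 (sl c t ff) ≤ NN c ∧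
      dSq 2 (sl c t hh) ≤ NN c) ∧
    (c.ε ^ 4 * dSq 3 (sl c t uu) ≤ NN c ∧ c.ε ^ 4 * dSq 3 (sl c t ww) ≤ NN c ∧ c.ε ^ 2 * dSq 3 (sl c t ff) ≤ NN c ∧
      c.ε ^ 2 * dSq 3 (sl c t hh) ≤ NN c) := by
  obtain ⟨g0, g1, g2, g4, g5⟩ := NN_ge c ht
  have hε := c.hε
  simp only [φsl, θsl, ψsl, L2Sq] at g0 g1 g2 g4 g5
  have hp : ∀ j, 0 ≤ dSq j (sl c t ff) ∧ 0 ≤ dSq j (sl c t hh) ∧ 0 ≤ dSq j (fun x => (sl c t uu x, sl c t ww x)) ∧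
      dSq j (sl c t uu) ≤ dSq j (fun x => (sl c t uu x, sl c t ww x)) ∧
      dSq j (sl c t ww) ≤ dSq j (fun x => (sl c t uu x, sl c t ww x)) := fun j =>
    ⟨dSq_nonneg _ _, dSq_nonneg _ _, dSq_nonneg _ _, dSq_fst c t uu ww j, dSq_snd c t uu ww j⟩
  obtain ⟨f0, k0, p0, u0, w0⟩ := hp 0
  obtain ⟨f1, k1, p1, u1, w1⟩ := hp 1
  obtain ⟨f2, k2, p2, u2, w2⟩ := hp 2
  obtain ⟨f3, k3, p3, u3, w3⟩ := hp 3
  have hi : c.ε ^ 2 * (c.ε ^ 2)⁻¹ = 1 := mul_inv_cancel₀ (by positivity)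
  have hi0 : 0 ≤ (c.ε ^ 2)⁻¹ := by positivity
  rw [inv_mul_le_iff₀ (by positivity)] at g0
  have P0 : dSq 0 (fun x => (sl c t uu x, sl c t ww x)) ≤ c.ε ^ 2 * NN c := by nlinarith
  have F0 : (c.ε ^ 2)⁻¹ * dSq 0 (sl c t ff) ≤ c.ε ^ 2 * NN c := by nlinarith
  have H0 : (c.ε ^ 2)⁻¹ * dSq 0 (sl c t hh) ≤ c.ε ^ 2 * NN c := by nlinarith
  have H1 : (c.ε ^ 2)⁻¹ * dSq 1 (sl c t hh) ≤ NN c := by nlinarith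
  rw [inv_mul_le_iff₀ (by positivity)] at F0 H0 H1 g2
  have h4 : c.ε ^ 2 * ((c.ε ^ 2)⁻¹ * dSq 2 (sl c t ff) + dSq 2 (fun x => (sl c t uu x, sl c t ww x)) + (c.ε ^ 2)⁻¹ * dSq 2 (sl c t hh))
    = dSq 2 (sl c t ff) + c.ε ^ 2 * dSq 2 (fun x => (sl c t uu x, sl c t ww x)) + dSq 2 (sl c t hh) := by
    linear_combination (dSq 2 (sl c t ff) + dSq 2 (sl c t hh)) * hi
  have h5 : c.ε ^ 4 * ((c.ε ^ 2)⁻¹ * dSq 3 (sl c t ff) + dSq 3 (fun x => (sl c t uu x, sl c t ww x)) + (c.ε ^ 2)⁻¹ * dSq 3 (sl c t hh))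
    = c.ε ^ 2 * dSq 3 (sl c t ff) + c.ε ^ 4 * dSq 3 (fun x => (sl c t uu x, sl c t ww x)) + c.ε ^ 2 * dSq 3 (sl c t hh) := by
    linear_combination c.ε ^ 2 * (dSq 3 (sl c t ff) + dSq 3 (sl c t hh)) * hi
  rw [h4] at g4
  rw [h5] at g5
  have q2 : 0 < c.ε ^ 2 := by positivity
  have q4 : 0 < c.ε ^ 4 := by positivity
  have a1 := mul_nonneg hi0 k1
  have b1 := mul_nonneg q2.le p2
  have b2 := mul_nonneg q4.le p3
  have b3 := mul_nonneg q2.le f3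
  have b4 := mul_nonneg q2.le k3
  have b5 := mul_le_mul_of_nonneg_left u2 q2.le
  have b6 := mul_le_mul_of_nonneg_left w2 q2.le
  have b7 := mul_le_mul_of_nonneg_left u3 q4.le
  have b8 := mul_le_mul_of_nonneg_left w3 q4.le
  refine ⟨⟨by linarith, by linarith, by linarith, by linarith⟩, ⟨by linarith, by linarith, by linarith, by linarith⟩,
    ⟨by linarith, by linarith, by linarith, by linarith⟩, ⟨by linarith, by linarith, by linarith, by linarith⟩⟩

/-- Uniform bounds of a field and of its gradient. -/
lemma bd_field (G : Sm (Cfg q)) (n : ℤ)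
    (h0 : ∀ c : Cfg q, ∀ t ∈ Set.Icc 0 c.T, dSq 0 (sl c t G) ≤ c.ε ^ 4 * (c.ε ^ n) ^ 2 * NN c)
    (h1 : ∀ c : Cfg q, ∀ t ∈ Set.Icc 0 c.T, dSq 1 (sl c t G) ≤ c.ε ^ 2 * (c.ε ^ n) ^ 2 * NN c)
    (h2 : ∀ c : Cfg q, ∀ t ∈ Set.Icc 0 c.T, dSq 2 (sl c t G) ≤ (c.ε ^ n) ^ 2 * NN c)
    (h3 : ∀ c : Cfg q, ∀ t ∈ Set.Icc 0 c.T, c.ε ^ 2 * dSq 3 (sl c t G) ≤ (c.ε ^ n) ^ 2 * NN c) :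
    Bd (n + 1) (n + 2) 0 G ∧ Bd n (n + 1) 0 (D1 G) ∧ Bd n (n + 1) 0 (D2 G) := by
  have e : ∀ c : Cfg q, (c.ε ^ (n + 1)) ^ 2 = c.ε ^ 2 * (c.ε ^ n) ^ 2 := fun c => by
    rw [zpow_add₀ c.hε.ne', zpow_one]; ring
  have m : ∀ (c : Cfg q) {x y z : ℝ}, x ≤ y → c.ε ^ 2 * y ≤ z → c.ε ^ 2 * x ≤ z := fun c x y z h h' =>
    (mul_le_mul_of_nonneg_left h (by positivity)).trans h'
  have a : ∀ H : Sm (Cfg q), (∀ (c : Cfg q) (t : ℝ) (j : ℕ), dSq j (sl c t H) ≤ dSq (j + 1) (sl c t G)) → Bd n (n + 1) 0 H := by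
    intro H hH
    refine bd_of_agmon n ?_ ?_ ?_ ?_ <;> intro c t ht <;> rw [← dSq_zero]
    · exact (hH c t 0).trans (h1 c t ht)
    · exact ((dSq_D1 c t H 0).trans (hH c t 1)).trans (h2 c t ht)
    · exact ((dSq_D2 c t H 0).trans (hH c t 1)).trans (h2 c t ht)
    · exact m c (((dSq_D1 c t _ 0).trans (dSq_D2 c t H 1)).trans (hH c t 2)) (h3 c t ht)
  refine ⟨?_, a _ fun c t j => dSq_D1 c t G j, a _ fun c t j => dSq_D2 c t G j⟩
  rw [show n + 2 = n + 1 + 1 by ring]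
  refine bd_of_agmon (n + 1) ?_ ?_ ?_ ?_ <;> intro c t ht <;> rw [← dSq_zero, e]
  · exact (h0 c t ht).trans (le_of_eq (by ring))
  · exact (dSq_D1 c t G 0).trans (h1 c t ht)
  · exact (dSq_D2 c t G 0).trans (h1 c t ht)
  · exact (m c ((dSq_D1 c t _ 0).trans (dSq_D2 c t G 1)) le_rfl).trans ((mul_le_mul_of_nonneg_left (h2 c t ht)
      (by positivity)).trans (le_of_eq (by ring)))

lemma bd_ff : Bd 1 2 0 (ff : Sm (Cfg q)) ∧ Bd 0 1 0 (D1 ff : Sm (Cfg q)) ∧ Bd 0 1 0 (D2 ff : Sm (Cfg q)) := by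
  refine bd_field ff 0 ?_ ?_ ?_ ?_ <;> intro c t ht <;> obtain ⟨⟨_, _, h0, _⟩, ⟨_, _, h1, _⟩, ⟨_, _, h2, _⟩, ⟨_, _, h3, _⟩⟩ := N_bounds c ht <;>
    simpa
lemma bd_hh : Bd 1 2 0 (hh : Sm (Cfg q)) ∧ Bd 0 1 0 (D1 hh : Sm (Cfg q)) ∧ Bd 0 1 0 (D2 hh : Sm (Cfg q)) := by
  refine bd_field hh 0 ?_ ?_ ?_ ?_ <;> intro c t ht <;> obtain ⟨⟨_, _, _, h0⟩, ⟨_, _, _, h1⟩, ⟨_, _, _, h2⟩, ⟨_, _, _, h3⟩⟩ := N_bounds c ht <;>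
    simpa
lemma bd_uw (G : Sm (Cfg q))
    (h : ∀ c : Cfg q, ∀ t ∈ Set.Icc 0 c.T, dSq 0 (sl c t G) ≤ c.ε ^ 2 * NN c ∧ dSq 1 (sl c t G) ≤ NN c ∧
      c.ε ^ 2 * dSq 2 (sl c t G) ≤ NN c ∧ c.ε ^ 4 * dSq 3 (sl c t G) ≤ NN c) :
    Bd 0 1 0 G ∧ Bd (-1) 0 0 (D1 G) ∧ Bd (-1) 0 0 (D2 G) := by
  refine bd_field G (-1) ?_ ?_ ?_ ?_ <;> intro c t ht <;> obtain ⟨h0, h1, h2, h3⟩ := h c t ht <;> have hε := c.hε <;>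
    rw [zpow_neg, zpow_one]
  · rwa [show c.ε ^ 4 * c.ε⁻¹ ^ 2 = c.ε ^ 2 by field_simp]
  · rwa [show c.ε ^ 2 * c.ε⁻¹ ^ 2 = 1 by field_simp, one_mul]
  · rw [inv_pow, le_inv_mul_iff₀ (by positivity)]; exact h2
  · rw [inv_pow, le_inv_mul_iff₀ (by positivity)]; linarith
lemma bd_uu : Bd 0 1 0 (uu : Sm (Cfg q)) ∧ Bd (-1) 0 0 (D1 uu : Sm (Cfg q)) ∧ Bd (-1) 0 0 (D2 uu : Sm (Cfg q)) := by
  refine bd_uw uu fun c t ht => ?_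
  obtain ⟨⟨h0, _⟩, ⟨h1, _⟩, ⟨h2, _⟩, ⟨h3, _⟩⟩ := N_bounds c ht
  exact ⟨h0, h1, h2, h3⟩
lemma bd_ww : Bd 0 1 0 (ww : Sm (Cfg q)) ∧ Bd (-1) 0 0 (D1 ww : Sm (Cfg q)) ∧ Bd (-1) 0 0 (D2 ww : Sm (Cfg q)) := by
  refine bd_uw ww fun c t ht => ?_
  obtain ⟨⟨_, h0, _⟩, ⟨_, h1, _⟩, ⟨_, h2, _⟩, ⟨_, h3, _⟩⟩ := N_bounds c ht
  exact ⟨h0, h1, h2, h3⟩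

/-! ### The background temperature and density -/

/-- An upper bound of the temperature. -/
def cA (q : Par) : ℝ := 2 + q.Pr / (q.γ / (q.γ - 1))
/-- A bound of the slope of the temperature. -/
def cK (q : Par) : ℝ := q.K + q.Pr / (q.γ / (q.γ - 1))

lemma cp_pos (q : Par) : 0 < q.γ / (q.γ - 1) := div_pos (by linarith [q.hγ]) (by linarith [q.hγ])

lemma aa_bd (c : Cfg q) (t : ℝ) {x : ℝ × ℝ} (hx : x ∈ Ω) : 1 / 2 ≤ ev c (t, x) aa ∧ ev c (t, x) aa ≤ cA q := by
  have hy := y_mem hx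
  rw [ev_aa c t hx]
  refine ⟨tT_ge c hy.1.le hy.2.le, ?_⟩
  unfold tT cA
  have h := abs_le.1 c.hχ2
  have h1 : 0 < q.Pr / (q.γ / (q.γ - 1)) := div_pos q.hPr (cp_pos q)
  have h2 : c.ε ^ 2 * q.Pr / (2 * (q.γ / (q.γ - 1))) = c.ε ^ 2 * (q.Pr / (q.γ / (q.γ - 1))) / 2 := by
    have := (cp_pos q).ne'; field_simp
  rw [h2]
  have h3 : c.ε ^ 2 ≤ 1 := pow_le_one₀ c.hε.le c.hε1
  have h4 : 0 ≤ c.ε ^ 2 := by positivity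
  have h5 : c.ε ^ 2 * (q.Pr / (q.γ / (q.γ - 1))) ≤ q.Pr / (q.γ / (q.γ - 1)) := by nlinarith
  have h6 : 0 ≤ c.ε ^ 2 * (q.Pr / (q.γ / (q.γ - 1))) := by positivity
  have h7 : x.2 - x.2 ^ 2 ≤ 1 := by nlinarith
  nlinarith

lemma ab_ev (c : Cfg q) (v : V) : ev c v aa * ev c v bb = 1 := by rw [← map_mul, ab1, map_one]

lemma bb_bd (c : Cfg q) (t : ℝ) {x : ℝ × ℝ} (hx : x ∈ Ω) : (cA q)⁻¹ ≤ ev c (t, x) bb ∧ ev c (t, x) bb ≤ 2 := by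
  obtain ⟨h1, h2⟩ := aa_bd c t hx
  have e : ev c (t, x) bb = (ev c (t, x) aa)⁻¹ := eq_inv_of_mul_eq_one_right (ab_ev c _)
  rw [e]
  constructor
  · exact inv_anti₀ (by linarith) h2
  · rw [inv_le_comm₀ (by linarith) (by norm_num)]; linarith

lemma D2_tT (c : Cfg q) (t : ℝ) {x : ℝ × ℝ} (hx : x ∈ Ω) :
    ev c (t, x) (D2 aa) = (1 - c.χ) - c.ε ^ 2 * q.Pr / (2 * (q.γ / (q.γ - 1))) * (2 * x.2 - 1) := by
  have hl : ev c (t, x) (D2 aa) = d2 (fun x => ev c (t, x) aa) x := (d2_ev aa c t x).symm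
  rw [hl, (d_congr (g := fun x => ev c (t, x) aa) (g' := fun x => tT q.γ q.Pr c.ε c.χ x) (fun x hx => ev_aa c t hx) hx).2]
  unfold d2 tT
  have h : HasFDerivAt (fun x : ℝ × ℝ => c.χ + (1 - c.χ) * x.2 - c.ε ^ 2 * q.Pr / (2 * (q.γ / (q.γ - 1))) * (x.2 ^ 2 - x.2))
      (((1 - c.χ) • ContinuousLinearMap.snd ℝ ℝ ℝ) - (c.ε ^ 2 * q.Pr / (2 * (q.γ / (q.γ - 1)))) •
        ((2 * x.2) • ContinuousLinearMap.snd ℝ ℝ ℝ - ContinuousLinearMap.snd ℝ ℝ ℝ)) x := by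
    have hs : HasFDerivAt (fun x : ℝ × ℝ => x.2) (ContinuousLinearMap.snd ℝ ℝ ℝ) x := hasFDerivAt_snd
    have h2 := hs.pow 2
    have := ((hs.const_mul (1 - c.χ)).const_add c.χ).sub ((h2.sub hs).const_mul (c.ε ^ 2 * q.Pr / (2 * (q.γ / (q.γ - 1)))))
    exact this.congr_fderiv (by simp [pow_one])
  rw [h.fderiv]; simp

lemma D22_tT (c : Cfg q) (t : ℝ) {x : ℝ × ℝ} (hx : x ∈ Ω) :
    ev c (t, x) (D2 (D2 aa)) = - (c.ε ^ 2 * q.Pr / (q.γ / (q.γ - 1))) := by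
  have hl : ev c (t, x) (D2 (D2 aa)) = d2 (fun x => ev c (t, x) (D2 aa)) x := (d2_ev (D2 aa) c t x).symm
  rw [hl, (d_congr (g := fun x => ev c (t, x) (D2 aa)) (g' := fun x => (1 - c.χ) - c.ε ^ 2 * q.Pr / (2 * (q.γ / (q.γ - 1))) * (2 * x.2 - 1))
    (fun x hx => D2_tT c t hx) hx).2]
  unfold d2
  have h : HasFDerivAt (fun x : ℝ × ℝ => (1 - c.χ) - c.ε ^ 2 * q.Pr / (2 * (q.γ / (q.γ - 1))) * (2 * x.2 - 1))
      (- ((c.ε ^ 2 * q.Pr / (2 * (q.γ / (q.γ - 1)))) • ((2 : ℝ) • ContinuousLinearMap.snd ℝ ℝ ℝ))) x := by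
    have hs : HasFDerivAt (fun x : ℝ × ℝ => x.2) (ContinuousLinearMap.snd ℝ ℝ ℝ) x := hasFDerivAt_snd
    have := (((hs.const_mul 2).sub_const 1).const_mul (c.ε ^ 2 * q.Pr / (2 * (q.γ / (q.γ - 1))))).const_sub (1 - c.χ)
    simpa using this
  rw [h.fderiv]
  have := (cp_pos q).ne'
  simp
  field_simp

lemma aa'_bd (c : Cfg q) (t : ℝ) {x : ℝ × ℝ} (hx : x ∈ Ω) : |ev c (t, x) (D2 aa)| ≤ cK q * c.ε := by
  have hy := y_mem hx
  rw [D2_tT c t hx]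
  have h := abs_le.1 c.hχ
  have h2 : c.ε ^ 2 * q.Pr / (2 * (q.γ / (q.γ - 1))) = c.ε ^ 2 * (q.Pr / (q.γ / (q.γ - 1))) / 2 := by
    have := (cp_pos q).ne'; field_simp
  have h1 : 0 < q.Pr / (q.γ / (q.γ - 1)) := div_pos q.hPr (cp_pos q)
  have hε := c.hε
  have h3 : c.ε ^ 2 ≤ c.ε := by nlinarith [c.hε1]
  have h4 : c.ε ^ 2 * (q.Pr / (q.γ / (q.γ - 1))) ≤ c.ε * (q.Pr / (q.γ / (q.γ - 1))) := by nlinarith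
  have h5 : 0 ≤ c.ε ^ 2 * (q.Pr / (q.γ / (q.γ - 1))) := by positivity
  unfold cK
  rw [h2, abs_le]
  constructor <;> nlinarith

lemma bd_a : Bd 0 0 0 (aa : Sm (Cfg q)) := Bd.cst0 (cA q) fun c t ht x hx => by
  obtain ⟨h1, h2⟩ := aa_bd c t hx
  rw [abs_of_nonneg (by linarith)]; exact h2
lemma cA_pos (q : Par) : 0 < cA q := by
  have := div_pos q.hPr (cp_pos q); unfold cA; linarith
lemma bd_b : Bd 0 0 0 (bb : Sm (Cfg q)) := Bd.cst0 2 fun c t ht x hx => by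
  obtain ⟨h1, h2⟩ := bb_bd c t hx
  have := inv_pos.2 (cA_pos q)
  rw [abs_of_nonneg (by linarith)]; exact h2
lemma cK_pos (q : Par) : 0 < cK q := by
  have := div_pos q.hPr (cp_pos q); have := q.hK; unfold cK; linarith
lemma bd_a' : Bd 1 1 0 (D2 aa : Sm (Cfg q)) := ⟨cK q, (cK_pos q).le, fun c t ht x hx => by simpa using aa'_bd c t hx⟩
lemma bd_a'' : Bd 2 2 0 (D2 (D2 aa) : Sm (Cfg q)) := ⟨q.Pr / (q.γ / (q.γ - 1)), (div_pos q.hPr (cp_pos q)).le, fun c t ht x hx => by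
  have h := div_pos q.hPr (cp_pos q)
  rw [D22_tT c t hx, abs_neg, abs_of_nonneg (by rw [mul_div_assoc]; positivity)]
  have e : c.ε ^ (2 : ℤ) = c.ε ^ 2 := by norm_cast
  rw [e]; apply le_of_eq; simp; ring⟩
lemma bd_b' : Bd 1 1 0 (D2 bb : Sm (Cfg q)) := by
  rw [D2_bb]; exact ((bd_a'.neg.mul bd_b).mul bd_b).mono
lemma D22_bb : D2 (D2 (bb : Sm (Cfg q))) = - D2 (D2 aa) * bb * bb - D2 aa * D2 bb * bb - D2 aa * bb * D2 bb := by
  rw [D2_bb]; simp only [map_neg, Derivation.leibniz, smul_eq_mul, D2_bb]; ring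
lemma bd_b'' : Bd 2 2 0 (D2 (D2 bb) : Sm (Cfg q)) := by
  rw [D22_bb]
  exact ((((bd_a''.neg.mul bd_b).mul bd_b).mono).sub (((bd_a'.mul bd_b').mul bd_b).mono)).sub (((bd_a'.mul bd_b).mul bd_b').mono)

attribute [irreducible] QQ DT dl Bd

end

section
set_option linter.all false
variable {q : Par}

lemma Bd.of_eq {n m : ℤ} {j : ℕ} {G H : Sm (Cfg q)} (h : Bd n m j G) (e : H = G) : Bd n m j H := e ▸ h
lemma D02_aa : D0 (D2 (aa : Sm (Cfg q))) = 0 := by rw [← D20, D0_aa, map_zero]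
lemma D12_aa : D1 (D2 (aa : Sm (Cfg q))) = 0 := by rw [← D21, D1_aa, map_zero]
lemma D02_bb : D0 (D2 (bb : Sm (Cfg q))) = 0 := by rw [← D20, D0_bb, map_zero]
lemma D12_bb : D1 (D2 (bb : Sm (Cfg q))) = 0 := by rw [← D21, D1_bb, map_zero]
lemma D022_aa : D0 (D2 (D2 (aa : Sm (Cfg q)))) = 0 := by rw [← D20, D02_aa, map_zero]
lemma D122_aa : D1 (D2 (D2 (aa : Sm (Cfg q)))) = 0 := by rw [← D21, D12_aa, map_zero]
lemma D022_bb : D0 (D2 (D2 (bb : Sm (Cfg q)))) = 0 := by rw [← D20, D02_bb, map_zero]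
lemma D122_bb : D1 (D2 (D2 (bb : Sm (Cfg q)))) = 0 := by rw [← D21, D12_bb, map_zero]

lemma b0f : Bd 1 2 0 (ff : Sm (Cfg q)) := bd_ff.1
lemma b0f1 : Bd 0 1 0 (D1 ff : Sm (Cfg q)) := bd_ff.2.1
lemma b0f2 : Bd 0 1 0 (D2 ff : Sm (Cfg q)) := bd_ff.2.2
lemma b0h : Bd 1 2 0 (hh : Sm (Cfg q)) := bd_hh.1
lemma b0h1 : Bd 0 1 0 (D1 hh : Sm (Cfg q)) := bd_hh.2.1
lemma b0h2 : Bd 0 1 0 (D2 hh : Sm (Cfg q)) := bd_hh.2.2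
lemma b0u : Bd 0 1 0 (uu : Sm (Cfg q)) := bd_uu.1
lemma b0u1 : Bd (-1) 0 0 (D1 uu : Sm (Cfg q)) := bd_uu.2.1
lemma b0u2 : Bd (-1) 0 0 (D2 uu : Sm (Cfg q)) := bd_uu.2.2
lemma b0w : Bd 0 1 0 (ww : Sm (Cfg q)) := bd_ww.1
lemma b0w1 : Bd (-1) 0 0 (D1 ww : Sm (Cfg q)) := bd_ww.2.1
lemma b0w2 : Bd (-1) 0 0 (D2 ww : Sm (Cfg q)) := bd_ww.2.2
lemma b0y : Bd 0 0 0 (yy : Sm (Cfg q)) := bd_y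
lemma b0a : Bd 0 0 0 (aa : Sm (Cfg q)) := bd_a
lemma b0b : Bd 0 0 0 (bb : Sm (Cfg q)) := bd_b
lemma b0a2 : Bd 1 1 0 (D2 aa : Sm (Cfg q)) := bd_a'
lemma b0b2 : Bd 1 1 0 (D2 bb : Sm (Cfg q)) := bd_b'
lemma b0a22 : Bd 2 2 0 (D2 (D2 aa) : Sm (Cfg q)) := bd_a''
lemma b0b22 : Bd 2 2 0 (D2 (D2 bb) : Sm (Cfg q)) := bd_b''
lemma b1u : Bd 1 1 1 (uu : Sm (Cfg q)) := bd_jet (by simp [jl])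
lemma b1u1 : Bd 1 1 1 (D1 uu : Sm (Cfg q)) := bd_jet (by simp [jl])
lemma b1u2 : Bd 1 1 1 (D2 uu : Sm (Cfg q)) := bd_jet (by simp [jl])
lemma b1u11 : Bd 0 0 1 (D1 (D1 uu) : Sm (Cfg q)) := bd_jet (by simp [jl])
lemma b1u12 : Bd 0 0 1 (D1 (D2 uu) : Sm (Cfg q)) := bd_jet (by simp [jl])
lemma b1u22 : Bd 0 0 1 (D2 (D2 uu) : Sm (Cfg q)) := bd_jet (by simp [jl])
lemma b1u111 : Bd (-1) (-1) 1 (D1 (D1 (D1 uu)) : Sm (Cfg q)) := bd_jet (by simp [jl])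
lemma b1u112 : Bd (-1) (-1) 1 (D1 (D1 (D2 uu)) : Sm (Cfg q)) := bd_jet (by simp [jl])
lemma b1u122 : Bd (-1) (-1) 1 (D1 (D2 (D2 uu)) : Sm (Cfg q)) := bd_jet (by simp [jl])
lemma b1u222 : Bd (-1) (-1) 1 (D2 (D2 (D2 uu)) : Sm (Cfg q)) := bd_jet (by simp [jl])
lemma b1ut : Bd (-1) (-1) 1 (D0 uu : Sm (Cfg q)) := bd_jet (by simp [jl])
lemma b1ut1 : Bd (-1) (-1) 1 (D0 (D1 uu) : Sm (Cfg q)) := bd_jet (by simp [jl])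
lemma b1ut2 : Bd (-1) (-1) 1 (D0 (D2 uu) : Sm (Cfg q)) := bd_jet (by simp [jl])
lemma b1w : Bd 1 1 1 (ww : Sm (Cfg q)) := bd_jet (by simp [jl])
lemma b1w1 : Bd 1 1 1 (D1 ww : Sm (Cfg q)) := bd_jet (by simp [jl])
lemma b1w2 : Bd 1 1 1 (D2 ww : Sm (Cfg q)) := bd_jet (by simp [jl])
lemma b1w11 : Bd 0 0 1 (D1 (D1 ww) : Sm (Cfg q)) := bd_jet (by simp [jl])
lemma b1w12 : Bd 0 0 1 (D1 (D2 ww) : Sm (Cfg q)) := bd_jet (by simp [jl])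
lemma b1w22 : Bd 0 0 1 (D2 (D2 ww) : Sm (Cfg q)) := bd_jet (by simp [jl])
lemma b1w111 : Bd (-1) (-1) 1 (D1 (D1 (D1 ww)) : Sm (Cfg q)) := bd_jet (by simp [jl])
lemma b1w112 : Bd (-1) (-1) 1 (D1 (D1 (D2 ww)) : Sm (Cfg q)) := bd_jet (by simp [jl])
lemma b1w122 : Bd (-1) (-1) 1 (D1 (D2 (D2 ww)) : Sm (Cfg q)) := bd_jet (by simp [jl])
lemma b1w222 : Bd (-1) (-1) 1 (D2 (D2 (D2 ww)) : Sm (Cfg q)) := bd_jet (by simp [jl])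
lemma b1wt : Bd (-1) (-1) 1 (D0 ww : Sm (Cfg q)) := bd_jet (by simp [jl])
lemma b1wt1 : Bd (-1) (-1) 1 (D0 (D1 ww) : Sm (Cfg q)) := bd_jet (by simp [jl])
lemma b1wt2 : Bd (-1) (-1) 1 (D0 (D2 ww) : Sm (Cfg q)) := bd_jet (by simp [jl])
lemma b1f : Bd 1 1 1 (ff : Sm (Cfg q)) := bd_jet (by simp [jl])
lemma b1f1 : Bd 1 1 1 (D1 ff : Sm (Cfg q)) := bd_jet (by simp [jl])
lemma b1f2 : Bd 1 1 1 (D2 ff : Sm (Cfg q)) := bd_jet (by simp [jl])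
lemma b1f11 : Bd 1 1 1 (D1 (D1 ff) : Sm (Cfg q)) := bd_jet (by simp [jl])
lemma b1f12 : Bd 1 1 1 (D1 (D2 ff) : Sm (Cfg q)) := bd_jet (by simp [jl])
lemma b1f22 : Bd 1 1 1 (D2 (D2 ff) : Sm (Cfg q)) := bd_jet (by simp [jl])
lemma b1ft : Bd 1 1 1 (D0 ff : Sm (Cfg q)) := bd_jet (by simp [jl])
lemma b1h : Bd 2 2 1 (hh : Sm (Cfg q)) := bd_jet (by simp [jl])
lemma b1h1 : Bd 2 2 1 (D1 hh : Sm (Cfg q)) := bd_jet (by simp [jl])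
lemma b1h2 : Bd 2 2 1 (D2 hh : Sm (Cfg q)) := bd_jet (by simp [jl])
lemma b1h11 : Bd 1 1 1 (D1 (D1 hh) : Sm (Cfg q)) := bd_jet (by simp [jl])
lemma b1h12 : Bd 1 1 1 (D1 (D2 hh) : Sm (Cfg q)) := bd_jet (by simp [jl])
lemma b1h22 : Bd 1 1 1 (D2 (D2 hh) : Sm (Cfg q)) := bd_jet (by simp [jl])
lemma b1h111 : Bd 0 0 1 (D1 (D1 (D1 hh)) : Sm (Cfg q)) := bd_jet (by simp [jl])
lemma b1h112 : Bd 0 0 1 (D1 (D1 (D2 hh)) : Sm (Cfg q)) := bd_jet (by simp [jl])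
lemma b1h122 : Bd 0 0 1 (D1 (D2 (D2 hh)) : Sm (Cfg q)) := bd_jet (by simp [jl])
lemma b1h222 : Bd 0 0 1 (D2 (D2 (D2 hh)) : Sm (Cfg q)) := bd_jet (by simp [jl])
lemma b1ht : Bd 0 0 1 (D0 hh : Sm (Cfg q)) := bd_jet (by simp [jl])
lemma b1ht1 : Bd 0 0 1 (D0 (D1 hh) : Sm (Cfg q)) := bd_jet (by simp [jl])
lemma b1ht2 : Bd 0 0 1 (D0 (D2 hh) : Sm (Cfg q)) := bd_jet (by simp [jl])

lemma b0R : Bd 0 0 0 (RR : Sm (Cfg q)) :=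
  (b0b.mono).add
    (b0f.mono)

lemma b0d : Bd (-1) 0 0 (dv : Sm (Cfg q)) :=
  (b0u1.mono).add
    (b0w2.mono)

lemma b1d : Bd 1 1 1 (dv : Sm (Cfg q)) :=
  (b1u1.mono).add
    (b1w2.mono)

lemma b1d1 : Bd 0 0 1 (D1 dv : Sm (Cfg q)) :=
  Bd.of_eq (G := D1 (D1 uu) + D1 (D2 ww)) ((b1u11.mono).add
    (b1w12.mono)) (by
  simp only [map_add, map_sub, map_neg, map_zero, Derivation.leibniz, smul_eq_mul, D10, D20, D21, DD_kc, DD_Ep, D0_yy, D1_yy, D2_yy, D0_aa, D1_aa, D0_bb, D1_bb, D02_aa, D12_aa, D02_bb, D12_bb, D022_aa, D122_aa, D022_bb, D122_bb, mul_zero, zero_mul, add_zero, zero_add, sub_zero, mul_one, one_mul] <;> ring)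

lemma b1d2 : Bd 0 0 1 (D2 dv : Sm (Cfg q)) :=
  Bd.of_eq (G := D1 (D2 uu) + D2 (D2 ww)) ((b1u12.mono).add
    (b1w22.mono)) (by
  simp only [map_add, map_sub, map_neg, map_zero, Derivation.leibniz, smul_eq_mul, D10, D20, D21, DD_kc, DD_Ep, D0_yy, D1_yy, D2_yy, D0_aa, D1_aa, D0_bb, D1_bb, D02_aa, D12_aa, D02_bb, D12_bb, D022_aa, D122_aa, D022_bb, D122_bb, mul_zero, zero_mul, add_zero, zero_add, sub_zero, mul_one, one_mul] <;> ring)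

lemma b1d11 : Bd (-1) (-1) 1 (D1 (D1 dv) : Sm (Cfg q)) :=
  Bd.of_eq (G := D1 (D1 (D1 uu)) + D1 (D1 (D2 ww))) ((b1u111.mono).add
    (b1w112.mono)) (by
  simp only [map_add, map_sub, map_neg, map_zero, Derivation.leibniz, smul_eq_mul, D10, D20, D21, DD_kc, DD_Ep, D0_yy, D1_yy, D2_yy, D0_aa, D1_aa, D0_bb, D1_bb, D02_aa, D12_aa, D02_bb, D12_bb, D022_aa, D122_aa, D022_bb, D122_bb, mul_zero, zero_mul, add_zero, zero_add, sub_zero, mul_one, one_mul] <;> ring)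

lemma b1d12 : Bd (-1) (-1) 1 (D1 (D2 dv) : Sm (Cfg q)) :=
  Bd.of_eq (G := D1 (D1 (D2 uu)) + D1 (D2 (D2 ww))) ((b1u112.mono).add
    (b1w122.mono)) (by
  simp only [map_add, map_sub, map_neg, map_zero, Derivation.leibniz, smul_eq_mul, D10, D20, D21, DD_kc, DD_Ep, D0_yy, D1_yy, D2_yy, D0_aa, D1_aa, D0_bb, D1_bb, D02_aa, D12_aa, D02_bb, D12_bb, D022_aa, D122_aa, D022_bb, D122_bb, mul_zero, zero_mul, add_zero, zero_add, sub_zero, mul_one, one_mul] <;> ring)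

lemma b1d22 : Bd (-1) (-1) 1 (D2 (D2 dv) : Sm (Cfg q)) :=
  Bd.of_eq (G := D1 (D2 (D2 uu)) + D2 (D2 (D2 ww))) ((b1u122.mono).add
    (b1w222.mono)) (by
  simp only [map_add, map_sub, map_neg, map_zero, Derivation.leibniz, smul_eq_mul, D10, D20, D21, DD_kc, DD_Ep, D0_yy, D1_yy, D2_yy, D0_aa, D1_aa, D0_bb, D1_bb, D02_aa, D12_aa, D02_bb, D12_bb, D022_aa, D122_aa, D022_bb, D122_bb, mul_zero, zero_mul, add_zero, zero_add, sub_zero, mul_one, one_mul] <;> ring)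

lemma b1dt : Bd (-1) (-1) 1 (D0 dv : Sm (Cfg q)) :=
  Bd.of_eq (G := D0 (D1 uu) + D0 (D2 ww)) ((b1ut1.mono).add
    (b1wt2.mono)) (by
  simp only [map_add, map_sub, map_neg, map_zero, Derivation.leibniz, smul_eq_mul, D10, D20, D21, DD_kc, DD_Ep, D0_yy, D1_yy, D2_yy, D0_aa, D1_aa, D0_bb, D1_bb, D02_aa, D12_aa, D02_bb, D12_bb, D022_aa, D122_aa, D022_bb, D122_bb, mul_zero, zero_mul, add_zero, zero_add, sub_zero, mul_one, one_mul] <;> ring)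

lemma b0pi : Bd 1 2 0 (pp : Sm (Cfg q)) :=
  (((b0a.mul b0f).mono).add
    ((b0b.mul b0h).mono)).add
    ((b0f.mul b0h).mono)

lemma b1pi : Bd 1 1 1 (pp : Sm (Cfg q)) :=
  (((b0a.mul b1f).mono).add
    ((b0b.mul b1h).mono)).add
    ((b0f.mul b1h).mono)

lemma b0pi1 : Bd 0 1 0 (D1 pp : Sm (Cfg q)) :=
  Bd.of_eq (G := aa * D1 ff + bb * D1 hh + D1 ff * hh + ff * D1 hh) (((((b0a.mul b0f1).mono).add
    ((b0b.mul b0h1).mono)).add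
    ((b0f1.mul b0h).mono)).add
    ((b0f.mul b0h1).mono)) (by
  simp only [map_add, map_sub, map_neg, map_zero, Derivation.leibniz, smul_eq_mul, D10, D20, D21, DD_kc, DD_Ep, D0_yy, D1_yy, D2_yy, D0_aa, D1_aa, D0_bb, D1_bb, D02_aa, D12_aa, D02_bb, D12_bb, D022_aa, D122_aa, D022_bb, D122_bb, mul_zero, zero_mul, add_zero, zero_add, sub_zero, mul_one, one_mul] <;> ring)

lemma b1pi1 : Bd 1 1 1 (D1 pp : Sm (Cfg q)) :=
  Bd.of_eq (G := aa * D1 ff + bb * D1 hh + D1 ff * hh + ff * D1 hh) (((((b0a.mul b1f1).mono).add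
    ((b0b.mul b1h1).mono)).add
    ((b0f1.mul b1h).mono)).add
    ((b0f.mul b1h1).mono)) (by
  simp only [map_add, map_sub, map_neg, map_zero, Derivation.leibniz, smul_eq_mul, D10, D20, D21, DD_kc, DD_Ep, D0_yy, D1_yy, D2_yy, D0_aa, D1_aa, D0_bb, D1_bb, D02_aa, D12_aa, D02_bb, D12_bb, D022_aa, D122_aa, D022_bb, D122_bb, mul_zero, zero_mul, add_zero, zero_add, sub_zero, mul_one, one_mul] <;> ring)

lemma b0pi2 : Bd 0 1 0 (D2 pp : Sm (Cfg q)) :=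
  Bd.of_eq (G := aa * D2 ff + bb * D2 hh + D2 ff * hh + ff * D2 hh + D2 aa * ff + D2 bb * hh) (((((((b0a.mul b0f2).mono).add
    ((b0b.mul b0h2).mono)).add
    ((b0f2.mul b0h).mono)).add
    ((b0f.mul b0h2).mono)).add
    ((b0a2.mul b0f).mono)).add
    ((b0b2.mul b0h).mono)) (by
  simp only [map_add, map_sub, map_neg, map_zero, Derivation.leibniz, smul_eq_mul, D10, D20, D21, DD_kc, DD_Ep, D0_yy, D1_yy, D2_yy, D0_aa, D1_aa, D0_bb, D1_bb, D02_aa, D12_aa, D02_bb, D12_bb, D022_aa, D122_aa, D022_bb, D122_bb, mul_zero, zero_mul, add_zero, zero_add, sub_zero, mul_one, one_mul] <;> ring)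

lemma b1pi2 : Bd 1 1 1 (D2 pp : Sm (Cfg q)) :=
  Bd.of_eq (G := aa * D2 ff + bb * D2 hh + D2 ff * hh + ff * D2 hh + D2 aa * ff + D2 bb * hh) (((((((b0a.mul b1f2).mono).add
    ((b0b.mul b1h2).mono)).add
    ((b0f2.mul b1h).mono)).add
    ((b0f.mul b1h2).mono)).add
    ((b0a2.mul b1f).mono)).add
    ((b0b2.mul b1h).mono)) (by
  simp only [map_add, map_sub, map_neg, map_zero, Derivation.leibniz, smul_eq_mul, D10, D20, D21, DD_kc, DD_Ep, D0_yy, D1_yy, D2_yy, D0_aa, D1_aa, D0_bb, D1_bb, D02_aa, D12_aa, D02_bb, D12_bb, D022_aa, D122_aa, D022_bb, D122_bb, mul_zero, zero_mul, add_zero, zero_add, sub_zero, mul_one, one_mul] <;> ring)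

lemma b1pi11 : Bd 1 1 1 (D1 (D1 pp) : Sm (Cfg q)) :=
  Bd.of_eq (G := aa * D1 (D1 ff) + bb * D1 (D1 hh) + D1 (D1 ff) * hh + 2 * D1 ff * D1 hh + ff * D1 (D1 hh)) ((((((b0a.mul b1f11).mono).add
    ((b0b.mul b1h11).mono)).add
    ((b1f11.mul b0h).mono)).add
    ((((bd_n 2).mul b0f1).mul b1h1).mono)).add
    ((b0f.mul b1h11).mono)) (by
  simp only [map_add, map_sub, map_neg, map_zero, Derivation.leibniz, smul_eq_mul, D10, D20, D21, DD_kc, DD_Ep, D0_yy, D1_yy, D2_yy, D0_aa, D1_aa, D0_bb, D1_bb, D02_aa, D12_aa, D02_bb, D12_bb, D022_aa, D122_aa, D022_bb, D122_bb, mul_zero, zero_mul, add_zero, zero_add, sub_zero, mul_one, one_mul] <;> ring)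

lemma b1pit : Bd 0 0 1 (D0 pp : Sm (Cfg q)) :=
  Bd.of_eq (G := aa * D0 ff + bb * D0 hh + D0 ff * hh + ff * D0 hh) (((((b0a.mul b1ft).mono).add
    ((b0b.mul b1ht).mono)).add
    ((b1ft.mul b0h).mono)).add
    ((b0f.mul b1ht).mono)) (by
  simp only [map_add, map_sub, map_neg, map_zero, Derivation.leibniz, smul_eq_mul, D10, D20, D21, DD_kc, DD_Ep, D0_yy, D1_yy, D2_yy, D0_aa, D1_aa, D0_bb, D1_bb, D02_aa, D12_aa, D02_bb, D12_bb, D022_aa, D122_aa, D022_bb, D122_bb, mul_zero, zero_mul, add_zero, zero_add, sub_zero, mul_one, one_mul] <;> ring)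

lemma b1B1 : Bd (-1) (-1) 1 (B1 : Sm (Cfg q)) :=
  (((b1ut.mono).add
    (((Bd.add (n := 0) (m := 0) b0y.mono b0u.mono).mul b1u1).mono)).add
    ((b0w.mul b1u2).mono)).add
    (b1w.mono)

lemma b1B2 : Bd (-1) (-1) 1 (B2 : Sm (Cfg q)) :=
  ((b1wt.mono).add
    (((Bd.add (n := 0) (m := 0) b0y.mono b0u.mono).mul b1w1).mono)).add
    ((b0w.mul b1w2).mono)

lemma b1B3 : Bd 0 0 1 (B3 : Sm (Cfg q)) :=
  (((b1ht.mono).add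
    (((Bd.add (n := 0) (m := 0) b0y.mono b0u.mono).mul b1h1).mono)).add
    ((b0w.mul b1h2).mono)).add
    ((b1w.mul b0a2).mono)

lemma b1B11 : Bd (-1) (-1) 1 (D1 B1 : Sm (Cfg q)) :=
  Bd.of_eq (G := D0 (D1 uu) + (yy + uu) * D1 (D1 uu) + D1 uu * D1 uu + ww * D1 (D2 uu) + D1 ww * D2 uu + D1 ww) ((((((b1ut1.mono).add
    (((Bd.add (n := 0) (m := 0) b0y.mono b0u.mono).mul b1u11).mono)).add
    ((b0u1.mul b1u1).mono)).add
    ((b0w.mul b1u12).mono)).add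
    ((b0w1.mul b1u2).mono)).add
    (b1w1.mono)) (by
  simp only [map_add, map_sub, map_neg, map_zero, Derivation.leibniz, smul_eq_mul, D10, D20, D21, DD_kc, DD_Ep, D0_yy, D1_yy, D2_yy, D0_aa, D1_aa, D0_bb, D1_bb, D02_aa, D12_aa, D02_bb, D12_bb, D022_aa, D122_aa, D022_bb, D122_bb, mul_zero, zero_mul, add_zero, zero_add, sub_zero, mul_one, one_mul] <;> ring)

lemma b1B21 : Bd (-1) (-1) 1 (D1 B2 : Sm (Cfg q)) :=
  Bd.of_eq (G := D0 (D1 ww) + (yy + uu) * D1 (D1 ww) + D1 uu * D1 ww + ww * D1 (D2 ww) + D1 ww * D2 ww) (((((b1wt1.mono).add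
    (((Bd.add (n := 0) (m := 0) b0y.mono b0u.mono).mul b1w11).mono)).add
    ((b0u1.mul b1w1).mono)).add
    ((b0w.mul b1w12).mono)).add
    ((b0w1.mul b1w2).mono)) (by
  simp only [map_add, map_sub, map_neg, map_zero, Derivation.leibniz, smul_eq_mul, D10, D20, D21, DD_kc, DD_Ep, D0_yy, D1_yy, D2_yy, D0_aa, D1_aa, D0_bb, D1_bb, D02_aa, D12_aa, D02_bb, D12_bb, D022_aa, D122_aa, D022_bb, D122_bb, mul_zero, zero_mul, add_zero, zero_add, sub_zero, mul_one, one_mul] <;> ring)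

lemma b1B12 : Bd (-1) (-1) 1 (D2 B1 : Sm (Cfg q)) :=
  Bd.of_eq (G := D0 (D2 uu) + (yy + uu) * D1 (D2 uu) + (1 + D2 uu) * D1 uu + ww * D2 (D2 uu) + D2 ww * D2 uu + D2 ww) ((((((b1ut2.mono).add
    (((Bd.add (n := 0) (m := 0) b0y.mono b0u.mono).mul b1u12).mono)).add
    (((Bd.add (n := -1) (m := 0) bd_1.mono b0u2.mono).mul b1u1).mono)).add
    ((b0w.mul b1u22).mono)).add
    ((b0w2.mul b1u2).mono)).add
    (b1w2.mono)) (by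
  simp only [map_add, map_sub, map_neg, map_zero, Derivation.leibniz, smul_eq_mul, D10, D20, D21, DD_kc, DD_Ep, D0_yy, D1_yy, D2_yy, D0_aa, D1_aa, D0_bb, D1_bb, D02_aa, D12_aa, D02_bb, D12_bb, D022_aa, D122_aa, D022_bb, D122_bb, mul_zero, zero_mul, add_zero, zero_add, sub_zero, mul_one, one_mul] <;> ring)

lemma b1B22 : Bd (-1) (-1) 1 (D2 B2 : Sm (Cfg q)) :=
  Bd.of_eq (G := D0 (D2 ww) + (yy + uu) * D1 (D2 ww) + (1 + D2 uu) * D1 ww + ww * D2 (D2 ww) + D2 ww * D2 ww) (((((b1wt2.mono).add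
    (((Bd.add (n := 0) (m := 0) b0y.mono b0u.mono).mul b1w12).mono)).add
    (((Bd.add (n := -1) (m := 0) bd_1.mono b0u2.mono).mul b1w1).mono)).add
    ((b0w.mul b1w22).mono)).add
    ((b0w2.mul b1w2).mono)) (by
  simp only [map_add, map_sub, map_neg, map_zero, Derivation.leibniz, smul_eq_mul, D10, D20, D21, DD_kc, DD_Ep, D0_yy, D1_yy, D2_yy, D0_aa, D1_aa, D0_bb, D1_bb, D02_aa, D12_aa, D02_bb, D12_bb, D022_aa, D122_aa, D022_bb, D122_bb, mul_zero, zero_mul, add_zero, zero_add, sub_zero, mul_one, one_mul] <;> ring)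

lemma b1B31 : Bd 0 0 1 (D1 B3 : Sm (Cfg q)) :=
  Bd.of_eq (G := D0 (D1 hh) + (yy + uu) * D1 (D1 hh) + D1 uu * D1 hh + ww * D1 (D2 hh) + D1 ww * D2 hh + D1 ww * D2 aa) ((((((b1ht1.mono).add
    (((Bd.add (n := 0) (m := 0) b0y.mono b0u.mono).mul b1h11).mono)).add
    ((b0u1.mul b1h1).mono)).add
    ((b0w.mul b1h12).mono)).add
    ((b0w1.mul b1h2).mono)).add
    ((b1w1.mul b0a2).mono)) (by
  simp only [map_add, map_sub, map_neg, map_zero, Derivation.leibniz, smul_eq_mul, D10, D20, D21, DD_kc, DD_Ep, D0_yy, D1_yy, D2_yy, D0_aa, D1_aa, D0_bb, D1_bb, D02_aa, D12_aa, D02_bb, D12_bb, D022_aa, D122_aa, D022_bb, D122_bb, mul_zero, zero_mul, add_zero, zero_add, sub_zero, mul_one, one_mul] <;> ring)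

lemma b1B32 : Bd 0 0 1 (D2 B3 : Sm (Cfg q)) :=
  Bd.of_eq (G := D0 (D2 hh) + (yy + uu) * D1 (D2 hh) + (1 + D2 uu) * D1 hh + ww * D2 (D2 hh) + D2 ww * D2 hh + D2 ww * D2 aa + ww * D2 (D2 aa)) (((((((b1ht2.mono).add
    (((Bd.add (n := 0) (m := 0) b0y.mono b0u.mono).mul b1h12).mono)).add
    (((Bd.add (n := -1) (m := 0) bd_1.mono b0u2.mono).mul b1h1).mono)).add
    ((b0w.mul b1h22).mono)).add
    ((b0w2.mul b1h2).mono)).add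
    ((b1w2.mul b0a2).mono)).add
    ((b1w.mul b0a22).mono)) (by
  simp only [map_add, map_sub, map_neg, map_zero, Derivation.leibniz, smul_eq_mul, D10, D20, D21, DD_kc, DD_Ep, D0_yy, D1_yy, D2_yy, D0_aa, D1_aa, D0_bb, D1_bb, D02_aa, D12_aa, D02_bb, D12_bb, D022_aa, D122_aa, D022_bb, D122_bb, mul_zero, zero_mul, add_zero, zero_add, sub_zero, mul_one, one_mul] <;> ring)

lemma b1HT : Bd 0 1 1 (HT : Sm (Cfg q)) :=
  (((((bd_k _).mul (Bd.add (n := 0) (m := 1) (b0u1.mul b1u1).mono (b0w2.mul b1w2).mono)).mono).add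
    ((((bd_k _).mul (Bd.add (n := -1) (m := 0) b0w1.mono b0u2.mono)).mul (Bd.add (n := 1) (m := 1) b1w1.mono b1u2.mono)).mono)).add
    (((bd_k _).mul (Bd.add (n := 1) (m := 1) b1w1.mono b1u2.mono)).mono)).add
    ((((bd_k _).mul b0d).mul b1d).mono)

lemma b1HT1 : Bd (-1) 0 1 (D1 HT : Sm (Cfg q)) :=
  Bd.of_eq (G := 2 * kc (2 * cμ q) * (D1 uu * D1 (D1 uu) + D2 ww * D1 (D2 ww)) + 2 * Mu * (D1 ww + D2 uu) * (D1 (D1 ww) + D1 (D2 uu)) + kc (2 * cμ q) * (D1 (D1 ww) + D1 (D2 uu)) + 2 * kc (q.r * q.Re⁻¹) * dv * D1 dv) (((((((bd_n 2).mul (bd_k _)).mul (Bd.add (n := -1) (m := 0) (b0u1.mul b1u11).mono (b0w2.mul b1w12).mono)).mono).add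
    (((((bd_n 2).mul (bd_k _)).mul (Bd.add (n := -1) (m := 0) b0w1.mono b0u2.mono)).mul (Bd.add (n := 0) (m := 0) b1w11.mono b1u12.mono)).mono)).add
    (((bd_k _).mul (Bd.add (n := 0) (m := 0) b1w11.mono b1u12.mono)).mono)).add
    (((((bd_n 2).mul (bd_k _)).mul b0d).mul b1d1).mono)) (by
  simp only [map_add, map_sub, map_neg, map_zero, Derivation.leibniz, smul_eq_mul, D10, D20, D21, DD_kc, DD_Ep, D0_yy, D1_yy, D2_yy, D0_aa, D1_aa, D0_bb, D1_bb, D02_aa, D12_aa, D02_bb, D12_bb, D022_aa, D122_aa, D022_bb, D122_bb, mul_zero, zero_mul, add_zero, zero_add, sub_zero, mul_one, one_mul] <;> ring)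

lemma b1HT2 : Bd (-1) 0 1 (D2 HT : Sm (Cfg q)) :=
  Bd.of_eq (G := 2 * kc (2 * cμ q) * (D1 uu * D1 (D2 uu) + D2 ww * D2 (D2 ww)) + 2 * Mu * (D1 ww + D2 uu) * (D1 (D2 ww) + D2 (D2 uu)) + kc (2 * cμ q) * (D1 (D2 ww) + D2 (D2 uu)) + 2 * kc (q.r * q.Re⁻¹) * dv * D2 dv) (((((((bd_n 2).mul (bd_k _)).mul (Bd.add (n := -1) (m := 0) (b0u1.mul b1u12).mono (b0w2.mul b1w22).mono)).mono).add
    (((((bd_n 2).mul (bd_k _)).mul (Bd.add (n := -1) (m := 0) b0w1.mono b0u2.mono)).mul (Bd.add (n := 0) (m := 0) b1w12.mono b1u22.mono)).mono)).add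
    (((bd_k _).mul (Bd.add (n := 0) (m := 0) b1w12.mono b1u22.mono)).mono)).add
    (((((bd_n 2).mul (bd_k _)).mul b0d).mul b1d2).mono)) (by
  simp only [map_add, map_sub, map_neg, map_zero, Derivation.leibniz, smul_eq_mul, D10, D20, D21, DD_kc, DD_Ep, D0_yy, D1_yy, D2_yy, D0_aa, D1_aa, D0_bb, D1_bb, D02_aa, D12_aa, D02_bb, D12_bb, D022_aa, D122_aa, D022_bb, D122_bb, mul_zero, zero_mul, add_zero, zero_add, sub_zero, mul_one, one_mul] <;> ring)

lemma b1HTt : Bd (-2) (-1) 1 (D0 HT : Sm (Cfg q)) :=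
  Bd.of_eq (G := 2 * kc (2 * cμ q) * (D1 uu * D0 (D1 uu) + D2 ww * D0 (D2 ww)) + 2 * Mu * (D1 ww + D2 uu) * (D0 (D1 ww) + D0 (D2 uu)) + kc (2 * cμ q) * (D0 (D1 ww) + D0 (D2 uu)) + 2 * kc (q.r * q.Re⁻¹) * dv * D0 dv) (((((((bd_n 2).mul (bd_k _)).mul (Bd.add (n := -2) (m := -1) (b0u1.mul b1ut1).mono (b0w2.mul b1wt2).mono)).mono).add
    (((((bd_n 2).mul (bd_k _)).mul (Bd.add (n := -1) (m := 0) b0w1.mono b0u2.mono)).mul (Bd.add (n := -1) (m := -1) b1wt1.mono b1ut2.mono)).mono)).add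
    (((bd_k _).mul (Bd.add (n := -1) (m := -1) b1wt1.mono b1ut2.mono)).mono)).add
    (((((bd_n 2).mul (bd_k _)).mul b0d).mul b1dt).mono)) (by
  simp only [map_add, map_sub, map_neg, map_zero, Derivation.leibniz, smul_eq_mul, D10, D20, D21, DD_kc, DD_Ep, D0_yy, D1_yy, D2_yy, D0_aa, D1_aa, D0_bb, D1_bb, D02_aa, D12_aa, D02_bb, D12_bb, D022_aa, D122_aa, D022_bb, D122_bb, mul_zero, zero_mul, add_zero, zero_add, sub_zero, mul_one, one_mul] <;> ring)

end

section
set_option linter.all false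
variable {q : Par}

/-! ### Energy identities -/

lemma Zr.of_eq {G H : Sm (Cfg q)} (h : Zr G) (e : H = G) : Zr H := e ▸ h

lemma DD_2 (e : V) : DD e (2 : Sm (Cfg q)) = 0 := by
  rw [show (2 : Sm (Cfg q)) = 1 + 1 by norm_num, map_add, Derivation.map_one_eq_zero, add_zero]
lemma DD_3 (e : V) : DD e (3 : Sm (Cfg q)) = 0 := by
  rw [show (3 : Sm (Cfg q)) = 2 + 1 by norm_num, map_add, DD_2, Derivation.map_one_eq_zero, add_zero]
lemma DD_4 (e : V) : DD e (4 : Sm (Cfg q)) = 0 := by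
  rw [show (4 : Sm (Cfg q)) = 2 + 2 by norm_num, map_add, DD_2, add_zero]
lemma DD_6 (e : V) : DD e (6 : Sm (Cfg q)) = 0 := by
  rw [show (6 : Sm (Cfg q)) = 3 + 3 by norm_num, map_add, DD_3, add_zero]

/-- Energy of a differentiated system. -/
def eng (Fg Ug Wg Hg : Sm (Cfg q)) : Sm (Cfg q) := Ep 2 * (Ep (-2) * (aa * aa * Fg * Fg) + RR * (Ug * Ug + Wg * Wg) + Ep (-2) * (Cg * bb * RR * Hg * Hg))
/-- Dissipation of a differentiated system. -/
def dsg (Ug Wg Hg : Sm (Cfg q)) : Sm (Cfg q) :=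
  2 * Ep 2 * (Mu * (D1 Ug * D1 Ug + D2 Ug * D2 Ug + D1 Wg * D1 Wg + D2 Wg * D2 Wg) + La * (D1 Ug + D2 Wg) * (D1 Ug + D2 Wg) + Ep (-2) * (Ka * bb * (D1 Hg * D1 Hg + D2 Hg * D2 Hg)))
/-- Remainder of a differentiated system. -/
def remg (Fg Ug Wg Hg Pg mg n1 n2 kg : Sm (Cfg q)) : Sm (Cfg q) :=
  Ep 2 * Ep (-2) * (aa * aa * Fg * Fg * dv + 2 * aa * D2 aa * ww * Fg * Fg - 2 * aa * aa * D2 bb * Fg * Wg - 2 * aa * aa * Fg * mg + 2 * Pg * (D1 Ug + D2 Wg) - 2 * Cg * D2 aa * bb * RR * Hg * Wg - 2 * bb * Hg * kg + Cg * D2 bb * RR * ww * Hg * Hg - 2 * Ka * D2 bb * Hg * D2 Hg) - 2 * Ep 2 * (RR * Wg * Ug + n1 * Ug + n2 * Wg)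

lemma gen_id (Fg Ug Wg Hg Pg mg n1 n2 kg : Sm (Cfg q)) (hU : Zb Ug) (hW : Zb Wg) (hH : Zb Hg)
    (hM : Zr (D0 Fg + (yy + uu) * D1 Fg + ww * D2 Fg + bb * (D1 Ug + D2 Wg) + Wg * D2 bb + mg))
    (h1 : Zr (RR * (D0 Ug + (yy + uu) * D1 Ug + ww * D2 Ug + Wg) + Ep (-2) * D1 (aa * Fg + bb * Hg + Pg) - Mu * (D1 (D1 Ug) + D2 (D2 Ug)) - La * (D1 (D1 Ug) + D1 (D2 Wg)) + n1))
    (h2 : Zr (RR * (D0 Wg + (yy + uu) * D1 Wg + ww * D2 Wg) + Ep (-2) * D2 (aa * Fg + bb * Hg + Pg) - Mu * (D1 (D1 Wg) + D2 (D2 Wg)) - La * (D1 (D2 Ug) + D2 (D2 Wg)) + n2))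
    (hE : Zr (Cg * RR * (D0 Hg + (yy + uu) * D1 Hg + ww * D2 Hg + Wg * D2 aa) + (D1 Ug + D2 Wg) - Ka * (D1 (D1 Hg) + D2 (D2 Hg)) + kg)) :
    ∃ J1 J2 : Sm (Cfg q), Zb J2 ∧ Zr (D0 (eng Fg Ug Wg Hg) + D1 J1 + D2 J2 + dsg Ug Wg Hg - remg Fg Ug Wg Hg Pg mg n1 n2 kg) :=
  ⟨(yy + uu) * eng Fg Ug Wg Hg + 2 * Ep 2 * Ep (-2) * (aa * Fg + bb * Hg + Pg) * Ug - 2 * Ep 2 * Mu * (Ug * D1 Ug + Wg * D1 Wg) - 2 * Ep 2 * La * Ug * (D1 Ug + D2 Wg) - 2 * Ep 2 * Ep (-2) * Ka * bb * Hg * D1 Hg,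
    ww * eng Fg Ug Wg Hg + 2 * Ep 2 * Ep (-2) * (aa * Fg + bb * Hg + Pg) * Wg - 2 * Ep 2 * Mu * (Ug * D2 Ug + Wg * D2 Wg) - 2 * Ep 2 * La * Wg * (D1 Ug + D2 Wg) - 2 * Ep 2 * Ep (-2) * Ka * bb * Hg * D2 Hg,
    (((((bw.mulr _).add (hW.mul _)).sub (((hU.mulr _).add (hW.mulr _)).mul _)).sub ((hW.mul _).mulr _)).sub ((hH.mul _).mulr _)),
    Zr.of_eq (((((hM.mul (Ep 2 * Ep (-2) * (2 * aa * aa * Fg))).add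
    (h1.mul (Ep 2 * (2 * Ug)))).add
    (h2.mul (Ep 2 * (2 * Wg)))).add
    (hE.mul (Ep 2 * Ep (-2) * (2 * bb * Hg)))).add
    (zM.mul (Ep 2 * (Ug * Ug + Wg * Wg) + Ep 2 * Ep (-2) * Cg * bb * Hg * Hg))) (by
    simp only [eng, dsg, remg, eqM]
    simp only [map_add, map_sub, map_neg, map_zero, Derivation.leibniz, smul_eq_mul, D10, D20, D21, DD_kc, DD_Ep, D0_yy, D1_yy, D2_yy, D0_aa, D1_aa, D0_bb, D1_bb, D02_aa, D12_aa, D02_bb, D12_bb, D022_aa, D122_aa, D022_bb, D122_bb, DD_2, DD_3, DD_4, DD_6, Derivation.map_one_eq_zero, D2_bb, mul_zero, zero_mul, add_zero, zero_add, sub_zero, mul_one, one_mul]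
    linear_combination (- 2 * Ep (-2) * Ep 2 * Fg * D1 Ug * aa - 2 * Ep (-2) * Ep 2 * Fg * D2 Wg * aa) * (ab1 : (aa * bb : Sm (Cfg q)) = 1))⟩

end

section
set_option linter.all false
variable {q : Par}

lemma z_a222 : Zr (D2 (D2 (D2 (aa : Sm (Cfg q))))) := by
  have h : Zr (D2 (D2 (aa : Sm (Cfg q))) - cst fun c => -(c.ε ^ 2 * q.Pr / (q.γ / (q.γ - 1)))) := fun c t ht x hx => by
    rw [map_sub, D22_tT c t hx, ev_cst]; ring
  exact h.D2.of_eq (by rw [map_sub, DD_cst, sub_zero])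
lemma b0b222 : Bd 0 0 0 (D2 (D2 (D2 bb)) : Sm (Cfg q)) := by
  have h3 : Bd 0 0 0 (D2 (D2 (D2 aa)) : Sm (Cfg q)) := Bd.cst0 0 fun c t ht x hx => by
    rw [z_a222 c t ht x hx, abs_zero]
  refine Bd.of_eq (G := -(D2 (D2 (D2 aa)) * bb * bb) - 4 * D2 (D2 aa) * D2 bb * bb - 2 * D2 aa * D2 (D2 bb) * bb - 2 * D2 aa * D2 bb * D2 bb) (Bd.sub (Bd.sub (Bd.sub ((h3.mul b0b).mul b0b).neg.mono
    ((((bd_n 4).mul b0a22).mul b0b2).mul b0b).mono) ((((bd_n 2).mul b0a2).mul b0b22).mul b0b).mono) ((((bd_n 2).mul b0a2).mul b0b2).mul b0b2).mono) ?_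
  simp only [map_neg, map_sub, map_add, Derivation.leibniz, smul_eq_mul, D2_bb]
  ring

/-- An energy identity: `∂ₜ e + div J + ds = bad + small`. -/
def En (e ds bad : Sm (Cfg q)) : Prop :=
  ∃ J1 J2 S : Sm (Cfg q), Zb J2 ∧ Bd 0 1 2 S ∧ Zr (D0 e + D1 J1 + D2 J2 + ds - bad - S)

lemma En.of_gen {e ds bad rem J1 J2 K1 K2 S : Sm (Cfg q)} (hJ : Zb J2)
    (hz : Zr (D0 e + D1 J1 + D2 J2 + ds - rem)) (hK : Zb K2) (hS : Bd 0 1 2 S)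
    (h : Zr (rem - bad - S - D1 K1 - D2 K2)) : En e ds bad :=
  ⟨J1 - K1, J2 - K2, S, hJ.sub hK, hS, (hz.add h).of_eq (by simp only [map_sub]; ring)⟩

lemma En.int {e ds bad : Sm (Cfg q)} (h : En e ds bad) : ∃ C : ℝ, 0 ≤ C ∧ ∀ c : Cfg q, ∀ t ∈ Set.Icc 0 c.T,
    I c t (D0 e) ≤ - I c t ds + I c t bad + C * (dl c * DT c t) := by
  obtain ⟨J1, J2, S, hJ, hS, hz⟩ := h
  obtain ⟨C, hC, hS⟩ := hS.int
  refine ⟨C, hC, fun c t ht => ?_⟩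
  have h1 := I_congr (p := c) (t := t) (G := D0 e + D1 J1 + D2 J2 + ds - bad - S) (H := 0) fun x hx => by
    rw [hz c t ht x hx, map_zero]
  simp only [map_add, map_sub, map_zero, I_D1] at h1
  rw [I_D2_zero (fun x => hJ c t ht x 0 (by simp)) (fun x => hJ c t ht x 1 (by simp))] at h1
  have := le_abs_self (I c t S)
  have := hS c t ht
  linarith

lemma en0 : En (q := q) (Ep (-2) * Ep (-2) * (3 * aa * ff * ff - aa * aa * ff * ff * ff) + 3 * Ep (-2) * bb * RR * (uu * uu + ww * ww) + 3 * Ep (-2) * Ep (-2) * Cg * bb * bb * RR * hh * hh) (6 * Ep (-2) * bb * (Mu * (D1 uu * D1 uu + D2 uu * D2 uu + D1 ww * D1 ww + D2 ww * D2 ww) + La * dv * dv) + 6 * Ep (-2) * Ep (-2) * Ka * bb * bb * (D1 hh * D1 hh + D2 hh * D2 hh))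
    (6 * Ep (-2) * Ep (-2) * D2 bb * (1 + Cg) * bb * hh * ww - 6 * Ep (-2) * bb * bb * uu * ww) :=
  ⟨(yy + uu) * (Ep (-2) * Ep (-2) * (3 * aa * ff * ff - aa * aa * ff * ff * ff) + 3 * Ep (-2) * bb * RR * (uu * uu + ww * ww) + 3 * Ep (-2) * Ep (-2) * Cg * bb * bb * RR * hh * hh) + 6 * Ep (-2) * Ep (-2) * bb * pp * uu - 6 * Ep (-2) * bb * (Mu * (uu * D1 uu + ww * D1 ww) + La * uu * dv) - 6 * Ep (-2) * Ep (-2) * Ka * bb * bb * hh * D1 hh,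
    ww * (Ep (-2) * Ep (-2) * (3 * aa * ff * ff - aa * aa * ff * ff * ff) + 3 * Ep (-2) * bb * RR * (uu * uu + ww * ww) + 3 * Ep (-2) * Ep (-2) * Cg * bb * bb * RR * hh * hh) + 6 * Ep (-2) * Ep (-2) * bb * pp * ww - 6 * Ep (-2) * bb * (Mu * (uu * D2 uu + ww * D2 ww) + La * ww * dv) - 6 * Ep (-2) * Ep (-2) * Ka * bb * bb * hh * D2 hh,
    2 * Ep (-2) * Ep (-2) * aa * aa * aa * (bb * dv + D2 bb * ww) * ff * ff * ff - 6 * Ep (-2) * Ep (-2) * bb * bb * RR * hh * hh * dv + 6 * Ep (-2) * Ep (-2) * D2 bb * (1 + Cg) * ff * hh * ww - 6 * Ep (-2) * bb * ff * uu * ww + 3 * Ep (-2) * RR * ww * D2 bb * (uu * uu + ww * ww) - 6 * Ep (-2) * D2 bb * (Mu * uu * D2 uu + Mu * ww * D2 ww + La * ww * dv) + 6 * Ep (-2) * Ep (-2) * Cg * bb * D2 bb * ww * RR * hh * hh - 12 * Ep (-2) * Ep (-2) * Ka * bb * D2 bb * hh * D2 hh + 6 * Ep (-2) * Ep (-2)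 * bb * bb * hh * Ep 2 * HT,
    ((((bw.mulr _).add (bw.mul _)).sub (((((bu.mulr _).add (bw.mulr _)).mul _).add ((bw.mul _).mulr _)).mul _)).sub ((bh.mul _).mulr _)),
    ((((((((((((((((((bd_n 2).mul (bd_E (-2))).mul (bd_E (-2))).mul b0a).mul b0a).mul b0a).mul (Bd.add (n := 1) (m := 1) (b0b.mul b1d).mono (b0b2.mul b1w).mono)).mul b0f).mul b0f).mul b1f).mono).sub
    ((((((((((bd_n 6).mul (bd_E (-2))).mul (bd_E (-2))).mul b0b).mul b0b).mul b0R).mul b0h).mul b1h).mul b1d).mono)).add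
    (((((((((bd_n 6).mul (bd_E (-2))).mul (bd_E (-2))).mul b0b2).mul (Bd.add (n := 0) (m := 0) bd_1.mono (bd_k _).mono)).mul b0f).mul b1h).mul b1w).mono)).sub
    (((((((bd_n 6).mul (bd_E (-2))).mul b0b).mul b0f).mul b1u).mul b1w).mono)).add
    (((((((bd_n 3).mul (bd_E (-2))).mul b0R).mul b0w).mul b0b2).mul (Bd.add (n := 2) (m := 2) (b1u.mul b1u).mono (b1w.mul b1w).mono)).mono)).sub
    (((((bd_n 6).mul (bd_E (-2))).mul b0b2).mul (Bd.add (n := 2) (m := 2) (Bd.add (n := 2) (m := 2) (((bd_k _).mul b1u).mul b1u2).mono (((bd_k _).mul b1w).mul b1w2).mono).mono (((bd_k _).mul b1w).mul b1d).mono)).mono)).add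
    (((((((((((bd_n 6).mul (bd_E (-2))).mul (bd_E (-2))).mul (bd_k _)).mul b0b).mul b0b2).mul b0w).mul b0R).mul b1h).mul b1h).mono)).sub
    (((((((((bd_n 12).mul (bd_E (-2))).mul (bd_E (-2))).mul (bd_k _)).mul b0b).mul b0b2).mul b1h).mul b1h2).mono)).add
    (((((((((bd_n 6).mul (bd_E (-2))).mul (bd_E (-2))).mul b0b).mul b0b).mul b1h).mul (bd_E 2)).mul b1HT).mono),
    Zr.of_eq ((((zM.mul (Ep (-2) * Ep (-2) * (6 * aa * ff - 3 * aa * aa * ff * ff) + 3 * Ep (-2) * bb * (uu * uu + ww * ww) + 3 * Ep (-2) * Ep (-2) * Cg * bb * bb * hh * hh)).add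
    (z1.mul (6 * Ep (-2) * bb * uu))).add
    (z2.mul (6 * Ep (-2) * bb * ww))).add
    (zE.mul (6 * Ep (-2) * Ep (-2) * bb * bb * hh))) (by
    simp only [eqM, eq1, eq2, eqE]
    simp only [map_add, map_sub, map_neg, map_zero, Derivation.leibniz, smul_eq_mul, D10, D20, D21, DD_kc, DD_Ep, D0_yy, D1_yy, D2_yy, D0_aa, D1_aa, D0_bb, D1_bb, D02_aa, D12_aa, D02_bb, D12_bb, D022_aa, D122_aa, D022_bb, D122_bb, DD_2, DD_3, DD_4, DD_6, Derivation.map_one_eq_zero, D2_bb, mul_zero, zero_mul, add_zero, zero_add, sub_zero, mul_one, one_mul]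
    linear_combination (2 * Ep (-2) * Ep (-2) * aa * aa * D2 aa * bb * ff * ff * ff * ww - 3 * Ep (-2) * Ep (-2) * aa * D2 aa * bb * ff * ff * ww - 2 * Ep (-2) * Ep (-2) * aa * aa * ff * ff * ff * D1 uu - 2 * Ep (-2) * Ep (-2) * aa * aa * ff * ff * ff * D2 ww + 3 * Ep (-2) * Ep (-2) * aa * ff * ff * D1 uu + 3 * Ep (-2) * Ep (-2) * aa * ff * ff * D2 ww - 6 * Ep (-2) * Ep (-2) * bb * ff * hh * D1 uu - 6 * Ep (-2) * Ep (-2) * bb * ff * hh * D2 ww + 2 * Ep (-2) * Ep (-2) * aa * D2 aa * ff * ff * ff * ww - 3 * Ep (-2) * Ep (-2) * D2 aa * ff * ff * ww) * (ab1 : (aa * bb : Sm (Cfg q)) = 1))⟩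

lemma ent : En (q := q) (eng (D0 ff) (D0 uu) (D0 ww) (D0 hh)) (dsg (D0 uu) (D0 ww) (D0 hh))
    ((-2) * Ep 2 * bb * D0 ww * D0 uu - 2 * Ep 2 * Ep (-2) * Cg * D2 aa * bb * bb * D0 hh * D0 ww) := by
  obtain ⟨J1, J2, hJ, hz⟩ := gen_id (q := q) (D0 ff) (D0 uu) (D0 ww) (D0 hh) (D0 ff * hh + ff * D0 hh)
    (D0 uu * D1 ff + D0 ww * D2 ff + D0 ff * dv + ff * D0 dv)
    (D0 ff * B1 + RR * (D0 uu * D1 uu + D0 ww * D2 uu))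
    (D0 ff * B2 + RR * (D0 uu * D1 ww + D0 ww * D2 ww))
    (Cg * (D0 ff * B3 + RR * (D0 uu * D1 hh + D0 ww * D2 hh)) + D0 pp * dv + pp * D0 dv - Ep 2 * D0 HT)
    (bu.D0) (bw.D0) (bh.D0)
    (zM.D0.of_eq (by
    simp only [eqM]
    simp only [map_add, map_sub, map_neg, map_zero, Derivation.leibniz, smul_eq_mul, D10, D20, D21, DD_kc, DD_Ep, D0_yy, D1_yy, D2_yy, D0_aa, D1_aa, D0_bb, D1_bb, D02_aa, D12_aa, D02_bb, D12_bb, D022_aa, D122_aa, D022_bb, D122_bb, DD_2, DD_3, DD_4, DD_6, Derivation.map_one_eq_zero, D2_bb, mul_zero, zero_mul, add_zero, zero_add, sub_zero, mul_one, one_mul]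
    ring))
    (z1.D0.of_eq (by
    simp only [eq1]
    simp only [map_add, map_sub, map_neg, map_zero, Derivation.leibniz, smul_eq_mul, D10, D20, D21, DD_kc, DD_Ep, D0_yy, D1_yy, D2_yy, D0_aa, D1_aa, D0_bb, D1_bb, D02_aa, D12_aa, D02_bb, D12_bb, D022_aa, D122_aa, D022_bb, D122_bb, DD_2, DD_3, DD_4, DD_6, Derivation.map_one_eq_zero, D2_bb, mul_zero, zero_mul, add_zero, zero_add, sub_zero, mul_one, one_mul]
    ring))
    (z2.D0.of_eq (by
    simp only [eq2]
    simp only [map_add, map_sub, map_neg, map_zero, Derivation.leibniz, smul_eq_mul, D10, D20, D21, DD_kc, DD_Ep, D0_yy, D1_yy, D2_yy, D0_aa, D1_aa, D0_bb, D1_bb, D02_aa, D12_aa, D02_bb, D12_bb, D022_aa, D122_aa, D022_bb, D122_bb, DD_2, DD_3, DD_4, DD_6, Derivation.map_one_eq_zero, D2_bb, mul_zero, zero_mul, add_zero, zero_add, sub_zero, mul_one, one_mul]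
    ring))
    (zE.D0.of_eq (by
    simp only [eqE]
    simp only [map_add, map_sub, map_neg, map_zero, Derivation.leibniz, smul_eq_mul, D10, D20, D21, DD_kc, DD_Ep, D0_yy, D1_yy, D2_yy, D0_aa, D1_aa, D0_bb, D1_bb, D02_aa, D12_aa, D02_bb, D12_bb, D022_aa, D122_aa, D022_bb, D122_bb, DD_2, DD_3, DD_4, DD_6, Derivation.map_one_eq_zero, D2_bb, mul_zero, zero_mul, add_zero, zero_add, sub_zero, mul_one, one_mul]
    ring))
  refine En.of_gen hJ hz (K1 := Ep 2 * Ep (-2) * (2 * Cg * bb * RR - 2 * bb * bb) * D0 hh * D0 hh * uu - 2 * Ep 2 * Ep (-2) * Cg * bb * RR * D0 hh * D0 uu * hh + 2 * Ep 2 * RR * (D0 uu * D0 uu + D0 ww * D0 ww) * uu - 2 * Ep 2 * RR * D0 uu * (uu * D0 uu + ww * D0 ww))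
    (K2 := Ep 2 * Ep (-2) * (2 * Cg * bb * RR - 2 * bb * bb) * D0 hh * D0 hh * ww - 2 * Ep 2 * Ep (-2) * Cg * bb * RR * D0 hh * D0 ww * hh + 2 * Ep 2 * RR * (D0 uu * D0 uu + D0 ww * D0 ww) * ww - 2 * Ep 2 * RR * D0 ww * (uu * D0 uu + ww * D0 ww))
    (S := Ep 2 * Ep (-2) * (aa * aa * D0 ff * D0 ff * dv) + 2 * Ep 2 * Ep (-2) * aa * D2 aa * ww * D0 ff * D0 ff - 2 * Ep 2 * Ep (-2) * aa * aa * D2 bb * D0 ff * D0 ww - 2 * Ep 2 * Ep (-2) * aa * aa * D0 ff * (D0 uu * D1 ff + D0 ww * D2 ff + D0 ff * dv + ff * D0 dv) + 2 * Ep 2 * Ep (-2) * (D0 ff * hh + ff * D0 hh) * D0 dv - 2 * Ep 2 * Ep (-2) * Cg * D2 aa * bb * ff * D0 hh * D0 ww - 2 * Ep 2 * Ep (-2) * bb * D0 hh * Cg * D0 ff * ((yy + uu) * D1 hh + ww * D2 hh + ww * D2 aa) - 2 * Ep 2 * Ep (-2) * bb * D0 hh * dv * (aa * D0 ff + D0 ff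 * hh + ff * D0 hh) - 2 * Ep 2 * Ep (-2) * bb * D0 hh * pp * D0 dv + 2 * Ep 2 * Ep (-2) * bb * D0 hh * Ep 2 * D0 HT + Ep 2 * Ep (-2) * Cg * D2 bb * RR * ww * D0 hh * D0 hh - 2 * Ep 2 * Ep (-2) * Ka * D2 bb * D0 hh * D0 (D2 hh) + 2 * Ep 2 * Ep (-2) * Cg * bb * D0 hh * D0 hh * ((yy + uu) * D1 ff + ww * D2 ff + ww * D2 bb) - Ep 2 * Ep (-2) * uu * (2 * Cg * bb * D1 ff) * D0 hh * D0 hh - Ep 2 * Ep (-2) * ww * (2 * Cg * (D2 bb * RR + bb * (D2 bb + D2 ff)) - 4 * bb * D2 bb) * D0 hh * D0 hh - 2 * Ep 2 * Ep (-2) * (2 * Cg * bb * RR - 2 * bb * bb) * (uu * D0 hh * D0 (D1 hh) + ww * D0 hh * D0 (D2 hh)) + 2 * Ep 2 * Ep (-2) * Cg * hh * bb * RR * (D0 (D1 hh) * D0 uu + D0 (D2 hh) * D0 ww + D0 hh * D0 dv) + 2 * Ep 2 * Ep (-2) * Cg * hh * (bb * D1 ff * D0 hh * D0 uu + (D2 bb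 * RR + bb * (D2 bb + D2 ff)) * D0 hh * D0 ww) - 2 * Ep 2 * ff * D0 ww * D0 uu - 2 * Ep 2 * D0 ff * ((yy + uu) * D1 uu + ww * D2 uu + ww) * D0 uu - 2 * Ep 2 * D0 ff * ((yy + uu) * D1 ww + ww * D2 ww) * D0 ww + 2 * Ep 2 * (D0 uu * D0 uu + D0 ww * D0 ww) * ((yy + uu) * D1 ff + ww * D2 ff + ww * D2 bb) - 2 * Ep 2 * (D1 ff * uu + (D2 bb + D2 ff) * ww) * (D0 uu * D0 uu + D0 ww * D0 ww) - 4 * Ep 2 * RR * (uu * (D0 uu * D0 (D1 uu) + D0 ww * D0 (D1 ww)) + ww * (D0 uu * D0 (D2 uu) + D0 ww * D0 (D2 ww))) + 2 * Ep 2 * (D1 ff * D0 uu + (D2 bb + D2 ff) * D0 ww) * (uu * D0 uu + ww * D0 ww) + 2 * Ep 2 * RR * D0 dv * (uu * D0 uu + ww * D0 ww) + 2 * Ep 2 * RR * (D0 uu * (uu * D0 (D1 uu) + ww * D0 (D1 ww)) + D0 ww * (uu * D0 (D2 uu) + ww * D0 (D2 ww)))) (((((((bh.D0.mul _).mulr _).mulr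 _).sub (((bh.D0.mul _).mulr _).mulr _)).add ((((bu.D0.mulr _).add (bw.D0.mulr _)).mul _).mulr _)).sub ((bw.D0.mul _).mulr _)))
    ((((((((((((((((((((((((((((((bd_E 2).mul (bd_E (-2))).mul ((((b0a.mul b0a).mul b1ft).mul b1ft).mul b0d)).mono).add
    (((((((((bd_n 2).mul (bd_E 2)).mul (bd_E (-2))).mul b0a).mul b0a2).mul b0w).mul b1ft).mul b1ft).mono)).sub
    (((((((((bd_n 2).mul (bd_E 2)).mul (bd_E (-2))).mul b0a).mul b0a).mul b0b2).mul b1ft).mul b1wt).mono)).sub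
    ((((((((bd_n 2).mul (bd_E 2)).mul (bd_E (-2))).mul b0a).mul b0a).mul b1ft).mul (Bd.add (n := -1) (m := 0) (Bd.add (n := -1) (m := 0) (Bd.add (n := -1) (m := 0) (b1ut.mul b0f1).mono (b1wt.mul b0f2).mono).mono (b1ft.mul b0d).mono).mono (b0f.mul b1dt).mono)).mono)).add
    ((((((bd_n 2).mul (bd_E 2)).mul (bd_E (-2))).mul (Bd.add (n := 1) (m := 2) (b1ft.mul b0h).mono (b0f.mul b1ht).mono)).mul b1dt).mono)).sub
    ((((((((((bd_n 2).mul (bd_E 2)).mul (bd_E (-2))).mul (bd_k _)).mul b0a2).mul b0b).mul b0f).mul b1ht).mul b1wt).mono)).sub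
    (((((((((bd_n 2).mul (bd_E 2)).mul (bd_E (-2))).mul b0b).mul b1ht).mul (bd_k _)).mul b1ft).mul (Bd.add (n := 0) (m := 1) (Bd.add (n := 0) (m := 1) ((Bd.add (n := 0) (m := 0) b0y.mono b0u.mono).mul b0h1).mono (b0w.mul b0h2).mono).mono (b0w.mul b0a2).mono)).mono)).sub
    ((((((((bd_n 2).mul (bd_E 2)).mul (bd_E (-2))).mul b0b).mul b1ht).mul b0d).mul (Bd.add (n := 1) (m := 1) (Bd.add (n := 1) (m := 1) (b0a.mul b1ft).mono (b1ft.mul b0h).mono).mono (b0f.mul b1ht).mono)).mono)).sub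
    ((((((((bd_n 2).mul (bd_E 2)).mul (bd_E (-2))).mul b0b).mul b1ht).mul b0pi).mul b1dt).mono)).add
    ((((((((bd_n 2).mul (bd_E 2)).mul (bd_E (-2))).mul b0b).mul b1ht).mul (bd_E 2)).mul b1HTt).mono)).add
    (((((((((bd_E 2).mul (bd_E (-2))).mul (bd_k _)).mul b0b2).mul b0R).mul b0w).mul b1ht).mul b1ht).mono)).sub
    ((((((((bd_n 2).mul (bd_E 2)).mul (bd_E (-2))).mul (bd_k _)).mul b0b2).mul b1ht).mul b1ht2).mono)).add
    (((((((((bd_n 2).mul (bd_E 2)).mul (bd_E (-2))).mul (bd_k _)).mul b0b).mul b1ht).mul b1ht).mul (Bd.add (n := 0) (m := 1) (Bd.add (n := 0) (m := 1) ((Bd.add (n := 0) (m := 0) b0y.mono b0u.mono).mul b0f1).mono (b0w.mul b0f2).mono).mono (b0w.mul b0b2).mono)).mono)).sub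
    (((((((bd_E 2).mul (bd_E (-2))).mul b0u).mul ((((bd_n 2).mul (bd_k _)).mul b0b).mul b0f1)).mul b1ht).mul b1ht).mono)).sub
    (((((((bd_E 2).mul (bd_E (-2))).mul b0w).mul (Bd.sub (n := 0) (m := 1) (((bd_n 2).mul (bd_k _)).mul (Bd.add (n := 0) (m := 1) (b0b2.mul b0R).mono (b0b.mul (Bd.add (n := 0) (m := 1) b0b2.mono b0f2.mono)).mono)).mono (((bd_n 4).mul b0b).mul b0b2).mono)).mul b1ht).mul b1ht).mono)).sub
    ((((((bd_n 2).mul (bd_E 2)).mul (bd_E (-2))).mul (Bd.sub (n := 0) (m := 0) ((((bd_n 2).mul (bd_k _)).mul b0b).mul b0R).mono (((bd_n 2).mul b0b).mul b0b).mono)).mul (Bd.add (n := 0) (m := 1) ((b0u.mul b1ht).mul b1ht1).mono ((b0w.mul b1ht).mul b1ht2).mono)).mono)).add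
    (((((((((bd_n 2).mul (bd_E 2)).mul (bd_E (-2))).mul (bd_k _)).mul b0h).mul b0b).mul b0R).mul (Bd.add (n := -1) (m := -1) (Bd.add (n := -1) (m := -1) (b1ht1.mul b1ut).mono (b1ht2.mul b1wt).mono).mono (b1ht.mul b1dt).mono)).mono)).add
    (((((((bd_n 2).mul (bd_E 2)).mul (bd_E (-2))).mul (bd_k _)).mul b0h).mul (Bd.add (n := -1) (m := 0) (((b0b.mul b0f1).mul b1ht).mul b1ut).mono (((Bd.add (n := 0) (m := 1) (b0b2.mul b0R).mono (b0b.mul (Bd.add (n := 0) (m := 1) b0b2.mono b0f2.mono)).mono).mul b1ht).mul b1wt).mono)).mono)).sub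
    ((((((bd_n 2).mul (bd_E 2)).mul b0f).mul b1wt).mul b1ut).mono)).sub
    ((((((bd_n 2).mul (bd_E 2)).mul b1ft).mul (Bd.add (n := -1) (m := 0) (Bd.add (n := -1) (m := 0) ((Bd.add (n := 0) (m := 0) b0y.mono b0u.mono).mul b0u1).mono (b0w.mul b0u2).mono).mono b0w.mono)).mul b1ut).mono)).sub
    ((((((bd_n 2).mul (bd_E 2)).mul b1ft).mul (Bd.add (n := -1) (m := 0) ((Bd.add (n := 0) (m := 0) b0y.mono b0u.mono).mul b0w1).mono (b0w.mul b0w2).mono)).mul b1wt).mono)).add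
    (((((bd_n 2).mul (bd_E 2)).mul (Bd.add (n := -2) (m := -2) (b1ut.mul b1ut).mono (b1wt.mul b1wt).mono)).mul (Bd.add (n := 0) (m := 1) (Bd.add (n := 0) (m := 1) ((Bd.add (n := 0) (m := 0) b0y.mono b0u.mono).mul b0f1).mono (b0w.mul b0f2).mono).mono (b0w.mul b0b2).mono)).mono)).sub
    (((((bd_n 2).mul (bd_E 2)).mul (Bd.add (n := 0) (m := 2) (b0f1.mul b0u).mono ((Bd.add (n := 0) (m := 1) b0b2.mono b0f2.mono).mul b0w).mono)).mul (Bd.add (n := -2) (m := -2) (b1ut.mul b1ut).mono (b1wt.mul b1wt).mono)).mono)).sub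
    (((((bd_n 4).mul (bd_E 2)).mul b0R).mul (Bd.add (n := -2) (m := -1) (b0u.mul (Bd.add (n := -2) (m := -2) (b1ut.mul b1ut1).mono (b1wt.mul b1wt1).mono)).mono (b0w.mul (Bd.add (n := -2) (m := -2) (b1ut.mul b1ut2).mono (b1wt.mul b1wt2).mono)).mono)).mono)).add
    (((((bd_n 2).mul (bd_E 2)).mul (Bd.add (n := -1) (m := 0) (b0f1.mul b1ut).mono ((Bd.add (n := 0) (m := 1) b0b2.mono b0f2.mono).mul b1wt).mono)).mul (Bd.add (n := -1) (m := 0) (b0u.mul b1ut).mono (b0w.mul b1wt).mono)).mono)).add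
    ((((((bd_n 2).mul (bd_E 2)).mul b0R).mul b1dt).mul (Bd.add (n := -1) (m := 0) (b0u.mul b1ut).mono (b0w.mul b1wt).mono)).mono)).add
    (((((bd_n 2).mul (bd_E 2)).mul b0R).mul (Bd.add (n := -2) (m := -1) (b1ut.mul (Bd.add (n := -1) (m := 0) (b0u.mul b1ut1).mono (b0w.mul b1wt1).mono)).mono (b1wt.mul (Bd.add (n := -1) (m := 0) (b0u.mul b1ut2).mono (b0w.mul b1wt2).mono)).mono)).mono))
    ?_
  exact Zr.of_eq (zM.mul ((-2) * Ep 2 * (D0 uu * D0 uu + D0 ww * D0 ww) - 2 * Ep 2 * Ep (-2) * Cg * bb * D0 hh * D0 hh)) (by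
    simp only [remg, eqM]
    simp only [map_add, map_sub, map_neg, map_zero, Derivation.leibniz, smul_eq_mul, D10, D20, D21, DD_kc, DD_Ep, D0_yy, D1_yy, D2_yy, D0_aa, D1_aa, D0_bb, D1_bb, D02_aa, D12_aa, D02_bb, D12_bb, D022_aa, D122_aa, D022_bb, D122_bb, DD_2, DD_3, DD_4, DD_6, Derivation.map_one_eq_zero, D2_bb, mul_zero, zero_mul, add_zero, zero_add, sub_zero, mul_one, one_mul]
    ring)

lemma enxx : En (q := q) (eng (D1 (D1 ff)) (D1 (D1 uu)) (D1 (D1 ww)) (D1 (D1 hh))) (dsg (D1 (D1 uu)) (D1 (D1 ww)) (D1 (D1 hh)))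
    (0 * ww) := by
  obtain ⟨J1, J2, hJ, hz⟩ := gen_id (q := q) (D1 (D1 ff)) (D1 (D1 uu)) (D1 (D1 ww)) (D1 (D1 hh)) (D1 (D1 ff) * hh + 2 * D1 ff * D1 hh + ff * D1 (D1 hh))
    (2 * D1 uu * D1 (D1 ff) + D1 (D1 uu) * D1 ff + 2 * D1 ww * D1 (D2 ff) + D1 (D1 ww) * D2 ff + D1 (D1 ff) * dv + 2 * D1 ff * D1 dv + ff * D1 (D1 dv))
    (D1 (D1 ff) * B1 + 2 * D1 ff * D1 B1 + RR * (2 * D1 uu * D1 (D1 uu) + D1 (D1 uu) * D1 uu + 2 * D1 ww * D1 (D2 uu) + D1 (D1 ww) * D2 uu))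
    (D1 (D1 ff) * B2 + 2 * D1 ff * D1 B2 + RR * (2 * D1 uu * D1 (D1 ww) + D1 (D1 uu) * D1 ww + 2 * D1 ww * D1 (D2 ww) + D1 (D1 ww) * D2 ww))
    (Cg * (D1 (D1 ff) * B3 + 2 * D1 ff * D1 B3 + RR * (D1 (D1 uu) * D1 hh + 2 * D1 uu * D1 (D1 hh) + D1 (D1 ww) * D2 hh + 2 * D1 ww * D1 (D2 hh))) + D1 (D1 pp) * dv + 2 * D1 pp * D1 dv + pp * D1 (D1 dv) - Ep 2 * D1 (D1 HT))
    (bu.D1.D1) (bw.D1.D1) (bh.D1.D1)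
    (zM.D1.D1.of_eq (by
    simp only [eqM]
    simp only [map_add, map_sub, map_neg, map_zero, Derivation.leibniz, smul_eq_mul, D10, D20, D21, DD_kc, DD_Ep, D0_yy, D1_yy, D2_yy, D0_aa, D1_aa, D0_bb, D1_bb, D02_aa, D12_aa, D02_bb, D12_bb, D022_aa, D122_aa, D022_bb, D122_bb, DD_2, DD_3, DD_4, DD_6, Derivation.map_one_eq_zero, D2_bb, mul_zero, zero_mul, add_zero, zero_add, sub_zero, mul_one, one_mul]
    ring))
    (z1.D1.D1.of_eq (by
    simp only [eq1]
    simp only [map_add, map_sub, map_neg, map_zero, Derivation.leibniz, smul_eq_mul, D10, D20, D21, DD_kc, DD_Ep, D0_yy, D1_yy, D2_yy, D0_aa, D1_aa, D0_bb, D1_bb, D02_aa, D12_aa, D02_bb, D12_bb, D022_aa, D122_aa, D022_bb, D122_bb, DD_2, DD_3, DD_4, DD_6, Derivation.map_one_eq_zero, D2_bb, mul_zero, zero_mul, add_zero, zero_add, sub_zero, mul_one, one_mul]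
    ring))
    (z2.D1.D1.of_eq (by
    simp only [eq2]
    simp only [map_add, map_sub, map_neg, map_zero, Derivation.leibniz, smul_eq_mul, D10, D20, D21, DD_kc, DD_Ep, D0_yy, D1_yy, D2_yy, D0_aa, D1_aa, D0_bb, D1_bb, D02_aa, D12_aa, D02_bb, D12_bb, D022_aa, D122_aa, D022_bb, D122_bb, DD_2, DD_3, DD_4, DD_6, Derivation.map_one_eq_zero, D2_bb, mul_zero, zero_mul, add_zero, zero_add, sub_zero, mul_one, one_mul]
    ring))
    (zE.D1.D1.of_eq (by
    simp only [eqE]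
    simp only [map_add, map_sub, map_neg, map_zero, Derivation.leibniz, smul_eq_mul, D10, D20, D21, DD_kc, DD_Ep, D0_yy, D1_yy, D2_yy, D0_aa, D1_aa, D0_bb, D1_bb, D02_aa, D12_aa, D02_bb, D12_bb, D022_aa, D122_aa, D022_bb, D122_bb, DD_2, DD_3, DD_4, DD_6, Derivation.map_one_eq_zero, D2_bb, mul_zero, zero_mul, add_zero, zero_add, sub_zero, mul_one, one_mul]
    ring))
  refine En.of_gen hJ hz (K1 := 0 * uu - 2 * Ep 2 * Ep (-2) * Cg * bb * D1 ff * B3 * D1 (D1 hh) + 2 * Ep 2 * Ep (-2) * bb * Ep 2 * D1 HT * D1 (D1 hh) - 2 * Ep 2 * D1 ff * (B1 * D1 (D1 uu) + B2 * D1 (D1 ww)))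
    (K2 := 0 * ww)
    (S := Ep 2 * Ep (-2) * (aa * aa * D1 (D1 ff) * D1 (D1 ff) * dv) + 2 * Ep 2 * Ep (-2) * aa * D2 aa * ww * D1 (D1 ff) * D1 (D1 ff) - 2 * Ep 2 * Ep (-2) * aa * aa * D2 bb * D1 (D1 ff) * D1 (D1 ww) - 2 * Ep 2 * Ep (-2) * aa * aa * D1 (D1 ff) * (2 * D1 uu * D1 (D1 ff) + D1 (D1 uu) * D1 ff + 2 * D1 ww * D1 (D2 ff) + D1 (D1 ww) * D2 ff + D1 (D1 ff) * dv + 2 * D1 ff * D1 dv + ff * D1 (D1 dv)) + 2 * Ep 2 * Ep (-2) * (D1 (D1 ff) * hh + 2 * D1 ff * D1 hh + ff * D1 (D1 hh)) * D1 (D1 dv) - 2 * Ep 2 * Ep (-2) * Cg * D2 aa * bb * RR * D1 (D1 hh) * D1 (D1 ww) + 2 * Ep 2 * Ep (-2) * Cg * bb * D1 ff * (D1 B3 * D1 (D1 hh) + B3 * D1 (D1 (D1 hh))) - 2 * Ep 2 * Ep (-2) * bb * D1 (D1 hh) * Cg * (2 * D1 ff * D1 B3 + RR * (D1 (D1 uu)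 * D1 hh + 2 * D1 uu * D1 (D1 hh) + D1 (D1 ww) * D2 hh + 2 * D1 ww * D1 (D2 hh))) - 2 * Ep 2 * Ep (-2) * bb * D1 (D1 hh) * (D1 (D1 pp) * dv + 2 * D1 pp * D1 dv + pp * D1 (D1 dv)) - 2 * Ep 2 * Ep (-2) * bb * D1 (D1 (D1 hh)) * Ep 2 * D1 HT + Ep 2 * Ep (-2) * Cg * D2 bb * RR * ww * D1 (D1 hh) * D1 (D1 hh) - 2 * Ep 2 * Ep (-2) * Ka * D2 bb * D1 (D1 hh) * D1 (D1 (D2 hh)) - 2 * Ep 2 * RR * D1 (D1 ww) * D1 (D1 uu) + 2 * Ep 2 * D1 ff * (D1 B1 * D1 (D1 uu) + B1 * D1 (D1 (D1 uu))) + 2 * Ep 2 * D1 ff * (D1 B2 * D1 (D1 ww) + B2 * D1 (D1 (D1 ww))) - 2 * Ep 2 * D1 (D1 uu) * (2 * D1 ff * D1 B1 + RR * (2 * D1 uu * D1 (D1 uu) + D1 (D1 uu) * D1 uu + 2 * D1 ww * D1 (D2 uu) + D1 (D1 ww) * D2 uu)) - 2 * Ep 2 * D1 (D1 ww) * (2 *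 D1 ff * D1 B2 + RR * (2 * D1 uu * D1 (D1 ww) + D1 (D1 uu) * D1 ww + 2 * D1 ww * D1 (D2 ww) + D1 (D1 ww) * D2 ww))) ((bw.mul _))
    ((((((((((((((((((((bd_E 2).mul (bd_E (-2))).mul ((((b0a.mul b0a).mul b1f11).mul b1f11).mul b0d)).mono).add
    (((((((((bd_n 2).mul (bd_E 2)).mul (bd_E (-2))).mul b0a).mul b0a2).mul b0w).mul b1f11).mul b1f11).mono)).sub
    (((((((((bd_n 2).mul (bd_E 2)).mul (bd_E (-2))).mul b0a).mul b0a).mul b0b2).mul b1f11).mul b1w11).mono)).sub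
    ((((((((bd_n 2).mul (bd_E 2)).mul (bd_E (-2))).mul b0a).mul b0a).mul b1f11).mul (Bd.add (n := 0) (m := 1) (Bd.add (n := 0) (m := 1) (Bd.add (n := 0) (m := 1) (Bd.add (n := 0) (m := 1) (Bd.add (n := 0) (m := 1) (Bd.add (n := 0) (m := 1) (((bd_n 2).mul b0u1).mul b1f11).mono (b1u11.mul b0f1).mono).mono (((bd_n 2).mul b0w1).mul b1f12).mono).mono (b1w11.mul b0f2).mono).mono (b1f11.mul b0d).mono).mono (((bd_n 2).mul b0f1).mul b1d1).mono).mono (b0f.mul b1d11).mono)).mono)).add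
    ((((((bd_n 2).mul (bd_E 2)).mul (bd_E (-2))).mul (Bd.add (n := 2) (m := 3) (Bd.add (n := 2) (m := 3) (b1f11.mul b0h).mono (((bd_n 2).mul b0f1).mul b1h1).mono).mono (b0f.mul b1h11).mono)).mul b1d11).mono)).sub
    ((((((((((bd_n 2).mul (bd_E 2)).mul (bd_E (-2))).mul (bd_k _)).mul b0a2).mul b0b).mul b0R).mul b1h11).mul b1w11).mono)).add
    ((((((((bd_n 2).mul (bd_E 2)).mul (bd_E (-2))).mul (bd_k _)).mul b0b).mul b0f1).mul (Bd.add (n := 0) (m := 0) (b1B31.mul b1h11).mono (b1B3.mul b1h111).mono)).mono)).sub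
    ((((((((bd_n 2).mul (bd_E 2)).mul (bd_E (-2))).mul b0b).mul b1h11).mul (bd_k _)).mul (Bd.add (n := 0) (m := 1) (((bd_n 2).mul b0f1).mul b1B31).mono (b0R.mul (Bd.add (n := 0) (m := 1) (Bd.add (n := 0) (m := 1) (Bd.add (n := 0) (m := 1) (b1u11.mul b0h1).mono (((bd_n 2).mul b0u1).mul b1h11).mono).mono (b1w11.mul b0h2).mono).mono (((bd_n 2).mul b0w1).mul b1h12).mono)).mono)).mono)).sub
    (((((((bd_n 2).mul (bd_E 2)).mul (bd_E (-2))).mul b0b).mul b1h11).mul (Bd.add (n := 0) (m := 1) (Bd.add (n := 0) (m := 1) (b1pi11.mul b0d).mono (((bd_n 2).mul b0pi1).mul b1d1).mono).mono (b0pi.mul b1d11).mono)).mono)).sub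
    ((((((((bd_n 2).mul (bd_E 2)).mul (bd_E (-2))).mul b0b).mul b1h111).mul (bd_E 2)).mul b1HT1).mono)).add
    (((((((((bd_E 2).mul (bd_E (-2))).mul (bd_k _)).mul b0b2).mul b0R).mul b0w).mul b1h11).mul b1h11).mono)).sub
    ((((((((bd_n 2).mul (bd_E 2)).mul (bd_E (-2))).mul (bd_k _)).mul b0b2).mul b1h11).mul b1h112).mono)).sub
    ((((((bd_n 2).mul (bd_E 2)).mul b0R).mul b1w11).mul b1u11).mono)).add
    (((((bd_n 2).mul (bd_E 2)).mul b0f1).mul (Bd.add (n := -2) (m := -2) (b1B11.mul b1u11).mono (b1B1.mul b1u111).mono)).mono)).add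
    (((((bd_n 2).mul (bd_E 2)).mul b0f1).mul (Bd.add (n := -2) (m := -2) (b1B21.mul b1w11).mono (b1B2.mul b1w111).mono)).mono)).sub
    (((((bd_n 2).mul (bd_E 2)).mul b1u11).mul (Bd.add (n := -1) (m := 0) (((bd_n 2).mul b0f1).mul b1B11).mono (b0R.mul (Bd.add (n := -1) (m := 0) (Bd.add (n := -1) (m := 0) (Bd.add (n := -1) (m := 0) (((bd_n 2).mul b0u1).mul b1u11).mono (b1u11.mul b0u1).mono).mono (((bd_n 2).mul b0w1).mul b1u12).mono).mono (b1w11.mul b0u2).mono)).mono)).mono)).sub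
    (((((bd_n 2).mul (bd_E 2)).mul b1w11).mul (Bd.add (n := -1) (m := 0) (((bd_n 2).mul b0f1).mul b1B21).mono (b0R.mul (Bd.add (n := -1) (m := 0) (Bd.add (n := -1) (m := 0) (Bd.add (n := -1) (m := 0) (((bd_n 2).mul b0u1).mul b1w11).mono (b1u11.mul b0w1).mono).mono (((bd_n 2).mul b0w1).mul b1w12).mono).mono (b1w11.mul b0w2).mono)).mono)).mono))
    ?_
  exact (zM.mul 0).of_eq (by
    simp only [remg]
    simp only [map_add, map_sub, map_neg, map_zero, Derivation.leibniz, smul_eq_mul, D10, D20, D21, DD_kc, DD_Ep, D0_yy, D1_yy, D2_yy, D0_aa, D1_aa, D0_bb, D1_bb, D02_aa, D12_aa, D02_bb, D12_bb, D022_aa, D122_aa, D022_bb, D122_bb, DD_2, DD_3, DD_4, DD_6, Derivation.map_one_eq_zero, D2_bb, mul_zero, zero_mul, add_zero, zero_add, sub_zero, mul_one, one_mul]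
    linear_combination (0) * (ab1 : (aa * bb : Sm (Cfg q)) = 1))

lemma enn0 : En (q := q) ((Mu + La) * D2 ff * D2 ff) (2 * Ep (-2) * D2 ff * D2 ff)
    (0 * ww - 2 * bb * bb * D0 ww * D2 ff) :=
  ⟨(yy + uu) * ((Mu + La) * D2 ff * D2 ff),
    ww * ((Mu + La) * D2 ff * D2 ff),
    (Mu + La) * dv * D2 ff * D2 ff - 2 * Ep (-2) * D2 ff * (aa * ff * D2 ff + RR * (bb * D2 hh + D2 ff * hh + ff * D2 hh + D2 aa * ff + D2 bb * hh)) - 2 * D2 ff * ((2 * bb * ff + ff * ff) * D0 ww) - 2 * D2 ff * (RR * RR * ((yy + uu) * D1 ww + ww * D2 ww)) - 2 * Mu * RR * (D1 (D2 uu) - D1 (D1 ww)) * D2 ff - 2 * (Mu + La) * ((1 + D2 uu) * D1 ff + D2 ww * D2 ff + (D2 bb + D2 ff) * dv + D2 ww * D2 bb + ww * D2 (D2 bb)) * D2 ff,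
    (bw.mulr _),
    (((((((((Bd.add (n := 0) (m := 0) (bd_k _).mono (bd_k _).mono).mul b1d).mul b0f2).mul b1f2).mono).sub
    (((((bd_n 2).mul (bd_E (-2))).mul b1f2).mul (Bd.add (n := 2) (m := 2) ((b0a.mul b0f).mul b1f2).mono (b0R.mul (Bd.add (n := 2) (m := 2) (Bd.add (n := 2) (m := 2) (Bd.add (n := 2) (m := 2) (Bd.add (n := 2) (m := 2) (b0b.mul b1h2).mono (b0f2.mul b1h).mono).mono (b0f.mul b1h2).mono).mono (b0a2.mul b1f).mono).mono (b0b2.mul b1h).mono)).mono)).mono)).sub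
    ((((bd_n 2).mul b1f2).mul ((Bd.add (n := 1) (m := 2) (((bd_n 2).mul b0b).mul b0f).mono (b0f.mul b0f).mono).mul b1wt)).mono)).sub
    ((((bd_n 2).mul b1f2).mul ((b0R.mul b0R).mul (Bd.add (n := 1) (m := 1) ((Bd.add (n := 0) (m := 0) b0y.mono b0u.mono).mul b1w1).mono (b0w.mul b1w2).mono))).mono)).sub
    ((((((bd_n 2).mul (bd_k _)).mul b0R).mul (Bd.sub (n := 0) (m := 0) b1u12.mono b1w11.mono)).mul b1f2).mono)).sub
    (((((bd_n 2).mul (Bd.add (n := 0) (m := 0) (bd_k _).mono (bd_k _).mono)).mul (Bd.add (n := 0) (m := 1) (Bd.add (n := 0) (m := 1) (Bd.add (n := 0) (m := 1) (Bd.add (n := 0) (m := 1) ((Bd.add (n := -1) (m := 0) bd_1.mono b0u2.mono).mul b1f1).mono (b1w2.mul b0f2).mono).mono ((Bd.add (n := 0) (m := 1) b0b2.mono b0f2.mono).mul b1d).mono).mono (b1w2.mul b0b2).mono).mono (b1w.mul b0b22).mono)).mul b1f2).mono),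
    Zr.of_eq ((zM.D2.mul (2 * D2 ff * (Mu + La))).add
    (z2.mul (2 * D2 ff * RR))) (by
    simp only [eqM, eq2]
    simp only [map_add, map_sub, map_neg, map_zero, Derivation.leibniz, smul_eq_mul, D10, D20, D21, DD_kc, DD_Ep, D0_yy, D1_yy, D2_yy, D0_aa, D1_aa, D0_bb, D1_bb, D02_aa, D12_aa, D02_bb, D12_bb, D022_aa, D122_aa, D022_bb, D122_bb, DD_2, DD_3, DD_4, DD_6, Derivation.map_one_eq_zero, D2_bb, mul_zero, zero_mul, add_zero, zero_add, sub_zero, mul_one, one_mul]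
    linear_combination (- 2 * Ep (-2) * D2 ff * D2 ff) * (ab1 : (aa * bb : Sm (Cfg q)) = 1))⟩

lemma enn1 : En (q := q) ((Mu + La) * D1 (D2 ff) * D1 (D2 ff)) (2 * Ep (-2) * D1 (D2 ff) * D1 (D2 ff))
    (0 * ww - 2 * D1 (D2 ff) * (bb * bb * D0 (D1 ww) + Mu * bb * (D1 (D1 (D2 uu)) - D1 (D1 (D1 ww))) + Ep (-2) * bb * bb * D1 (D2 hh))) :=
  ⟨(yy + uu) * ((Mu + La) * D1 (D2 ff) * D1 (D2 ff)),
    ww * ((Mu + La) * D1 (D2 ff) * D1 (D2 ff)),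
    (Mu + La) * dv * D1 (D2 ff) * D1 (D2 ff) - 2 * (Mu + La) * D1 (D2 ff) * (D1 uu * D1 (D2 ff) + D1 ww * D2 (D2 ff)) - 2 * Ep (-2) * D1 (D2 ff) * (D1 ff * D2 pp + aa * ff * D1 (D2 ff) + RR * (D2 bb * D1 hh + D2 aa * D1 ff + D1 (D2 ff) * hh + D1 ff * D2 hh + D2 ff * D1 hh + ff * D1 (D2 hh)) + ff * bb * D1 (D2 hh)) - 4 * D1 (D2 ff) * (RR * D1 ff * B2) - 2 * D1 (D2 ff) * ((2 * bb * ff + ff * ff) * D0 (D1 ww)) - 2 * D1 (D2 ff) * (RR * RR * ((yy + uu) * D1 (D1 ww) + D1 uu * D1 ww + ww * D1 (D2 ww) + D1 ww * D2 ww)) - 2 * Mu * D1 (D2 ff) * (D1 ff * (D1 (D2 uu) - D1 (D1 ww)) + ff * (D1 (D1 (D2 uu)) - D1 (D1 (D1 ww)))) - 2 * (Mu + La) * D1 (D2 ff) * ((1 + D2 uu) * D1 (D1 ff) + D1 (D2 uu) * D1 ff + D1 (D2 ww) * D2 ff + D2 ww * D1 (D2 ff) + D1 (D2 ff) * dv +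 (D2 bb + D2 ff) * D1 dv + D1 (D2 ww) * D2 bb + D1 ww * D2 (D2 bb)),
    (bw.mulr _),
    (((((((((((Bd.add (n := 0) (m := 0) (bd_k _).mono (bd_k _).mono).mul b0d).mul b1f12).mul b1f12).mono).sub
    (((((bd_n 2).mul (Bd.add (n := 0) (m := 0) (bd_k _).mono (bd_k _).mono)).mul b1f12).mul (Bd.add (n := 0) (m := 1) (b0u1.mul b1f12).mono (b0w1.mul b1f22).mono)).mono)).sub
    (((((bd_n 2).mul (bd_E (-2))).mul b1f12).mul (Bd.add (n := 1) (m := 2) (Bd.add (n := 1) (m := 2) (Bd.add (n := 1) (m := 2) (b0f1.mul b1pi2).mono ((b0a.mul b0f).mul b1f12).mono).mono (b0R.mul (Bd.add (n := 2) (m := 2) (Bd.add (n := 2) (m := 2) (Bd.add (n := 2) (m := 2) (Bd.add (n := 2) (m := 2) (Bd.add (n := 2) (m := 2) (b0b2.mul b1h1).mono (b0a2.mul b1f1).mono).mono (b1f12.mul b0h).mono).mono (b0f1.mul b1h2).mono).mono (b0f2.mul b1h1).mono).mono (b0f.mul b1h12).mono)).mono).mono ((b0f.mul b0b).mul b1h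12).mono)).mono)).sub
    ((((bd_n 4).mul b1f12).mul ((b0R.mul b0f1).mul b1B2)).mono)).sub
    ((((bd_n 2).mul b1f12).mul ((Bd.add (n := 1) (m := 2) (((bd_n 2).mul b0b).mul b0f).mono (b0f.mul b0f).mono).mul b1wt1)).mono)).sub
    ((((bd_n 2).mul b1f12).mul ((b0R.mul b0R).mul (Bd.add (n := 0) (m := 0) (Bd.add (n := 0) (m := 0) (Bd.add (n := 0) (m := 0) ((Bd.add (n := 0) (m := 0) b0y.mono b0u.mono).mul b1w11).mono (b0u1.mul b1w1).mono).mono (b0w.mul b1w12).mono).mono (b0w1.mul b1w2).mono))).mono)).sub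
    (((((bd_n 2).mul (bd_k _)).mul b1f12).mul (Bd.add (n := 0) (m := 1) (b0f1.mul (Bd.sub (n := 0) (m := 0) b1u12.mono b1w11.mono)).mono (b0f.mul (Bd.sub (n := -1) (m := -1) b1u112.mono b1w111.mono)).mono)).mono)).sub
    (((((bd_n 2).mul (Bd.add (n := 0) (m := 0) (bd_k _).mono (bd_k _).mono)).mul b1f12).mul (Bd.add (n := 0) (m := 1) (Bd.add (n := 0) (m := 1) (Bd.add (n := 0) (m := 1) (Bd.add (n := 0) (m := 1) (Bd.add (n := 0) (m := 1) (Bd.add (n := 0) (m := 1) (Bd.add (n := 0) (m := 1) ((Bd.add (n := -1) (m := 0) bd_1.mono b0u2.mono).mul b1f11).mono (b1u12.mul b0f1).mono).mono (b1w12.mul b0f2).mono).mono (b0w2.mul b1f12).mono).mono (b1f12.mul b0d).mono).mono ((Bd.add (n := 0) (m := 1) b0b2.mono b0f2.mono).mul b1d1).mono).mono (b1w12.mul b0b2).mono).mono (b1w1.mul b0b22).mono)).mono),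
    Zr.of_eq (((zM.D2.D1.mul (2 * D1 (D2 ff) * (Mu + La))).add
    (z2.D1.mul (2 * D1 (D2 ff) * RR))).add
    (z2.mul (2 * D1 (D2 ff) * D1 ff))) (by
    simp only [eqM, eq2]
    simp only [map_add, map_sub, map_neg, map_zero, Derivation.leibniz, smul_eq_mul, D10, D20, D21, DD_kc, DD_Ep, D0_yy, D1_yy, D2_yy, D0_aa, D1_aa, D0_bb, D1_bb, D02_aa, D12_aa, D02_bb, D12_bb, D022_aa, D122_aa, D022_bb, D122_bb, DD_2, DD_3, DD_4, DD_6, Derivation.map_one_eq_zero, D2_bb, mul_zero, zero_mul, add_zero, zero_add, sub_zero, mul_one, one_mul]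
    linear_combination (- 2 * Ep (-2) * D1 (D2 ff) * D1 (D2 ff)) * (ab1 : (aa * bb : Sm (Cfg q)) = 1))⟩

lemma enn2 : En (q := q) ((Mu + La) * D2 (D2 ff) * D2 (D2 ff)) (2 * Ep (-2) * D2 (D2 ff) * D2 (D2 ff))
    (0 * ww - 2 * D2 (D2 ff) * (bb * bb * D0 (D2 ww) + Mu * bb * (D1 (D2 (D2 uu)) - D1 (D1 (D2 ww))) + Ep (-2) * bb * bb * D2 (D2 hh))) :=
  ⟨(yy + uu) * ((Mu + La) * D2 (D2 ff) * D2 (D2 ff)),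
    ww * ((Mu + La) * D2 (D2 ff) * D2 (D2 ff)),
    (Mu + La) * dv * D2 (D2 ff) * D2 (D2 ff) - 2 * (Mu + La) * D2 (D2 ff) * ((1 + D2 uu) * D1 (D2 ff) + D2 ww * D2 (D2 ff)) - 2 * Ep (-2) * D2 (D2 ff) * ((D2 bb + D2 ff) * D2 pp + aa * ff * D2 (D2 ff) + RR * (2 * D2 bb * D2 hh + D2 (D2 bb) * hh + 2 * D2 aa * D2 ff + D2 (D2 aa) * ff + D2 (D2 ff) * hh + 2 * D2 ff * D2 hh + ff * D2 (D2 hh)) + ff * bb * D2 (D2 hh)) - 4 * D2 (D2 ff) * (RR * (D2 bb + D2 ff) * B2) - 2 * D2 (D2 ff) * ((2 * bb * ff + ff * ff) * D0 (D2 ww)) - 2 * D2 (D2 ff) * (RR * RR * ((yy + uu) * D1 (D2 ww) + (1 + D2 uu) * D1 ww + ww * D2 (D2 ww) + D2 ww * D2 ww)) - 2 * Mu * D2 (D2 ff) * ((D2 bb + D2 ff) * (D1 (D2 uu) - D1 (D1 ww)) + ff * (D1 (D2 (D2 uu)) - D1 (D1 (D2 ww)))) - 2 * (Mu + La) * D2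 (D2 ff) * ((1 + D2 uu) * D1 (D2 ff) + D2 (D2 uu) * D1 ff + D2 (D2 ww) * D2 ff + D2 ww * D2 (D2 ff) + D2 (D2 bb) * dv + D2 (D2 ff) * dv + (D2 bb + D2 ff) * D2 dv + D2 (D2 ww) * D2 bb + 2 * D2 ww * D2 (D2 bb) + ww * D2 (D2 (D2 bb))),
    (bw.mulr _),
    (((((((((((Bd.add (n := 0) (m := 0) (bd_k _).mono (bd_k _).mono).mul b0d).mul b1f22).mul b1f22).mono).sub
    (((((bd_n 2).mul (Bd.add (n := 0) (m := 0) (bd_k _).mono (bd_k _).mono)).mul b1f22).mul (Bd.add (n := 0) (m := 1) ((Bd.add (n := -1) (m := 0) bd_1.mono b0u2.mono).mul b1f12).mono (b0w2.mul b1f22).mono)).mono)).sub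
    (((((bd_n 2).mul (bd_E (-2))).mul b1f22).mul (Bd.add (n := 1) (m := 2) (Bd.add (n := 1) (m := 2) (Bd.add (n := 1) (m := 2) ((Bd.add (n := 0) (m := 1) b0b2.mono b0f2.mono).mul b1pi2).mono ((b0a.mul b0f).mul b1f22).mono).mono (b0R.mul (Bd.add (n := 2) (m := 2) (Bd.add (n := 2) (m := 2) (Bd.add (n := 2) (m := 2) (Bd.add (n := 2) (m := 2) (Bd.add (n := 2) (m := 2) (Bd.add (n := 3) (m := 3) (((bd_n 2).mul b0b2).mul b1h2).mono (b0b22.mul b1h).mono).mono (((bd_n 2).mul b0a2).mul b1f2).mono).mono (b0a22.mul b1f).mono).mono (b1f22.mul b0h).mono).mono (((bd_n 2).mul b0f2).mul b1h2).mono).mono (b0f.mul b1h22).mono)).mono).mono ((b0f.mul b0b).mul b1h22).mono)).mono)).sub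
    ((((bd_n 4).mul b1f22).mul ((b0R.mul (Bd.add (n := 0) (m := 1) b0b2.mono b0f2.mono)).mul b1B2)).mono)).sub
    ((((bd_n 2).mul b1f22).mul ((Bd.add (n := 1) (m := 2) (((bd_n 2).mul b0b).mul b0f).mono (b0f.mul b0f).mono).mul b1wt2)).mono)).sub
    ((((bd_n 2).mul b1f22).mul ((b0R.mul b0R).mul (Bd.add (n := 0) (m := 0) (Bd.add (n := 0) (m := 0) (Bd.add (n := 0) (m := 0) ((Bd.add (n := 0) (m := 0) b0y.mono b0u.mono).mul b1w12).mono ((Bd.add (n := -1) (m := 0) bd_1.mono b0u2.mono).mul b1w1).mono).mono (b0w.mul b1w22).mono).mono (b0w2.mul b1w2).mono))).mono)).sub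
    (((((bd_n 2).mul (bd_k _)).mul b1f22).mul (Bd.add (n := 0) (m := 1) ((Bd.add (n := 0) (m := 1) b0b2.mono b0f2.mono).mul (Bd.sub (n := 0) (m := 0) b1u12.mono b1w11.mono)).mono (b0f.mul (Bd.sub (n := -1) (m := -1) b1u122.mono b1w112.mono)).mono)).mono)).sub
    (((((bd_n 2).mul (Bd.add (n := 0) (m := 0) (bd_k _).mono (bd_k _).mono)).mul b1f22).mul (Bd.add (n := 0) (m := 1) (Bd.add (n := 0) (m := 1) (Bd.add (n := 0) (m := 1) (Bd.add (n := 0) (m := 1) (Bd.add (n := 0) (m := 1) (Bd.add (n := 0) (m := 1) (Bd.add (n := 0) (m := 1) (Bd.add (n := 0) (m := 1) (Bd.add (n := 0) (m := 1) ((Bd.add (n := -1) (m := 0) bd_1.mono b0u2.mono).mul b1f12).mono (b1u22.mul b0f1).mono).mono (b1w22.mul b0f2).mono).mono (b0w2.mul b1f22).mono).mono (b0b22.mul b1d).mono).mono (b1f22.mul b0d).mono).mono ((Bd.add (n := 0) (m := 1) b0b2.mono b0f2.mono).mul b1d2).mono).mono (b1w22.mul b0b2).mono).mono (((bd_n 2).mul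 b1w2).mul b0b22).mono).mono (b1w.mul b0b222).mono)).mono),
    Zr.of_eq (((zM.D2.D2.mul (2 * D2 (D2 ff) * (Mu + La))).add
    (z2.D2.mul (2 * D2 (D2 ff) * RR))).add
    (z2.mul (2 * D2 (D2 ff) * (D2 bb + D2 ff)))) (by
    simp only [eqM, eq2]
    simp only [map_add, map_sub, map_neg, map_zero, Derivation.leibniz, smul_eq_mul, D10, D20, D21, DD_kc, DD_Ep, D0_yy, D1_yy, D2_yy, D0_aa, D1_aa, D0_bb, D1_bb, D02_aa, D12_aa, D02_bb, D12_bb, D022_aa, D122_aa, D022_bb, D122_bb, DD_2, DD_3, DD_4, DD_6, Derivation.map_one_eq_zero, D2_bb, mul_zero, zero_mul, add_zero, zero_add, sub_zero, mul_one, one_mul]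
    linear_combination (- 2 * Ep (-2) * D2 (D2 ff) * D2 (D2 ff)) * (ab1 : (aa * bb : Sm (Cfg q)) = 1))⟩

end

section
set_option linter.all false
variable {q : Par}

/-! ### Recovering the full dissipation from the primary one -/

def P0 : Sm (Cfg q) := Ep (-2) * (D1 uu * D1 uu + D2 uu * D2 uu + D1 ww * D1 ww + D2 ww * D2 ww)
  + Ep (-2) * Ep (-2) * (D1 hh * D1 hh + D2 hh * D2 hh)
def Pg (Ug Wg Hg : Sm (Cfg q)) : Sm (Cfg q) :=
  Ep 2 * (D1 Ug * D1 Ug + D2 Ug * D2 Ug + D1 Wg * D1 Wg + D2 Wg * D2 Wg) + (D1 Hg * D1 Hg + D2 Hg * D2 Hg)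

/-- Tangential dissipation. -/
def Zd (c : Cfg q) (t : ℝ) : ℝ := I c t P0 + I c t (Pg (D0 uu) (D0 ww) (D0 hh))
  + I c t (Pg (D1 (D1 uu)) (D1 (D1 ww)) (D1 (D1 hh)))
/-- Primary dissipations up to level `k`. -/
def Yl (k : ℕ) (c : Cfg q) (t : ℝ) : ℝ := Zd c t
  + (if 1 ≤ k then I c t (Ep (-2) * (D2 ff * D2 ff)) + I c t (Ep (-2) * (D1 (D2 ff) * D1 (D2 ff))) else 0)
  + (if 2 ≤ k then I c t (Ep (-2) * (D2 (D2 ff) * D2 (D2 ff))) else 0)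

lemma I_Ep (c : Cfg q) (t : ℝ) (n : ℤ) (G : Sm (Cfg q)) : I c t (Ep n * G) = c.ε ^ n * I c t G := by
  unfold Ep; exact I_cst_mul c t (fun c => c.ε ^ n) G
lemma Ep_pos (c : Cfg q) (n : ℤ) : 0 < c.ε ^ n := zpow_pos c.hε n
lemma I_Ep_sq (c : Cfg q) (t : ℝ) (n : ℤ) (G : Sm (Cfg q)) : I c t (Ep n * G * (Ep n * G)) = c.ε ^ (2 * n) * I c t (G * G) := by
  rw [show Ep n * G * (Ep n * G) = Ep (2 * n) * (G * G) by rw [two_mul, ← Ep_mul]; ring, I_Ep]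
lemma I_Epn (c : Cfg q) (t : ℝ) (n : ℤ) (G : Sm (Cfg q)) : 0 ≤ I c t (Ep n * (G * G)) := by
  rw [I_Ep]; exact mul_nonneg (Ep_pos c n).le (I_sq_nonneg _ _ _)

lemma Yl_mono (c : Cfg q) (t : ℝ) {k l : ℕ} (h : k ≤ l) : Yl k c t ≤ Yl l c t := by
  have h1 := I_Epn c t (-2) (D2 ff)
  have h2 := I_Epn c t (-2) (D1 (D2 ff))
  have h3 := I_Epn c t (-2) (D2 (D2 ff))
  unfold Yl
  split_ifs <;> first | linarith | omega

/-- `X` is negligible or controlled by the level-`k` dissipation. -/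
def Nf (k : ℕ) (X : Cfg q → ℝ → ℝ) : Prop := ∀ η : ℝ, 0 < η → ∃ C : ℝ, 0 ≤ C ∧ ∀ c : Cfg q, ∀ t ∈ Set.Icc 0 c.T,
  X c t ≤ η * DT c t + C * (Yl k c t + dl c * DT c t)
def Ng (k : ℕ) (G : Sm (Cfg q)) : Prop := Nf k fun c t => I c t (G * G)

lemma P0_nonneg (c : Cfg q) (t : ℝ) : 0 ≤ I c t P0 := by
  unfold P0
  rw [mul_assoc]
  simp only [map_add, I_Ep, mul_add]
  have := Ep_pos c (-2)
  have h := I_sq_nonneg c t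
  have h1 := h (D1 uu); have h2 := h (D2 uu); have h3 := h (D1 ww); have h4 := h (D2 ww)
  have h5 := h (D1 hh); have h6 := h (D2 hh)
  positivity
lemma Pg_nonneg (c : Cfg q) (t : ℝ) (Ug Wg Hg : Sm (Cfg q)) : 0 ≤ I c t (Pg Ug Wg Hg) := by
  unfold Pg
  simp only [map_add, I_Ep, mul_add]
  have := Ep_pos c 2
  have h := I_sq_nonneg c t
  have h1 := h (D1 Ug); have h2 := h (D2 Ug); have h3 := h (D1 Wg); have h4 := h (D2 Wg)
  have h5 := h (D1 Hg); have h6 := h (D2 Hg)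
  positivity
lemma Zd_nonneg (c : Cfg q) (t : ℝ) : 0 ≤ Zd c t := by
  unfold Zd
  have h1 := P0_nonneg c t
  have h2 := Pg_nonneg c t (D0 uu) (D0 ww) (D0 hh)
  have h3 := Pg_nonneg c t (D1 (D1 uu)) (D1 (D1 ww)) (D1 (D1 hh))
  linarith
lemma Yl_zero (c : Cfg q) (t : ℝ) : Yl 0 c t = Zd c t := by simp [Yl]
lemma Yl_nonneg (c : Cfg q) (t : ℝ) (k : ℕ) : 0 ≤ Yl k c t := by
  have := Yl_mono c t (Nat.zero_le k)
  rw [Yl_zero] at this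
  exact (Zd_nonneg c t).trans this
lemma ldD_nonneg (c : Cfg q) (t : ℝ) : 0 ≤ dl c * DT c t := mul_nonneg (dl_pos c).le (DT_nonneg c t)

section
variable {k : ℕ} {X X' : Cfg q → ℝ → ℝ} {G H : Sm (Cfg q)}

lemma Nf.up (h : Nf k X) {l : ℕ} (hkl : k ≤ l := by decide) : Nf l X := fun η hη => by
  obtain ⟨C, hC, h⟩ := h η hη
  refine ⟨C, hC, fun c t ht => (h c t ht).trans ?_⟩
  have := Yl_mono c t hkl
  gcongr
lemma Ng.up (h : Ng k G) {l : ℕ} (hkl : k ≤ l := by decide) : Ng l G := Nf.up h hkl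
lemma Nf.le (h : Nf k X) (C : ℝ) (hC : 0 < C) (hl : ∀ c : Cfg q, ∀ t ∈ Set.Icc 0 c.T, X' c t ≤ C * X c t) : Nf k X' := fun η hη => by
  obtain ⟨C', hC', h⟩ := h (η / C) (by positivity)
  refine ⟨C * C', by positivity, fun c t ht => (hl c t ht).trans ?_⟩
  have := mul_le_mul_of_nonneg_left (h c t ht) hC.le
  refine this.trans (le_of_eq ?_)
  field_simp
lemma Nf.add (h : Nf k X) (h' : Nf k X') : Nf k fun c t => X c t + X' c t := fun η hη => by
  obtain ⟨C, hC, h⟩ := h (η / 2) (by positivity)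
  obtain ⟨C', hC', h'⟩ := h' (η / 2) (by positivity)
  refine ⟨C + C', by positivity, fun c t ht => ?_⟩
  have := h c t ht
  have := h' c t ht
  linear_combination this + h c t ht
lemma Nf.smul (h : Nf k X) (C : ℝ) (hC : 0 < C) : Nf k fun c t => C * X c t := h.le C hC fun _ _ _ => le_rfl
/-- Limit version. -/
lemma Nf.lim (h : ∀ η : ℝ, 0 < η → ∃ X' : Cfg q → ℝ → ℝ, Nf k X' ∧ ∀ c : Cfg q, ∀ t ∈ Set.Icc 0 c.T, X c t ≤ η * DT c t + X' c t) :
    Nf k X := fun η hη => by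
  obtain ⟨X', h1, h2⟩ := h (η / 2) (by positivity)
  obtain ⟨C, hC, h1⟩ := h1 (η / 2) (by positivity)
  refine ⟨C, hC, fun c t ht => ?_⟩
  linear_combination h2 c t ht + h1 c t ht
lemma Nf.prim (h : ∀ c : Cfg q, ∀ t ∈ Set.Icc 0 c.T, X c t ≤ Yl k c t) : Nf k X := fun η hη =>
  ⟨1, zero_le_one, fun c t ht => by
    have := h c t ht
    have := ldD_nonneg c t
    have := mul_nonneg hη.le (DT_nonneg c t)
    linarith⟩
lemma Ng.add (h : Ng k G) (h' : Ng k H) : Ng k (G + H) :=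
  (Nf.add h h').le 2 two_pos fun c t ht => by
    have := I_sq_nonneg c t (G - H)
    rw [show (G - H) * (G - H) = G * G - 2 * (G * H) + H * H by ring] at this
    rw [show (G + H) * (G + H) = G * G + 2 * (G * H) + H * H by ring]
    simp only [map_add, map_sub] at *
    linarith
lemma Ng.neg (h : Ng k G) : Ng k (-G) := by
  unfold Ng at *; simpa only [neg_mul_neg] using h
lemma Ng.sub (h : Ng k G) (h' : Ng k H) : Ng k (G - H) := by
  rw [sub_eq_add_neg]; exact h.add h'.neg
lemma Ng.zr (h : Ng k G) (hz : Zr (H - G)) : Ng k H := Nf.le h 1 one_pos fun c t ht => by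
  rw [one_mul]
  refine le_of_eq (I_congr fun x hx => ?_)
  have := hz c t ht x hx
  rw [map_sub] at this
  rw [map_mul, map_mul, sub_eq_zero.1 this]
lemma Ng.of_eq (h : Ng k G) (e : H = G) : Ng k H := e ▸ h
lemma Bd.le0 {K : Sm (Cfg q)} (h : Bd 0 0 0 K) : ∃ C : ℝ, 0 < C ∧ ∀ c : Cfg q, ∀ t ∈ Set.Icc 0 c.T, ∀ x ∈ Ω, |ev c (t, x) K| ≤ C := by
  unfold Bd at h
  obtain ⟨C, hC, h⟩ := h
  exact ⟨C + 1, by positivity, fun c t ht x hx => by have := h c t ht x hx; simp at this; linarith⟩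
lemma I_Bd_mul {c : Cfg q} {t C : ℝ} {K G : Sm (Cfg q)} (h : ∀ x ∈ Ω, |ev c (t, x) K| ≤ C) :
    I c t (K * G * (K * G)) ≤ C ^ 2 * I c t (G * G) := by
  have e : C ^ 2 * I c t (G * G) = I c t ((C ^ 2) • (G * G)) := by rw [map_smul]; rfl
  rw [e]
  refine I_mono fun x hx => ?_
  have h2 : ev c (t, x) K ^ 2 ≤ C ^ 2 := sq_le_sq' (abs_le.1 (h x hx)).1 (abs_le.1 (h x hx)).2
  simp only [map_mul, map_smul, smul_eq_mul]
  have := mul_le_mul_of_nonneg_right h2 (mul_self_nonneg (ev c (t, x) G))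
  linarith
lemma Ng.mulB (h : Ng k G) {K : Sm (Cfg q)} (hK : Bd 0 0 0 K) : Ng k (K * G) := by
  obtain ⟨C, hC, hK⟩ := hK.le0
  exact Nf.le h (C ^ 2) (by positivity) fun c t ht => I_Bd_mul (hK c t ht)
lemma Ng.small (h : Bd 0 1 1 G) : Ng k G := fun η hη => by
  obtain ⟨C, hC, h⟩ := h.int1
  refine ⟨2 * C, by positivity, fun c t ht => (h c t ht).trans ?_⟩
  have h1 : C * (c.ε ^ (0 : ℤ) * dl c ^ ((1 : ℤ) - 0)) ^ 2 * DT c t = C * dl c * (dl c * DT c t) := by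
    simp; ring
  rw [h1]
  have h2 := ldD_nonneg c t
  have h3 := mul_nonneg hη.le (DT_nonneg c t)
  have h4 := mul_nonneg (mul_nonneg two_pos.le hC) (Yl_nonneg c t k)
  have h5 : C * dl c * (dl c * DT c t) ≤ C * 2 * (dl c * DT c t) := by
    have := dl_le c
    gcongr
  linarith
/-- Elements of size one are bounded by the total dissipation. -/
lemma Bd.int00 (h : Bd 0 0 1 G) : ∃ C : ℝ, 0 ≤ C ∧ ∀ c : Cfg q, ∀ t ∈ Set.Icc 0 c.T, I c t (G * G) ≤ C * DT c t := by
  obtain ⟨C, hC, h⟩ := h.int1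
  refine ⟨C, hC, fun c t ht => (h c t ht).trans (le_of_eq (by simp))⟩
lemma Ng.div {x : ℝ} (hx : x ≠ 0) (h : Ng k (kc x * G)) : Ng k G :=
  (h.mulB (bd_k x⁻¹)).of_eq (by
    have : (kc x⁻¹ * kc x : Sm (Cfg q)) = 1 := by apply Sm.ext'; intro c v; simp [hx]
    rw [← mul_assoc, this, one_mul])
lemma Ng.poin (hb : Zb G) {n : ℤ} (h : Ng k (Ep n * D2 G)) : Ng k (Ep n * G) := Nf.le h 16 (by norm_num) fun c t ht => by
  rw [I_Ep_sq, I_Ep_sq]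
  have := poincare2 c t G (fun x => hb c t ht x 0 (by simp))
  have := mul_le_mul_of_nonneg_left this (Ep_pos c (2 * n)).le
  linarith
lemma Ng.mean (h0 : ∀ c : Cfg q, ∀ t ∈ Set.Icc 0 c.T, I c t G = 0) {n : ℤ} (h : Ng k (Ep n * D1 G)) (h' : Ng k (Ep n * D2 G)) :
    Ng k (Ep n * G) := (Nf.add h h').le 200 (by norm_num) fun c t ht => by
  simp only [I_Ep_sq]
  have := poincare_mean c t G (h0 c t ht)
  have := mul_le_mul_of_nonneg_left this (Ep_pos c (2 * n)).le
  linarith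
lemma Ng.int1 {n : ℤ} (h : Ng k (Ep (n - 1) * G)) (h' : Ng k (Ep (n + 1) * D1 (D1 G))) : Ng k (Ep n * D1 G) :=
  (Nf.add h h').le 1 (by norm_num) fun c t ht => by
  simp only [I_Ep_sq, one_mul]
  have := interp1 c t (Ep_pos c (-2)) G
  have := mul_le_mul_of_nonneg_left this (Ep_pos c (2 * n)).le
  refine this.trans (le_of_eq ?_)
  have e1 : c.ε ^ (2 * (n - 1)) = c.ε ^ (2 * n) * c.ε ^ (-2 : ℤ) := by rw [← zpow_add₀ c.hε.ne']; congr 1; ring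
  have e2 : c.ε ^ (2 * (n + 1)) = c.ε ^ (2 * n) * (c.ε ^ (-2 : ℤ))⁻¹ := by
    rw [← zpow_neg, ← zpow_add₀ c.hε.ne']; congr 1; ring
  rw [e1, e2]; ring
lemma Ng.int2 {n : ℤ} (h : Ng k (Ep (n - 1) * G)) (h' : Bd 0 0 1 (Ep (n + 1) * D2 (D2 G))) : Ng k (Ep n * D2 G) := by
  obtain ⟨C, hC, h'⟩ := h'.int00
  refine Nf.lim fun η hη => ?_
  set s : ℝ := min 1 (η / (1000 * (C + 1))) with hs
  have hs0 : 0 < s := lt_min one_pos (by positivity)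
  have hs1 : s ≤ 1 := min_le_left _ _
  have hs2 : s * (1000 * (C + 1)) ≤ η := by
    have := min_le_right 1 (η / (1000 * (C + 1)))
    rwa [← hs, le_div_iff₀ (by positivity)] at this
  refine ⟨_, Nf.smul h (1000 * s⁻¹ ^ 2) (by positivity), fun c t ht => ?_⟩
  have h1 := h' c t ht
  rw [I_Ep_sq] at h1
  have hse : s * c.ε ≤ 1 := by have := c.hε1; have := c.hε; nlinarith
  have := interp2 c t (mul_pos hs0 c.hε) hse G
  have := mul_le_mul_of_nonneg_left this (Ep_pos c (2 * n)).le
  simp only [I_Ep_sq]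
  refine this.trans ?_
  have e1 : c.ε ^ (2 * (n - 1)) = c.ε ^ (2 * n) * c.ε⁻¹ ^ 2 := by
    rw [inv_pow, ← zpow_natCast, ← zpow_neg, ← zpow_add₀ c.hε.ne']; congr 1; push_cast; ring
  have e2 : c.ε ^ (2 * (n + 1)) = c.ε ^ (2 * n) * c.ε ^ 2 := by
    rw [← zpow_natCast, ← zpow_add₀ c.hε.ne']; congr 1; push_cast; ring
  rw [e2] at h1
  rw [e1]
  have h3 : 1000 * s ^ 2 * (c.ε ^ (2 * n) * c.ε ^ 2 * I c t (D2 (D2 G) * D2 (D2 G))) ≤ η * DT c t := by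
    have hD := DT_nonneg c t
    calc _ ≤ 1000 * s ^ 2 * (C * DT c t) := by gcongr
      _ ≤ 1000 * s * (C * DT c t) := by
        have : s ^ 2 ≤ s := by nlinarith
        gcongr
      _ ≤ (s * (1000 * (C + 1))) * DT c t := by nlinarith [mul_nonneg hs0.le hD]
      _ ≤ _ := by gcongr
  rw [mul_inv, mul_pow, mul_pow]
  linarith
end

end

section
set_option linter.all false
variable {q : Par}

lemma bd_z : Bd 0 0 0 (0 : Sm (Cfg q)) := Bd.cst0 0 fun c t ht x hx => by simp

lemma hcμ' : 0 < cμ q := inv_pos.2 q.hRe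
lemma hcl' : 0 < cl q := by
  have := mul_pos q.hr (inv_pos.2 q.hRe)
  unfold cl; linarith
lemma hcκ' : 0 < cκ q := div_pos (cp_pos q) (mul_pos q.hRe q.hPr)
lemma hcμ : cμ q ≠ 0 := hcμ'.ne'
lemma hcκ : cκ q ≠ 0 := hcκ'.ne'
lemma Ng.divν {k : ℕ} {G : Sm (Cfg q)} (h : Ng k ((Mu + La) * G)) : Ng k G :=
  (h.mulB (bd_k (cμ q + cl q)⁻¹)).of_eq (by
    have h0 : cμ q + cl q ≠ 0 := (add_pos hcμ' hcl').ne'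
    have : (kc (cμ q + cl q)⁻¹ * (Mu + La) : Sm (Cfg q)) = 1 := by apply Sm.ext'; intro c v; simp [h0]
    rw [← mul_assoc, this, one_mul])
lemma Ng.conv {k : ℕ} {G : Sm (Cfg q)} (h : Ng k (Ep (-1) * G)) : Ng k (Ep 1 * Ep (-2) * G) :=
  h.of_eq (by rw [Ep_mul]; norm_num)
lemma Ng.conv' {k : ℕ} {G : Sm (Cfg q)} (h : Ng k (Ep 1 * Ep (-2) * G)) : Ng k (Ep (-1) * G) :=
  h.of_eq (by rw [Ep_mul]; norm_num)
lemma prim1 (c : Cfg q) (t : ℝ) : I c t (Ep (-1) * D2 ff * (Ep (-1) * D2 ff)) ≤ Yl 1 c t ∧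
    I c t (Ep (-1) * D1 (D2 ff) * (Ep (-1) * D1 (D2 ff))) ≤ Yl 1 c t := by
  have h1 := I_Epn c t (-2) (D2 ff)
  have h2 := I_Epn c t (-2) (D1 (D2 ff))
  have h3 := Zd_nonneg c t
  simp only [I_Ep_sq, Yl, I_Ep] at *
  norm_num1 at *
  simp only [if_true, if_false]
  constructor <;> linarith
lemma prim2 (c : Cfg q) (t : ℝ) : I c t (Ep (-1) * D2 (D2 ff) * (Ep (-1) * D2 (D2 ff))) ≤ Yl 2 c t := by
  have h1 := I_Epn c t (-2) (D2 ff)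
  have h2 := I_Epn c t (-2) (D1 (D2 ff))
  have h3 := Zd_nonneg c t
  simp only [I_Ep_sq, Yl, I_Ep] at *
  norm_num1 at *
  simp only [if_true, if_false]
  linarith

lemma mean_ff (c : Cfg q) : ∀ t ∈ Set.Icc 0 c.T, I c t ff = 0 := by
  have h0 : I c 0 ff = 0 := by
    have := c.std.2.2.2.1
    rw [φ_eq] at this
    rw [I_def]; exact this
  have hd : ∀ t ∈ Set.Icc 0 c.T, I c t (D0 ff) = 0 := fun t ht => by
    have e : I c t (D0 ff) = I c t (D0 ff - eqM) := I_congr fun x hx => by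
      rw [map_sub, zM c t ht x hx, sub_zero]
    rw [e, show D0 ff - eqM = -(D1 ((yy + uu) * ff + bb * uu) + D2 (ww * ff + bb * ww) : Sm (Cfg q)) by
      simp only [eqM, map_add, Derivation.leibniz, smul_eq_mul, D1_yy, D1_bb]; ring]
    rw [map_neg, map_add, I_D1, I_D2_zero, add_zero, neg_zero]
    all_goals
      intro x
      have := bw c t ht x
      simp [this]
  intro t ht
  have := constant_of_has_deriv_right_zero (f := fun s => I c s ff) (a := 0) (b := c.T) (I_cont c ff).continuousOn
    (fun s hs => by
      have := (I_hasDerivAt c s ff).hasDerivWithinAt (s := Set.Ici s)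
      rwa [hd s ⟨hs.1, hs.2.le⟩] at this) t ht
  rw [this, h0]

lemma gpi11_aux {g : Sm (Cfg q)} (h12 : Ng 1 (Ep (-1) * D1 (D2 pp) : Sm (Cfg q))) (h112 : Ng 1 (Ep 1 * D1 (D1 (D2 uu)) : Sm (Cfg q)))
    (hz : Zr (D1 (Ep 1 * Ep (-2) * D1 pp) - (D2 (Ep 1 * Mu * D1 (D2 uu)) + g))) (hg : Ng 1 g) :
    Ng 1 (Ep (-1) * D1 (D1 pp) : Sm (Cfg q)) := by
  have e1 : D1 (Ep 1 * Ep (-2) * D1 pp) = (Ep 1 * Ep (-2) * D1 (D1 pp) : Sm (Cfg q)) := by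
    simp only [Derivation.leibniz, smul_eq_mul, DD_Ep]; ring
  have e2 : D2 (Ep 1 * Ep (-2) * D1 pp) = (Ep 1 * Ep (-2) * D1 (D2 pp) : Sm (Cfg q)) := by
    rw [← D21]; simp only [Derivation.leibniz, smul_eq_mul, DD_Ep]; ring
  have e3 : D1 (Ep 1 * Mu * D1 (D2 uu)) = (Mu * (Ep 1 * D1 (D1 (D2 uu))) : Sm (Cfg q)) := by
    simp only [Derivation.leibniz, smul_eq_mul, DD_Ep, DD_kc]; ring
  obtain ⟨C, hC, hb⟩ := Bd.int00 (G := (Ep 1 * Ep (-2) * D1 pp : Sm (Cfg q))) ((((bd_E 1).mul (bd_E (-2))).mul b1pi1).mono)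
  have h3 : Ng 1 (D1 (Ep 1 * Mu * D1 (D2 uu)) : Sm (Cfg q)) := (h112.mulB (bd_k _)).of_eq e3
  have h2 : Ng 1 (D2 (Ep 1 * Ep (-2) * D1 pp) : Sm (Cfg q)) := h12.conv.of_eq e2
  refine Ng.conv' (Ng.of_eq (G := D1 (Ep 1 * Ep (-2) * D1 pp)) ?_ e1.symm)
  refine Nf.lim fun η hη => ?_
  set s : ℝ := min 1 (η / (2 * (C + 1))) with hs
  have hs0 : 0 < s := lt_min one_pos (by positivity)
  have hs2 : s * (2 * (C + 1)) ≤ η := by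
    have := min_le_right 1 (η / (2 * (C + 1)))
    rwa [← hs, le_div_iff₀ (by positivity)] at this
  refine ⟨_, ((Nf.smul h3 (30000 * s⁻¹) (by positivity)).add (Nf.smul h2 2 two_pos)).add (Nf.smul hg 10 (by norm_num)), fun c t ht => ?_⟩
  have := necas c t (Ep 1 * Ep (-2) * D1 pp) (Ep 1 * Mu * D1 (D2 uu)) g hs0 (min_le_left _ _) fun x hx => by
    have := hz c t ht x hx
    rw [map_sub] at this
    exact sub_eq_zero.1 this
  have h5 : 2 * s * I c t (Ep 1 * Ep (-2) * D1 pp * (Ep 1 * Ep (-2) * D1 pp)) ≤ η * DT c t := by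
    have hD := DT_nonneg c t
    calc _ ≤ 2 * s * (C * DT c t) := by have := hb c t ht; gcongr
      _ ≤ (s * (2 * (C + 1))) * DT c t := by nlinarith [mul_nonneg hs0.le hD]
      _ ≤ _ := by gcongr
  linarith

lemma prim0 (c : Cfg q) (t : ℝ) : I c t (Ep (-1) * D1 uu * (Ep (-1) * D1 uu)) ≤ Zd c t ∧
    I c t (Ep (-1) * D2 uu * (Ep (-1) * D2 uu)) ≤ Zd c t ∧
    I c t (Ep 1 * D0 (D1 uu) * (Ep 1 * D0 (D1 uu))) ≤ Zd c t ∧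
    I c t (Ep 1 * D0 (D2 uu) * (Ep 1 * D0 (D2 uu))) ≤ Zd c t ∧
    I c t (Ep 1 * D1 (D1 (D1 uu)) * (Ep 1 * D1 (D1 (D1 uu)))) ≤ Zd c t ∧
    I c t (Ep 1 * D1 (D1 (D2 uu)) * (Ep 1 * D1 (D1 (D2 uu)))) ≤ Zd c t ∧
    I c t (Ep (-1) * D1 ww * (Ep (-1) * D1 ww)) ≤ Zd c t ∧
    I c t (Ep (-1) * D2 ww * (Ep (-1) * D2 ww)) ≤ Zd c t ∧
    I c t (Ep 1 * D0 (D1 ww) * (Ep 1 * D0 (D1 ww))) ≤ Zd c t ∧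
    I c t (Ep 1 * D0 (D2 ww) * (Ep 1 * D0 (D2 ww))) ≤ Zd c t ∧
    I c t (Ep 1 * D1 (D1 (D1 ww)) * (Ep 1 * D1 (D1 (D1 ww)))) ≤ Zd c t ∧
    I c t (Ep 1 * D1 (D1 (D2 ww)) * (Ep 1 * D1 (D1 (D2 ww)))) ≤ Zd c t ∧
    I c t (Ep (-2) * D1 hh * (Ep (-2) * D1 hh)) ≤ Zd c t ∧
    I c t (Ep (-2) * D2 hh * (Ep (-2) * D2 hh)) ≤ Zd c t ∧
    I c t (Ep 0 * D0 (D1 hh) * (Ep 0 * D0 (D1 hh))) ≤ Zd c t ∧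
    I c t (Ep 0 * D0 (D2 hh) * (Ep 0 * D0 (D2 hh))) ≤ Zd c t ∧
    I c t (Ep 0 * D1 (D1 (D1 hh)) * (Ep 0 * D1 (D1 (D1 hh)))) ≤ Zd c t ∧
    I c t (Ep 0 * D1 (D1 (D2 hh)) * (Ep 0 * D1 (D1 (D2 hh)))) ≤ Zd c t := by
  have e : c.ε ^ (-2 : ℤ) * c.ε ^ (-2 : ℤ) = c.ε ^ (-4 : ℤ) := by rw [← zpow_add₀ c.hε.ne']; norm_num
  have p1 := Ep_pos c (-2)
  have p2 := Ep_pos c (-4)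
  have p3 := Ep_pos c 2
  have h := I_sq_nonneg c t
  have n0 := mul_nonneg (Ep_pos c (-2)).le (h (D1 uu))
  have n1 := mul_nonneg (Ep_pos c (-2)).le (h (D2 uu))
  have n2 := mul_nonneg (Ep_pos c 2).le (h (D0 (D1 uu)))
  have n3 := mul_nonneg (Ep_pos c 2).le (h (D0 (D2 uu)))
  have n4 := mul_nonneg (Ep_pos c 2).le (h (D1 (D1 (D1 uu))))
  have n5 := mul_nonneg (Ep_pos c 2).le (h (D1 (D1 (D2 uu))))
  have n6 := mul_nonneg (Ep_pos c (-2)).le (h (D1 ww))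
  have n7 := mul_nonneg (Ep_pos c (-2)).le (h (D2 ww))
  have n8 := mul_nonneg (Ep_pos c 2).le (h (D0 (D1 ww)))
  have n9 := mul_nonneg (Ep_pos c 2).le (h (D0 (D2 ww)))
  have n10 := mul_nonneg (Ep_pos c 2).le (h (D1 (D1 (D1 ww))))
  have n11 := mul_nonneg (Ep_pos c 2).le (h (D1 (D1 (D2 ww))))
  have n12 := mul_nonneg (Ep_pos c (-4)).le (h (D1 hh))
  have n13 := mul_nonneg (Ep_pos c (-4)).le (h (D2 hh))
  have n14 := mul_nonneg (Ep_pos c 0).le (h (D0 (D1 hh)))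
  have n15 := mul_nonneg (Ep_pos c 0).le (h (D0 (D2 hh)))
  have n16 := mul_nonneg (Ep_pos c 0).le (h (D1 (D1 (D1 hh))))
  have n17 := mul_nonneg (Ep_pos c 0).le (h (D1 (D1 (D2 hh))))
  simp only [I_Ep_sq]
  simp only [Zd, P0, Pg, map_add, I_Ep, mul_add, mul_assoc]
  simp only [← mul_assoc, e, D10, D20, D21]
  norm_num1
  norm_num1 at n0 n1 n2 n3 n4 n5 n6 n7 n8 n9 n10 n11 n12 n13 n14 n15 n16 n17
  simp only [zpow_zero, one_mul] at *
  refine ⟨?_, ?_, ?_, ?_, ?_, ?_, ?_, ?_, ?_, ?_, ?_, ?_, ?_, ?_, ?_, ?_, ?_, ?_⟩ <;> linarith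

lemma gu1 : Ng 0 (Ep (-1) * D1 uu : Sm (Cfg q)) :=
  Nf.prim fun c t ht => (Yl_zero c t).symm ▸ (prim0 c t).1

lemma gu2 : Ng 0 (Ep (-1) * D2 uu : Sm (Cfg q)) :=
  Nf.prim fun c t ht => (Yl_zero c t).symm ▸ (prim0 c t).2.1

lemma gut1 : Ng 0 (Ep 1 * D0 (D1 uu) : Sm (Cfg q)) :=
  Nf.prim fun c t ht => (Yl_zero c t).symm ▸ (prim0 c t).2.2.1

lemma gut2 : Ng 0 (Ep 1 * D0 (D2 uu) : Sm (Cfg q)) :=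
  Nf.prim fun c t ht => (Yl_zero c t).symm ▸ (prim0 c t).2.2.2.1

lemma gu111 : Ng 0 (Ep 1 * D1 (D1 (D1 uu)) : Sm (Cfg q)) :=
  Nf.prim fun c t ht => (Yl_zero c t).symm ▸ (prim0 c t).2.2.2.2.1

lemma gu112 : Ng 0 (Ep 1 * D1 (D1 (D2 uu)) : Sm (Cfg q)) :=
  Nf.prim fun c t ht => (Yl_zero c t).symm ▸ (prim0 c t).2.2.2.2.2.1

lemma gw1 : Ng 0 (Ep (-1) * D1 ww : Sm (Cfg q)) :=
  Nf.prim fun c t ht => (Yl_zero c t).symm ▸ (prim0 c t).2.2.2.2.2.2.1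

lemma gw2 : Ng 0 (Ep (-1) * D2 ww : Sm (Cfg q)) :=
  Nf.prim fun c t ht => (Yl_zero c t).symm ▸ (prim0 c t).2.2.2.2.2.2.2.1

lemma gwt1 : Ng 0 (Ep 1 * D0 (D1 ww) : Sm (Cfg q)) :=
  Nf.prim fun c t ht => (Yl_zero c t).symm ▸ (prim0 c t).2.2.2.2.2.2.2.2.1

lemma gwt2 : Ng 0 (Ep 1 * D0 (D2 ww) : Sm (Cfg q)) :=
  Nf.prim fun c t ht => (Yl_zero c t).symm ▸ (prim0 c t).2.2.2.2.2.2.2.2.2.1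

lemma gw111 : Ng 0 (Ep 1 * D1 (D1 (D1 ww)) : Sm (Cfg q)) :=
  Nf.prim fun c t ht => (Yl_zero c t).symm ▸ (prim0 c t).2.2.2.2.2.2.2.2.2.2.1

lemma gw112 : Ng 0 (Ep 1 * D1 (D1 (D2 ww)) : Sm (Cfg q)) :=
  Nf.prim fun c t ht => (Yl_zero c t).symm ▸ (prim0 c t).2.2.2.2.2.2.2.2.2.2.2.1

lemma gh1 : Ng 0 (Ep (-2) * D1 hh : Sm (Cfg q)) :=
  Nf.prim fun c t ht => (Yl_zero c t).symm ▸ (prim0 c t).2.2.2.2.2.2.2.2.2.2.2.2.1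

lemma gh2 : Ng 0 (Ep (-2) * D2 hh : Sm (Cfg q)) :=
  Nf.prim fun c t ht => (Yl_zero c t).symm ▸ (prim0 c t).2.2.2.2.2.2.2.2.2.2.2.2.2.1

lemma ght1 : Ng 0 (Ep 0 * D0 (D1 hh) : Sm (Cfg q)) :=
  Nf.prim fun c t ht => (Yl_zero c t).symm ▸ (prim0 c t).2.2.2.2.2.2.2.2.2.2.2.2.2.2.1

lemma ght2 : Ng 0 (Ep 0 * D0 (D2 hh) : Sm (Cfg q)) :=
  Nf.prim fun c t ht => (Yl_zero c t).symm ▸ (prim0 c t).2.2.2.2.2.2.2.2.2.2.2.2.2.2.2.1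

lemma gh111 : Ng 0 (Ep 0 * D1 (D1 (D1 hh)) : Sm (Cfg q)) :=
  Nf.prim fun c t ht => (Yl_zero c t).symm ▸ (prim0 c t).2.2.2.2.2.2.2.2.2.2.2.2.2.2.2.2.1

lemma gh112 : Ng 0 (Ep 0 * D1 (D1 (D2 hh)) : Sm (Cfg q)) :=
  Nf.prim fun c t ht => (Yl_zero c t).symm ▸ (prim0 c t).2.2.2.2.2.2.2.2.2.2.2.2.2.2.2.2.2

lemma gu : Ng 0 (Ep (-1) * uu : Sm (Cfg q)) :=
  Ng.poin (bu) gu2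

lemma gut : Ng 0 (Ep 1 * D0 uu : Sm (Cfg q)) :=
  Ng.poin (bu.D0) (gut2.of_eq (by rw [D20]))

lemma gw : Ng 0 (Ep (-1) * ww : Sm (Cfg q)) :=
  Ng.poin (bw) gw2

lemma gwt : Ng 0 (Ep 1 * D0 ww : Sm (Cfg q)) :=
  Ng.poin (bw.D0) (gwt2.of_eq (by rw [D20]))

lemma gh : Ng 0 (Ep (-2) * hh : Sm (Cfg q)) :=
  Ng.poin (bh) gh2

lemma ght : Ng 0 (Ep 0 * D0 hh : Sm (Cfg q)) :=
  Ng.poin (bh.D0) (ght2.of_eq (by rw [D20]))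

lemma gu11 : Ng 0 (Ep 0 * D1 (D1 uu) : Sm (Cfg q)) :=
  Ng.int1 (n := 0) gu1 gu111

lemma gu12 : Ng 0 (Ep 0 * D1 (D2 uu) : Sm (Cfg q)) :=
  Ng.int1 (n := 0) gu2 gu112

lemma gu22 : Ng 0 (Ep 0 * D2 (D2 uu) : Sm (Cfg q)) :=
  Ng.int2 (n := 0) gu2 ((bd_E 1).mul b1u222).mono

lemma gw11 : Ng 0 (Ep 0 * D1 (D1 ww) : Sm (Cfg q)) :=
  Ng.int1 (n := 0) gw1 gw111

lemma gw12 : Ng 0 (Ep 0 * D1 (D2 ww) : Sm (Cfg q)) :=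
  Ng.int1 (n := 0) gw2 gw112

lemma gw22 : Ng 0 (Ep 0 * D2 (D2 ww) : Sm (Cfg q)) :=
  Ng.int2 (n := 0) gw2 ((bd_E 1).mul b1w222).mono

lemma gh11 : Ng 0 (Ep (-1) * D1 (D1 hh) : Sm (Cfg q)) :=
  Ng.int1 (n := -1) gh1 gh111

lemma gh12 : Ng 0 (Ep (-1) * D1 (D2 hh) : Sm (Cfg q)) :=
  Ng.int1 (n := -1) gh2 gh112

lemma gh22 : Ng 0 (Ep (-1) * D2 (D2 hh) : Sm (Cfg q)) :=
  Ng.int2 (n := -1) gh2 ((bd_E 0).mul b1h222).mono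

lemma gh122 : Ng 0 (Ep 0 * D1 (D2 (D2 hh)) : Sm (Cfg q)) :=
  Ng.div hcκ (Ng.zr (G := Cg * bb * (Ep 0 * D0 (D1 hh)) - Ka * (Ep 0 * D1 (D1 (D1 hh))) + Ep 0 * D1 (D1 uu) + Ep 0 * D1 (D2 ww) + Ep 0 * (Cg * D1 ff * B3 + Cg * ff * D0 (D1 hh) + Cg * RR * ((yy + uu) * D1 (D1 hh) + D1 uu * D1 hh + ww * D1 (D2 hh) + D1 ww * D2 hh + D1 ww * D2 aa) + D1 pp * dv + pp * D1 dv - Ep 2 * D1 HT))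
    ((((((ght1).mulB (((bd_k _).mul b0b).mono)).sub
    ((gh111).mulB ((bd_k _).mono))).add
    gu11).add
    gw12).add (G := Cg * bb * (Ep 0 * D0 (D1 hh)) - Ka * (Ep 0 * D1 (D1 (D1 hh))) + Ep 0 * D1 (D1 uu) + Ep 0 * D1 (D2 ww))
    (H := Ep 0 * (Cg * D1 ff * B3 + Cg * ff * D0 (D1 hh) + Cg * RR * ((yy + uu) * D1 (D1 hh) + D1 uu * D1 hh + ww * D1 (D2 hh) + D1 ww * D2 hh + D1 ww * D2 aa) + D1 pp * dv + pp * D1 dv - Ep 2 * D1 HT))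
    (Ng.small (((bd_E 0).mul (Bd.sub (n := 0) (m := 1) (Bd.add (n := 0) (m := 1) (Bd.add (n := 0) (m := 1) (Bd.add (n := 0) (m := 1) (Bd.add (n := 0) (m := 1) (((bd_k _).mul b0f1).mul b1B3).mono (((bd_k _).mul b0f).mul b1ht1).mono).mono (((bd_k _).mul b0R).mul (Bd.add (n := 1) (m := 1) (Bd.add (n := 1) (m := 1) (Bd.add (n := 1) (m := 1) (Bd.add (n := 1) (m := 1) ((Bd.add (n := 0) (m := 0) b0y.mono b0u.mono).mul b1h11).mono (b0u1.mul b1h1).mono).mono (b0w.mul b1h12).mono).mono (b0w1.mul b1h2).mono).mono (b1w1.mul b0a2).mono)).mono).mono (b0pi1.mul b1d).mono).mono (b0pi.mul b1d1).mono).mono ((bd_E 2).mul b1HT1).mono)).mono)))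
    (Zr.of_eq (zE.D1.mul (-Ep 0)) (by
    simp only [eqE]
    simp only [map_add, map_sub, map_neg, map_zero, Derivation.leibniz, smul_eq_mul, D10, D20, D21, DD_kc, DD_Ep, D0_yy, D1_yy, D2_yy, D0_aa, D1_aa, D0_bb, D1_bb, D02_aa, D12_aa, D02_bb, D12_bb, D022_aa, D122_aa, D022_bb, D122_bb, DD_2, DD_3, DD_4, DD_6, Derivation.map_one_eq_zero, D2_bb, mul_zero, zero_mul, add_zero, zero_add, sub_zero, mul_one, one_mul]
    ring)))

lemma gh222 : Ng 0 (Ep 0 * D2 (D2 (D2 hh)) : Sm (Cfg q)) :=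
  Ng.div hcκ (Ng.zr (G := Cg * bb * (Ep 0 * D0 (D2 hh)) - Ka * (Ep 0 * D1 (D1 (D2 hh))) + Ep 0 * D1 (D2 uu) + Ep 0 * D2 (D2 ww) + Ep 0 * (Cg * (D2 bb + D2 ff) * B3 + Cg * ff * D0 (D2 hh) + Cg * RR * ((yy + uu) * D1 (D2 hh) + (1 + D2 uu) * D1 hh + ww * D2 (D2 hh) + D2 ww * D2 hh + D2 ww * D2 aa + ww * D2 (D2 aa)) + D2 pp * dv + pp * D2 dv - Ep 2 * D2 HT))
    ((((((ght2).mulB (((bd_k _).mul b0b).mono)).sub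
    ((gh112).mulB ((bd_k _).mono))).add
    gu12).add
    gw22).add (G := Cg * bb * (Ep 0 * D0 (D2 hh)) - Ka * (Ep 0 * D1 (D1 (D2 hh))) + Ep 0 * D1 (D2 uu) + Ep 0 * D2 (D2 ww))
    (H := Ep 0 * (Cg * (D2 bb + D2 ff) * B3 + Cg * ff * D0 (D2 hh) + Cg * RR * ((yy + uu) * D1 (D2 hh) + (1 + D2 uu) * D1 hh + ww * D2 (D2 hh) + D2 ww * D2 hh + D2 ww * D2 aa + ww * D2 (D2 aa)) + D2 pp * dv + pp * D2 dv - Ep 2 * D2 HT))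
    (Ng.small (((bd_E 0).mul (Bd.sub (n := 0) (m := 1) (Bd.add (n := 0) (m := 1) (Bd.add (n := 0) (m := 1) (Bd.add (n := 0) (m := 1) (Bd.add (n := 0) (m := 1) (((bd_k _).mul (Bd.add (n := 0) (m := 1) b0b2.mono b0f2.mono)).mul b1B3).mono (((bd_k _).mul b0f).mul b1ht2).mono).mono (((bd_k _).mul b0R).mul (Bd.add (n := 1) (m := 1) (Bd.add (n := 1) (m := 1) (Bd.add (n := 1) (m := 1) (Bd.add (n := 1) (m := 1) (Bd.add (n := 1) (m := 1) ((Bd.add (n := 0) (m := 0) b0y.mono b0u.mono).mul b1h12).mono ((Bd.add (n := -1) (m := 0) bd_1.mono b0u2.mono).mul b1h1).mono).mono (b0w.mul b1h22).mono).mono (b0w2.mul b1h2).mono).mono (b1w2.mul b0a2).mono).mono (b1w.mul b0a22).mono)).mono).mono (b0pi2.mul b1d).mono).mono (b0pi.mul b1d2).mono).mono ((bd_E 2).mul b1HT2).mono)).mono)))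
    (Zr.of_eq (zE.D2.mul (-Ep 0)) (by
    simp only [eqE]
    simp only [map_add, map_sub, map_neg, map_zero, Derivation.leibniz, smul_eq_mul, D10, D20, D21, DD_kc, DD_Ep, D0_yy, D1_yy, D2_yy, D0_aa, D1_aa, D0_bb, D1_bb, D02_aa, D12_aa, D02_bb, D12_bb, D022_aa, D122_aa, D022_bb, D122_bb, DD_2, DD_3, DD_4, DD_6, Derivation.map_one_eq_zero, D2_bb, mul_zero, zero_mul, add_zero, zero_add, sub_zero, mul_one, one_mul]
    ring)))

lemma gf2 : Ng 1 (Ep (-1) * D2 ff : Sm (Cfg q)) :=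
  Nf.prim fun c t ht => (prim1 c t).1

lemma gf12 : Ng 1 (Ep (-1) * D1 (D2 ff) : Sm (Cfg q)) :=
  Nf.prim fun c t ht => (prim1 c t).2

lemma gpi12 : Ng 1 (Ep (-1) * D1 (D2 pp) : Sm (Cfg q)) :=
  Ng.zr (G := aa * (Ep (-1) * D1 (D2 ff)) + bb * (Ep (-1) * D1 (D2 hh)) + Ep (-1) * (D2 aa * D1 ff + D2 bb * D1 hh + D1 (D2 ff) * hh + D1 ff * D2 hh + D2 ff * D1 hh + ff * D1 (D2 hh)))
    ((((gf12).mulB (b0a.mono)).add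
    ((gh12.up).mulB (b0b.mono))).add (G := aa * (Ep (-1) * D1 (D2 ff)) + bb * (Ep (-1) * D1 (D2 hh)))
    (H := Ep (-1) * (D2 aa * D1 ff + D2 bb * D1 hh + D1 (D2 ff) * hh + D1 ff * D2 hh + D2 ff * D1 hh + ff * D1 (D2 hh)))
    (Ng.small (((bd_E (-1)).mul (Bd.add (n := 2) (m := 2) (Bd.add (n := 2) (m := 2) (Bd.add (n := 2) (m := 2) (Bd.add (n := 2) (m := 2) (Bd.add (n := 2) (m := 2) (b0a2.mul b1f1).mono (b0b2.mul b1h1).mono).mono (b1f12.mul b0h).mono).mono (b0f1.mul b1h2).mono).mono (b0f2.mul b1h1).mono).mono (b0f.mul b1h12).mono)).mono)))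
    ((zM.mul 0).of_eq (by
    simp only [map_add, map_sub, map_neg, map_zero, Derivation.leibniz, smul_eq_mul, D10, D20, D21, DD_kc, DD_Ep, D0_yy, D1_yy, D2_yy, D0_aa, D1_aa, D0_bb, D1_bb, D02_aa, D12_aa, D02_bb, D12_bb, D022_aa, D122_aa, D022_bb, D122_bb, DD_2, DD_3, DD_4, DD_6, Derivation.map_one_eq_zero, D2_bb, mul_zero, zero_mul, add_zero, zero_add, sub_zero, mul_one, one_mul]
    linear_combination (0) * (ab1 : (aa * bb : Sm (Cfg q)) = 1)))

lemma gpi11 : Ng 1 (Ep (-1) * D1 (D1 pp) : Sm (Cfg q)) := by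
  have hz : Zr (D1 (Ep 1 * Ep (-2) * D1 pp) - (D2 (Ep 1 * Mu * D1 (D2 uu)) + ((Mu + La) * (Ep 1 * D1 (D1 (D1 uu))) + La * (Ep 1 * D1 (D1 (D2 ww))) - bb * (Ep 1 * D0 (D1 uu)) + Ep 1 * (0 * ff * D1 ff - D1 ff * B1 - ff * D0 (D1 uu) - RR * ((yy + uu) * D1 (D1 uu) + D1 uu * D1 uu + ww * D1 (D2 uu) + D1 ww * D2 uu + D1 ww)))) : Sm (Cfg q)) := Zr.of_eq (z1.D1.mul (Ep 1)) (by
    simp only [eq1]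
    simp only [map_add, map_sub, map_neg, map_zero, Derivation.leibniz, smul_eq_mul, D10, D20, D21, DD_kc, DD_Ep, D0_yy, D1_yy, D2_yy, D0_aa, D1_aa, D0_bb, D1_bb, D02_aa, D12_aa, D02_bb, D12_bb, D022_aa, D122_aa, D022_bb, D122_bb, DD_2, DD_3, DD_4, DD_6, Derivation.map_one_eq_zero, D2_bb, mul_zero, zero_mul, add_zero, zero_add, sub_zero, mul_one, one_mul]
    ring)
  have hg : Ng 1 ((Mu + La) * (Ep 1 * D1 (D1 (D1 uu))) + La * (Ep 1 * D1 (D1 (D2 ww))) - bb * (Ep 1 * D0 (D1 uu)) + Ep 1 * (0 * ff * D1 ff - D1 ff * B1 - ff * D0 (D1 uu) - RR * ((yy + uu) * D1 (D1 uu) + D1 uu * D1 uu + ww * D1 (D2 uu) + D1 ww * D2 uu + D1 ww)) : Sm (Cfg q)) := (((gu111.mulB (((bd_k _).mono).add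
    ((bd_k _).mono))).add
    (gw112.mulB (bd_k _))).sub (gut1.mulB b0b)).up.add (Ng.small (((bd_E 1).mul (Bd.sub (n := -1) (m := 0) (Bd.sub (n := -1) (m := 0) (Bd.sub (n := -1) (m := 0) ((bd_z.mul b0f).mul b1f1).mono (b0f1.mul b1B1).mono).mono (b0f.mul b1ut1).mono).mono (b0R.mul (Bd.add (n := 0) (m := 0) (Bd.add (n := 0) (m := 0) (Bd.add (n := 0) (m := 0) (Bd.add (n := 0) (m := 0) ((Bd.add (n := 0) (m := 0) b0y.mono b0u.mono).mul b1u11).mono (b0u1.mul b1u1).mono).mono (b0w.mul b1u12).mono).mono (b0w1.mul b1u2).mono).mono b1w1.mono)).mono)).mono))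
  exact gpi11_aux gpi12 gu112.up hz hg

lemma gf11 : Ng 1 (Ep (-1) * D1 (D1 ff) : Sm (Cfg q)) :=
  Ng.zr (G := bb * (Ep (-1) * D1 (D1 pp)) - bb * bb * (Ep (-1) * D1 (D1 hh)) + Ep (-1) * (0 * ff * D1 ff - bb * (D1 (D1 ff) * hh + 2 * D1 ff * D1 hh + ff * D1 (D1 hh))))
    ((((gpi11).mulB (b0b.mono)).sub
    ((gh11.up).mulB ((b0b.mul b0b).mono))).add (G := bb * (Ep (-1) * D1 (D1 pp)) - bb * bb * (Ep (-1) * D1 (D1 hh)))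
    (H := Ep (-1) * (0 * ff * D1 ff - bb * (D1 (D1 ff) * hh + 2 * D1 ff * D1 hh + ff * D1 (D1 hh))))
    (Ng.small (((bd_E (-1)).mul (Bd.sub (n := 2) (m := 3) ((bd_z.mul b0f).mul b1f1).mono (b0b.mul (Bd.add (n := 2) (m := 3) (Bd.add (n := 2) (m := 3) (b1f11.mul b0h).mono (((bd_n 2).mul b0f1).mul b1h1).mono).mono (b0f.mul b1h11).mono)).mono)).mono)))
    ((zM.mul 0).of_eq (by
    simp only [map_add, map_sub, map_neg, map_zero, Derivation.leibniz, smul_eq_mul, D10, D20, D21, DD_kc, DD_Ep, D0_yy, D1_yy, D2_yy, D0_aa, D1_aa, D0_bb, D1_bb, D02_aa, D12_aa, D02_bb, D12_bb, D022_aa, D122_aa, D022_bb, D122_bb, DD_2, DD_3, DD_4, DD_6, Derivation.map_one_eq_zero, D2_bb, mul_zero, zero_mul, add_zero, zero_add, sub_zero, mul_one, one_mul]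
    linear_combination (- Ep (-1) * D1 (D1 ff)) * (ab1 : (aa * bb : Sm (Cfg q)) = 1)))

lemma gf1 : Ng 1 (Ep (-1) * D1 ff : Sm (Cfg q)) :=
  Ng.mean (fun c t ht => I_D1 c t ff) gf11 (gf12.of_eq (by rw [D21]))

lemma gf : Ng 1 (Ep (-1) * ff : Sm (Cfg q)) :=
  Ng.mean mean_ff gf1 gf2

lemma gft : Ng 1 (Ep (-1) * D0 ff : Sm (Cfg q)) :=
  Ng.zr (G := 0 * yy * (Ep (-1) * D1 ff) - yy * (Ep (-1) * D1 ff) - bb * (Ep (-1) * D1 uu) - bb * (Ep (-1) * D2 ww) + Ep (-1) * (0 * ff * D1 ff - uu * D1 ff - ww * D2 ff - ww * D2 bb - ff * dv))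
    ((((((gf1).mulB ((bd_z.mul b0y).mono)).sub
    ((gf1).mulB (b0y.mono))).sub
    ((gu1.up).mulB (b0b.mono))).sub
    ((gw2.up).mulB (b0b.mono))).add (G := 0 * yy * (Ep (-1) * D1 ff) - yy * (Ep (-1) * D1 ff) - bb * (Ep (-1) * D1 uu) - bb * (Ep (-1) * D2 ww))
    (H := Ep (-1) * (0 * ff * D1 ff - uu * D1 ff - ww * D2 ff - ww * D2 bb - ff * dv))
    (Ng.small (((bd_E (-1)).mul (Bd.sub (n := 1) (m := 2) (Bd.sub (n := 1) (m := 2) (Bd.sub (n := 1) (m := 2) (Bd.sub (n := 1) (m := 2) ((bd_z.mul b0f).mul b1f1).mono (b0u.mul b1f1).mono).mono (b0w.mul b1f2).mono).mono (b1w.mul b0b2).mono).mono (b0f.mul b1d).mono)).mono)))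
    (Zr.of_eq (zM.mul (Ep (-1))) (by
    simp only [eqM]
    simp only [map_add, map_sub, map_neg, map_zero, Derivation.leibniz, smul_eq_mul, D10, D20, D21, DD_kc, DD_Ep, D0_yy, D1_yy, D2_yy, D0_aa, D1_aa, D0_bb, D1_bb, D02_aa, D12_aa, D02_bb, D12_bb, D022_aa, D122_aa, D022_bb, D122_bb, DD_2, DD_3, DD_4, DD_6, Derivation.map_one_eq_zero, D2_bb, mul_zero, zero_mul, add_zero, zero_add, sub_zero, mul_one, one_mul]
    ring))

lemma gu122 : Ng 1 (Ep 1 * D1 (D2 (D2 uu)) : Sm (Cfg q)) :=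
  Ng.div hcμ (Ng.zr (G := Ep 1 * Ep (-2) * D1 (D1 pp) + bb * (Ep 1 * D0 (D1 uu)) - (Mu + La) * (Ep 1 * D1 (D1 (D1 uu))) - La * (Ep 1 * D1 (D1 (D2 ww))) + Ep 1 * (D1 ff * B1 + ff * D0 (D1 uu) + RR * ((yy + uu) * D1 (D1 uu) + D1 uu * D1 uu + ww * D1 (D2 uu) + D1 ww * D2 uu + D1 ww)))
    ((((gpi11.conv.add
    ((gut1.up).mulB (b0b.mono))).sub
    ((gu111.up).mulB (((bd_k _).mono).add
    ((bd_k _).mono)))).sub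
    ((gw112.up).mulB ((bd_k _).mono))).add (G := Ep 1 * Ep (-2) * D1 (D1 pp) + bb * (Ep 1 * D0 (D1 uu)) - (Mu + La) * (Ep 1 * D1 (D1 (D1 uu))) - La * (Ep 1 * D1 (D1 (D2 ww))))
    (H := Ep 1 * (D1 ff * B1 + ff * D0 (D1 uu) + RR * ((yy + uu) * D1 (D1 uu) + D1 uu * D1 uu + ww * D1 (D2 uu) + D1 ww * D2 uu + D1 ww)))
    (Ng.small (((bd_E 1).mul (Bd.add (n := -1) (m := 0) (Bd.add (n := -1) (m := 0) (b0f1.mul b1B1).mono (b0f.mul b1ut1).mono).mono (b0R.mul (Bd.add (n := 0) (m := 0) (Bd.add (n := 0) (m := 0) (Bd.add (n := 0) (m := 0) (Bd.add (n := 0) (m := 0) ((Bd.add (n := 0) (m := 0) b0y.mono b0u.mono).mul b1u11).mono (b0u1.mul b1u1).mono).mono (b0w.mul b1u12).mono).mono (b0w1.mul b1u2).mono).mono b1w1.mono)).mono)).mono)))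
    (Zr.of_eq (z1.D1.mul (-Ep 1)) (by
    simp only [eq1]
    simp only [map_add, map_sub, map_neg, map_zero, Derivation.leibniz, smul_eq_mul, D10, D20, D21, DD_kc, DD_Ep, D0_yy, D1_yy, D2_yy, D0_aa, D1_aa, D0_bb, D1_bb, D02_aa, D12_aa, D02_bb, D12_bb, D022_aa, D122_aa, D022_bb, D122_bb, DD_2, DD_3, DD_4, DD_6, Derivation.map_one_eq_zero, D2_bb, mul_zero, zero_mul, add_zero, zero_add, sub_zero, mul_one, one_mul]
    ring)))

lemma gw122 : Ng 1 (Ep 1 * D1 (D2 (D2 ww)) : Sm (Cfg q)) :=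
  Ng.divν (Ng.zr (G := Ep 1 * Ep (-2) * D1 (D2 pp) + bb * (Ep 1 * D0 (D1 ww)) - Mu * (Ep 1 * D1 (D1 (D1 ww))) - La * (Ep 1 * D1 (D1 (D2 uu))) + Ep 1 * (D1 ff * B2 + ff * D0 (D1 ww) + RR * ((yy + uu) * D1 (D1 ww) + D1 uu * D1 ww + ww * D1 (D2 ww) + D1 ww * D2 ww)))
    ((((gpi12.conv.add
    ((gwt1.up).mulB (b0b.mono))).sub
    ((gw111.up).mulB ((bd_k _).mono))).sub
    ((gu112.up).mulB ((bd_k _).mono))).add (G := Ep 1 * Ep (-2) * D1 (D2 pp) + bb * (Ep 1 * D0 (D1 ww)) - Mu * (Ep 1 * D1 (D1 (D1 ww))) - La * (Ep 1 * D1 (D1 (D2 uu))))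
    (H := Ep 1 * (D1 ff * B2 + ff * D0 (D1 ww) + RR * ((yy + uu) * D1 (D1 ww) + D1 uu * D1 ww + ww * D1 (D2 ww) + D1 ww * D2 ww)))
    (Ng.small (((bd_E 1).mul (Bd.add (n := -1) (m := 0) (Bd.add (n := -1) (m := 0) (b0f1.mul b1B2).mono (b0f.mul b1wt1).mono).mono (b0R.mul (Bd.add (n := 0) (m := 0) (Bd.add (n := 0) (m := 0) (Bd.add (n := 0) (m := 0) ((Bd.add (n := 0) (m := 0) b0y.mono b0u.mono).mul b1w11).mono (b0u1.mul b1w1).mono).mono (b0w.mul b1w12).mono).mono (b0w1.mul b1w2).mono)).mono)).mono)))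
    (Zr.of_eq (z2.D1.mul (-Ep 1)) (by
    simp only [eq2]
    simp only [map_add, map_sub, map_neg, map_zero, Derivation.leibniz, smul_eq_mul, D10, D20, D21, DD_kc, DD_Ep, D0_yy, D1_yy, D2_yy, D0_aa, D1_aa, D0_bb, D1_bb, D02_aa, D12_aa, D02_bb, D12_bb, D022_aa, D122_aa, D022_bb, D122_bb, DD_2, DD_3, DD_4, DD_6, Derivation.map_one_eq_zero, D2_bb, mul_zero, zero_mul, add_zero, zero_add, sub_zero, mul_one, one_mul]
    ring)))

lemma gu222 : Ng 1 (Ep 1 * D2 (D2 (D2 uu)) : Sm (Cfg q)) :=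
  Ng.div hcμ (Ng.zr (G := Ep 1 * Ep (-2) * D1 (D2 pp) + bb * (Ep 1 * D0 (D2 uu)) - (Mu + La) * (Ep 1 * D1 (D1 (D2 uu))) - La * (Ep 1 * D1 (D2 (D2 ww))) + Ep 1 * ((D2 bb + D2 ff) * B1 + ff * D0 (D2 uu) + RR * ((yy + uu) * D1 (D2 uu) + (1 + D2 uu) * D1 uu + ww * D2 (D2 uu) + D2 ww * D2 uu + D2 ww)))
    ((((gpi12.conv.add
    ((gut2.up).mulB (b0b.mono))).sub
    ((gu112.up).mulB (((bd_k _).mono).add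
    ((bd_k _).mono)))).sub
    ((gw122).mulB ((bd_k _).mono))).add (G := Ep 1 * Ep (-2) * D1 (D2 pp) + bb * (Ep 1 * D0 (D2 uu)) - (Mu + La) * (Ep 1 * D1 (D1 (D2 uu))) - La * (Ep 1 * D1 (D2 (D2 ww))))
    (H := Ep 1 * ((D2 bb + D2 ff) * B1 + ff * D0 (D2 uu) + RR * ((yy + uu) * D1 (D2 uu) + (1 + D2 uu) * D1 uu + ww * D2 (D2 uu) + D2 ww * D2 uu + D2 ww)))
    (Ng.small (((bd_E 1).mul (Bd.add (n := -1) (m := 0) (Bd.add (n := -1) (m := 0) ((Bd.add (n := 0) (m := 1) b0b2.mono b0f2.mono).mul b1B1).mono (b0f.mul b1ut2).mono).mono (b0R.mul (Bd.add (n := 0) (m := 0) (Bd.add (n := 0) (m := 0) (Bd.add (n := 0) (m := 0) (Bd.add (n := 0) (m := 0) ((Bd.add (n := 0) (m := 0) b0y.mono b0u.mono).mul b1u12).mono ((Bd.add (n := -1) (m := 0) bd_1.mono b0u2.mono).mul b1u1).mono).mono (b0w.mul b1u22).mono).mono (b0w2.mul b1u2).mono).mono b1w2.mono)).mono)).mo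no)))
    (Zr.of_eq (z1.D2.mul (-Ep 1)) (by
    simp only [eq1]
    simp only [map_add, map_sub, map_neg, map_zero, Derivation.leibniz, smul_eq_mul, D10, D20, D21, DD_kc, DD_Ep, D0_yy, D1_yy, D2_yy, D0_aa, D1_aa, D0_bb, D1_bb, D02_aa, D12_aa, D02_bb, D12_bb, D022_aa, D122_aa, D022_bb, D122_bb, DD_2, DD_3, DD_4, DD_6, Derivation.map_one_eq_zero, D2_bb, mul_zero, zero_mul, add_zero, zero_add, sub_zero, mul_one, one_mul]
    ring)))

lemma gf22 : Ng 2 (Ep (-1) * D2 (D2 ff) : Sm (Cfg q)) :=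
  Nf.prim fun c t ht => prim2 c t

lemma gpi22 : Ng 2 (Ep (-1) * D2 (D2 pp) : Sm (Cfg q)) :=
  Ng.zr (G := aa * (Ep (-1) * D2 (D2 ff)) + bb * (Ep (-1) * D2 (D2 hh)) + Ep (-1) * (2 * D2 aa * D2 ff + 2 * D2 bb * D2 hh + D2 (D2 aa) * ff + D2 (D2 bb) * hh + D2 (D2 ff) * hh + 2 * D2 ff * D2 hh + ff * D2 (D2 hh)))
    ((((gf22).mulB (b0a.mono)).add
    ((gh22.up).mulB (b0b.mono))).add (G := aa * (Ep (-1) * D2 (D2 ff)) + bb * (Ep (-1) * D2 (D2 hh)))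
    (H := Ep (-1) * (2 * D2 aa * D2 ff + 2 * D2 bb * D2 hh + D2 (D2 aa) * ff + D2 (D2 bb) * hh + D2 (D2 ff) * hh + 2 * D2 ff * D2 hh + ff * D2 (D2 hh)))
    (Ng.small (((bd_E (-1)).mul (Bd.add (n := 2) (m := 2) (Bd.add (n := 2) (m := 2) (Bd.add (n := 2) (m := 2) (Bd.add (n := 2) (m := 2) (Bd.add (n := 2) (m := 2) (Bd.add (n := 2) (m := 2) (((bd_n 2).mul b0a2).mul b1f2).mono (((bd_n 2).mul b0b2).mul b1h2).mono).mono (b0a22.mul b1f).mono).mono (b0b22.mul b1h).mono).mono (b1f22.mul b0h).mono).mono (((bd_n 2).mul b0f2).mul b1h2).mono).mono (b0f.mul b1h22).mono)).mono)))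
    ((zM.mul 0).of_eq (by
    simp only [map_add, map_sub, map_neg, map_zero, Derivation.leibniz, smul_eq_mul, D10, D20, D21, DD_kc, DD_Ep, D0_yy, D1_yy, D2_yy, D0_aa, D1_aa, D0_bb, D1_bb, D02_aa, D12_aa, D02_bb, D12_bb, D022_aa, D122_aa, D022_bb, D122_bb, DD_2, DD_3, DD_4, DD_6, Derivation.map_one_eq_zero, D2_bb, mul_zero, zero_mul, add_zero, zero_add, sub_zero, mul_one, one_mul]
    linear_combination (0) * (ab1 : (aa * bb : Sm (Cfg q)) = 1)))

lemma gw222 : Ng 2 (Ep 1 * D2 (D2 (D2 ww)) : Sm (Cfg q)) :=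
  Ng.divν (Ng.zr (G := Ep 1 * Ep (-2) * D2 (D2 pp) + bb * (Ep 1 * D0 (D2 ww)) - Mu * (Ep 1 * D1 (D1 (D2 ww))) - La * (Ep 1 * D1 (D2 (D2 uu))) + Ep 1 * ((D2 bb + D2 ff) * B2 + ff * D0 (D2 ww) + RR * ((yy + uu) * D1 (D2 ww) + (1 + D2 uu) * D1 ww + ww * D2 (D2 ww) + D2 ww * D2 ww)))
    ((((gpi22.conv.add
    ((gwt2.up).mulB (b0b.mono))).sub
    ((gw112.up).mulB ((bd_k _).mono))).sub
    ((gu122.up).mulB ((bd_k _).mono))).add (G := Ep 1 * Ep (-2) * D2 (D2 pp) + bb * (Ep 1 * D0 (D2 ww)) - Mu * (Ep 1 * D1 (D1 (D2 ww))) - La * (Ep 1 * D1 (D2 (D2 uu))))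
    (H := Ep 1 * ((D2 bb + D2 ff) * B2 + ff * D0 (D2 ww) + RR * ((yy + uu) * D1 (D2 ww) + (1 + D2 uu) * D1 ww + ww * D2 (D2 ww) + D2 ww * D2 ww)))
    (Ng.small (((bd_E 1).mul (Bd.add (n := -1) (m := 0) (Bd.add (n := -1) (m := 0) ((Bd.add (n := 0) (m := 1) b0b2.mono b0f2.mono).mul b1B2).mono (b0f.mul b1wt2).mono).mono (b0R.mul (Bd.add (n := 0) (m := 0) (Bd.add (n := 0) (m := 0) (Bd.add (n := 0) (m := 0) ((Bd.add (n := 0) (m := 0) b0y.mono b0u.mono).mul b1w12).mono ((Bd.add (n := -1) (m := 0) bd_1.mono b0u2.mono).mul b1w1).mono).mono (b0w.mul b1w22).mono).mono (b0w2.mul b1w2).mono)).mono)).mono)))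
    (Zr.of_eq (z2.D2.mul (-Ep 1)) (by
    simp only [eq2]
    simp only [map_add, map_sub, map_neg, map_zero, Derivation.leibniz, smul_eq_mul, D10, D20, D21, DD_kc, DD_Ep, D0_yy, D1_yy, D2_yy, D0_aa, D1_aa, D0_bb, D1_bb, D02_aa, D12_aa, D02_bb, D12_bb, D022_aa, D122_aa, D022_bb, D122_bb, DD_2, DD_3, DD_4, DD_6, Derivation.map_one_eq_zero, D2_bb, mul_zero, zero_mul, add_zero, zero_add, sub_zero, mul_one, one_mul]
    ring)))

lemma DT_eq (c : Cfg q) (t : ℝ) : DT c t = (jl.map fun p => I c t (Ep (-p.1) * p.2 * (Ep (-p.1) * p.2))).sum := by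
  unfold DT QQ
  rw [map_list_sum, List.map_map]
  congr 1
  refine List.map_congr_left fun p hp => ?_
  rw [I_Ep_sq, Function.comp, I_Ep]
  congr 2; ring
lemma Nf.list {k : ℕ} (l : List (ℤ × Sm (Cfg q))) (h : ∀ p ∈ l, Ng k (Ep (-p.1) * p.2)) :
    Nf k fun c t => (l.map fun p => I c t (Ep (-p.1) * p.2 * (Ep (-p.1) * p.2))).sum := by
  induction l with
  | nil => exact Nf.prim fun c t ht => by simpa using Yl_nonneg c t k
  | cons p l ih =>
    simp only [List.map_cons, List.sum_cons]
    exact Nf.add (h p List.mem_cons_self) (ih fun r hr => h r (List.mem_cons_of_mem _ hr))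
lemma Ng_cons {k : ℕ} {p : ℤ × Sm (Cfg q)} {l : List (ℤ × Sm (Cfg q))} (h : Ng k (Ep (-p.1) * p.2)) (h' : ∀ p ∈ l, Ng k (Ep (-p.1) * p.2)) :
    ∀ r ∈ p :: l, Ng k (Ep (-r.1) * r.2) := List.forall_mem_cons.2 ⟨h, h'⟩
lemma Ng_jl : ∀ p ∈ (jl : List (ℤ × Sm (Cfg q))), Ng 2 (Ep (-p.1) * p.2) := by
  unfold jl
  refine Ng_cons gu.up ?_
  refine Ng_cons gw.up ?_
  refine Ng_cons gu1.up ?_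
  refine Ng_cons gu2.up ?_
  refine Ng_cons gw1.up ?_
  refine Ng_cons gw2.up ?_
  refine Ng_cons gu11.up ?_
  refine Ng_cons gu12.up ?_
  refine Ng_cons gu22.up ?_
  refine Ng_cons gw11.up ?_
  refine Ng_cons gw12.up ?_
  refine Ng_cons gw22.up ?_
  refine Ng_cons gu111.up ?_
  refine Ng_cons gu112.up ?_
  refine Ng_cons gu122.up ?_
  refine Ng_cons gu222.up ?_
  refine Ng_cons gw111.up ?_
  refine Ng_cons gw112.up ?_
  refine Ng_cons gw122.up ?_
  refine Ng_cons gw222 ?_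
  refine Ng_cons gut.up ?_
  refine Ng_cons gut1.up ?_
  refine Ng_cons gut2.up ?_
  refine Ng_cons gwt.up ?_
  refine Ng_cons gwt1.up ?_
  refine Ng_cons gwt2.up ?_
  refine Ng_cons gf.up ?_
  refine Ng_cons gf1.up ?_
  refine Ng_cons gf2.up ?_
  refine Ng_cons gf11.up ?_
  refine Ng_cons gf12.up ?_
  refine Ng_cons gf22 ?_
  refine Ng_cons gft.up ?_
  refine Ng_cons gh.up ?_
  refine Ng_cons gh1.up ?_
  refine Ng_cons gh2.up ?_
  refine Ng_cons gh11.up ?_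
  refine Ng_cons gh12.up ?_
  refine Ng_cons gh22.up ?_
  refine Ng_cons gh111.up ?_
  refine Ng_cons gh112.up ?_
  refine Ng_cons gh122.up ?_
  refine Ng_cons gh222.up ?_
  refine Ng_cons ght.up ?_
  refine Ng_cons ght1.up ?_
  refine Ng_cons ght2.up ?_
  exact fun p hp => absurd hp (List.not_mem_nil)
lemma DT_le : ∃ C : ℝ, 0 ≤ C ∧ ∀ c : Cfg q, ∀ t ∈ Set.Icc 0 c.T, DT c t ≤ C * (Yl 2 c t + dl c * DT c t) := by
  obtain ⟨C, hC, h⟩ := Nf.list _ (Ng_jl (q := q)) (1 / 2) (by norm_num)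
  refine ⟨2 * C, by positivity, fun c t ht => ?_⟩
  have := h c t ht
  beta_reduce at this
  rw [← DT_eq] at this
  linarith

end

section
set_option linter.all false
variable {q : Par}

/-! ### Energy inequalities -/

def Zq (q : Par) : ℝ := 1 + (1 + cg q) * cK q
/-- Smallness threshold for the Reynolds number. -/
def Zc (q : Par) : ℝ := 1000 * (1 + cA q + cA q ^ 2) * Zq q
lemma cg_pos (q : Par) : 0 < cg q := inv_pos.2 (by linarith [q.hγ])
lemma Zq_ge (q : Par) : 1 ≤ Zq q := by
  have := cg_pos q; have := cK_pos q; unfold Zq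
  have : 0 ≤ (1 + cg q) * cK q := by positivity
  linarith
lemma kxy {k B X Y : ℝ} (h : |k| ≤ B) : k * X * Y ≤ B / 2 * (X * X + Y * Y) := by
  have h1 : k * X * Y ≤ |k| * |X * Y| := by rw [← abs_mul, mul_assoc]; exact le_abs_self _
  have h2 : |X * Y| ≤ (X * X + Y * Y) / 2 := by
    rw [abs_le]; constructor <;> nlinarith [sq_nonneg (X + Y), sq_nonneg (X - Y)]
  have h3 : |k| * |X * Y| ≤ B * ((X * X + Y * Y) / 2) := mul_le_mul h h2 (abs_nonneg _) ((abs_nonneg _).trans h)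
  linarith
lemma bμ_ge (hμ : Zc q ≤ cμ q) (c : Cfg q) (t : ℝ) {x : ℝ × ℝ} (hx : x ∈ Ω) : 1000 * Zq q ≤ cμ q ∧ 1000 * Zq q ≤ ev c (t, x) bb * cμ q := by
  have h1 := cA_pos q
  have h2 := Zq_ge q
  have h3 := (bb_bd c t hx).1
  have h4 : 1000 * cA q * Zq q ≤ cμ q := by refine le_trans ?_ hμ; unfold Zc; nlinarith [mul_nonneg (sq_nonneg (cA q)) (zero_le_one.trans h2)]
  have h5 : 1000 * Zq q ≤ cμ q := by
    refine le_trans ?_ hμ; unfold Zc; nlinarith [mul_nonneg (sq_nonneg (cA q)) (zero_le_one.trans h2), mul_nonneg h1.le (zero_le_one.trans h2)]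
  refine ⟨h5, ?_⟩
  calc 1000 * Zq q = (cA q)⁻¹ * (1000 * cA q * Zq q) := by field_simp
    _ ≤ _ := mul_le_mul h3 h4 (by positivity) ((inv_pos.2 h1).le.trans h3)
lemma bκ_ge (hκ : Zc q ≤ cκ q) (c : Cfg q) (t : ℝ) {x : ℝ × ℝ} (hx : x ∈ Ω) :
    1000 * Zq q ≤ ev c (t, x) bb * cκ q ∧ 1000 * Zq q ≤ ev c (t, x) bb * ev c (t, x) bb * cκ q := by
  have h1 := cA_pos q
  have h2 := Zq_ge q
  have h3 := (bb_bd c t hx).1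
  have h4 : 1000 * cA q * Zq q ≤ cκ q := by refine le_trans ?_ hκ; unfold Zc; nlinarith [mul_nonneg (sq_nonneg (cA q)) (zero_le_one.trans h2)]
  have h5 : 1000 * cA q ^ 2 * Zq q ≤ cκ q := by
    refine le_trans ?_ hκ; unfold Zc; nlinarith [mul_nonneg (sq_nonneg (cA q)) (zero_le_one.trans h2), mul_nonneg h1.le (zero_le_one.trans h2)]
  have h6 := (inv_pos.2 h1).le.trans h3
  constructor
  · calc 1000 * Zq q = (cA q)⁻¹ * (1000 * cA q * Zq q) := by field_simp
      _ ≤ _ := mul_le_mul h3 h4 (by positivity) h6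
  · calc 1000 * Zq q = (cA q)⁻¹ * (cA q)⁻¹ * (1000 * cA q ^ 2 * Zq q) := by field_simp
      _ ≤ _ := mul_le_mul (mul_le_mul h3 h3 (inv_pos.2 h1).le h6) h5 (by positivity) (mul_nonneg h6 h6)
lemma ev_two (c : Cfg q) (v : V) : ev c v 2 = 2 := map_ofNat _ 2
lemma ev_three (c : Cfg q) (v : V) : ev c v 3 = 3 := map_ofNat _ 3
lemma ev_six (c : Cfg q) (v : V) : ev c v 6 = 6 := map_ofNat _ 6

lemma ev_sq (c : Cfg q) (v : V) (G : Sm (Cfg q)) : 0 ≤ ev c v G * ev c v G := mul_self_nonneg _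

def e0 : Sm (Cfg q) := Ep (-2) * Ep (-2) * (3 * aa * ff * ff - aa * aa * ff * ff * ff) + 3 * Ep (-2) * bb * RR * (uu * uu + ww * ww) + 3 * Ep (-2) * Ep (-2) * Cg * bb * bb * RR * hh * hh
def et : Sm (Cfg q) := eng (D0 ff) (D0 uu) (D0 ww) (D0 hh)
def ex : Sm (Cfg q) := eng (D1 (D1 ff)) (D1 (D1 uu)) (D1 (D1 ww)) (D1 (D1 hh))

lemma I_kc (c : Cfg q) (t x : ℝ) (G : Sm (Cfg q)) : I c t (kc x * G) = x * I c t G := by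
  unfold kc; exact I_cst_mul c t (fun _ => x) G

/-- Poincaré inequality for the three unknowns. -/
lemma poin3 (c : Cfg q) (t : ℝ) (ht : t ∈ Set.Icc 0 c.T) {U W H : Sm (Cfg q)} (hU : Zb U) (hW : Zb W) (hH : Zb H) {α β : ℝ}
    (hα : 0 ≤ α) (hβ : 0 ≤ β) : α * (I c t (U * U) + I c t (W * W)) + β * I c t (H * H) ≤
      16 * (α * (I c t (D1 U * D1 U) + I c t (D2 U * D2 U) + I c t (D1 W * D1 W) + I c t (D2 W * D2 W))
        + β * (I c t (D1 H * D1 H) + I c t (D2 H * D2 H))) := by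
  have h1 := poincare2 c t U (fun x => hU c t ht x 0 (by simp))
  have h2 := poincare2 c t W (fun x => hW c t ht x 0 (by simp))
  have h3 := poincare2 c t H (fun x => hH c t ht x 0 (by simp))
  have h4 := I_sq_nonneg c t (D1 U)
  have h5 := I_sq_nonneg c t (D1 W)
  have h6 := I_sq_nonneg c t (D1 H)
  have h7 : I c t (U * U) + I c t (W * W) ≤ 16 * (I c t (D1 U * D1 U) + I c t (D2 U * D2 U) + I c t (D1 W * D1 W) + I c t (D2 W * D2 W)) := by linarith
  have h8 : I c t (H * H) ≤ 16 * (I c t (D1 H * D1 H) + I c t (D2 H * D2 H)) := by linarith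
  have := mul_le_mul_of_nonneg_left h7 hα
  have := mul_le_mul_of_nonneg_left h8 hβ
  linarith

lemma E0_ineq (hμ : Zc q ≤ cμ q) (hκ : Zc q ≤ cκ q) : ∃ C : ℝ, 0 ≤ C ∧ ∀ c : Cfg q, ∀ t ∈ Set.Icc 0 c.T,
    I c t (D0 e0) ≤ - I c t P0 + C * (dl c * DT c t) := by
  obtain ⟨C, hC, h⟩ := (en0 (q := q)).int
  refine ⟨C, hC, fun c t ht => (h c t ht).trans ?_⟩
  clear h
  have hZ := Zq_ge q
  have hP := P0_nonneg c t
  have hε := c.hε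
  have h1 : I c t (kc (1000 * Zq q) * P0) ≤ I c t (6 * Ep (-2) * bb * (Mu * (D1 uu * D1 uu + D2 uu * D2 uu + D1 ww * D1 ww + D2 ww * D2 ww) + La * dv * dv) + 6 * Ep (-2) * Ep (-2) * Ka * bb * bb * (D1 hh * D1 hh + D2 hh * D2 hh)) := by
    refine I_mono fun x hx => ?_
    have hm := (bμ_ge hμ c t hx).2
    have hk := (bκ_ge hκ c t hx).2
    have hb : 0 < ev c (t, x) bb := (inv_pos.2 (cA_pos q)).trans_le (bb_bd c t hx).1
    have hl : 0 < cl q := hcl'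
    have n := ev_sq c (t, x)
    have n1 := n (D1 uu); have n2 := n (D2 uu); have n3 := n (D1 ww); have n4 := n (D2 ww); have n5 := n (D1 hh); have n6 := n (D2 hh); have n7 := n dv
    simp only [P0, map_add, map_mul, ev_kc, ev_Ep, ev_six] at *
    have p : 0 < c.ε ^ (-2 : ℤ) := Ep_pos c (-2)
    generalize c.ε ^ (-2 : ℤ) = E at *
    generalize ev c (t, x) bb = b at *
    generalize hA : ev c (t, x) (D1 uu) * ev c (t, x) (D1 uu) + ev c (t, x) (D2 uu) * ev c (t, x) (D2 uu) + ev c (t, x) (D1 ww) * ev c (t, x) (D1 ww) + ev c (t, x) (D2 ww) * ev c (t, x) (D2 ww) = A at *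
    generalize hB : ev c (t, x) (D1 hh) * ev c (t, x) (D1 hh) + ev c (t, x) (D2 hh) * ev c (t, x) (D2 hh) = B at *
    have hA0 : 0 ≤ A := by linarith
    have hB0 : 0 ≤ B := by linarith
    have k1 := mul_le_mul_of_nonneg_right hm (mul_nonneg p.le hA0)
    have k2 := mul_le_mul_of_nonneg_right hk (mul_nonneg (mul_nonneg p.le p.le) hB0)
    have k3 : 0 ≤ 6 * E * b * (cl q * ((ev c (t, x) (D1 uu) + ev c (t, x) (D2 ww)) * (ev c (t, x) (D1 uu) + ev c (t, x) (D2 ww)))) := by positivity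
    have k4 : 0 ≤ 1000 * Zq q * (E * A) := by positivity
    have k5 : 0 ≤ 1000 * Zq q * (E * E * B) := by positivity
    nlinarith
  have h2 : I c t (6 * Ep (-2) * Ep (-2) * D2 bb * (1 + Cg) * bb * hh * ww - 6 * Ep (-2) * bb * bb * uu * ww) ≤
      I c t (kc (24 * Zq q) * (Ep (-2) * (uu * uu + ww * ww) + Ep (-4) * (hh * hh))) := by
    refine I_mono fun x hx => ?_
    have hb := bb_bd c t hx
    have hb0 : 0 < ev c (t, x) bb := (inv_pos.2 (cA_pos q)).trans_le hb.1
    have ha := aa'_bd c t hx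
    have e1 : c.ε ^ (-2 : ℤ) = c.ε⁻¹ * c.ε⁻¹ := by rw [zpow_neg]; field_simp
    have e2 : c.ε ^ (-4 : ℤ) = c.ε⁻¹ * c.ε⁻¹ * (c.ε⁻¹ * c.ε⁻¹) := by rw [zpow_neg]; field_simp
    have hs : |c.ε⁻¹ * ev c (t, x) (D2 aa)| ≤ cK q := by
      rw [abs_mul, abs_of_pos (inv_pos.2 hε), inv_mul_le_iff₀ hε]; linarith
    simp only [D2_bb, map_add, map_sub, map_mul, map_neg, map_one, ev_kc, ev_Ep, ev_six, e1, e2]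
    generalize c.ε⁻¹ = s at *
    generalize ev c (t, x) (D2 aa) = a' at *
    generalize ev c (t, x) bb = b at *
    generalize ev c (t, x) uu = u at *
    generalize ev c (t, x) ww = w at *
    generalize ev c (t, x) hh = h at *
    have hg := cg_pos q
    have hK := cK_pos q
    have hb3 : b * b * b ≤ 8 := by
      have : b * b ≤ 4 := by nlinarith [hb.2]
      nlinarith [hb.2]
    have k1 : |(-6 * (1 + cg q)) * ((s * a') * (b * b * b))| ≤ 48 * ((1 + cg q) * cK q) := by
      rw [abs_mul, abs_mul (s * a'), abs_of_pos (a := b * b * b) (by positivity), abs_of_neg (a := -6 * (1 + cg q)) (by nlinarith)]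
      have : |s * a'| * (b * b * b) ≤ cK q * 8 := mul_le_mul hs hb3 (by positivity) hK.le
      nlinarith
    have k2 : |-6 * (b * b)| ≤ 24 := by rw [abs_mul, abs_of_pos (a := b * b) (by positivity)]; norm_num; nlinarith [hb.2]
    have k3 := kxy (X := s * s * h) (Y := s * w) k1
    have k4 := kxy (X := s * u) (Y := s * w) k2
    have k5 : Zq q = 1 + (1 + cg q) * cK q := rfl
    have k6 : 0 ≤ (1 + cg q) * cK q := by positivity
    rw [k5]
    generalize (1 + cg q) * cK q = B at *
    nlinarith [mul_nonneg k6 (mul_self_nonneg (s * u)), mul_self_nonneg (s * u), mul_self_nonneg (s * w), mul_self_nonneg (s * s * h)]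
  have h3 := poin3 c t ht bu bw bh (Ep_pos c (-2)).le (Ep_pos c (-4)).le
  have h4 : I c t P0 = c.ε ^ (-2 : ℤ) * (I c t (D1 uu * D1 uu) + I c t (D2 uu * D2 uu) + I c t (D1 ww * D1 ww) + I c t (D2 ww * D2 ww))
        + c.ε ^ (-4 : ℤ) * (I c t (D1 hh * D1 hh) + I c t (D2 hh * D2 hh)) := by
    unfold P0; rw [Ep_mul]; norm_num1; simp only [map_add, I_Ep]
  rw [I_kc] at h1 h2
  simp only [map_add (I c t) (Ep _ * _) (Ep _ * _), I_Ep, map_add (I c t) (_ * _) (_ * _)] at h2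
  rw [← h4] at h3
  have h5 := mul_le_mul_of_nonneg_left h3 (show 0 ≤ 24 * Zq q by linarith)
  have h6 : I c t P0 ≤ Zq q * I c t P0 := by nlinarith
  nlinarith

lemma dsg_ge (hμ : Zc q ≤ cμ q) (hκ : Zc q ≤ cκ q) (c : Cfg q) (t : ℝ) (U W H : Sm (Cfg q)) :
    2000 * Zq q * I c t (Pg U W H) ≤ I c t (dsg U W H) := by
  rw [← I_kc]
  refine I_mono fun x hx => ?_
  have hm := (bμ_ge hμ c t hx).1
  have hk := (bκ_ge hκ c t hx).1
  have hl : 0 < cl q := hcl'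
  have n := ev_sq c (t, x)
  have n1 := n (D1 U); have n2 := n (D2 U); have n3 := n (D1 W); have n4 := n (D2 W); have n5 := n (D1 H); have n6 := n (D2 H)
  simp only [Pg, dsg, map_add, map_mul, ev_kc, ev_Ep, ev_two] at *
  have p : 0 < c.ε ^ (2 : ℤ) := Ep_pos c 2
  have pp' : c.ε ^ (2 : ℤ) * c.ε ^ (-2 : ℤ) = 1 := by rw [← zpow_add₀ c.hε.ne']; norm_num
  generalize c.ε ^ (-2 : ℤ) = E' at *
  generalize c.ε ^ (2 : ℤ) = E at *
  generalize ev c (t, x) bb = b at *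
  generalize hA : ev c (t, x) (D1 U) * ev c (t, x) (D1 U) + ev c (t, x) (D2 U) * ev c (t, x) (D2 U) + ev c (t, x) (D1 W) * ev c (t, x) (D1 W) + ev c (t, x) (D2 W) * ev c (t, x) (D2 W) = A at *
  generalize hB : ev c (t, x) (D1 H) * ev c (t, x) (D1 H) + ev c (t, x) (D2 H) * ev c (t, x) (D2 H) = B at *
  have hA0 : 0 ≤ A := by linarith
  have hB0 : 0 ≤ B := by linarith
  have k1 := mul_le_mul_of_nonneg_right hm (mul_nonneg p.le hA0)
  have k2 := mul_le_mul_of_nonneg_right hk hB0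
  have k3 : 0 ≤ 2 * E * (cl q * ((ev c (t, x) (D1 U) + ev c (t, x) (D2 W)) * (ev c (t, x) (D1 U) + ev c (t, x) (D2 W)))) := by
    have := mul_self_nonneg (ev c (t, x) (D1 U) + ev c (t, x) (D2 W)); positivity
  have k4 : 2 * E * (E' * (cκ q * b * B)) = 2 * (b * cκ q * B) := by linear_combination (2 * cκ q * b * B) * pp'
  linarith

lemma Ex_ineq (hμ : Zc q ≤ cμ q) (hκ : Zc q ≤ cκ q) : ∃ C : ℝ, 0 ≤ C ∧ ∀ c : Cfg q, ∀ t ∈ Set.Icc 0 c.T,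
    I c t (D0 ex) ≤ - I c t (Pg (D1 (D1 uu)) (D1 (D1 ww)) (D1 (D1 hh))) + C * (dl c * DT c t) := by
  obtain ⟨C, hC, h⟩ := (enxx (q := q)).int
  refine ⟨C, hC, fun c t ht => (h c t ht).trans ?_⟩
  have h1 := dsg_ge hμ hκ c t (D1 (D1 uu)) (D1 (D1 ww)) (D1 (D1 hh))
  have h2 := Pg_nonneg c t (D1 (D1 uu)) (D1 (D1 ww)) (D1 (D1 hh))
  have hZ := Zq_ge q
  rw [zero_mul, map_zero]
  nlinarith

lemma Et_ineq (hμ : Zc q ≤ cμ q) (hκ : Zc q ≤ cκ q) : ∃ C : ℝ, 0 ≤ C ∧ ∀ c : Cfg q, ∀ t ∈ Set.Icc 0 c.T,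
    I c t (D0 et) ≤ - I c t (Pg (D0 uu) (D0 ww) (D0 hh)) + C * (dl c * DT c t) := by
  obtain ⟨C, hC, h⟩ := (ent (q := q)).int
  refine ⟨C, hC, fun c t ht => (h c t ht).trans ?_⟩
  clear h
  have h1 := dsg_ge hμ hκ c t (D0 uu) (D0 ww) (D0 hh)
  have hP := Pg_nonneg c t (D0 uu) (D0 ww) (D0 hh)
  have hZ := Zq_ge q
  have hε := c.hε
  have h2 : I c t ((-2) * Ep 2 * bb * D0 ww * D0 uu - 2 * Ep 2 * Ep (-2) * Cg * D2 aa * bb * bb * D0 hh * D0 ww) ≤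
      I c t (kc (4 * Zq q) * (Ep 2 * (D0 uu * D0 uu + D0 ww * D0 ww) + D0 hh * D0 hh)) := by
    refine I_mono fun x hx => ?_
    have hb := bb_bd c t hx
    have hb0 : 0 < ev c (t, x) bb := (inv_pos.2 (cA_pos q)).trans_le hb.1
    have ha := aa'_bd c t hx
    have e1 : c.ε ^ (2 : ℤ) = c.ε * c.ε := by rw [zpow_ofNat]; ring
    have e2 : c.ε ^ (-2 : ℤ) = c.ε⁻¹ * c.ε⁻¹ := by rw [zpow_neg]; field_simp
    have hs : |c.ε⁻¹ * ev c (t, x) (D2 aa)| ≤ cK q := by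
      rw [abs_mul, abs_of_pos (inv_pos.2 hε), inv_mul_le_iff₀ hε]; linarith
    have e3 : c.ε * c.ε⁻¹ = 1 := mul_inv_cancel₀ hε.ne'
    simp only [map_add, map_sub, map_mul, map_neg, ev_kc, ev_Ep, ev_two, e1, e2]
    generalize c.ε⁻¹ = s at *
    generalize ev c (t, x) (D2 aa) = a' at *
    generalize ev c (t, x) bb = b at *
    generalize ev c (t, x) (D0 uu) = u at *
    generalize ev c (t, x) (D0 ww) = w at *
    generalize ev c (t, x) (D0 hh) = h at *
    generalize c.ε = e at *
    have hg := cg_pos q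
    have hK := cK_pos q
    have hb3 : b * b ≤ 4 := by nlinarith [hb.2]
    have k1 : |(-2 * cg q) * ((s * a') * (b * b))| ≤ 8 * (cg q * cK q) := by
      rw [abs_mul, abs_mul (s * a'), abs_of_pos (a := b * b) (by positivity), abs_of_neg (a := -2 * cg q) (by nlinarith)]
      have : |s * a'| * (b * b) ≤ cK q * 4 := mul_le_mul hs hb3 (by positivity) hK.le
      nlinarith
    have k2 : |-2 * b| ≤ 4 := by rw [abs_mul, abs_of_pos hb0]; norm_num; linarith [hb.2]
    have k3 := kxy (X := h) (Y := e * w) k1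
    have k4 := kxy (X := e * w) (Y := e * u) k2
    have k5 : Zq q = 1 + (1 + cg q) * cK q := rfl
    have k6 : 0 ≤ cg q * cK q := by positivity
    have k7 : -2 * (e * e) * b * w * u - 2 * (e * e) * (s * s) * cg q * a' * b * b * h * w =
      (-2 * b) * (e * w) * (e * u) + (-2 * cg q) * ((s * a') * (b * b)) * h * (e * w) := by
      linear_combination (-2 * e * s * cg q * a' * b * b * h * w) * e3
    rw [k7, k5]
    have k8 : (1 + cg q) * cK q = cK q + cg q * cK q := by ring
    rw [k8]
    generalize cg q * cK q = B at *
    nlinarith [mul_nonneg k6 (mul_self_nonneg (e * u)), mul_self_nonneg (e * u), mul_self_nonneg (e * w), mul_self_nonneg h,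
      mul_nonneg hK.le (mul_self_nonneg (e * u)), mul_nonneg hK.le (mul_self_nonneg (e * w)), mul_nonneg hK.le (mul_self_nonneg h)]
  have h3 := poin3 c t ht bu.D0 bw.D0 bh.D0 (Ep_pos c 2).le zero_le_one
  have h4 : I c t (Pg (D0 uu) (D0 ww) (D0 hh)) = c.ε ^ (2 : ℤ) * (I c t (D1 (D0 uu) * D1 (D0 uu)) + I c t (D2 (D0 uu) * D2 (D0 uu)) + I c t (D1 (D0 ww) * D1 (D0 ww)) + I c t (D2 (D0 ww) * D2 (D0 ww)))
        + 1 * (I c t (D1 (D0 hh) * D1 (D0 hh)) + I c t (D2 (D0 hh) * D2 (D0 hh))) := by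
    unfold Pg; simp only [map_add, I_Ep, one_mul]
  rw [I_kc, map_add (I c t), I_Ep, map_add (I c t)] at h2
  rw [← h4] at h3
  have h5 := mul_le_mul_of_nonneg_left h3 (show 0 ≤ 4 * Zq q by linarith)
  have h6 : I c t (Pg (D0 uu) (D0 ww) (D0 hh)) ≤ Zq q * I c t (Pg (D0 uu) (D0 ww) (D0 hh)) := by nlinarith
  nlinarith

end

section
set_option linter.all false
variable {q : Par}

/-- Normal-derivative estimate for the density, in absorbed form. -/
lemma En.nrm {k : ℕ} {F G e : Sm (Cfg q)} (h : En e (2 * Ep (-2) * F * F) (0 * ww - 2 * F * G)) (hG : Ng k (Ep 1 * G)) :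
    ∀ η : ℝ, 0 < η → ∃ C : ℝ, 0 ≤ C ∧ ∀ c : Cfg q, ∀ t ∈ Set.Icc 0 c.T,
      I c t (D0 e) ≤ - I c t (Ep (-2) * (F * F)) + η * DT c t + C * (Yl k c t + dl c * DT c t) := fun η hη => by
  obtain ⟨C, hC, h⟩ := h.int
  obtain ⟨C', hC', h'⟩ := hG η hη
  refine ⟨C + C', by positivity, fun c t ht => (h c t ht).trans ?_⟩
  have h1 := h' c t ht
  have h2 := I_sq_nonneg c t (Ep (-1) * F + Ep 1 * G)
  have e1 : (Ep (-1) * F + Ep 1 * G) * (Ep (-1) * F + Ep 1 * G) = Ep (-2) * (F * F) + (2 * F * G) + Ep 1 * G * (Ep 1 * G) := by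
    have a1 : (Ep (-1) * Ep (-1) : Sm (Cfg q)) = Ep (-2) := Ep_mul _ _
    have a2 : (Ep (-1) * Ep 1 : Sm (Cfg q)) = 1 := by rw [Ep_mul]; exact Ep_zero
    linear_combination (F * F) * a1 + (2 * F * G) * a2
  have e2 : (2 * Ep (-2) * F * F : Sm (Cfg q)) = Ep (-2) * (F * F) + Ep (-2) * (F * F) := by ring
  rw [e1] at h2
  rw [e2, zero_mul, zero_sub]
  simp only [map_add, map_neg] at *
  have h3 := mul_nonneg hC (Yl_nonneg c t k)
  linarith

def en0e : Sm (Cfg q) := (Mu + La) * D2 ff * D2 ff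
def en1e : Sm (Cfg q) := (Mu + La) * D1 (D2 ff) * D1 (D2 ff)
def en2e : Sm (Cfg q) := (Mu + La) * D2 (D2 ff) * D2 (D2 ff)

lemma b0bb : Bd 0 0 0 (bb * bb : Sm (Cfg q)) := (b0b.mul b0b).mono
lemma b0mb : Bd 0 0 0 (Mu * bb : Sm (Cfg q)) := ((bd_k _).mul b0b).mono

/-- The total energy. -/
def ET (K1 K2 : ℝ) : Sm (Cfg q) := kc K1 * (e0 + et + ex) + kc K2 * (en0e + en1e) + en2e

lemma main_alg {A1 A2 A3 Cs C3 K2 B0 B1 K1 Ca D l x1 x2 x3 p1 p2 p3 Z y0 y1 y2 M0 M1 N : ℝ} (hCs : 1 ≤ Cs) (hC3 : 0 ≤ C3) (hK2 : K2 = C3 + 1)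
    (hK1 : K1 = K2 * (B0 + B1) + C3 + 1) (hCa : Ca = K1 * (A1 + A2 + A3) + K2 * (B0 + B1) + C3) (hK1' : 1 ≤ K1) (hK2' : 1 ≤ K2) (hCa0 : 0 ≤ Ca)
    (hDn : 0 ≤ D) (hp : 0 ≤ l * D) (i1 : x1 ≤ - p1 + A1 * (l * D)) (i2 : x2 ≤ - p2 + A2 * (l * D)) (i3 : x3 ≤ - p3 + A3 * (l * D))
    (eZ : Z = p1 + p2 + p3) (j0 : y0 ≤ - M0 + 1 / (16 * Cs * K2) * D + B0 * (Z + l * D))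
    (j1 : y1 ≤ - M1 + 1 / (16 * Cs * K2) * D + B1 * (Z + l * D)) (j2 : y2 ≤ - N + 1 / (8 * Cs) * D + C3 * (Z + (M0 + M1) + l * D))
    (hD2 : D ≤ Cs * (Z + (M0 + M1) + N + l * D)) (hd : l ≤ 1 / (2 * Cs * (1 + Ca))) :
    K1 * (x1 + x2 + x3) + K2 * (y0 + y1) + y2 ≤ - (1 / (4 * Cs) * D) := by
  have s1 := mul_le_mul_of_nonneg_left (add_le_add (add_le_add i1 i2) i3) (zero_le_one.trans hK1')
  have s2 := mul_le_mul_of_nonneg_left (add_le_add j0 j1) (zero_le_one.trans hK2')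
  have hd2 : l * D ≤ 1 / (2 * Cs * (1 + Ca)) * D := mul_le_mul_of_nonneg_right hd hDn
  have hd3 : (1 + Ca) * (l * D) ≤ 1 / (2 * Cs) * D := by
    have := mul_le_mul_of_nonneg_left hd2 (show 0 ≤ 1 + Ca by linarith)
    refine this.trans (le_of_eq ?_)
    field_simp
  have hD3 : 1 / Cs * D ≤ Z + (M0 + M1) + N + l * D := by
    rw [one_div, inv_mul_le_iff₀ (by linarith)]; exact hD2
  have q1 : K2 * (1 / (16 * Cs * K2) * D) = 1 / 16 * (1 / Cs * D) := by field_simp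
  have q2 : 1 / (8 * Cs) * D = 1 / 8 * (1 / Cs * D) := by field_simp
  have q3 : 1 / (4 * Cs) * D = 1 / 4 * (1 / Cs * D) := by field_simp
  have q4 : 1 / (2 * Cs) * D = 1 / 2 * (1 / Cs * D) := by field_simp
  rw [q2] at j2
  rw [q4] at hd3
  rw [q3]
  generalize 1 / Cs * D = E at *
  generalize l * D = d at *
  generalize 1 / (16 * Cs * K2) * D = y at *
  clear hd hd2 hD2 q2 q3 q4
  have t1 : K1 * Z = K2 * (B0 + B1) * Z + C3 * Z + Z := by rw [hK1]; ring
  have t2 : Ca * d = K1 * (A1 + A2 + A3) * d + K2 * (B0 + B1) * d + C3 * d := by rw [hCa]; ring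
  have t3 : K2 * (M0 + M1) = C3 * (M0 + M1) + (M0 + M1) := by rw [hK2]; ring
  have t4 : K1 * Z = K1 * (p1 + p2 + p3) := by rw [eZ]
  linarith

lemma main_ineq (hμ : Zc q ≤ cμ q) (hκ : Zc q ≤ cκ q) : ∃ K1 K2 δ c0 : ℝ, 1 ≤ K1 ∧ 1 ≤ K2 ∧ 0 < δ ∧ 0 < c0 ∧
    ∀ c : Cfg q, dl c ≤ δ → ∀ t ∈ Set.Icc 0 c.T, I c t (D0 (ET K1 K2)) ≤ - (c0 * DT c t) := by
  obtain ⟨A1, hA1, i1⟩ := E0_ineq hμ hκ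
  obtain ⟨A2, hA2, i2⟩ := Et_ineq hμ hκ
  obtain ⟨A3, hA3, i3⟩ := Ex_ineq hμ hκ
  obtain ⟨Cs', hCs', hD⟩ := DT_le (q := q)
  obtain ⟨Cs, hCs, hCs1⟩ : ∃ Cs : ℝ, 1 ≤ Cs ∧ Cs' ≤ Cs := ⟨Cs' + 1, by linarith, by linarith⟩
  have g0 : Ng 0 (Ep 1 * (bb * bb * D0 ww) : Sm (Cfg q)) := (gwt.mulB b0bb).of_eq (by ring)
  have g1 : Ng 0 (Ep 1 * (bb * bb * D0 (D1 ww) + Mu * bb * (D1 (D1 (D2 uu)) - D1 (D1 (D1 ww))) + Ep (-2) * bb * bb * D1 (D2 hh)) : Sm (Cfg q)) :=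
    (((gwt1.mulB b0bb).add ((gu112.sub gw111).mulB b0mb)).add (gh12.conv.mulB b0bb)).of_eq (by ring)
  have g2 : Ng 1 (Ep 1 * (bb * bb * D0 (D2 ww) + Mu * bb * (D1 (D2 (D2 uu)) - D1 (D1 (D2 ww))) + Ep (-2) * bb * bb * D2 (D2 hh)) : Sm (Cfg q)) :=
    (((gwt2.mulB b0bb).up.add ((gu122.sub gw112.up).mulB b0mb)).add (gh22.conv.mulB b0bb).up).of_eq (by ring)
  have m0 : En (q := q) en0e (2 * Ep (-2) * D2 ff * D2 ff) (0 * ww - 2 * D2 ff * (bb * bb * D0 ww)) := by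
    have := enn0 (q := q)
    rwa [show (2 * bb * bb * D0 ww * D2 ff : Sm (Cfg q)) = 2 * D2 ff * (bb * bb * D0 ww) by ring] at this
  obtain ⟨C3, hC3, j2⟩ := (show En en2e _ _ from enn2 (q := q)).nrm g2 (1 / (8 * Cs)) (by positivity)
  obtain ⟨K2, hK2⟩ : ∃ K2 : ℝ, K2 = C3 + 1 := ⟨_, rfl⟩
  have hK2' : 1 ≤ K2 := by linarith
  have hη : 0 < 1 / (16 * Cs * K2) := by positivity
  obtain ⟨B0, hB0, j0⟩ := m0.nrm g0 (1 / (16 * Cs * K2)) hη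
  obtain ⟨B1, hB1, j1⟩ := (show En en1e _ _ from enn1 (q := q)).nrm g1 (1 / (16 * Cs * K2)) hη
  obtain ⟨K1, hK1⟩ : ∃ K1 : ℝ, K1 = K2 * (B0 + B1) + C3 + 1 := ⟨_, rfl⟩
  have hK1' : 1 ≤ K1 := by have : 0 ≤ K2 * (B0 + B1) := by positivity
                           linarith
  obtain ⟨Ca, hCa⟩ : ∃ Ca : ℝ, Ca = K1 * (A1 + A2 + A3) + K2 * (B0 + B1) + C3 := ⟨_, rfl⟩
  have hCa0 : 0 ≤ Ca := by rw [hCa]; positivity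
  refine ⟨K1, K2, 1 / (2 * Cs * (1 + Ca)), 1 / (4 * Cs), hK1', hK2', by positivity, by positivity, fun c hd t ht => ?_⟩
  have i1 := i1 c t ht; have i2 := i2 c t ht; have i3 := i3 c t ht
  have j0 := j0 c t ht; have j1 := j1 c t ht; have j2 := j2 c t ht
  have hD := hD c t ht
  have hDn := DT_nonneg c t
  have hp := ldD_nonneg c t
  have eY0 : Yl 0 c t = Zd c t := Yl_zero c t
  have eY1 : Yl 1 c t = Zd c t + (I c t (Ep (-2) * (D2 ff * D2 ff)) + I c t (Ep (-2) * (D1 (D2 ff) * D1 (D2 ff)))) := by simp [Yl]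
  have eY2 : Yl 2 c t = Zd c t + (I c t (Ep (-2) * (D2 ff * D2 ff)) + I c t (Ep (-2) * (D1 (D2 ff) * D1 (D2 ff))))
      + I c t (Ep (-2) * (D2 (D2 ff) * D2 (D2 ff))) := by simp [Yl]
  have eD : I c t (D0 (ET K1 K2)) = K1 * (I c t (D0 e0) + I c t (D0 et) + I c t (D0 ex)) + K2 * (I c t (D0 en0e) + I c t (D0 en1e)) + I c t (D0 en2e) := by
    simp only [ET, map_add, Derivation.leibniz, DD_kc, smul_eq_mul, smul_zero, mul_zero, add_zero, I_kc]
  have hY2 := Yl_nonneg c t 2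
  have hD2 : DT c t ≤ Cs * (Yl 2 c t + dl c * DT c t) := hD.trans (mul_le_mul_of_nonneg_right hCs1 (by linarith))
  have eZ : Zd c t = I c t P0 + I c t (Pg (D0 uu) (D0 ww) (D0 hh)) + I c t (Pg (D1 (D1 uu)) (D1 (D1 ww)) (D1 (D1 hh))) := rfl
  have hZ := Zd_nonneg c t
  rw [eY0] at j0 j1
  rw [eY1] at j2
  rw [eY2] at hD2
  rw [eD]
  exact main_alg hCs hC3 hK2 hK1 hCa hK1' hK2' hCa0 hDn hp i1 i2 i3 eZ j0 j1 j2 hD2 hd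
end

section
set_option linter.all false
variable {q : Par}

/-! ### Elliptic recovery of the second derivatives at a fixed time -/

/-- Quantities controlled by the energy, with weights. -/
def el : List (ℤ × Sm (Cfg q)) := [(-2, ff), (-2, hh), (-1, uu), (-1, ww), (0, D0 ff), (1, D0 uu), (1, D0 ww), (0, D0 hh),
  (0, D1 (D1 ff)), (1, D1 (D1 uu)), (1, D1 (D1 ww)), (0, D1 (D1 hh)), (0, D2 ff), (0, D1 (D2 ff)), (0, D2 (D2 ff))]
def EEs : Sm (Cfg q) := (el.map fun p => Ep p.1 * p.2 * (Ep p.1 * p.2)).sum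
def EE (c : Cfg q) (t : ℝ) : ℝ := I c t EEs
lemma EE_eq (c : Cfg q) (t : ℝ) : EE c t = (el.map fun p => I c t (Ep p.1 * p.2 * (Ep p.1 * p.2))).sum := by
  unfold EE EEs; rw [map_list_sum, List.map_map]; rfl
lemma EE_ge (c : Cfg q) (t : ℝ) {n : ℤ} {G : Sm (Cfg q)} (h : (n, G) ∈ el) : I c t (Ep n * G * (Ep n * G)) ≤ EE c t := by
  rw [EE_eq]
  refine List.single_le_sum (fun x hx => ?_) _ (List.mem_map.2 ⟨_, h, rfl⟩)
  obtain ⟨p, _, rfl⟩ := List.mem_map.1 hx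
  exact I_sq_nonneg _ _ _
lemma EE_nonneg (c : Cfg q) (t : ℝ) : 0 ≤ EE c t := (I_sq_nonneg _ _ _).trans (EE_ge c t (n := -2) (G := ff) (by simp [el]))
/-- Pure normal second derivatives. -/
def QE (c : Cfg q) (t : ℝ) : ℝ := I c t (Ep 1 * D2 (D2 uu) * (Ep 1 * D2 (D2 uu))) + I c t (Ep 1 * D2 (D2 ww) * (Ep 1 * D2 (D2 ww)))
  + I c t (Ep 0 * D2 (D2 hh) * (Ep 0 * D2 (D2 hh)))
lemma QE_ge (c : Cfg q) (t : ℝ) : 0 ≤ QE c t ∧ I c t (Ep 1 * D2 (D2 uu) * (Ep 1 * D2 (D2 uu))) ≤ QE c t + EE c t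
    ∧ I c t (Ep 1 * D2 (D2 ww) * (Ep 1 * D2 (D2 ww))) ≤ QE c t + EE c t ∧ I c t (Ep 0 * D2 (D2 hh) * (Ep 0 * D2 (D2 hh))) ≤ QE c t + EE c t := by
  have h1 := I_sq_nonneg c t (Ep 1 * D2 (D2 uu))
  have h2 := I_sq_nonneg c t (Ep 1 * D2 (D2 ww))
  have h3 := I_sq_nonneg c t (Ep 0 * D2 (D2 hh))
  have h4 := EE_nonneg c t
  unfold QE
  refine ⟨?_, ?_, ?_, ?_⟩ <;> linarith

def Wf (X : Cfg q → ℝ → ℝ) : Prop := ∀ η : ℝ, 0 < η → ∃ C : ℝ, 0 ≤ C ∧ ∀ c : Cfg q, ∀ t ∈ Set.Icc 0 c.T,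
  X c t ≤ η * QE c t + C * EE c t
/-- Weighted control by the energy, up to a small multiple of the normal second derivatives. -/
def W (n : ℤ) (G : Sm (Cfg q)) : Prop := Wf fun c t => I c t (Ep n * G * (Ep n * G))

section
variable {X X' : Cfg q → ℝ → ℝ} {G H : Sm (Cfg q)} {n : ℤ}

lemma Wf.le (h : Wf X) (C : ℝ) (hC : 0 < C) (hl : ∀ c : Cfg q, ∀ t ∈ Set.Icc 0 c.T, X' c t ≤ C * X c t) : Wf X' := fun η hη => by
  obtain ⟨C', hC', h⟩ := h (η / C) (by positivity)
  refine ⟨C * C', by positivity, fun c t ht => (hl c t ht).trans ?_⟩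
  refine (mul_le_mul_of_nonneg_left (h c t ht) hC.le).trans (le_of_eq ?_)
  field_simp
lemma Wf.add (h : Wf X) (h' : Wf X') : Wf fun c t => X c t + X' c t := fun η hη => by
  obtain ⟨C, hC, h⟩ := h (η / 2) (by positivity)
  obtain ⟨C', hC', h'⟩ := h' (η / 2) (by positivity)
  refine ⟨C + C', by positivity, fun c t ht => ?_⟩
  linear_combination h' c t ht + h c t ht
lemma Wf.lim (h : ∀ η : ℝ, 0 < η → ∃ X' : Cfg q → ℝ → ℝ, Wf X' ∧ ∀ c : Cfg q, ∀ t ∈ Set.Icc 0 c.T, X c t ≤ η * (QE c t + EE c t) + X' c t) :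
    Wf X := fun η hη => by
  obtain ⟨X', h1, h2⟩ := h (η / 2) (by positivity)
  obtain ⟨C, hC, h1⟩ := h1 (η / 2) (by positivity)
  refine ⟨C + η / 2, by positivity, fun c t ht => ?_⟩
  linear_combination h2 c t ht + h1 c t ht
lemma W.prim (h : (n, G) ∈ el) : W n G := fun η hη => ⟨1, zero_le_one, fun c t ht => by
  have := EE_ge c t h
  have := mul_nonneg hη.le (QE_ge c t).1
  linarith⟩
lemma W.of_eq (h : W n G) (e : H = G) : W n H := e ▸ h
lemma W.add (h : W n G) (h' : W n H) : W n (G + H) :=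
  (Wf.add h h').le 2 two_pos fun c t ht => by
    have := I_sq_nonneg c t (Ep n * G - Ep n * H)
    rw [show (Ep n * G - Ep n * H) * (Ep n * G - Ep n * H) = Ep n * G * (Ep n * G) - 2 * (Ep n * G * (Ep n * H)) + Ep n * H * (Ep n * H) by ring] at this
    rw [show Ep n * (G + H) * (Ep n * (G + H)) = Ep n * G * (Ep n * G) + 2 * (Ep n * G * (Ep n * H)) + Ep n * H * (Ep n * H) by ring]
    simp only [map_add, map_sub] at *
    linarith
lemma W.neg (h : W n G) : W n (-G) := by
  unfold W at *; simpa only [show ∀ A B : Sm (Cfg q), A * -B * (A * -B) = A * B * (A * B) from fun A B => by ring] using h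
lemma W.sub (h : W n G) (h' : W n H) : W n (G - H) := by
  rw [sub_eq_add_neg]; exact h.add h'.neg
lemma W.zr (h : W n G) (hz : Zr (H - G)) : W n H := Wf.le h 1 one_pos fun c t ht => by
  rw [one_mul]
  refine le_of_eq (I_congr fun x hx => ?_)
  have := hz c t ht x hx
  rw [map_sub] at this
  simp only [map_mul]
  rw [sub_eq_zero.1 this]
lemma W.mul {j m p : ℤ} {K : Sm (Cfg q)} (hK : Bd j m 0 K) (h : W n G) (h1 : 0 ≤ p - n + j := by decide) (h2 : 0 ≤ p - n + m := by decide) :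
    W p (K * G) := by
  obtain ⟨C, hC, hK⟩ := (((bd_E (p - n)).mul hK).mono (n' := 0) (m' := 0) h1 h2).le0
  refine Wf.le h (C ^ 2) (by positivity) fun c t ht => ?_
  rw [show Ep p * (K * G) = Ep (p - n) * K * (Ep n * G) by
    rw [show p = p - n + n by ring, ← Ep_mul, show p - n + n - n = p - n by ring]; ring]
  exact I_Bd_mul (hK c t ht)
lemma W.up {p : ℤ} (h : W n G) (h1 : 0 ≤ p - n + 0 := by decide) : W p G := (W.mul bd_1 h h1 h1).of_eq (one_mul _).symm
lemma W.div {x : ℝ} (hx : x ≠ 0) (h : W n (kc x * G)) : W n G :=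
  (W.mul (bd_k x⁻¹) h (by omega) (by omega)).of_eq (by
    have : (kc x⁻¹ * kc x : Sm (Cfg q)) = 1 := by apply Sm.ext'; intro c v; simp [hx]
    rw [← mul_assoc, this, one_mul])
lemma W.int1 (h : W (n - 1) G) (h' : W (n + 1) (D1 (D1 G))) : W n (D1 G) :=
  (Wf.add h h').le 1 (by norm_num) fun c t ht => by
  simp only [I_Ep_sq, one_mul]
  have := mul_le_mul_of_nonneg_left (interp1 c t (Ep_pos c (-2)) G) (Ep_pos c (2 * n)).le
  refine this.trans (le_of_eq ?_)
  have e1 : c.ε ^ (2 * (n - 1)) = c.ε ^ (2 * n) * c.ε ^ (-2 : ℤ) := by rw [← zpow_add₀ c.hε.ne']; congr 1; ring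
  have e2 : c.ε ^ (2 * (n + 1)) = c.ε ^ (2 * n) * (c.ε ^ (-2 : ℤ))⁻¹ := by
    rw [← zpow_neg, ← zpow_add₀ c.hε.ne']; congr 1; ring
  rw [e1, e2]; ring
lemma W.int2 (h : W (n - 1) G) (h' : ∀ (c : Cfg q) t, I c t (Ep (n + 1) * D2 (D2 G) * (Ep (n + 1) * D2 (D2 G))) ≤ QE c t + EE c t) :
    W n (D2 G) := by
  refine Wf.lim fun η hη => ?_
  set s : ℝ := min 1 (η / 1000) with hs
  have hs0 : 0 < s := lt_min one_pos (by positivity)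
  have hs1 : s ≤ 1 := min_le_left _ _
  have hs2 : s ≤ η / 1000 := min_le_right _ _
  refine ⟨_, Wf.le h (1000 * s⁻¹ ^ 2) (by positivity) fun _ _ _ => le_rfl, fun c t ht => ?_⟩
  have h1 := h' c t
  rw [I_Ep_sq] at h1
  have hse : s * c.ε ≤ 1 := by have := c.hε1; have := c.hε; nlinarith
  have := mul_le_mul_of_nonneg_left (interp2 c t (mul_pos hs0 c.hε) hse G) (Ep_pos c (2 * n)).le
  simp only [I_Ep_sq]
  refine this.trans ?_
  have e1 : c.ε ^ (2 * (n - 1)) = c.ε ^ (2 * n) * c.ε⁻¹ ^ 2 := by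
    rw [inv_pow, ← zpow_natCast, ← zpow_neg, ← zpow_add₀ c.hε.ne']; congr 1; push_cast; ring
  have e2 : c.ε ^ (2 * (n + 1)) = c.ε ^ (2 * n) * c.ε ^ 2 := by
    rw [← zpow_natCast, ← zpow_add₀ c.hε.ne']; congr 1; push_cast; ring
  rw [e2] at h1
  rw [e1]
  have h3 : 1000 * s ^ 2 * (c.ε ^ (2 * n) * c.ε ^ 2 * I c t (D2 (D2 G) * D2 (D2 G))) ≤ η * (QE c t + EE c t) := by
    have hD : 0 ≤ QE c t + EE c t := add_nonneg (QE_ge c t).1 (EE_nonneg c t)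
    have : 1000 * s ^ 2 ≤ η := by nlinarith
    exact (mul_le_mul_of_nonneg_left h1 (by positivity)).trans (mul_le_mul_of_nonneg_right this hD)
  rw [mul_inv, mul_pow, mul_pow]
  linarith
lemma W.mix (hb : Zb G) (h : W n (D1 (D1 G))) (h' : ∀ (c : Cfg q) t, I c t (Ep n * D2 (D2 G) * (Ep n * D2 (D2 G))) ≤ QE c t + EE c t) :
    W n (D1 (D2 G)) := by
  refine Wf.lim fun η hη => ⟨_, Wf.le h η⁻¹ (by positivity) fun _ _ _ => le_rfl, fun c t ht => ?_⟩
  have h1 := h' c t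
  have h2 := mul_le_mul_of_nonneg_left (mixed_bc c t (inv_pos.2 hη) G (fun x => hb.D1 c t ht x 0 (by simp)) (fun x => hb.D1 c t ht x 1 (by simp))) (Ep_pos c (2 * n)).le
  rw [inv_inv] at h2
  simp only [I_Ep_sq] at *
  linear_combination h2 + η * h1
end

lemma wf : W (-2) (ff : Sm (Cfg q)) := W.prim (by simp [el])
lemma wh : W (-2) (hh : Sm (Cfg q)) := W.prim (by simp [el])
lemma wu : W (-1) (uu : Sm (Cfg q)) := W.prim (by simp [el])
lemma ww' : W (-1) (ww : Sm (Cfg q)) := W.prim (by simp [el])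
lemma wu11 : W 1 (D1 (D1 uu) : Sm (Cfg q)) := W.prim (by simp [el])
lemma ww11 : W 1 (D1 (D1 ww) : Sm (Cfg q)) := W.prim (by simp [el])
lemma wh11 : W 0 (D1 (D1 hh) : Sm (Cfg q)) := W.prim (by simp [el])
lemma wf1 : W (-1) (D1 ff : Sm (Cfg q)) := W.int1 wf (W.prim (by simp [el]))
lemma wf2 : W (-1) (D2 ff : Sm (Cfg q)) := W.int2 wf fun c t => by
  have := EE_ge c t (n := 0) (G := D2 (D2 ff)) (by simp [el]); have := (QE_ge c t).1; norm_num1; linarith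
lemma wh1 : W (-1) (D1 hh : Sm (Cfg q)) := W.int1 wh wh11
lemma wh2 : W (-1) (D2 hh : Sm (Cfg q)) := W.int2 wh fun c t => (QE_ge c t).2.2.2
lemma wu1 : W 0 (D1 uu : Sm (Cfg q)) := W.int1 wu wu11
lemma wu2 : W 0 (D2 uu : Sm (Cfg q)) := W.int2 wu fun c t => (QE_ge c t).2.1
lemma ww1 : W 0 (D1 ww : Sm (Cfg q)) := W.int1 ww' ww11
lemma ww2 : W 0 (D2 ww : Sm (Cfg q)) := W.int2 ww' fun c t => (QE_ge c t).2.2.1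
lemma wu12 : W 1 (D1 (D2 uu) : Sm (Cfg q)) := W.mix bu wu11 fun c t => (QE_ge c t).2.1
lemma ww12 : W 1 (D1 (D2 ww) : Sm (Cfg q)) := W.mix bw ww11 fun c t => (QE_ge c t).2.2.1
lemma wh12 : W 0 (D1 (D2 hh) : Sm (Cfg q)) := W.mix bh wh11 fun c t => (QE_ge c t).2.2.2

lemma b0yu : Bd 0 0 0 (yy + uu : Sm (Cfg q)) := Bd.add b0y b0u.mono
lemma b0ah : Bd 0 0 0 (aa + hh : Sm (Cfg q)) := Bd.add b0a b0h.mono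
lemma b01p : Bd 0 0 0 (1 + pp : Sm (Cfg q)) := Bd.add bd_1 b0pi.mono
lemma wB1 : W 1 (B1 : Sm (Cfg q)) :=
  (((W.prim (by simp [el])).add (W.mul b0yu wu1)).add (W.mul b0w wu2)).add ww'.up
lemma wB2 : W 1 (B2 : Sm (Cfg q)) :=
  ((W.prim (by simp [el])).add (W.mul b0yu ww1)).add (W.mul b0w ww2)
lemma wB3 : W 0 (B3 : Sm (Cfg q)) :=
  (((W.prim (by simp [el])).add (W.mul b0yu wh1)).add (W.mul b0w wh2)).add ((W.mul b0a2 ww').of_eq (mul_comm _ _))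
lemma wp1 : W (-1) (D1 pp : Sm (Cfg q)) :=
  ((W.mul b0ah wf1).add (W.mul b0R wh1)).of_eq (by
    simp only [map_add, Derivation.leibniz, smul_eq_mul, D1_aa, D1_bb]; ring)
lemma wp2 : W (-1) (D2 pp : Sm (Cfg q)) :=
  ((((W.mul b0ah wf2).add (W.mul b0R wh2)).add (W.mul b0a2 wf)).add (W.mul b0b2 wh)).of_eq (by
    simp only [map_add, Derivation.leibniz, smul_eq_mul]; ring)
lemma wd : W 0 (dv : Sm (Cfg q)) := wu1.add ww2
lemma wHT : W 0 (Ep 2 * HT : Sm (Cfg q)) :=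
  W.mul (bd_E 2) (n := 1) ((((W.mul (bd_k (2 * cμ q)) ((W.mul b0u1 wu1 (p := 1)).add (W.mul b0w2 ww2))).add
    (W.mul (Bd.mul (bd_k (cμ q)) (Bd.add b0w1 b0u2)) (W.add ww1 wu2))).add
    (W.mul (bd_k (2 * cμ q)) (W.add ww1 wu2))).add (W.mul ((bd_k (q.r * q.Re⁻¹)).mul b0d) wd))
lemma wu22 : W 1 (D2 (D2 uu) : Sm (Cfg q)) := W.div hcμ <|
  ((((W.mul b0R wB1).add (W.mul (bd_E (-2)) wp1)).sub (W.mul (bd_k (cl q)) (wu11.add ww12))).sub (W.mul (bd_k (cμ q)) wu11)).zr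
    (Zr.of_eq (z1.mul (-1)) (by simp only [eq1, map_add]; ring))
lemma ww22 : W 1 (D2 (D2 ww) : Sm (Cfg q)) := W.div (x := cμ q + cl q) (add_pos hcμ' hcl').ne' <|
  ((((W.mul b0R wB2).add (W.mul (bd_E (-2)) wp2)).sub (W.mul (bd_k (cl q)) wu12)).sub (W.mul (bd_k (cμ q)) ww11)).zr
    (Zr.of_eq (z2.mul (-1)) (by
      rw [show (kc (cμ q + cl q) : Sm (Cfg q)) = Mu + La by apply Sm.ext'; intro c v; simp]
      simp only [eq2, map_add, D21]; ring))
lemma wh22 : W 0 (D2 (D2 hh) : Sm (Cfg q)) := W.div hcκ <|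
  ((((W.mul ((bd_k (cg q)).mul b0R) wB3).add (W.mul b01p wd)).sub wHT).sub (W.mul (bd_k (cκ q)) wh11)).zr
    (Zr.of_eq (zE.mul (-1)) (by simp only [eqE]; ring))

lemma QE_le : ∃ C : ℝ, 0 ≤ C ∧ ∀ c : Cfg q, ∀ t ∈ Set.Icc 0 c.T, QE c t ≤ C * EE c t := by
  obtain ⟨C1, h1, k1⟩ := (Wf.add (Wf.add (wu22 (q := q)) ww22) wh22) (1 / 2) (by norm_num)
  refine ⟨2 * C1, by positivity, fun c t ht => ?_⟩
  have := k1 c t ht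
  change QE c t ≤ _ at this
  linarith
/-- Full control by the energy. -/
lemma W.full {n : ℤ} {G : Sm (Cfg q)} (h : W n G) : ∃ C : ℝ, 0 ≤ C ∧ ∀ c : Cfg q, ∀ t ∈ Set.Icc 0 c.T, I c t (Ep n * G * (Ep n * G)) ≤ C * EE c t := by
  obtain ⟨C, hC, k⟩ := h 1 one_pos
  obtain ⟨C', hC', k'⟩ := QE_le (q := q)
  refine ⟨C' + C, by positivity, fun c t ht => ?_⟩
  linear_combination k c t ht + k' c t ht
end

section
set_option linter.all false
variable {q : Par}

/-! ### Coercivity of the total energy and integration in time -/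

lemma f_small : ∃ δ : ℝ, 0 < δ ∧ ∀ c : Cfg q, dl c ≤ δ → ∀ t ∈ Set.Icc 0 c.T, ∀ x ∈ Ω, |ev c (t, x) ff| ≤ (cA q)⁻¹ / 2 := by
  have h := (b0f (q := q)).mono (n' := 0) (m' := 1)
  unfold Bd at h
  obtain ⟨C, hC, h⟩ := h
  have := cA_pos q
  refine ⟨(cA q)⁻¹ / 2 / (C + 1), by positivity, fun c hc t ht x hx => (h c t ht x hx).trans ?_⟩
  rw [le_div_iff₀ (by positivity)] at hc
  have := dl_pos c
  simp
  linarith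

lemma two_bd {c1 C2 k S : ℝ} (h1 : c1 ≤ k) (h2 : k ≤ C2) (hS : 0 ≤ S) : c1 * S ≤ k * S ∧ k * S ≤ C2 * S :=
  ⟨mul_le_mul_of_nonneg_right h1 hS, mul_le_mul_of_nonneg_right h2 hS⟩

lemma pw_eng {A a b R g e2 E c1 F U W H : ℝ} (he : e2 * E = 1) (he2 : 0 < e2) (hA : 0 < A) (hg : 0 < g) (ha : 1 / 2 ≤ a) (ha2 : a ≤ A) (hb : A⁻¹ ≤ b) (hb2 : b ≤ 2)
    (hR : A⁻¹ / 2 ≤ R) (hR2 : R ≤ 3) (h1 : c1 ≤ 1 / 4) (h2 : c1 ≤ A⁻¹ / 2) (h3 : c1 ≤ g * A⁻¹ * (A⁻¹ / 2)) :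
    c1 * (F * F + e2 * (U * U + W * W) + H * H) ≤ e2 * (E * (a * a * F * F) + R * (U * U + W * W) + E * (g * b * R * H * H)) ∧
    e2 * (E * (a * a * F * F) + R * (U * U + W * W) + E * (g * b * R * H * H)) ≤ (A ^ 2 + 3 + 6 * g) * (F * F + e2 * (U * U + W * W) + H * H) := by
  have hi : 0 < A⁻¹ := inv_pos.2 hA
  have e : e2 * (E * (a * a * F * F) + R * (U * U + W * W) + E * (g * b * R * H * H)) = (a * a) * (F * F) + R * (e2 * (U * U + W * W)) + (g * b * R) * (H * H) := by
    linear_combination (a * a * F * F + g * b * R * H * H) * he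
  have q1 : 0 ≤ A ^ 2 := by positivity
  have hb0 : 0 < b := hi.trans_le hb
  have hR0 : 0 < R := (half_pos hi).trans_le hR
  have k1 := two_bd (c1 := c1) (C2 := A ^ 2 + 3 + 6 * g) (k := a * a) (S := F * F) (by nlinarith) (by nlinarith) (mul_self_nonneg _)
  have k2 := two_bd (c1 := c1) (C2 := A ^ 2 + 3 + 6 * g) (k := R) (S := e2 * (U * U + W * W)) (by linarith) (by linarith) (mul_nonneg he2.le (add_nonneg (mul_self_nonneg _) (mul_self_nonneg _)))
  have k3 := two_bd (c1 := c1) (C2 := A ^ 2 + 3 + 6 * g) (k := g * b * R) (S := H * H) (h3.trans (by gcongr)) (by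
    have : g * b * R ≤ g * 2 * 3 := by gcongr
    linarith) (mul_self_nonneg _)
  rw [e]
  constructor <;> linarith [k1.1, k1.2, k2.1, k2.2, k3.1, k3.2]

lemma pw_e0 {A a b R g E c1 f u w h : ℝ} (hE : 0 < E) (hA : 0 < A) (hg : 0 < g) (ha : 1 / 2 ≤ a) (ha2 : a ≤ A) (hb : A⁻¹ ≤ b) (hb2 : b ≤ 2)
    (hR : A⁻¹ / 2 ≤ R) (hR2 : R ≤ 3) (hf : |f| ≤ A⁻¹ / 2) (h1 : c1 ≤ 1 / 4) (h2 : c1 ≤ A⁻¹ * (A⁻¹ / 2)) (h3 : c1 ≤ g * A⁻¹ * A⁻¹ * (A⁻¹ / 2)) :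
    c1 * (E * E * (f * f) + E * (u * u + w * w) + E * E * (h * h)) ≤ E * E * (3 * a * f * f - a * a * f * f * f) + 3 * E * b * R * (u * u + w * w) + 3 * E * E * g * b * b * R * h * h ∧
    E * E * (3 * a * f * f - a * a * f * f * f) + 3 * E * b * R * (u * u + w * w) + 3 * E * E * g * b * b * R * h * h ≤ (4 * A + 18 + 36 * g) * (E * E * (f * f) + E * (u * u + w * w) + E * E * (h * h)) := by
  have hi : 0 < A⁻¹ := inv_pos.2 hA
  have haf : |a * f| ≤ 1 := by
    rw [abs_mul, abs_of_pos (by linarith)]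
    have : a * |f| ≤ A * (A⁻¹ / 2) := mul_le_mul ha2 hf (abs_nonneg _) hA.le
    have : A * (A⁻¹ / 2) = 1 / 2 := by field_simp
    linarith
  obtain ⟨f1, f2⟩ := abs_le.1 haf
  have hb0 : 0 < b := hi.trans_le hb
  have hR0 : 0 < R := (half_pos hi).trans_le hR
  have e : E * E * (3 * a * f * f - a * a * f * f * f) + 3 * E * b * R * (u * u + w * w) + 3 * E * E * g * b * b * R * h * h
    = (a * (3 - a * f)) * (E * E * (f * f)) + (3 * (b * R)) * (E * (u * u + w * w)) + (3 * (g * b * b * R)) * (E * E * (h * h)) := by ring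
  have k1 := two_bd (c1 := c1) (C2 := 4 * A + 18 + 36 * g) (k := a * (3 - a * f)) (S := E * E * (f * f)) (by nlinarith) (by nlinarith) (by have := mul_self_nonneg f; positivity)
  have p1 : A⁻¹ * (A⁻¹ / 2) ≤ b * R := by gcongr
  have p2 : b * R ≤ 2 * 3 := by gcongr
  have p3 : g * A⁻¹ * A⁻¹ * (A⁻¹ / 2) ≤ g * b * b * R := by gcongr
  have p4 : g * b * b * R ≤ g * 2 * 2 * 3 := by gcongr
  have k2 := two_bd (c1 := c1) (C2 := 4 * A + 18 + 36 * g) (k := 3 * (b * R)) (S := E * (u * u + w * w)) (by nlinarith) (by linarith) (mul_nonneg hE.le (add_nonneg (mul_self_nonneg _) (mul_self_nonneg _)))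
  have k3 := two_bd (c1 := c1) (C2 := 4 * A + 18 + 36 * g) (k := 3 * (g * b * b * R)) (S := E * E * (h * h)) (by
    have : 0 ≤ g * b * b * R := by positivity
    linarith) (by linarith) (by have := mul_self_nonneg h; positivity)
  rw [e]
  constructor <;> linarith [k1.1, k1.2, k2.1, k2.2, k3.1, k3.2]

lemma ET_bd (K1 K2 : ℝ) (hK1 : 1 ≤ K1) (hK2 : 1 ≤ K2) : ∃ δ c1 C2 : ℝ, 0 < δ ∧ 0 < c1 ∧ 0 < C2 ∧ ∀ c : Cfg q, dl c ≤ δ → ∀ t ∈ Set.Icc 0 c.T,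
    c1 * EE c t ≤ I c t (ET K1 K2) ∧ I c t (ET K1 K2) ≤ C2 * EE c t := by
  obtain ⟨δ, hδ, hf⟩ := f_small (q := q)
  have hA := cA_pos q
  have hg := cg_pos q
  have hν : 0 < cμ q + cl q := add_pos hcμ' hcl'
  have hi : 0 < (cA q)⁻¹ := inv_pos.2 hA
  obtain ⟨c1, hc1, l1, l2, l3, l4, l5, l6⟩ : ∃ c1 : ℝ, 0 < c1 ∧ c1 ≤ 1 / 4 ∧ c1 ≤ (cA q)⁻¹ / 2 ∧ c1 ≤ cg q * (cA q)⁻¹ * ((cA q)⁻¹ / 2) ∧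
      c1 ≤ (cA q)⁻¹ * ((cA q)⁻¹ / 2) ∧ c1 ≤ cg q * (cA q)⁻¹ * (cA q)⁻¹ * ((cA q)⁻¹ / 2) ∧ c1 ≤ cμ q + cl q :=
    ⟨min (1 / 4) (min ((cA q)⁻¹ / 2) (min (cg q * (cA q)⁻¹ * ((cA q)⁻¹ / 2)) (min ((cA q)⁻¹ * ((cA q)⁻¹ / 2))
      (min (cg q * (cA q)⁻¹ * (cA q)⁻¹ * ((cA q)⁻¹ / 2)) (cμ q + cl q))))), by positivity, by simp, by simp, by simp, by simp, by simp, by simp⟩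
  set M := (4 * cA q + 18 + 36 * cg q) + (cA q ^ 2 + 3 + 6 * cg q) with hM
  have hM0 : 0 < M := by positivity
  refine ⟨δ, c1, K1 * M + K2 * (cμ q + cl q), hδ, hc1, by positivity, fun c hc t ht => ?_⟩
  have key : ∀ x ∈ Ω, c1 * ev c (t, x) EEs ≤ ev c (t, x) (ET K1 K2) ∧ ev c (t, x) (ET K1 K2) ≤ (K1 * M + K2 * (cμ q + cl q)) * ev c (t, x) EEs := by
    intro x hx
    have ha := aa_bd c t hx
    have hb := bb_bd c t hx
    have hf := hf c hc t ht x hx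
    have hε := c.hε
    have hA1 : (cA q)⁻¹ ≤ 2 := hb.1.trans hb.2
    have hR : (cA q)⁻¹ / 2 ≤ ev c (t, x) RR := by simp only [map_add]; linarith [(abs_le.1 hf).1, hb.1]
    have hR2 : ev c (t, x) RR ≤ 3 := by simp only [map_add]; linarith [(abs_le.1 hf).2, hb.2]
    have e1 : c.ε ^ (2 : ℤ) * c.ε ^ (-2 : ℤ) = 1 := by rw [← zpow_add₀ hε.ne']; simp
    have e2 : c.ε ^ (-1 : ℤ) * c.ε ^ (-1 : ℤ) = c.ε ^ (-2 : ℤ) := by rw [← zpow_add₀ hε.ne']; norm_num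
    have e3 : c.ε ^ (1 : ℤ) * c.ε ^ (1 : ℤ) = c.ε ^ (2 : ℤ) := by rw [← zpow_add₀ hε.ne']; norm_num
    have k0 := pw_e0 (u := ev c (t, x) uu) (w := ev c (t, x) ww) (h := ev c (t, x) hh) (Ep_pos c (-2)) hA hg ha.1 ha.2 hb.1 hb.2 hR hR2 hf l1 l4 l5
    have kg := fun F U W H : Sm (Cfg q) => pw_eng (F := ev c (t, x) F) (U := ev c (t, x) U) (W := ev c (t, x) W) (H := ev c (t, x) H) e1 (Ep_pos c 2) hA hg ha.1 ha.2 hb.1 hb.2 hR hR2 l1 l2 l3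
    have kt := kg (D0 ff) (D0 uu) (D0 ww) (D0 hh)
    have kx := kg (D1 (D1 ff)) (D1 (D1 uu)) (D1 (D1 ww)) (D1 (D1 hh))
    have n1 := ev_sq c (t, x) (D2 ff)
    have n2 := ev_sq c (t, x) (D1 (D2 ff))
    have n3 := ev_sq c (t, x) (D2 (D2 ff))
    have eE : ev c (t, x) EEs = (c.ε ^ (-2 : ℤ) * c.ε ^ (-2 : ℤ) * (ev c (t, x) ff * ev c (t, x) ff) + c.ε ^ (-2 : ℤ) * (ev c (t, x) uu * ev c (t, x) uu + ev c (t, x) ww * ev c (t, x) ww) + c.ε ^ (-2 : ℤ) * c.ε ^ (-2 : ℤ) * (ev c (t, x) hh * ev c (t, x) hh))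
      + (ev c (t, x) (D0 ff) * ev c (t, x) (D0 ff) + c.ε ^ (2 : ℤ) * (ev c (t, x) (D0 uu) * ev c (t, x) (D0 uu) + ev c (t, x) (D0 ww) * ev c (t, x) (D0 ww)) + ev c (t, x) (D0 hh) * ev c (t, x) (D0 hh))
      + (ev c (t, x) (D1 (D1 ff)) * ev c (t, x) (D1 (D1 ff)) + c.ε ^ (2 : ℤ) * (ev c (t, x) (D1 (D1 uu)) * ev c (t, x) (D1 (D1 uu)) + ev c (t, x) (D1 (D1 ww)) * ev c (t, x) (D1 (D1 ww))) + ev c (t, x) (D1 (D1 hh)) * ev c (t, x) (D1 (D1 hh)))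
      + (ev c (t, x) (D2 ff) * ev c (t, x) (D2 ff) + ev c (t, x) (D1 (D2 ff)) * ev c (t, x) (D1 (D2 ff)) + ev c (t, x) (D2 (D2 ff)) * ev c (t, x) (D2 (D2 ff))) := by
      simp only [EEs, el, List.map_cons, List.map_nil, List.sum_cons, List.sum_nil, map_add, map_mul, map_zero, ev_Ep, zpow_zero, one_mul]
      rw [← e2, ← e3]; ring
    have eT : ev c (t, x) (ET K1 K2) = K1 * (ev c (t, x) e0 + ev c (t, x) et + ev c (t, x) ex) + K2 * ((cμ q + cl q) * (ev c (t, x) (D2 ff) * ev c (t, x) (D2 ff)) + (cμ q + cl q) * (ev c (t, x) (D1 (D2 ff)) * ev c (t, x) (D1 (D2 ff)))) + (cμ q + cl q) * (ev c (t, x) (D2 (D2 ff)) * ev c (t, x) (D2 (D2 ff))) := by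
      simp only [ET, en0e, en1e, en2e, map_add, map_mul, ev_kc]; ring
    have eg : ∀ F U W H : Sm (Cfg q), ev c (t, x) (eng F U W H) = c.ε ^ (2 : ℤ) * (c.ε ^ (-2 : ℤ) * (ev c (t, x) aa * ev c (t, x) aa * ev c (t, x) F * ev c (t, x) F) + ev c (t, x) RR * (ev c (t, x) U * ev c (t, x) U + ev c (t, x) W * ev c (t, x) W) + c.ε ^ (-2 : ℤ) * (cg q * ev c (t, x) bb * ev c (t, x) RR * ev c (t, x) H * ev c (t, x) H)) := by
      intro F U W H; simp only [eng, map_add, map_mul, ev_kc, ev_Ep]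
    have e0' : ev c (t, x) e0 = c.ε ^ (-2 : ℤ) * c.ε ^ (-2 : ℤ) * (3 * ev c (t, x) aa * ev c (t, x) ff * ev c (t, x) ff - ev c (t, x) aa * ev c (t, x) aa * ev c (t, x) ff * ev c (t, x) ff * ev c (t, x) ff) + 3 * c.ε ^ (-2 : ℤ) * ev c (t, x) bb * ev c (t, x) RR * (ev c (t, x) uu * ev c (t, x) uu + ev c (t, x) ww * ev c (t, x) ww) + 3 * c.ε ^ (-2 : ℤ) * c.ε ^ (-2 : ℤ) * cg q * ev c (t, x) bb * ev c (t, x) bb * ev c (t, x) RR * ev c (t, x) hh * ev c (t, x) hh := by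
      simp only [e0, map_add, map_sub, map_mul, ev_kc, ev_Ep, ev_three]
    rw [eT, eE, et, ex, eg, eg, e0']
    have s0 : 0 ≤ c.ε ^ (-2 : ℤ) * c.ε ^ (-2 : ℤ) * (ev c (t, x) ff * ev c (t, x) ff) + c.ε ^ (-2 : ℤ) * (ev c (t, x) uu * ev c (t, x) uu + ev c (t, x) ww * ev c (t, x) ww) + c.ε ^ (-2 : ℤ) * c.ε ^ (-2 : ℤ) * (ev c (t, x) hh * ev c (t, x) hh) := by
      have := ev_sq c (t, x) ff; have := ev_sq c (t, x) hh; have := add_nonneg (ev_sq c (t, x) uu) (ev_sq c (t, x) ww); positivity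
    have sg : ∀ F U W H : Sm (Cfg q), 0 ≤ ev c (t, x) F * ev c (t, x) F + c.ε ^ (2 : ℤ) * (ev c (t, x) U * ev c (t, x) U + ev c (t, x) W * ev c (t, x) W) + ev c (t, x) H * ev c (t, x) H := by
      intro F U W H
      have := ev_sq c (t, x) F; have := ev_sq c (t, x) H; have := add_nonneg (ev_sq c (t, x) U) (ev_sq c (t, x) W); positivity
    have st := sg (D0 ff) (D0 uu) (D0 ww) (D0 hh)
    have sx := sg (D1 (D1 ff)) (D1 (D1 uu)) (D1 (D1 ww)) (D1 (D1 hh))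
    clear kg eg e0' eE eT sg hf e1 e2 e3
    revert k0 kt kx s0 st sx
    generalize (c.ε ^ (-2 : ℤ) * c.ε ^ (-2 : ℤ) * (ev c (t, x) ff * ev c (t, x) ff) + c.ε ^ (-2 : ℤ) * (ev c (t, x) uu * ev c (t, x) uu + ev c (t, x) ww * ev c (t, x) ww) + c.ε ^ (-2 : ℤ) * c.ε ^ (-2 : ℤ) * (ev c (t, x) hh * ev c (t, x) hh)) = S0
    generalize (ev c (t, x) (D0 ff) * ev c (t, x) (D0 ff) + c.ε ^ (2 : ℤ) * (ev c (t, x) (D0 uu) * ev c (t, x) (D0 uu) + ev c (t, x) (D0 ww) * ev c (t, x) (D0 ww)) + ev c (t, x) (D0 hh) * ev c (t, x) (D0 hh)) = St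
    generalize (ev c (t, x) (D1 (D1 ff)) * ev c (t, x) (D1 (D1 ff)) + c.ε ^ (2 : ℤ) * (ev c (t, x) (D1 (D1 uu)) * ev c (t, x) (D1 (D1 uu)) + ev c (t, x) (D1 (D1 ww)) * ev c (t, x) (D1 (D1 ww))) + ev c (t, x) (D1 (D1 hh)) * ev c (t, x) (D1 (D1 hh))) = Sx
    generalize ev c (t, x) (D2 ff) * ev c (t, x) (D2 ff) = N1 at *
    generalize ev c (t, x) (D1 (D2 ff)) * ev c (t, x) (D1 (D2 ff)) = N2 at *
    generalize ev c (t, x) (D2 (D2 ff)) * ev c (t, x) (D2 (D2 ff)) = N3 at *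
    generalize c.ε ^ (-2 : ℤ) * c.ε ^ (-2 : ℤ) * (3 * ev c (t, x) aa * ev c (t, x) ff * ev c (t, x) ff - ev c (t, x) aa * ev c (t, x) aa * ev c (t, x) ff * ev c (t, x) ff * ev c (t, x) ff) + 3 * c.ε ^ (-2 : ℤ) * ev c (t, x) bb * ev c (t, x) RR * (ev c (t, x) uu * ev c (t, x) uu + ev c (t, x) ww * ev c (t, x) ww) + 3 * c.ε ^ (-2 : ℤ) * c.ε ^ (-2 : ℤ) * cg q * ev c (t, x) bb * ev c (t, x) bb * ev c (t, x) RR * ev c (t, x) hh * ev c (t, x) hh = Y0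
    generalize c.ε ^ (2 : ℤ) * (c.ε ^ (-2 : ℤ) * (ev c (t, x) aa * ev c (t, x) aa * ev c (t, x) (D0 ff) * ev c (t, x) (D0 ff)) + _ * _ + _) = Yt
    generalize c.ε ^ (2 : ℤ) * (c.ε ^ (-2 : ℤ) * (ev c (t, x) aa * ev c (t, x) aa * ev c (t, x) (D1 (D1 ff)) * ev c (t, x) (D1 (D1 ff))) + _ * _ + _) = Yx
    intro k0 kt kx s0 st sx
    generalize hν' : cμ q + cl q = ν at *
    have g1 : 0 ≤ 4 * cA q + 18 + 36 * cg q := by positivity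
    have g2 : 0 ≤ cA q ^ 2 + 3 + 6 * cg q := by positivity
    have u0 : Y0 ≤ M * S0 := k0.2.trans (mul_le_mul_of_nonneg_right (by linarith) s0)
    have ut : Yt ≤ M * St := kt.2.trans (mul_le_mul_of_nonneg_right (by linarith) st)
    have ux : Yx ≤ M * Sx := kx.2.trans (mul_le_mul_of_nonneg_right (by linarith) sx)
    have hY : 0 ≤ Y0 + Yt + Yx := by have := mul_nonneg hc1.le s0; have := mul_nonneg hc1.le st; have := mul_nonneg hc1.le sx; linarith
    have hN : 0 ≤ ν * N1 + ν * N2 := by positivity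
    have v1 := mul_le_mul_of_nonneg_right l6 n1
    have v2 := mul_le_mul_of_nonneg_right l6 n2
    have v3 := mul_le_mul_of_nonneg_right l6 n3
    constructor
    · have a1 : 1 * (Y0 + Yt + Yx) ≤ K1 * (Y0 + Yt + Yx) := mul_le_mul_of_nonneg_right hK1 hY
      have a2 : 1 * (ν * N1 + ν * N2) ≤ K2 * (ν * N1 + ν * N2) := mul_le_mul_of_nonneg_right hK2 hN
      linarith [k0.1, kt.1, kx.1]
    · have a1 : K1 * (Y0 + Yt + Yx) ≤ K1 * (M * S0 + M * St + M * Sx) := mul_le_mul_of_nonneg_left (by linarith) (by linarith)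
      have a2 : 1 * (ν * N3) ≤ K2 * (ν * N3) := mul_le_mul_of_nonneg_right hK2 (by positivity)
      have a3 : 0 ≤ K1 * M * (N1 + N2 + N3) := by positivity
      have a4 : 0 ≤ K2 * ν * (S0 + St + Sx) := by positivity
      linarith
  constructor
  · rw [EE, ← smul_eq_mul, ← map_smul]
    exact I_mono fun x hx => by rw [map_smul, smul_eq_mul]; exact (key x hx).1
  · rw [EE, ← smul_eq_mul, ← map_smul]
    exact I_mono fun x hx => by rw [map_smul, smul_eq_mul]; exact (key x hx).2

lemma DT_cont (c : Cfg q) : Continuous fun t => DT c t := by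
  have := I_cont c (QQ (q := q)); unfold DT; exact this

/-- Time-integrated energy inequality. -/
lemma energy (hμ : Zc q ≤ cμ q) (hκ : Zc q ≤ cκ q) : ∃ δ C : ℝ, 0 < δ ∧ 0 < C ∧ ∀ c : Cfg q, dl c ≤ δ → ∀ t ∈ Set.Icc 0 c.T,
    EE c t + ∫ s in (0 : ℝ)..t, DT c s ≤ C * EE c 0 := by
  obtain ⟨K1, K2, δ, c0, hK1, hK2, hδ, hc0, h⟩ := main_ineq hμ hκ
  obtain ⟨δ', c1, C2, hδ', hc1, hC2, h'⟩ := ET_bd (q := q) K1 K2 hK1 hK2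
  have hm : 0 < min c0 c1 := lt_min hc0 hc1
  refine ⟨min δ δ', C2 / min c0 c1, lt_min hδ hδ', by positivity, fun c hc t ht => ?_⟩
  have hc1' := hc.trans (min_le_left _ _)
  have hc2' := hc.trans (min_le_right _ _)
  have h0 : (0 : ℝ) ∈ Set.Icc 0 c.T := ⟨le_rfl, c.hT.le⟩
  have hIntg : IntervalIntegrable (fun s => DT c s) volume 0 t := (DT_cont c).intervalIntegrable _ _
  have e1 : ∫ s in (0 : ℝ)..t, I c s (D0 (ET K1 K2)) = I c t (ET K1 K2) - I c 0 (ET K1 K2) :=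
    intervalIntegral.integral_eq_sub_of_hasDerivAt (fun s _ => I_hasDerivAt c s _) ((I_cont c _).intervalIntegrable _ _)
  have e2 : ∫ s in (0 : ℝ)..t, I c s (D0 (ET K1 K2)) ≤ ∫ s in (0 : ℝ)..t, -(c0 * DT c s) :=
    intervalIntegral.integral_mono_on ht.1 ((I_cont c _).intervalIntegrable _ _) ((continuous_const.mul (DT_cont c)).neg.intervalIntegrable _ _)
      fun s hs => h c hc1' s ⟨hs.1, hs.2.trans ht.2⟩
  rw [e1, intervalIntegral.integral_neg, intervalIntegral.integral_const_mul] at e2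
  have hD : 0 ≤ ∫ s in (0 : ℝ)..t, DT c s := intervalIntegral.integral_nonneg ht.1 fun s _ => DT_nonneg c s
  have a1 := (h' c hc2' t ht).1
  have a2 := (h' c hc2' 0 h0).2
  have a3 := mul_le_mul_of_nonneg_right (min_le_left c0 c1) hD
  have a4 := mul_le_mul_of_nonneg_right (min_le_right c0 c1) (EE_nonneg c t)
  rw [div_mul_eq_mul_div, le_div_iff₀ hm]
  linarith
end

section
set_option linter.all false
variable {q : Par}

/-! ### Final assembly -/

lemma dSq1_le (c : Cfg q) (t : ℝ) (G : Sm (Cfg q)) :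
    dSq 1 (sl c t G) ≤ 2 * (I c t (D1 G * D1 G) + I c t (D2 G * D2 G)) := by
  have := dSq_succ c t G 0
  rwa [dSq_zero, dSq_zero] at this
lemma dSq2_le (c : Cfg q) (t : ℝ) (G : Sm (Cfg q)) : dSq 2 (sl c t G) ≤
    4 * (I c t (D1 (D1 G) * D1 (D1 G)) + 2 * I c t (D1 (D2 G) * D1 (D2 G)) + I c t (D2 (D2 G) * D2 (D2 G))) := by
  have h := dSq_succ c t G 1
  have h1 := dSq1_le c t (D1 G)
  have h2 := dSq1_le c t (D2 G)
  rw [D21] at h1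
  norm_num at h
  linarith
lemma dSq3_le (c : Cfg q) (t : ℝ) (G : Sm (Cfg q)) : dSq 3 (sl c t G) ≤
    8 * (I c t (D1 (D1 (D1 G)) * D1 (D1 (D1 G))) + 3 * I c t (D1 (D1 (D2 G)) * D1 (D1 (D2 G)))
      + 3 * I c t (D1 (D2 (D2 G)) * D1 (D2 (D2 G))) + I c t (D2 (D2 (D2 G)) * D2 (D2 (D2 G)))) := by
  have h := dSq_succ c t G 2
  have h1 := dSq2_le c t (D1 G)
  have h2 := dSq2_le c t (D2 G)
  simp only [D21] at h1
  norm_num at h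
  linarith

lemma jet_le (c : Cfg q) (t : ℝ) {n k : ℤ} {G : Sm (Cfg q)} (h : (n, G) ∈ jl) (hk : -2 * n ≤ k) :
    c.ε ^ k * I c t (G * G) ≤ DT c t := by
  have h1 : c.ε ^ (2 * -n) * I c t (G * G) ≤ DT c t := by
    rw [← I_Ep_sq, DT_eq]
    refine List.single_le_sum (fun x hx => ?_) _ (List.mem_map.2 ⟨_, h, rfl⟩)
    obtain ⟨p, _, rfl⟩ := List.mem_map.1 hx
    exact I_sq_nonneg _ _ _
  refine (mul_le_mul_of_nonneg_right ?_ (I_sq_nonneg _ _ _)).trans h1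
  exact zpow_le_zpow_right_of_le_one₀ c.hε c.hε1 (by linarith)

lemma fin_f (c : Cfg q) (t : ℝ) : (c.ε ^ 2)⁻¹ * HSq 2 (c.S.φ t) ≤ 21 * DT c t := by
  have a0 := jet_le c t (n := 1) (k := -2) (G := ff) (by simp [jl]) (by norm_num)
  have a1 := jet_le c t (n := 1) (k := -2) (G := D1 ff) (by simp [jl]) (by norm_num)
  have a2 := jet_le c t (n := 1) (k := -2) (G := D2 ff) (by simp [jl]) (by norm_num)
  have a11 := jet_le c t (n := 1) (k := -2) (G := D1 (D1 ff)) (by simp [jl]) (by norm_num)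
  have a12 := jet_le c t (n := 1) (k := -2) (G := D1 (D2 ff)) (by simp [jl]) (by norm_num)
  have a22 := jet_le c t (n := 1) (k := -2) (G := D2 (D2 ff)) (by simp [jl]) (by norm_num)
  have e : c.ε ^ (-2 : ℤ) = (c.ε ^ 2)⁻¹ := by rw [zpow_neg]; norm_cast
  rw [e] at a0 a1 a2 a11 a12 a22
  have hp : 0 ≤ (c.ε ^ 2)⁻¹ := by positivity
  have h1 := mul_le_mul_of_nonneg_left (dSq1_le c t ff) hp
  have h2 := mul_le_mul_of_nonneg_left (dSq2_le c t ff) hp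
  rw [φsl, HSq, Finset.sum_range_succ, Finset.sum_range_succ, Finset.sum_range_one, dSq_zero]
  linarith

lemma fin_gen (c : Cfg q) (t : ℝ) (k : ℤ) (G : Sm (Cfg q)) (a0 : c.ε ^ k * I c t (G * G) ≤ DT c t)
    (a1 : c.ε ^ k * I c t (D1 G * D1 G) ≤ DT c t) (a2 : c.ε ^ k * I c t (D2 G * D2 G) ≤ DT c t)
    (a11 : c.ε ^ k * I c t (D1 (D1 G) * D1 (D1 G)) ≤ DT c t) (a12 : c.ε ^ k * I c t (D1 (D2 G) * D1 (D2 G)) ≤ DT c t)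
    (a22 : c.ε ^ k * I c t (D2 (D2 G) * D2 (D2 G)) ≤ DT c t)
    (a111 : c.ε ^ k * I c t (D1 (D1 (D1 G)) * D1 (D1 (D1 G))) ≤ DT c t)
    (a112 : c.ε ^ k * I c t (D1 (D1 (D2 G)) * D1 (D1 (D2 G))) ≤ DT c t)
    (a122 : c.ε ^ k * I c t (D1 (D2 (D2 G)) * D1 (D2 (D2 G))) ≤ DT c t)
    (a222 : c.ε ^ k * I c t (D2 (D2 (D2 G)) * D2 (D2 (D2 G))) ≤ DT c t) :
    c.ε ^ k * HSq 3 (sl c t G) ≤ 85 * DT c t := by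
  have hp : 0 ≤ c.ε ^ k := (Ep_pos c k).le
  have h1 := mul_le_mul_of_nonneg_left (dSq1_le c t G) hp
  have h2 := mul_le_mul_of_nonneg_left (dSq2_le c t G) hp
  have h3 := mul_le_mul_of_nonneg_left (dSq3_le c t G) hp
  rw [HSq, Finset.sum_range_succ, Finset.sum_range_succ, Finset.sum_range_succ, Finset.sum_range_one, dSq_zero]
  linarith

lemma fin_h (c : Cfg q) (t : ℝ) : HSq 3 (c.S.θ t) ≤ 85 * DT c t := by
  have := fin_gen c t 0 hh (jet_le c t (n := 2) (by simp [jl]) (by norm_num)) (jet_le c t (n := 2) (by simp [jl]) (by norm_num))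
    (jet_le c t (n := 2) (by simp [jl]) (by norm_num)) (jet_le c t (n := 1) (by simp [jl]) (by norm_num))
    (jet_le c t (n := 1) (by simp [jl]) (by norm_num)) (jet_le c t (n := 1) (by simp [jl]) (by norm_num))
    (jet_le c t (n := 0) (by simp [jl]) (by norm_num)) (jet_le c t (n := 0) (by simp [jl]) (by norm_num))
    (jet_le c t (n := 0) (by simp [jl]) (by norm_num)) (jet_le c t (n := 0) (by simp [jl]) (by norm_num))
  rwa [zpow_zero, one_mul, ← θsl] at this
lemma fin_u (c : Cfg q) (t : ℝ) : c.ε ^ 2 * HSq 3 (c.S.ψ t) ≤ 340 * DT c t := by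
  have hu := fin_gen c t 2 uu (jet_le c t (n := 1) (by simp [jl]) (by norm_num)) (jet_le c t (n := 1) (by simp [jl]) (by norm_num))
    (jet_le c t (n := 1) (by simp [jl]) (by norm_num)) (jet_le c t (n := 0) (by simp [jl]) (by norm_num))
    (jet_le c t (n := 0) (by simp [jl]) (by norm_num)) (jet_le c t (n := 0) (by simp [jl]) (by norm_num))
    (jet_le c t (n := -1) (by simp [jl]) (by norm_num)) (jet_le c t (n := -1) (by simp [jl]) (by norm_num))
    (jet_le c t (n := -1) (by simp [jl]) (by norm_num)) (jet_le c t (n := -1) (by simp [jl]) (by norm_num))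
  have hw := fin_gen c t 2 ww (jet_le c t (n := 1) (by simp [jl]) (by norm_num)) (jet_le c t (n := 1) (by simp [jl]) (by norm_num))
    (jet_le c t (n := 1) (by simp [jl]) (by norm_num)) (jet_le c t (n := 0) (by simp [jl]) (by norm_num))
    (jet_le c t (n := 0) (by simp [jl]) (by norm_num)) (jet_le c t (n := 0) (by simp [jl]) (by norm_num))
    (jet_le c t (n := -1) (by simp [jl]) (by norm_num)) (jet_le c t (n := -1) (by simp [jl]) (by norm_num))
    (jet_le c t (n := -1) (by simp [jl]) (by norm_num)) (jet_le c t (n := -1) (by simp [jl]) (by norm_num))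
  have e : c.ε ^ (2 : ℤ) = c.ε ^ 2 := by norm_cast
  rw [e] at hu hw
  have hs : HSq 3 (c.S.ψ t) ≤ 2 * (HSq 3 (sl c t uu) + HSq 3 (sl c t ww)) := by
    rw [ψsl, HSq, HSq, HSq, ← Finset.sum_add_distrib, Finset.mul_sum]
    exact Finset.sum_le_sum fun j _ => dSq_pair c t uu ww j
  have := mul_le_mul_of_nonneg_left hs (by positivity : 0 ≤ c.ε ^ 2)
  linarith

lemma fin_int (c : Cfg q) {t : ℝ} (ht : 0 ≤ t) :
    c.ε ^ 2 * ∫ s in (0 : ℝ)..t, ((c.ε ^ 4)⁻¹ * HSq 2 (c.S.φ s) + HSq 3 (c.S.ψ s) + (c.ε ^ 2)⁻¹ * HSq 3 (c.S.θ s))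
      ≤ 446 * ∫ s in (0 : ℝ)..t, DT c s := by
  have hD : 0 ≤ ∫ s in (0 : ℝ)..t, DT c s := intervalIntegral.integral_nonneg ht fun s _ => DT_nonneg c s
  have hε := c.hε.ne'
  by_cases hi : IntervalIntegrable (fun s => (c.ε ^ 4)⁻¹ * HSq 2 (c.S.φ s) + HSq 3 (c.S.ψ s) + (c.ε ^ 2)⁻¹ * HSq 3 (c.S.θ s)) volume 0 t
  · rw [← intervalIntegral.integral_const_mul, ← intervalIntegral.integral_const_mul]
    refine intervalIntegral.integral_mono_on ht (hi.const_mul _) ((continuous_const.mul (DT_cont c)).intervalIntegrable _ _) fun s hs => ?_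
    have h1 := fin_f c s
    have h2 := fin_u c s
    have h3 := fin_h c s
    have e : c.ε ^ 2 * ((c.ε ^ 4)⁻¹ * HSq 2 (c.S.φ s) + HSq 3 (c.S.ψ s) + (c.ε ^ 2)⁻¹ * HSq 3 (c.S.θ s))
      = (c.ε ^ 2)⁻¹ * HSq 2 (c.S.φ s) + c.ε ^ 2 * HSq 3 (c.S.ψ s) + HSq 3 (c.S.θ s) := by field_simp
    rw [e]; linarith
  · rw [intervalIntegral.integral_undef hi]; linarith

lemma fin_sup : ∃ C : ℝ, 0 ≤ C ∧ ∀ c : Cfg q, ∀ t ∈ Set.Icc 0 c.T,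
    c.ε ^ 2 * ((c.ε ^ 2)⁻¹ * dSq 2 (c.S.φ t) + dSq 2 (c.S.ψ t) + (c.ε ^ 2)⁻¹ * dSq 2 (c.S.θ t)) ≤ C * EE c t := by
  obtain ⟨C1, p1, h1⟩ := (wu11 (q := q)).full
  obtain ⟨C2, p2, h2⟩ := (wu12 (q := q)).full
  obtain ⟨C3, p3, h3⟩ := (wu22 (q := q)).full
  obtain ⟨C4, p4, h4⟩ := (ww11 (q := q)).full
  obtain ⟨C5, p5, h5⟩ := (ww12 (q := q)).full
  obtain ⟨C6, p6, h6⟩ := (ww22 (q := q)).full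
  obtain ⟨C7, p7, h7⟩ := (wh11 (q := q)).full
  obtain ⟨C8, p8, h8⟩ := (wh12 (q := q)).full
  obtain ⟨C9, p9, h9⟩ := (wh22 (q := q)).full
  refine ⟨16 + 8 * (C1 + 2 * C2 + C3 + C4 + 2 * C5 + C6) + 4 * (C7 + 2 * C8 + C9), by positivity, fun c t ht => ?_⟩
  have b1 := h1 c t ht
  have b2 := h2 c t ht
  have b3 := h3 c t ht
  have b4 := h4 c t ht
  have b5 := h5 c t ht
  have b6 := h6 c t ht
  have b7 := h7 c t ht
  have b8 := h8 c t ht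
  have b9 := h9 c t ht
  have f1 := EE_ge c t (n := 0) (G := D1 (D1 ff)) (by simp [el])
  have f2 := EE_ge c t (n := 0) (G := D1 (D2 ff)) (by simp [el])
  have f3 := EE_ge c t (n := 0) (G := D2 (D2 ff)) (by simp [el])
  have e : c.ε ^ (2 * 1 : ℤ) = c.ε ^ 2 := by norm_cast
  rw [I_Ep_sq] at *
  rw [mul_zero, zpow_zero, one_mul] at b7 b8 b9 f1 f2 f3
  rw [e] at b1 b2 b3 b4 b5 b6
  have hp : 0 ≤ c.ε ^ 2 := by positivity
  have hε := c.hε.ne'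
  have g1 := dSq2_le c t ff
  have g2 := dSq2_le c t hh
  have g3 := mul_le_mul_of_nonneg_left (dSq2_le c t uu) hp
  have g4 := mul_le_mul_of_nonneg_left (dSq2_le c t ww) hp
  have g5 := mul_le_mul_of_nonneg_left (dSq_pair c t uu ww 2) hp
  rw [← ψsl] at g5
  rw [← φsl] at g1
  rw [← θsl] at g2
  have ee : c.ε ^ 2 * ((c.ε ^ 2)⁻¹ * dSq 2 (c.S.φ t) + dSq 2 (c.S.ψ t) + (c.ε ^ 2)⁻¹ * dSq 2 (c.S.θ t))
    = dSq 2 (c.S.φ t) + c.ε ^ 2 * dSq 2 (c.S.ψ t) + dSq 2 (c.S.θ t) := by field_simp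
  rw [ee]; linarith

/-- The initial quantity on the right-hand side. -/
def R0 (c : Cfg q) : ℝ := c.ε ^ 2 * A3 c.ε c.S.φ c.S.ψ c.S.θ 0 + c.ε ^ 2 * A4 c.ε c.S.φ c.S.ψ c.S.θ 0
  + A1 c.ε c.S.φ c.S.ψ c.S.θ 0 + A2 c.ε c.S.φ c.S.ψ c.S.θ 0 + (c.ε ^ 2)⁻¹ * A0 c.ε c.S.φ c.S.ψ c.S.θ 0

lemma R0_ge (c : Cfg q) :
    (c.ε ^ 2)⁻¹ * (L2Sq (c.S.ψ 0) + (c.ε ^ 2)⁻¹ * L2Sq (c.S.φ 0) + (c.ε ^ 2)⁻¹ * L2Sq (c.S.θ 0)) ≤ R0 c ∧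
    (c.ε ^ 2)⁻¹ * dSq 1 (c.S.φ 0) ≤ R0 c ∧
    c.ε ^ 2 * ((c.ε ^ 2)⁻¹ * L2Sq (dt c.S.φ 0) + L2Sq (dt c.S.ψ 0) + (c.ε ^ 2)⁻¹ * L2Sq (dt c.S.θ 0)) ≤ R0 c ∧
    c.ε ^ 2 * ((c.ε ^ 2)⁻¹ * dSq 2 (c.S.φ 0) + dSq 2 (c.S.ψ 0) + (c.ε ^ 2)⁻¹ * dSq 2 (c.S.θ 0)) ≤ R0 c := by
  obtain ⟨h0, h1, h2, h3, h4, h5⟩ := A_nonneg c.ε c.S.φ c.S.ψ c.S.θ (le_refl (0 : ℝ))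
  have ht : (0 : ℝ) ∈ Set.Icc (0 : ℝ) 0 := ⟨le_rfl, le_rfl⟩
  have hi : 0 ≤ (c.ε ^ 2)⁻¹ := by positivity
  have g0 : L2Sq (c.S.ψ 0) + (c.ε ^ 2)⁻¹ * L2Sq (c.S.φ 0) + (c.ε ^ 2)⁻¹ * L2Sq (c.S.θ 0) ≤ A0 c.ε c.S.φ c.S.ψ c.S.θ 0 := by
    obtain ⟨Y, hY, hb⟩ := bdd3 c 0 (c.ε ^ 2)⁻¹ 1 (c.ε ^ 2)⁻¹ hi zero_le_one hi
    have := le_sup' (X := fun t => L2Sq (c.S.ψ t) + (c.ε ^ 2)⁻¹ * L2Sq (c.S.φ t) + (c.ε ^ 2)⁻¹ * L2Sq (c.S.θ t)) hY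
      (fun s => by have := hb s; simp only [L2Sq]; linarith) ht
    rw [A0, intervalIntegral.integral_same, add_zero]; exact this
  have g2 : (c.ε ^ 2)⁻¹ * dSq 1 (c.S.φ 0) ≤ A2 c.ε c.S.φ c.S.ψ c.S.θ 0 := by
    obtain ⟨Y, hY, hb⟩ := bdd3 c 1 1 0 0 zero_le_one le_rfl le_rfl
    have := le_sup' (X := fun t => dSq 1 (c.S.φ t)) hY (fun s => by have := hb s; linarith) ht
    rw [A2, intervalIntegral.integral_same, intervalIntegral.integral_same, add_zero, add_zero]
    exact mul_le_mul_of_nonneg_left this hi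
  have g3 : (c.ε ^ 2)⁻¹ * L2Sq (dt c.S.φ 0) + L2Sq (dt c.S.ψ 0) + (c.ε ^ 2)⁻¹ * L2Sq (dt c.S.θ 0) ≤
      A3 c.ε c.S.φ c.S.ψ c.S.θ 0 := by
    obtain ⟨Y, hY, hb⟩ := dSq_bdd c 0 (D0 ff : Sm (Cfg q))
    obtain ⟨Y', hY', hb'⟩ := dSq_bdd2 c 0 (D0 uu : Sm (Cfg q)) (D0 ww)
    obtain ⟨Z', hZ', hb''⟩ := dSq_bdd c 0 (D0 hh : Sm (Cfg q))
    have := le_sup' (X := fun t => (c.ε ^ 2)⁻¹ * L2Sq (dt c.S.φ t) + L2Sq (dt c.S.ψ t) + (c.ε ^ 2)⁻¹ * L2Sq (dt c.S.θ t))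
      (Y := fun t => (c.ε ^ 2)⁻¹ * Y t + Y' t + (c.ε ^ 2)⁻¹ * Z' t) (by fun_prop)
      (fun s => by
        have a1 := mul_le_mul_of_nonneg_left (hb s) hi
        have a2 := hb' s
        have a3 := mul_le_mul_of_nonneg_left (hb'' s) hi
        rw [dtψsl, dtθsl, dtφsl]
        simp only [L2Sq]
        linarith) ht
    rw [A3, intervalIntegral.integral_same, add_zero]; exact this
  have g4 : (c.ε ^ 2)⁻¹ * dSq 2 (c.S.φ 0) + dSq 2 (c.S.ψ 0) + (c.ε ^ 2)⁻¹ * dSq 2 (c.S.θ 0) ≤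
      A4 c.ε c.S.φ c.S.ψ c.S.θ 0 := by
    obtain ⟨Y, hY, hb⟩ := bdd3 c 2 (c.ε ^ 2)⁻¹ 1 (c.ε ^ 2)⁻¹ hi zero_le_one hi
    have := le_sup' (X := fun t => (c.ε ^ 2)⁻¹ * dSq 2 (c.S.φ t) + dSq 2 (c.S.ψ t) + (c.ε ^ 2)⁻¹ * dSq 2 (c.S.θ t)) hY
      (fun s => by have := hb s; linarith) ht
    rw [A4, intervalIntegral.integral_same, add_zero]; exact this
  have k0 := mul_le_mul_of_nonneg_left g0 hi
  have k3 := mul_le_mul_of_nonneg_left g3 (by positivity : 0 ≤ c.ε ^ 2)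
  have k4 := mul_le_mul_of_nonneg_left g4 (by positivity : 0 ≤ c.ε ^ 2)
  have n0 := mul_nonneg hi h0
  have n3 := mul_nonneg (by positivity : 0 ≤ c.ε ^ 2) h3
  have n4 := mul_nonneg (by positivity : 0 ≤ c.ε ^ 2) h4
  unfold R0
  refine ⟨?_, ?_, ?_, ?_⟩ <;> linarith

lemma EE0_le (c : Cfg q) : EE c 0 ≤ 30 * R0 c := by
  obtain ⟨r0, r2, r3, r4⟩ := R0_ge c
  have hε := c.hε.ne'
  have hp : 0 < c.ε ^ 2 := by have := c.hε; positivity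
  have hp1 : c.ε ^ 2 ≤ 1 := pow_le_one₀ c.hε.le c.hε1
  have hi : 0 ≤ (c.ε ^ 2)⁻¹ := by positivity
  have hi1 : 1 ≤ (c.ε ^ 2)⁻¹ := (one_le_inv₀ hp).2 hp1
  -- order zero
  have u0 := dSq_fst c 0 (uu : Sm (Cfg q)) ww 0
  have w0 := dSq_snd c 0 (uu : Sm (Cfg q)) ww 0
  rw [← ψsl] at u0 w0
  have ut := dSq_fst c 0 (D0 uu : Sm (Cfg q)) (D0 ww) 0
  have wt := dSq_snd c 0 (D0 uu : Sm (Cfg q)) (D0 ww) 0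
  rw [← dtψsl] at ut wt
  have u2 := dSq_fst c 0 (uu : Sm (Cfg q)) ww 2
  have w2 := dSq_snd c 0 (uu : Sm (Cfg q)) ww 2
  rw [← ψsl] at u2 w2
  have u11 := (dSq_D1 c 0 (D1 (uu : Sm (Cfg q))) 0).trans (dSq_D1 c 0 uu 1)
  have w11 := (dSq_D1 c 0 (D1 (ww : Sm (Cfg q))) 0).trans (dSq_D1 c 0 ww 1)
  have h11 := (dSq_D1 c 0 (D1 (hh : Sm (Cfg q))) 0).trans (dSq_D1 c 0 hh 1)
  have f11 := (dSq_D1 c 0 (D1 (ff : Sm (Cfg q))) 0).trans (dSq_D1 c 0 ff 1)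
  have f12 := (dSq_D1 c 0 (D2 (ff : Sm (Cfg q))) 0).trans (dSq_D2 c 0 ff 1)
  have f22 := (dSq_D2 c 0 (D2 (ff : Sm (Cfg q))) 0).trans (dSq_D2 c 0 ff 1)
  have f2 := dSq_D2 c 0 (ff : Sm (Cfg q)) 0
  norm_num at u11 w11 h11 f11 f12 f22 f2
  simp only [dSq_zero] at *
  simp only [L2Sq] at r0 r3
  have e1 : c.ε ^ (2 * 1 : ℤ) = c.ε ^ 2 := by norm_cast
  have e2 : c.ε ^ (2 * -1 : ℤ) = (c.ε ^ 2)⁻¹ := by rw [show (2 * -1 : ℤ) = -2 by norm_num, zpow_neg]; norm_cast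
  have e3 : c.ε ^ (2 * -2 : ℤ) = (c.ε ^ 2)⁻¹ * (c.ε ^ 2)⁻¹ := by
    rw [← e2, ← zpow_add₀ hε]; norm_num
  have n1 := mul_nonneg hi (dSq_nonneg 0 (c.S.ψ 0))
  have n2 := mul_nonneg hi (mul_nonneg hi (dSq_nonneg 0 (c.S.φ 0)))
  have n3 := mul_nonneg hi (mul_nonneg hi (dSq_nonneg 0 (c.S.θ 0)))
  have n4 := dSq_nonneg 0 (dt c.S.φ 0)
  have n5 := mul_nonneg hp.le (dSq_nonneg 0 (dt c.S.ψ 0))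
  have n6 := dSq_nonneg 0 (dt c.S.θ 0)
  have n7 := dSq_nonneg 2 (c.S.φ 0)
  have n8 := mul_nonneg hp.le (dSq_nonneg 2 (c.S.ψ 0))
  have n9 := dSq_nonneg 2 (c.S.θ 0)
  have v1 := mul_le_mul_of_nonneg_left u0 hi
  have v2 := mul_le_mul_of_nonneg_left w0 hi
  have v3 := mul_le_mul_of_nonneg_left ut hp.le
  have v4 := mul_le_mul_of_nonneg_left wt hp.le
  have v5 := mul_le_mul_of_nonneg_left (u11.trans u2) hp.le
  have v6 := mul_le_mul_of_nonneg_left (w11.trans w2) hp.le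
  have v7 := mul_le_mul_of_nonneg_right hi1 (dSq_nonneg 1 (c.S.φ 0))
  have x3 : c.ε ^ 2 * ((c.ε ^ 2)⁻¹ * dSq 0 (dt c.S.φ 0) + dSq 0 (dt c.S.ψ 0) + (c.ε ^ 2)⁻¹ * dSq 0 (dt c.S.θ 0))
    = dSq 0 (dt c.S.φ 0) + c.ε ^ 2 * dSq 0 (dt c.S.ψ 0) + dSq 0 (dt c.S.θ 0) := by field_simp
  have x4 : c.ε ^ 2 * ((c.ε ^ 2)⁻¹ * dSq 2 (c.S.φ 0) + dSq 2 (c.S.ψ 0) + (c.ε ^ 2)⁻¹ * dSq 2 (c.S.θ 0))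
    = dSq 2 (c.S.φ 0) + c.ε ^ 2 * dSq 2 (c.S.ψ 0) + dSq 2 (c.S.θ 0) := by field_simp
  rw [x3] at r3
  rw [x4] at r4
  have y1 : dSq 0 (c.S.φ 0) = I c 0 (ff * ff) := by rw [φsl, dSq_zero]
  have y2 : dSq 0 (c.S.θ 0) = I c 0 (hh * hh) := by rw [θsl, dSq_zero]
  have y3 : dSq 0 (dt c.S.φ 0) = I c 0 (D0 ff * D0 ff) := by rw [dtφsl, dSq_zero]
  have y4 : dSq 0 (dt c.S.θ 0) = I c 0 (D0 hh * D0 hh) := by rw [dtθsl, dSq_zero]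
  rw [← φsl] at f11 f12 f22 f2
  rw [← θsl] at h11
  rw [EE_eq]
  simp only [el, List.map_cons, List.map_nil, List.sum_cons, List.sum_nil, I_Ep_sq, e1, e2, e3, mul_zero, zpow_zero, one_mul, add_zero]
  rw [← y1, ← y2, ← y3, ← y4]
  linarith

lemma final (hμ : Zc q ≤ cμ q) (hκ : Zc q ≤ cκ q) : ∃ δ C : ℝ, 0 < δ ∧ 0 < C ∧ ∀ c : Cfg q, dl c ≤ δ → ∀ t ∈ Set.Icc 0 c.T,
    c.ε ^ 2 * A4 c.ε c.S.φ c.S.ψ c.S.θ t ≤ C * R0 c := by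
  obtain ⟨δ, C, hδ, hC, h⟩ := energy hμ hκ
  obtain ⟨C', hC', h'⟩ := fin_sup (q := q)
  refine ⟨δ, (C' + 446) * C * 30, hδ, by positivity, fun c hc t ht => ?_⟩
  have hp : 0 < c.ε ^ 2 := by have := c.hε; positivity
  have hE0 := EE_nonneg c 0
  have a1 : (⨆ s ∈ Set.Icc (0 : ℝ) t, ((c.ε ^ 2)⁻¹ * dSq 2 (c.S.φ s) + dSq 2 (c.S.ψ s) + (c.ε ^ 2)⁻¹ * dSq 2 (c.S.θ s)))
      ≤ (c.ε ^ 2)⁻¹ * (C' * (C * EE c 0)) := by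
    refine sup_le' (by positivity) fun s hs => ?_
    have hs' : s ∈ Set.Icc 0 c.T := ⟨hs.1, hs.2.trans ht.2⟩
    rw [le_inv_mul_iff₀ hp]
    refine (h' c s hs').trans (mul_le_mul_of_nonneg_left ?_ hC')
    have b1 := h c hc s hs'
    have b2 : 0 ≤ ∫ s in (0 : ℝ)..s, DT c s := intervalIntegral.integral_nonneg hs.1 fun s _ => DT_nonneg c s
    linarith
  rw [le_inv_mul_iff₀ hp] at a1
  have a2 := fin_int c ht.1
  have a3 := h c hc t ht
  have a4 := EE_nonneg c t
  have a5 := mul_le_mul_of_nonneg_left (EE0_le c) (by positivity : 0 ≤ (C' + 446) * C)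
  rw [A4, mul_add]
  linarith

theorem final_estimate (γ Pr r Kχ : ℝ)
    (hγ : 1 < γ) (hPr : 0 < Pr) (hr : 0 < 1 + r) (hK : 0 < Kχ) :
    ∃ Re₀ ε₁ : ℝ, 0 < Re₀ ∧ 0 < ε₁ ∧
      ∀ Re : ℝ, 0 < Re → Re < Re₀ →
        ∃ ε₂ N₁ C : ℝ, 0 < ε₂ ∧ 0 < N₁ ∧ 0 < C ∧
          ∀ (ε χ T : ℝ) (S : PerturbSol γ Pr r Re ε χ T),
            0 < ε → ε ≤ 1 → ε < ε₁ → ε ≤ ε₂ → 0 < χ → |1 - χ| ≤ Kχ * ε →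
            |1 - χ| ≤ 1 / 2 → 0 ≤ T → SmoothSol S → StdHyp S →
            Nfun ε S.φ S.ψ S.θ T ≤ 1 → Nfun ε S.φ S.ψ S.θ T ≤ N₁ →
            ∀ t ∈ Set.Icc (0 : ℝ) T,
              ε ^ 2 * A4 ε S.φ S.ψ S.θ t
                ≤ C * (ε ^ 2 * A3 ε S.φ S.ψ S.θ 0 + ε ^ 2 * A4 ε S.φ S.ψ S.θ 0
                    + A1 ε S.φ S.ψ S.θ 0 + A2 ε S.φ S.ψ S.θ 0
                    + (ε ^ 2)⁻¹ * A0 ε S.φ S.ψ S.θ 0) := by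
  set Z : ℝ := Zc ⟨γ, Pr, r, Kχ, 1, hγ, hPr, hr, hK, one_pos⟩ with hZ
  have hZ0 : 0 < Z := by
    have h1 := Zq_ge ⟨γ, Pr, r, Kχ, 1, hγ, hPr, hr, hK, one_pos⟩
    have h2 := cp_pos ⟨γ, Pr, r, Kχ, 1, hγ, hPr, hr, hK, one_pos⟩
    have h3 : 0 < cA ⟨γ, Pr, r, Kχ, 1, hγ, hPr, hr, hK, one_pos⟩ := by
      unfold cA; exact add_pos two_pos (div_pos hPr h2)
    rw [hZ, Zc]; positivity
  have hcp : 0 < γ / (γ - 1) := div_pos (by linarith) (by linarith)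
  refine ⟨min (1 / Z) (γ / (γ - 1) / (Pr * Z)), 2, lt_min (by positivity) (by positivity), two_pos, fun Re hRe hRe0 => ?_⟩
  have hμ : Zc ⟨γ, Pr, r, Kχ, Re, hγ, hPr, hr, hK, hRe⟩ ≤ cμ ⟨γ, Pr, r, Kχ, Re, hγ, hPr, hr, hK, hRe⟩ := by
    change Z ≤ Re⁻¹
    have := hRe0.trans_le (min_le_left _ _)
    rw [lt_div_iff₀ hZ0] at this
    rw [le_inv_comm₀ hZ0 hRe, ← one_div, le_div_iff₀ hZ0]; exact this.le
  have hκ : Zc ⟨γ, Pr, r, Kχ, Re, hγ, hPr, hr, hK, hRe⟩ ≤ cκ ⟨γ, Pr, r, Kχ, Re, hγ, hPr, hr, hK, hRe⟩ := by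
    change Z ≤ γ / (γ - 1) / (Re * Pr)
    have := hRe0.trans_le (min_le_right _ _)
    rw [lt_div_iff₀ (by positivity)] at this
    rw [le_div_iff₀ (by positivity)]
    linarith
  obtain ⟨δ, C, hδ, hC, h⟩ := final hμ hκ
  refine ⟨δ / 2, (δ / 2) ^ 2, C + 1, by positivity, by positivity, by positivity, ?_⟩
  intro ε χ T S hε hε1 _ hε2 _ hχ hχ2 hT hsm hstd hN1 hN t ht
  obtain ⟨h0, h1, h2, h3, h4, h5⟩ := A_nonneg ε S.φ S.ψ S.θ (le_refl (0 : ℝ))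
  have n0 : 0 ≤ (ε ^ 2)⁻¹ * A0 ε S.φ S.ψ S.θ 0 := by positivity
  have n3 : 0 ≤ ε ^ 2 * A3 ε S.φ S.ψ S.θ 0 := by positivity
  have n4 : 0 ≤ ε ^ 2 * A4 ε S.φ S.ψ S.θ 0 := by positivity
  rcases hT.eq_or_lt with hT0 | hT0
  · have ht0 : t = 0 := le_antisymm (hT0 ▸ ht.2) ht.1
    subst ht0
    have : 0 ≤ C * (ε ^ 2 * A3 ε S.φ S.ψ S.θ 0 + ε ^ 2 * A4 ε S.φ S.ψ S.θ 0
                    + A1 ε S.φ S.ψ S.θ 0 + A2 ε S.φ S.ψ S.θ 0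
                    + (ε ^ 2)⁻¹ * A0 ε S.φ S.ψ S.θ 0) := by positivity
    linarith
  · have hd : √(Nfun ε S.φ S.ψ S.θ T) + ε ≤ δ := by
      have := (Real.sqrt_le_left (by positivity : 0 ≤ δ / 2)).2 hN
      linarith
    have := h ⟨ε, χ, T, S, hε, hε1, hχ, hχ2, hT0, hsm, hstd, hN1⟩ (by unfold dl NN; exact hd) t ht
    unfold R0 at this
    dsimp only at this
    linarith
end
/-- `ε`-weighted `H²`-type estimate `ε²A₄`. -/
theorem second_order_weighted_estimate (γ Pr r Kχ : ℝ)
    (hγ : 1 < γ) (hPr : 0 < Pr) (hr : 0 < 1 + r) (hK : 0 < Kχ) :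
    ∃ Re₀ ε₁ : ℝ, 0 < Re₀ ∧ 0 < ε₁ ∧
      ∀ Re : ℝ, 0 < Re → Re < Re₀ →
        ∃ ε₂ N₁ C : ℝ, 0 < ε₂ ∧ 0 < N₁ ∧ 0 < C ∧
          ∀ (ε χ T : ℝ) (S : PerturbSol γ Pr r Re ε χ T),
            0 < ε → ε ≤ 1 → ε < ε₁ → ε ≤ ε₂ → 0 < χ → |1 - χ| ≤ Kχ * ε →
            |1 - χ| ≤ 1 / 2 → 0 ≤ T → SmoothSol S → StdHyp S →
            Nfun ε S.φ S.ψ S.θ T ≤ 1 → Nfun ε S.φ S.ψ S.θ T ≤ N₁ →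
            ∀ t ∈ Set.Icc (0 : ℝ) T,
              ε ^ 2 * A4 ε S.φ S.ψ S.θ t
                ≤ C * (ε ^ 2 * A3 ε S.φ S.ψ S.θ 0 + ε ^ 2 * A4 ε S.φ S.ψ S.θ 0
                    + A1 ε S.φ S.ψ S.θ 0 + A2 ε S.φ S.ψ S.θ 0
                    + (ε ^ 2)⁻¹ * A0 ε S.φ S.ψ S.θ 0) :=
  final_estimate γ Pr r Kχ hγ hPr hr hK
end Couette
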